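/- (Preiss) Let d be a nonnegative integer and μ a locally finite Borel measure on ℝ^n such that the d-dimensional density θ(x) = lim_{r→0} μ(B_{x,r})/(ω_d r^d) exists and satisfies 0 < θ(x) < +∞ for μ-almost every x. Then μ = θ H^d ⌐ K, where K is a countably H^d-rectifiable set. -/

import Mathlib

open MeasureTheory Metric Filter Set
open scoped ENNReal NNReal Topology RealInnerProductSpace

noncomputable section

/-- Euclidean space `ℝ^n`. -/
abbrev Euc (n : ℕ) : Type := EuclideanSpace ℝ (Fin n)

/-- A set is countably `H^d`-rectifiable if, up to an `H^d`-negligible set, it can be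
covered by countably many images of `C^1` maps from `ℝ^d`. -/
def CountablyRectifiable (d : ℕ) {n : ℕ} (K : Set (Euc n)) : Prop :=
  ∃ f : ℕ → (Euc d → Euc n), (∀ i, ContDiff ℝ 1 (f i)) ∧
    μH[(d : ℝ)] (K \ ⋃ i, Set.range (f i)) = 0

/-- A smooth diffeomorphism of `ℝ^n`. -/
def IsDiffeo {n : ℕ} (f : Euc n → Euc n) : Prop :=
  ContDiff ℝ (⊤ : ℕ∞) f ∧ ∃ g : Euc n → Euc n, ContDiff ℝ (⊤ : ℕ∞) g ∧
    Function.LeftInverse g f ∧ Function.RightInverse g f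

/-- The class `𝔇(x,r)`: maps equal to the identity outside `B(x,r)` which are smoothly
isotopic to the identity inside `B(x,r)`. -/
def IsotopyClass {n : ℕ} (x : Euc n) (r : ℝ) : Set (Euc n → Euc n) :=
  {φ | (∀ z ∉ ball x r, φ z = z) ∧
    ∃ lam : ℝ → Euc n → Euc n,
      ContDiff ℝ (⊤ : ℕ∞) (fun p : ℝ × Euc n => lam p.1 p.2) ∧
      lam 0 = id ∧ lam 1 = φ ∧
      (∀ t ∈ Icc (0 : ℝ) 1, ∀ z ∉ ball x r, lam t z = z) ∧
      (∀ t ∈ Icc (0 : ℝ) 1, IsDiffeo (lam t))}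

/-- The class `D(x,r)`: Lipschitz maps in the `C^0`-closure of `𝔇(x,r)`. -/
def DeformClass {n : ℕ} (x : Euc n) (r : ℝ) : Set (Euc n → Euc n) :=
  {φ | (∃ C : ℝ≥0, LipschitzWith C φ) ∧
    ∃ ψ : ℕ → (Euc n → Euc n), (∀ j, ψ j ∈ IsotopyClass x r) ∧
      TendstoUniformly ψ φ atTop}

/-- `K` is relatively closed in `U`. -/
def RelClosedIn {n : ℕ} (U K : Set (Euc n)) : Prop :=
  K ⊆ U ∧ ∃ F : Set (Euc n), IsClosed F ∧ K = F ∩ U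

/-- `inf { H^d(J) : J ∈ P, J ∖ cl B(x,r) = K ∖ cl B(x,r) }`. -/
def competInf (d : ℕ) {n : ℕ} (P : Set (Set (Euc n))) (K : Set (Euc n)) (x : Euc n)
    (r : ℝ) : ℝ≥0∞ :=
  sInf {m | ∃ J ∈ P, J \ closure (ball x r) = K \ closure (ball x r) ∧ m = μH[(d : ℝ)] J}

/-- A family `P` is a good class (for boundary `H`). -/
def IsGoodClass (d : ℕ) {n : ℕ} (H : Set (Euc n)) (P : Set (Set (Euc n))) : Prop :=
  ∀ K ∈ P, ∀ x ∈ K, ∀ᵐ r ∂(volume : Measure ℝ),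
    (0 < r ∧ ENNReal.ofReal r < EMetric.infEdist x H) →
      ∀ φ ∈ DeformClass x r, competInf d P K x r ≤ μH[(d : ℝ)] (φ '' K)

/-- The Plateau infimum `m₀ = inf {H^d(K) : K ∈ P}`. -/
def plateauInf (d : ℕ) {n : ℕ} (P : Set (Set (Euc n))) : ℝ≥0∞ := ⨅ K ∈ P, μH[(d : ℝ)] K

/-- A minimizing sequence: `H^d(K_j) ↓ m₀`. -/
def IsMinimizingSeq (d : ℕ) {n : ℕ} (P : Set (Set (Euc n))) (Kj : ℕ → Set (Euc n)) : Prop :=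
  (∀ j, Kj j ∈ P) ∧ Antitone (fun j => μH[(d : ℝ)] (Kj j)) ∧
    Tendsto (fun j => μH[(d : ℝ)] (Kj j)) atTop (𝓝 (plateauInf d P))

/-- The support of a measure. -/
def sptMeas {n : ℕ} (μ : Measure (Euc n)) : Set (Euc n) :=
  {x | ∀ r : ℝ, 0 < r → 0 < μ (ball x r)}

/-- Weak-* convergence of measures in the open set `U`. -/
def WeakStarOn {n : ℕ} (U : Set (Euc n)) (μs : ℕ → Measure (Euc n)) (μ : Measure (Euc n)) :
    Prop :=
  ∀ f : Euc n → ℝ, Continuous f → HasCompactSupport f → tsupport f ⊆ U →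
    Tendsto (fun j => ∫ z, f z ∂(μs j)) atTop (𝓝 (∫ z, f z ∂μ))

/-- The (multiplicity one) varifold associated to `K` is stationary in `U`: the first
variation of `H^d ⌐ K` along any compactly supported `C^1` vector field in `U` vanishes. -/
def StationaryIn (d : ℕ) {n : ℕ} (K U : Set (Euc n)) : Prop :=
  ∀ X : Euc n → Euc n, ContDiff ℝ 1 X → HasCompactSupport X → tsupport X ⊆ U →
    HasDerivAt (fun t : ℝ => (μH[(d : ℝ)] ((fun z => z + t • X z) '' K)).toReal) 0 0

/-- `S` is a `d`-dimensional real analytic submanifold of `ℝ^n`. -/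
def IsAnalyticSubmanifold (d : ℕ) {n : ℕ} (S : Set (Euc n)) : Prop :=
  ∀ x ∈ S, ∃ (U : Set (Euc n)) (V : Set (Euc d)) (f : Euc d → Euc n),
    IsOpen U ∧ x ∈ U ∧ IsOpen V ∧ AnalyticOnNhd ℝ f V ∧ Set.InjOn f V ∧
    (∀ y ∈ V, Function.Injective (fderiv ℝ f y)) ∧ f '' V = S ∩ U

/-- `ω_d`, the Lebesgue measure of the unit ball of `ℝ^d`. -/
def ballVol (d : ℕ) : ℝ≥0∞ := volume (ball (0 : Euc d) 1)

/-- The `d`-dimensional density of `μ` at `x` is `θ`. -/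
def HasDensityAt (d : ℕ) {n : ℕ} (μ : Measure (Euc n)) (x : Euc n) (θ : ℝ≥0∞) : Prop :=
  Tendsto (fun r : ℝ => μ (ball x r) / (ballVol d * ENNReal.ofReal r ^ d)) (𝓝[>] 0) (𝓝 θ)

/-- The blow-up `(K - x)/r`. -/
def blowup {n : ℕ} (x : Euc n) (r : ℝ) (K : Set (Euc n)) : Set (Euc n) :=
  (fun y => r⁻¹ • (y - x)) '' K

/-- `π` is the approximate tangent plane of `K` at `x`: `π` is a `d`-dimensional subspace and
`H^d ⌐ (K-x)/r` converges weakly-* to `H^d ⌐ π` as `r → 0⁺`. -/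
def HasApproxTangentPlane (d : ℕ) {n : ℕ} (K : Set (Euc n)) (x : Euc n) (π : Set (Euc n)) :
    Prop :=
  (∃ W : Submodule ℝ (Euc n), Module.finrank ℝ W = d ∧ π = (W : Set (Euc n))) ∧
  ∀ f : Euc n → ℝ, Continuous f → HasCompactSupport f →
    Tendsto (fun r : ℝ => ∫ z, f z ∂(μH[(d : ℝ)].restrict (blowup x r K))) (𝓝[>] 0)
      (𝓝 (∫ z, f z ∂(μH[(d : ℝ)].restrict π)))

/-- The sphere `S^m`, realized as the unit sphere of `ℝ^{m+1}`. -/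
def sph (m : ℕ) : Set (Euc (m + 1)) := sphere 0 1

/-- A smooth embedding of `S^{n-d}` into `ℝ^n ∖ H` (given by a smooth ambient map which is
injective and immersive on the sphere, with image avoiding `H`). -/
def IsEmbeddedSphere (n d : ℕ) (H : Set (Euc n)) (γ : Euc (n - d + 1) → Euc n) : Prop :=
  ContDiff ℝ (⊤ : ℕ∞) γ ∧ Set.InjOn γ (sph (n - d)) ∧
  (∀ y ∈ sph (n - d), ∀ v : Euc (n - d + 1), ⟪v, y⟫ = (0 : ℝ) → fderiv ℝ γ y v = 0 → v = 0) ∧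
  γ '' sph (n - d) ⊆ Hᶜ

/-- `γ` and `γ'` are smoothly isotopic embeddings of `S^{n-d}` in `ℝ^n ∖ H`. -/
def SphereIsotopic (n d : ℕ) (H : Set (Euc n)) (γ γ' : Euc (n - d + 1) → Euc n) : Prop :=
  ∃ Γ : ℝ → Euc (n - d + 1) → Euc n,
    ContDiff ℝ (⊤ : ℕ∞) (fun p : ℝ × Euc (n - d + 1) => Γ p.1 p.2) ∧
    Set.EqOn (Γ 0) γ (sph (n - d)) ∧ Set.EqOn (Γ 1) γ' (sph (n - d)) ∧
    ∀ t ∈ Icc (0 : ℝ) 1, IsEmbeddedSphere n d H (Γ t)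

/-- `C` is a family of smooth embeddings of `S^{n-d}` into `ℝ^n ∖ H` closed by isotopy. -/
def ClosedByIsotopy (n d : ℕ) (H : Set (Euc n)) (C : Set (Euc (n - d + 1) → Euc n)) : Prop :=
  (∀ γ ∈ C, IsEmbeddedSphere n d H γ) ∧
  ∀ γ ∈ C, ∀ γ' : Euc (n - d + 1) → Euc n,
    IsEmbeddedSphere n d H γ' → SphereIsotopic n d H γ γ' → γ' ∈ C

/-- `K` is a `C`-spanning set of `H`. -/
def IsSpanning (n d : ℕ) (C : Set (Euc (n - d + 1) → Euc n)) (K : Set (Euc n)) : Prop :=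
  ∀ γ ∈ C, (K ∩ γ '' sph (n - d)).Nonempty

/-- `F(H,C)`: the countably `H^d`-rectifiable relatively closed `C`-spanning sets of `H`. -/
def spanningClass (n d : ℕ) (H : Set (Euc n)) (C : Set (Euc (n - d + 1) → Euc n)) :
    Set (Set (Euc n)) :=
  {K | RelClosedIn Hᶜ K ∧ CountablyRectifiable d K ∧ IsSpanning n d C K}

/-- `Σ(H)`: Lipschitz maps homotopic to the identity through maps preserving `H`. -/
def SlidingMaps {n : ℕ} (H : Set (Euc n)) : Set (Euc n → Euc n) :=
  {φ | (∃ C : ℝ≥0, LipschitzWith C φ) ∧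
    ∃ Φ : ℝ → Euc n → Euc n, Continuous (fun p : ℝ × Euc n => Φ p.1 p.2) ∧
      Φ 0 = id ∧ Φ 1 = φ ∧ ∀ t ∈ Icc (0 : ℝ) 1, Φ t '' H ⊆ H}

/-- `A(H,K₀) = {φ(K₀) : φ ∈ Σ(H)}`. -/
def slidingClass {n : ℕ} (H K0 : Set (Euc n)) : Set (Set (Euc n)) :=
  {K | ∃ φ ∈ SlidingMaps H, K = φ '' K0}

/-- The cone competitor for `K` in `B(x,r)`. -/
def coneCompetitor {n : ℕ} (x : Euc n) (r : ℝ) (K : Set (Euc n)) : Set (Euc n) :=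
  (K \ ball x r) ∪
    {w | ∃ z ∈ K ∩ sphere x r, ∃ lam ∈ Icc (0 : ℝ) 1, w = lam • x + (1 - lam) • z}

section uniform
variable {E : Type*} [NormedAddCommGroup E] [InnerProductSpace ℝ E] [FiniteDimensional ℝ E]
  [MeasurableSpace E] [BorelSpace E]

/-- A `d`-uniform measure `ν` normalised like Lebesgue measure, carried by the closed set `S ∋ 0`. -/
structure Unif (d : ℕ) (ν : Measure E) (S : Set E) : Prop where
  closed : IsClosed S
  zero_mem : (0 : E) ∈ S
  null : ν Sᶜ = 0
  ball_eq : ∀ x ∈ S, ∀ r, ν (ball x r) = volume (ball (0 : Euc d) r)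

lemma volume_ball_euc (d : ℕ) {r : ℝ} (hr : 0 < r) :
    volume (ball (0 : Euc d) r) = ENNReal.ofReal r ^ d * ballVol d := by
  rw [Measure.addHaar_ball_of_pos _ _ hr, ballVol, ENNReal.ofReal_pow hr.le]
  simp

lemma ballVol_pos (d : ℕ) : 0 < ballVol d := measure_ball_pos _ _ one_pos

lemma ballVol_ne_top (d : ℕ) : ballVol d ≠ ⊤ := measure_ball_lt_top.ne

namespace Unif
variable {d : ℕ} {ν : Measure E} {S : Set E}

lemma isLocallyFinite (h : Unif d ν S) : IsLocallyFiniteMeasure ν := by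
  refine ⟨fun x => ⟨ball x 1, ball_mem_nhds x one_pos, ?_⟩⟩
  calc ν (ball x 1) ≤ ν (ball 0 (1 + ‖x‖)) := by
        apply measure_mono; apply ball_subset_ball'; simp
    _ < ⊤ := by rw [h.ball_eq 0 h.zero_mem]; exact measure_ball_lt_top

lemma ae_mem (h : Unif d ν S) : ∀ᵐ z ∂ν, z ∈ S := h.null

lemma map_norm (h : Unif d ν S) {x : E} (hx : x ∈ S) :
    ν.map (fun z => ‖z - x‖) = (volume : Measure (Euc d)).map (fun u => ‖u‖) := by
  have hm : Measurable (fun z : E => ‖z - x‖) := by fun_prop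
  have hm' : Measurable (fun u : Euc d => ‖u‖) := by fun_prop
  have key : ∀ r, ν.map (fun z => ‖z - x‖) (Iio r) =
      (volume : Measure (Euc d)).map (fun u => ‖u‖) (Iio r) := by
    intro r
    rw [Measure.map_apply hm measurableSet_Iio, Measure.map_apply hm' measurableSet_Iio]
    have e1 : (fun z : E => ‖z - x‖) ⁻¹' Iio r = ball x r := by
      ext z; simp [dist_eq_norm]
    have e2 : (fun u : Euc d => ‖u‖) ⁻¹' Iio r = ball 0 r := by
      ext z; simp
    rw [e1, e2, h.ball_eq x hx]
  have fin : ∀ r, (volume : Measure (Euc d)).map (fun u => ‖u‖) (Iio r) ≠ ⊤ := by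
    intro r
    rw [Measure.map_apply hm' measurableSet_Iio]
    have e2 : (fun u : Euc d => ‖u‖) ⁻¹' Iio r = ball 0 r := by
      ext z; simp
    rw [e2]; exact measure_ball_lt_top.ne
  refine Measure.ext_of_Ico' _ _ (fun a b hab => ?_) (fun a b hab => ?_)
  · exact ne_top_of_le_ne_top (fin b) ((key b).symm ▸ measure_mono Ico_subset_Iio_self)
  · have : Ico a b = Iio b \ Iio a := by ext z; simp [and_comm]
    rw [this, measure_sdiff (Iio_subset_Iio hab.le) measurableSet_Iio.nullMeasurableSet (key a ▸ fin a),
      measure_sdiff (Iio_subset_Iio hab.le) measurableSet_Iio.nullMeasurableSet (fin a), key, key]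

lemma integral_radial (h : Unif d ν S) {x : E} (hx : x ∈ S) {g : ℝ → ℝ} (hg : Measurable g) :
    ∫ z, g ‖z - x‖ ∂ν = ∫ u : Euc d, g ‖u‖ := by
  rw [← integral_map (φ := fun z : E => ‖z - x‖) (f := g) (by fun_prop)
      hg.aestronglyMeasurable, h.map_norm hx,
    integral_map (by fun_prop) hg.aestronglyMeasurable]

lemma integrable_radial (h : Unif d ν S) {x : E} (hx : x ∈ S) {g : ℝ → ℝ} (hg : Measurable g)
    (hi : Integrable (fun u : Euc d => g ‖u‖)) : Integrable (fun z => g ‖z - x‖) ν := by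
  have := (integrable_map_measure (f := fun u : Euc d => ‖u‖) (μ := volume) (g := g)
    hg.aestronglyMeasurable (by fun_prop)).2 hi
  rw [← h.map_norm hx] at this
  exact this.comp_measurable (by fun_prop)

/-- Blow-ups of uniform measures are uniform. -/
lemma blowup (h : Unif d ν S) {x : E} (hx : x ∈ S) {r : ℝ} (hr : 0 < r) :
    Unif d ((ENNReal.ofReal r ^ d)⁻¹ • ν.map (fun z => r⁻¹ • (z - x)))
      ((fun a => x + r • a) ⁻¹' S) := by
  have hm : Measurable (fun z : E => r⁻¹ • (z - x)) := by fun_prop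
  have hc : Continuous (fun a : E => x + r • a) := by fun_prop
  have hr' : ENNReal.ofReal r ^ d ≠ 0 := pow_ne_zero _ (by simpa using hr)
  have hr'' : ENNReal.ofReal r ^ d ≠ ⊤ := by finiteness
  refine ⟨h.closed.preimage hc, by simpa using hx, ?_, fun a ha s => ?_⟩
  · rw [Measure.smul_apply, Measure.map_apply hm (h.closed.preimage hc).measurableSet.compl]
    have : (fun z : E => r⁻¹ • (z - x)) ⁻¹' ((fun a => x + r • a) ⁻¹' S)ᶜ = Sᶜ := by
      ext z; simp [smul_smul, hr.ne']
    rw [this, h.null]; simp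
  · rw [Measure.smul_apply, Measure.map_apply hm measurableSet_ball]
    have : (fun z : E => r⁻¹ • (z - x)) ⁻¹' (ball a s) = ball (x + r • a) (r * s) := by
      ext z
      have : r⁻¹ • (z - x) - a = r⁻¹ • (z - (x + r • a)) := by
        rw [← sub_sub, smul_sub r⁻¹ _ (r • a), smul_smul, inv_mul_cancel₀ hr.ne', one_smul]
      simp only [mem_preimage, mem_ball, dist_eq_norm, this, norm_smul, norm_inv, Real.norm_eq_abs,
        abs_of_pos hr]
      rw [inv_mul_lt_iff₀ hr]
    rw [this, h.ball_eq _ ha]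
    rcases le_or_gt s 0 with hs | hs
    · rw [ball_eq_empty.2 hs, ball_eq_empty.2 (mul_nonpos_of_nonneg_of_nonpos hr.le hs)]; simp
    · rw [volume_ball_euc _ hs, volume_ball_euc _ (mul_pos hr hs), ENNReal.ofReal_mul hr.le,
        mul_pow, smul_eq_mul, mul_assoc, ENNReal.inv_mul_cancel_left hr' hr'']

end Unif
end uniform

section vague
variable {E : Type*} [NormedAddCommGroup E] [InnerProductSpace ℝ E] [FiniteDimensional ℝ E]
  [MeasurableSpace E] [BorelSpace E]

open scoped CompactlySupported

lemma exists_vague_limit {ι : Type*} (𝒰 : Ultrafilter ι) (μ : ι → Measure E)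
    [∀ i, IsLocallyFiniteMeasure (μ i)]
    (hbd : ∀ R : ℝ, ∃ C : ℝ≥0, ∀ᶠ i in (𝒰 : Filter ι), μ i (ball 0 R) ≤ C) :
    ∃ ν : Measure E, ν.Regular ∧ ∀ f : E → ℝ, Continuous f → HasCompactSupport f →
      Tendsto (fun i => ∫ z, f z ∂μ i) 𝒰 (𝓝 (∫ z, f z ∂ν)) := by
  have hintg : ∀ (f : C_c(E, ℝ)) i, Integrable f (μ i) := fun f i =>
    f.continuous.integrable_of_hasCompactSupport f.hasCompactSupport
  have hlim : ∀ f : C_c(E, ℝ), ∃ l : ℝ, Tendsto (fun i => ∫ z, f z ∂μ i) 𝒰 (𝓝 l) := by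
    intro f
    obtain ⟨R, hR⟩ := f.hasCompactSupport.isCompact.isBounded.subset_ball (0 : E)
    obtain ⟨C, hC⟩ := hbd R
    obtain ⟨M, hM⟩ := f.continuous.bounded_above_of_compact_support f.hasCompactSupport
    have hM0 : 0 ≤ M := (norm_nonneg _).trans (hM 0)
    have hb : ∀ᶠ i in (𝒰 : Filter ι), ∫ z, f z ∂μ i ∈ Icc (-(M * C)) (M * C) := by
      filter_upwards [hC] with i hi
      rw [mem_Icc, ← abs_le, ← Real.norm_eq_abs]
      have h1 : ∫ z, f z ∂μ i = ∫ z in ball 0 R, f z ∂μ i := by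
        rw [setIntegral_eq_integral_of_forall_compl_eq_zero]
        intro x hx
        by_contra h
        exact hx (hR (subset_tsupport _ h))
      rw [h1]
      have h2 := norm_setIntegral_le_of_norm_le_const (μ := μ i) (s := ball 0 R) (f := f) (C := M)
        (hi.trans_lt ENNReal.coe_lt_top) (fun x _ => hM x)
      refine h2.trans (mul_le_mul_of_nonneg_left ?_ hM0)
      exact ENNReal.toReal_le_of_le_ofReal C.2 (by simpa using hi)
    obtain ⟨l, -, hl⟩ := isCompact_Icc.ultrafilter_le_nhds' (𝒰.map fun i => ∫ z, f z ∂μ i) hb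
    exact ⟨l, hl⟩
  choose L hL using hlim
  let Λ₀ : C_c(E, ℝ) →ₗ[ℝ] ℝ :=
    { toFun := L
      map_add' := fun f g => by
        refine tendsto_nhds_unique (hL (f + g)) (((hL f).add (hL g)).congr fun i => ?_)
        rw [← integral_add (hintg f i) (hintg g i)]; rfl
      map_smul' := fun c f => by
        refine tendsto_nhds_unique (hL (c • f)) (((hL f).const_mul c).congr fun i => ?_)
        rw [← integral_const_mul]; rfl }
  let Λ : C_c(E, ℝ) →ₚ[ℝ] ℝ := PositiveLinearMap.mk₀ Λ₀ fun f hf =>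
    ge_of_tendsto (hL f) (Eventually.of_forall fun i => integral_nonneg fun z => hf z)
  refine ⟨RealRMK.rieszMeasure Λ, inferInstance, fun f hf hfc => ?_⟩
  have h := RealRMK.integral_rieszMeasure Λ ⟨⟨f, hf⟩, hfc⟩
  have h2 := hL ⟨⟨f, hf⟩, hfc⟩
  have e : Λ ⟨⟨f, hf⟩, hfc⟩ = L ⟨⟨f, hf⟩, hfc⟩ := rfl
  rw [← e, ← h] at h2
  exact h2

lemma vague_open_le {ι : Type*} {l : Filter ι} [l.NeBot] {μ : ι → Measure E} {ν : Measure E}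
    [∀ i, IsLocallyFiniteMeasure (μ i)] [ν.Regular]
    (h : ∀ f : E → ℝ, Continuous f → HasCompactSupport f →
      Tendsto (fun i => ∫ z, f z ∂μ i) l (𝓝 (∫ z, f z ∂ν)))
    {U : Set E} (hU : IsOpen U) {a : ℝ≥0∞} (ha : ∀ᶠ i in l, μ i U ≤ a) : ν U ≤ a := by
  rcases eq_or_ne a ⊤ with rfl | hat
  · exact le_top
  refine le_of_forall_lt fun b hb => ?_
  obtain ⟨K, hKU, hK, hbK⟩ := hU.exists_lt_isCompact hb
  refine hbK.trans_le ?_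
  obtain ⟨f, hf1, hf0, hfc, hf⟩ := exists_continuous_one_zero_of_isCompact hK hU.isClosed_compl
    (disjoint_compl_right_iff_subset.2 hKU)
  have hle : ∫ z, f z ∂ν ≤ a.toReal := by
    refine le_of_tendsto (h f f.continuous hfc) ?_
    filter_upwards [ha] with i hi
    have : ∫ z, f z ∂μ i ≤ ∫ z, U.indicator 1 z ∂μ i := by
      refine integral_mono (f.continuous.integrable_of_hasCompactSupport hfc) ?_ ?_
      · exact (integrable_indicator_iff hU.measurableSet).2
          (integrableOn_const (hs := ne_top_of_le_ne_top hat hi))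
      · intro z
        by_cases hz : z ∈ U
        · simpa [hz] using (hf z).2
        · simpa [hz] using (hf0 hz).le
    refine this.trans ?_
    rw [integral_indicator_one hU.measurableSet]
    exact ENNReal.toReal_mono hat hi
  have hge : (ν K).toReal ≤ ∫ z, f z ∂ν := by
    rw [← measureReal_def, ← integral_indicator_one hK.measurableSet]
    refine integral_mono ((integrable_indicator_iff hK.measurableSet).2
      (integrableOn_const (hs := hK.measure_lt_top.ne)))
      (f.continuous.integrable_of_hasCompactSupport hfc) fun z => ?_
    by_cases hz : z ∈ K
    · simpa [hz] using (hf1 hz).ge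
    · simpa [hz] using (hf z).1
  exact (ENNReal.toReal_le_toReal hK.measure_lt_top.ne hat).1 (hge.trans hle)

lemma vague_le_open {ι : Type*} {l : Filter ι} [l.NeBot] {μ : ι → Measure E} {ν : Measure E}
    [∀ i, IsLocallyFiniteMeasure (μ i)] [ν.Regular]
    (h : ∀ f : E → ℝ, Continuous f → HasCompactSupport f →
      Tendsto (fun i => ∫ z, f z ∂μ i) l (𝓝 (∫ z, f z ∂ν)))
    {C U : Set E} (hC : IsCompact C) (hU : IsOpen U) (hCU : C ⊆ U) {a : ℝ≥0∞}
    (ha : ∀ᶠ i in l, a ≤ μ i C) : a ≤ ν U := by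
  obtain ⟨i₀, hi₀⟩ := ha.exists
  have hat : a ≠ ⊤ := ne_top_of_le_ne_top hC.measure_lt_top.ne hi₀
  by_cases hUt : ν U = ⊤
  · rw [hUt]; exact le_top
  obtain ⟨f, hf1, hf0, hfc, hf⟩ := exists_continuous_one_zero_of_isCompact hC hU.isClosed_compl
    (disjoint_compl_right_iff_subset.2 hCU)
  have hge : a.toReal ≤ ∫ z, f z ∂ν := by
    refine ge_of_tendsto (h f f.continuous hfc) ?_
    filter_upwards [ha] with i hi
    have : ∫ z, C.indicator 1 z ∂μ i ≤ ∫ z, f z ∂μ i := by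
      refine integral_mono ((integrable_indicator_iff hC.measurableSet).2
        (integrableOn_const (hs := hC.measure_lt_top.ne)))
        (f.continuous.integrable_of_hasCompactSupport hfc) fun z => ?_
      by_cases hz : z ∈ C
      · simpa [hz] using (hf1 hz).ge
      · simpa [hz] using (hf z).1
    refine le_trans ?_ this
    rw [integral_indicator_one hC.measurableSet]
    exact ENNReal.toReal_mono hC.measure_lt_top.ne hi
  have hle : ∫ z, f z ∂ν ≤ (ν U).toReal := by
    rw [← measureReal_def, ← integral_indicator_one hU.measurableSet]
    refine integral_mono (f.continuous.integrable_of_hasCompactSupport hfc)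
      ((integrable_indicator_iff hU.measurableSet).2 (integrableOn_const (hs := hUt))) fun z => ?_
    by_cases hz : z ∈ U
    · simpa [hz] using (hf z).2
    · simpa [hz] using (hf0 hz).le
  exact (ENNReal.toReal_le_toReal hat hUt).1 (hge.trans hle)

/-- The limit set of a family of sets along an ultrafilter. -/
def ulim {X : Type*} [PseudoMetricSpace X] {ι : Type*} (𝒰 : Filter ι) (A : ι → Set X) : Set X :=
  {z | ∀ ε > 0, ∀ᶠ i in 𝒰, ∃ a ∈ A i, dist a z < ε}

lemma isClosed_ulim {X : Type*} [PseudoMetricSpace X] {ι : Type*} (𝒰 : Filter ι)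
    (A : ι → Set X) : IsClosed (ulim 𝒰 A) := by
  refine isClosed_of_closure_subset fun z hz ε hε => ?_
  obtain ⟨w, hw, hwz⟩ := Metric.mem_closure_iff.1 hz (ε / 2) (by positivity)
  filter_upwards [hw (ε / 2) (by positivity)] with i ⟨a, ha, haw⟩
  refine ⟨a, ha, ?_⟩
  linarith [dist_triangle a w z, dist_comm z w]

lemma exists_seq_of_mem_ulim {X : Type*} [PseudoMetricSpace X] [ProperSpace X] {ι : Type*}
    {𝒰 : Filter ι} {A : ι → Set X} (hc : ∀ i, IsClosed (A i)) (hne : ∀ i, (A i).Nonempty) {z : X}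
    (hz : z ∈ ulim 𝒰 A) : ∃ a : ι → X, (∀ i, a i ∈ A i) ∧ Tendsto a 𝒰 (𝓝 z) := by
  choose a ha haz using fun i => (hc i).exists_infDist_eq_dist (hne i) z
  refine ⟨a, ha, ?_⟩
  rw [Metric.tendsto_nhds]
  intro ε hε
  filter_upwards [hz ε hε] with i ⟨b, hb, hbz⟩
  rw [dist_comm, ← haz]
  exact (infDist_le_dist_of_mem hb).trans_lt (by rwa [dist_comm])

lemma mem_ulim_of_tendsto {X : Type*} [PseudoMetricSpace X] {ι : Type*}
    {𝒰 : Filter ι} {A : ι → Set X} {a : ι → X} (ha : ∀ i, a i ∈ A i) {z : X}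
    (h : Tendsto a 𝒰 (𝓝 z)) : z ∈ ulim 𝒰 A := fun ε hε => by
  filter_upwards [Metric.tendsto_nhds.1 h ε hε] with i hi
  exact ⟨a i, ha i, hi⟩

/-- Compactness: asymptotically uniform measures converge to a uniform measure carried by the
limit set. -/
theorem exists_unif_limit {ι : Type*} (𝒰 : Ultrafilter ι) {d : ℕ}
    (μ : ι → Measure E) [∀ i, IsLocallyFiniteMeasure (μ i)] (A : ι → Set E) (h0 : ∀ i, 0 ∈ A i)
    (hnull : ∀ R : ℝ, Tendsto (fun i => μ i (ball 0 R \ A i)) 𝒰 (𝓝 0))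
    (hle : ∀ R r : ℝ, 0 < r → ∀ b > volume (ball (0 : Euc d) r),
      ∀ᶠ i in (𝒰 : Filter ι), ∀ z ∈ A i ∩ ball 0 R, μ i (ball z r) ≤ b)
    (hge : ∀ R r : ℝ, 0 < r → ∀ b < volume (ball (0 : Euc d) r),
      ∀ᶠ i in (𝒰 : Filter ι), ∀ z ∈ A i ∩ ball 0 R, b ≤ μ i (ball z r)) :
    ∃ ν : Measure E, Unif d ν (ulim 𝒰 A) ∧ ∀ f : E → ℝ, Continuous f → HasCompactSupport f →
      Tendsto (fun i => ∫ z, f z ∂μ i) 𝒰 (𝓝 (∫ z, f z ∂ν)) := by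
  have hvol : ∀ r : ℝ, volume (ball (0 : Euc d) r) < ⊤ := fun r => measure_ball_lt_top
  have hcont : Continuous (fun r : ℝ => ENNReal.ofReal r ^ d * ballVol d) :=
    ENNReal.continuous_mul_const (ballVol_ne_top d) |>.comp
      ((ENNReal.continuous_pow d).comp ENNReal.continuous_ofReal)
  obtain ⟨ν, hreg, hν⟩ := exists_vague_limit 𝒰 μ fun R => by
    obtain ⟨C, hC, -⟩ := ENNReal.lt_iff_exists_nnreal_btwn.1 (hvol (max R 1))
    refine ⟨C, ?_⟩
    filter_upwards [hle 1 (max R 1) (by positivity) C hC] with i hi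
    exact (measure_mono (ball_subset_ball (le_max_left _ _))).trans (hi 0 ⟨h0 i, by simp⟩)
  refine ⟨ν, ⟨isClosed_ulim _ _, fun ε hε => Eventually.of_forall fun i => ⟨0, h0 i, by simpa⟩,
    ?_, ?_⟩, hν⟩
  · refine measure_null_of_locally_null _ fun z hz => ?_
    simp only [ulim, mem_compl_iff, mem_setOf_eq, not_forall] at hz
    obtain ⟨ε, hε, hz⟩ := hz
    rw [← Ultrafilter.eventually_not] at hz
    refine ⟨ball z ε, mem_nhdsWithin_of_mem_nhds (ball_mem_nhds z hε), ?_⟩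
    refine nonpos_iff_eq_zero.1 (le_of_forall_gt fun b hb => ?_)
    obtain ⟨b', hb'0, hb'⟩ := exists_between hb
    refine lt_of_le_of_lt (vague_open_le hν isOpen_ball ?_) hb'
    filter_upwards [hz, (hnull (ε + ‖z‖)).eventually_lt_const hb'0] with i hi hi2
    refine le_trans (measure_mono fun a ha => mem_diff_of_mem ?_ fun haA => hi ⟨a, haA, ha⟩) hi2.le
    rw [mem_ball_zero_iff]
    rw [mem_ball, dist_eq_norm] at ha
    linarith [norm_le_norm_sub_add a z]
  · intro z hz r
    rcases le_or_gt r 0 with hr | hr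
    · rw [ball_eq_empty.2 hr, ball_eq_empty.2 hr]; simp
    apply le_antisymm
    · refine le_of_forall_gt fun b hb => ?_
      obtain ⟨b', hb1, hb'⟩ := exists_between hb
      refine lt_of_le_of_lt (vague_open_le hν isOpen_ball ?_) hb'
      have : ∃ ε > 0, volume (ball (0 : Euc d) (r + ε)) < b' := by
        rw [volume_ball_euc d hr] at hb1
        obtain ⟨ε, hε, h⟩ := Metric.eventually_nhds_iff.1 (hcont.continuousAt.eventually_lt_const hb1)
        refine ⟨ε / 2, by positivity, ?_⟩
        rw [volume_ball_euc d (by positivity)]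
        apply h
        simp [abs_of_pos hε]; linarith
      obtain ⟨ε, hε, hb2⟩ := this
      filter_upwards [hle (‖z‖ + ε) (r + ε) (by positivity) b' hb2, hz ε hε] with i hi ⟨a, ha, haz⟩
      have haR : a ∈ ball 0 (‖z‖ + ε) := by
        rw [mem_ball_zero_iff]
        rw [dist_eq_norm] at haz
        linarith [norm_le_norm_sub_add a z]
      refine le_trans (measure_mono ?_) (hi a ⟨ha, haR⟩)
      apply ball_subset_ball'; rw [dist_comm]; linarith
    · refine le_of_forall_lt fun b hb => ?_
      obtain ⟨b', hb1, hb'⟩ := exists_between hb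
      have : ∃ ε > 0, 0 < r - 2 * ε ∧ b' < volume (ball (0 : Euc d) (r - 2 * ε)) := by
        rw [volume_ball_euc d hr] at hb'
        obtain ⟨ε, hε, h⟩ := Metric.eventually_nhds_iff.1
          ((hcont.continuousAt.eventually_const_lt hb').and (eventually_gt_nhds hr))
        have := @h (r - 2 * (ε / 4)) (by simp [abs_of_pos hε]; linarith)
        refine ⟨ε / 4, by positivity, this.2, ?_⟩
        rw [volume_ball_euc d this.2]
        exact this.1
      obtain ⟨ε, hε, hr2, hb2⟩ := this
      refine hb1.trans_le (vague_le_open hν (isCompact_closedBall z (r - ε)) isOpen_ball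
        (closedBall_subset_ball (by linarith)) ?_)
      filter_upwards [hge (‖z‖ + ε) (r - 2 * ε) hr2 b' hb2, hz ε hε] with i hi ⟨a, ha, haz⟩
      have haR : a ∈ ball 0 (‖z‖ + ε) := by
        rw [mem_ball_zero_iff]
        rw [dist_eq_norm] at haz
        linarith [norm_le_norm_sub_add a z]
      refine (hi a ⟨ha, haR⟩).trans (measure_mono ?_)
      · refine (ball_subset_closedBall).trans (closedBall_subset_closedBall' ?_)
        linarith

end vague

section flat
variable {E : Type*} [NormedAddCommGroup E] [InnerProductSpace ℝ E] [FiniteDimensional ℝ E]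

/-- The set `A` seen from `x` at scale `r`. -/
def dil (x : E) (r : ℝ) (A : Set E) : Set E := (fun a => x + r • a) ⁻¹' A

lemma mem_dil {x : E} {r : ℝ} {A : Set E} {a : E} : a ∈ dil x r A ↔ x + r • a ∈ A := Iff.rfl

lemma dil_dil (x y : E) (r s : ℝ) (A : Set E) :
    dil y s (dil x r A) = dil (x + r • y) (r * s) A := by
  ext a; simp [mem_dil, smul_add, smul_smul, add_assoc]

lemma dil_mono {x : E} {r : ℝ} {A B : Set E} (h : A ⊆ B) : dil x r A ⊆ dil x r B :=
  preimage_mono h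

lemma dil_zero_one (A : Set E) : dil 0 1 A = A := by ext a; simp [mem_dil]

lemma IsClosed.dil {A : Set E} (h : IsClosed A) (x : E) (r : ℝ) : IsClosed (dil x r A) :=
  h.preimage (by fun_prop)

/-- `A` comes `ε`-close to every point of the unit disc of some `d`-dimensional plane. -/
def Fl (d : ℕ) (ε : ℝ) (A : Set E) : Prop :=
  ∃ L : Euc d →ₗᵢ[ℝ] E, ∀ c, ‖c‖ ≤ 1 → ∃ a ∈ A, ‖a - L c‖ ≤ ε

variable {d : ℕ} {ε ε' : ℝ} {A B : Set E}

lemma Fl.mono (h : Fl d ε A) (hε : ε ≤ ε') (hAB : A ⊆ B) : Fl d ε' B := by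
  obtain ⟨L, hL⟩ := h
  refine ⟨L, fun c hc => ?_⟩
  obtain ⟨a, ha, h⟩ := hL c hc
  exact ⟨a, hAB ha, h.trans hε⟩

lemma Fl.of_range (L : Euc d →ₗᵢ[ℝ] E) (h : range L ⊆ A) (hε : 0 ≤ ε) : Fl d ε A :=
  ⟨L, fun c _ => ⟨L c, h ⟨c, rfl⟩, by simpa⟩⟩

lemma Fl.scale {x : E} {r t : ℝ} (h : Fl d ε (dil x r A)) (ht0 : 0 < t) (ht : t ≤ 1) :
    Fl d (ε / t) (dil x (r * t) A) := by
  obtain ⟨L, hL⟩ := h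
  refine ⟨L, fun c hc => ?_⟩
  obtain ⟨a, ha, h⟩ := hL (t • c) (by
    rw [norm_smul, Real.norm_of_nonneg ht0.le]; exact mul_le_one₀ ht (norm_nonneg _) hc)
  refine ⟨t⁻¹ • a, ?_, ?_⟩
  · rw [mem_dil, smul_smul, mul_assoc, mul_inv_cancel₀ ht0.ne', mul_one]; exact ha
  · have : t⁻¹ • a - L c = t⁻¹ • (a - L (t • c)) := by
      rw [smul_sub, map_smul, smul_smul, inv_mul_cancel₀ ht0.ne', one_smul]
    rw [this, norm_smul, norm_inv, Real.norm_of_nonneg ht0.le, inv_mul_eq_div]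
    gcongr

lemma dil_ulim_subset {ι : Type*} {𝒰 : Filter ι} {A : ι → Set E} {a : ι → E} {z : E}
    (ha : Tendsto a 𝒰 (𝓝 z)) {ρ : ℝ} (hρ : 0 < ρ) :
    dil z ρ (ulim 𝒰 A) ⊆ ulim 𝒰 (fun i => dil (a i) ρ (A i)) := by
  intro w hw ε hε
  filter_upwards [hw (ρ * ε / 2) (by positivity),
    Metric.tendsto_nhds.1 ha (ρ * ε / 2) (by positivity)] with i ⟨b, hb, hbw⟩ hai
  refine ⟨ρ⁻¹ • (b - a i), ?_, ?_⟩
  · rw [mem_dil, smul_smul, mul_inv_cancel₀ hρ.ne']; simpa using hb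
  · have : ρ⁻¹ • (b - a i) - w = ρ⁻¹ • ((b - (z + ρ • w)) - (a i - z)) := by
      have : w = ρ⁻¹ • (ρ • w) := by rw [smul_smul, inv_mul_cancel₀ hρ.ne', one_smul]
      conv_lhs => rw [this]
      rw [← smul_sub]; congr 1; abel
    rw [dist_eq_norm, this, norm_smul, norm_inv, Real.norm_of_nonneg hρ.le, inv_mul_lt_iff₀ hρ]
    rw [dist_eq_norm] at hbw hai
    linarith [norm_sub_le (b - (z + ρ • w)) (a i - z)]

lemma Fl.ulim {ι : Type*} {𝒰 : Ultrafilter ι} {A : ι → Set E}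
    (h : ∀ᶠ i in (𝒰 : Filter ι), Fl d ε (A i)) : Fl d ε (ulim 𝒰 A) := by
  classical
  obtain ⟨i₀, L₀, -⟩ := h.exists
  have : ∀ i, ∃ L : Euc d →ₗᵢ[ℝ] E, Fl d ε (A i) → ∀ c, ‖c‖ ≤ 1 → ∃ a ∈ A i, ‖a - L c‖ ≤ ε := by
    intro i
    by_cases hi : Fl d ε (A i)
    · obtain ⟨L, hL⟩ := hi; exact ⟨L, fun _ => hL⟩
    · exact ⟨L₀, fun h => absurd h hi⟩
  choose L hL using this
  have hL1 : ∀ᶠ i in (𝒰 : Filter ι), (L i).toContinuousLinearMap ∈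
      closedBall (0 : Euc d →L[ℝ] E) 1 := Eventually.of_forall fun i => by
    simpa using (L i).norm_toContinuousLinearMap_le
  obtain ⟨M, -, hM⟩ := (isCompact_closedBall (0 : Euc d →L[ℝ] E) 1).ultrafilter_le_nhds'
    (𝒰.map fun i => (L i).toContinuousLinearMap) hL1
  have hM' : ∀ c, Tendsto (fun i => L i c) 𝒰 (𝓝 (M c)) := fun c =>
    (((ContinuousLinearMap.apply ℝ E c).continuous.tendsto M).comp hM :)
  have hMn : ∀ c, ‖M c‖ = ‖c‖ := fun c =>
    tendsto_nhds_unique (hM' c).norm (by simp)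
  refine ⟨⟨M.toLinearMap, hMn⟩, fun c hc => ?_⟩
  have : ∀ i, ∃ a, Fl d ε (A i) → a ∈ A i ∧ ‖a - L i c‖ ≤ ε := by
    intro i
    by_cases hi : Fl d ε (A i)
    · obtain ⟨a, ha⟩ := hL i hi c hc; exact ⟨a, fun _ => ha⟩
    · exact ⟨0, fun h => absurd h hi⟩
  choose a ha using this
  have hb : ∀ᶠ i in (𝒰 : Filter ι), a i ∈ closedBall (0 : E) (ε + 1) := by
    filter_upwards [h] with i hi
    rw [mem_closedBall_zero_iff]
    have h1 := (ha i hi).2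
    have h2 : ‖L i c‖ ≤ 1 := by simpa using hc
    linarith [norm_le_norm_sub_add (a i) (L i c)]
  obtain ⟨z, -, hz⟩ := (isCompact_closedBall (0 : E) (ε + 1)).ultrafilter_le_nhds' (𝒰.map a) hb
  have hz : Tendsto a 𝒰 (𝓝 z) := hz
  refine ⟨z, fun δ hδ => ?_, ?_⟩
  · filter_upwards [h, Metric.tendsto_nhds.1 hz δ hδ] with i hi hi'
    exact ⟨a i, (ha i hi).1, hi'⟩
  · refine le_of_tendsto (hz.sub (hM' c)).norm ?_
    filter_upwards [h] with i hi using (ha i hi).2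

lemma Fl.of_ulim {ι : Type*} {𝒰 : Filter ι} {A : ι → Set E}
    (h : Fl d ε (_root_.ulim 𝒰 A)) (hε : ε < ε') : ∀ᶠ i in 𝒰, Fl d ε' (A i) := by
  obtain ⟨L, hL⟩ := h
  set δ := (ε' - ε) / 2 with hδ
  have hδ0 : 0 < δ := by simp [hδ, hε]
  obtain ⟨t, ht, htf, hcov⟩ := (isCompact_closedBall (0 : Euc d) 1).finite_cover_balls hδ0
  have : ∀ c ∈ t, ∀ᶠ i in 𝒰, ∃ a ∈ A i, ‖a - L c‖ ≤ ε + δ := fun c hc => by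
    obtain ⟨w, hw, hwc⟩ := hL c (by simpa using ht hc)
    filter_upwards [hw δ hδ0] with i ⟨a, ha, haw⟩
    refine ⟨a, ha, ?_⟩
    rw [dist_eq_norm] at haw
    linarith [norm_sub_le_norm_sub_add_norm_sub a w (L c)]
  filter_upwards [(eventually_all_finite htf).2 this] with i hi
  refine ⟨L, fun c hc => ?_⟩
  obtain ⟨c', hc', hcc⟩ := mem_iUnion₂.1 (hcov (by simpa using hc : c ∈ closedBall (0 : Euc d) 1))
  obtain ⟨a, ha, hac⟩ := hi c' hc'
  refine ⟨a, ha, ?_⟩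
  have : ‖L c' - L c‖ < δ := by
    rw [← map_sub, L.norm_map, ← dist_eq_norm, dist_comm]; exact hcc
  linarith [norm_sub_le_norm_sub_add_norm_sub a (L c') (L c)]

end flat

section uniform_limits
variable {E : Type*} [NormedAddCommGroup E] [InnerProductSpace ℝ E] [FiniteDimensional ℝ E]
  [MeasurableSpace E] [BorelSpace E]

lemma Unif.dil {d : ℕ} {ν : Measure E} {S : Set E} (h : Unif d ν S) {x : E} (hx : x ∈ S)
    {r : ℝ} (hr : 0 < r) :
    Unif d ((ENNReal.ofReal r ^ d)⁻¹ • ν.map (fun z => r⁻¹ • (z - x))) (dil x r S) :=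
  h.blowup hx hr

lemma Unif.exists_limit {ι : Type*} (𝒰 : Ultrafilter ι) {d : ℕ} {μ : ι → Measure E}
    {A : ι → Set E} (h : ∀ i, Unif d (μ i) (A i)) :
    ∃ ν : Measure E, Unif d ν (ulim 𝒰 A) ∧ ∀ f : E → ℝ, Continuous f → HasCompactSupport f →
      Tendsto (fun i => ∫ z, f z ∂μ i) 𝒰 (𝓝 (∫ z, f z ∂ν)) := by
  have := fun i => (h i).isLocallyFinite
  refine exists_unif_limit 𝒰 μ A (fun i => (h i).zero_mem) (fun R => ?_) ?_ ?_
  · refine tendsto_const_nhds.congr fun i => ?_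
    exact (measure_mono_null (fun x hx => hx.2) (h i).null).symm
  · exact fun R r hr b hb => Eventually.of_forall fun i z hz => by
      rw [(h i).ball_eq z hz.1]; exact hb.le
  · exact fun R r hr b hb => Eventually.of_forall fun i z hz => by
      rw [(h i).ball_eq z hz.1]; exact hb.le

/-- Every point of the carrier of a uniform measure is in its support. -/
lemma Unif.measure_ball_pos {d : ℕ} {ν : Measure E} {S : Set E} (h : Unif d ν S) {x : E}
    (hx : x ∈ S) {r : ℝ} (hr : 0 < r) : 0 < ν (ball x r) := by
  rw [h.ball_eq x hx]; exact Metric.measure_ball_pos _ _ hr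

lemma Unif.exists_mem_ball {d : ℕ} {ν : Measure E} {S : Set E} (h : Unif d ν S) {x : E}
    (hx : x ∈ S) {r : ℝ} (hr : 0 < r) {p : E → Prop} (hp : ∀ᵐ z ∂ν, p z) :
    ∃ z ∈ S, z ∈ ball x r ∧ p z := by
  by_contra! hcon
  have : ν (ball x r) = 0 := by
    refine measure_mono_null (t := Sᶜ ∪ {z | ¬ p z}) (fun z hz => ?_) (measure_union_null h.null hp)
    by_cases hzS : z ∈ S
    · exact Or.inr (hcon z hzS hz)
    · exact Or.inl hzS
  exact (h.measure_ball_pos hx hr).ne' this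

end uniform_limits

section dimension
variable {E : Type*} [NormedAddCommGroup E] [InnerProductSpace ℝ E] [FiniteDimensional ℝ E]
  [MeasurableSpace E] [BorelSpace E]

lemma volume_ball_ofReal (d : ℕ) {r : ℝ} (hr : 0 < r) :
    volume (ball (0 : Euc d) r) = ENNReal.ofReal (r ^ d * (ballVol d).toReal) := by
  rw [volume_ball_euc d hr, ENNReal.ofReal_mul (by positivity), ENNReal.ofReal_pow hr.le,
    ENNReal.ofReal_toReal (ballVol_ne_top d)]

lemma unif_range {d : ℕ} (L : Euc d →ₗᵢ[ℝ] E) :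
    Unif d ((volume : Measure (Euc d)).map L) (range L) := by
  have hm : Measurable L := L.continuous.measurable
  have hc : IsClosed (range L) := L.isometry.isClosedEmbedding.isClosed_range
  refine ⟨hc, ⟨0, by simp⟩, ?_, ?_⟩
  · rw [Measure.map_apply hm hc.measurableSet.compl]; simp
  · rintro _ ⟨c, rfl⟩ r
    rw [Measure.map_apply hm measurableSet_ball, L.isometry.preimage_ball,
      Measure.addHaar_ball_center]

lemma exists_isometry_range (W : Submodule ℝ E) {d : ℕ} (h : Module.finrank ℝ W = d) :
    ∃ L : Euc d →ₗᵢ[ℝ] E, range L = W := by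
  subst h
  refine ⟨W.subtypeₗᵢ.comp (stdOrthonormalBasis ℝ W).repr.symm.toLinearIsometry, ?_⟩
  ext x
  simp only [mem_range, LinearIsometry.coe_comp, Function.comp]
  constructor
  · rintro ⟨c, rfl⟩; exact Subtype.mem _
  · intro hx
    exact ⟨(stdOrthonormalBasis ℝ W).repr ⟨x, hx⟩, by simp⟩

lemma exists_unif_submodule (W : Submodule ℝ E) :
    ∃ μ : Measure E, Unif (Module.finrank ℝ W) μ (W : Set E) := by
  obtain ⟨L, hL⟩ := exists_isometry_range W rfl
  exact ⟨_, hL ▸ unif_range L⟩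

lemma measure_eq_zero_of_growth {ρ ν : Measure E} [IsLocallyFiniteMeasure ρ]
    [IsLocallyFiniteMeasure ν] {s : Set E}
    (h : ∀ x ∈ s, ∀ ε : ℝ≥0, 0 < ε → ∀ᶠ r in 𝓝[>] (0 : ℝ),
      ρ (closedBall x r) ≤ ε * ν (closedBall x r)) : ρ s = 0 := by
  have key : ∀ t ⊆ s, ν t < ⊤ → ρ t = 0 := by
    intro t hts htν
    have h1 : ∀ ε : ℝ≥0, 0 < ε → ρ t ≤ ε * ν t := by
      intro ε hε
      have := VitaliFamily.measure_le_of_frequently_le (v := Besicovitch.vitaliFamily ρ)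
        (ρ := ρ) (ε • ν) Measure.AbsolutelyContinuous.rfl t (fun x hx => by
          refine (Besicovitch.tendsto_filterAt ρ x).frequently (Eventually.frequently ?_)
          filter_upwards [h x (hts hx) ε hε] with r hr
          simpa [Measure.nnreal_smul_coe_apply] using hr)
      simpa [Measure.nnreal_smul_coe_apply] using this
    refine nonpos_iff_eq_zero.1 (ENNReal.le_of_forall_pos_le_add fun ε hε _ => ?_)
    obtain ⟨C, hC, -⟩ := ENNReal.lt_iff_exists_nnreal_btwn.1 htν
    refine (h1 (ε / (C + 1)) (by positivity)).trans ?_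
    rw [zero_add]
    calc ((ε / (C + 1) : ℝ≥0) : ℝ≥0∞) * ν t ≤ ((ε / (C + 1) : ℝ≥0) : ℝ≥0∞) * (C + 1 : ℝ≥0) := by
          gcongr; exact hC.le.trans (by exact_mod_cast (le_add_of_nonneg_right zero_le_one))
      _ = ε := by
          rw [← ENNReal.coe_mul, div_mul_cancel₀]; positivity
  have hs : s ⊆ ⋃ n : ℕ, s ∩ ball 0 n := fun x hx => by
    obtain ⟨n, hn⟩ := exists_nat_gt ‖x‖
    exact mem_iUnion.2 ⟨n, hx, by simpa using hn⟩
  refine measure_mono_null hs (measure_iUnion_null fun n => key _ inter_subset_left ?_)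
  exact (measure_mono inter_subset_right).trans_lt measure_ball_lt_top

lemma Unif.dim_le {d m : ℕ} {ν μ : Measure E} {S T : Set E} (h : Unif d ν S) (h' : Unif m μ T)
    (hST : S ⊆ T) : d ≤ m := by
  by_contra! hlt
  have := h.isLocallyFinite
  have := h'.isLocallyFinite
  have h0 : ν S = 0 := by
    refine measure_eq_zero_of_growth (ν := μ) fun x hx ε hε => ?_
    have hcd : 0 < (ballVol d).toReal := ENNReal.toReal_pos (ballVol_pos d).ne' (ballVol_ne_top d)
    have hcm : 0 < (ballVol m).toReal := ENNReal.toReal_pos (ballVol_pos m).ne' (ballVol_ne_top m)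
    have hlim : Tendsto (fun r : ℝ => (2 * r) ^ (d - m) * 2 ^ m * (ballVol d).toReal) (𝓝[>] 0) (𝓝 0) := by
      refine Tendsto.mono_left ?_ nhdsWithin_le_nhds
      have : Continuous (fun r : ℝ => (2 * r) ^ (d - m) * 2 ^ m * (ballVol d).toReal) := by fun_prop
      simpa [(Nat.sub_pos_of_lt hlt).ne'] using this.tendsto 0
    filter_upwards [hlim.eventually_lt_const (u := ε * (ballVol m).toReal) (by positivity),
      self_mem_nhdsWithin] with r hr (hr0 : 0 < r)
    calc ν (closedBall x r) ≤ ν (ball x (2 * r)) :=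
          measure_mono (closedBall_subset_ball (by linarith))
      _ = ENNReal.ofReal ((2 * r) ^ d * (ballVol d).toReal) := by
          rw [h.ball_eq x hx, volume_ball_ofReal d (by positivity)]
      _ ≤ ENNReal.ofReal (ε * (r ^ m * (ballVol m).toReal)) := by
          apply ENNReal.ofReal_le_ofReal
          have : (2 * r) ^ d = (2 * r) ^ (d - m) * 2 ^ m * r ^ m := by
            rw [mul_assoc, ← mul_pow, ← pow_add, Nat.sub_add_cancel hlt.le]
          rw [this]
          nlinarith [pow_pos hr0 m]
      _ = ε * μ (ball x r) := by
          rw [h'.ball_eq x (hST hx), volume_ball_ofReal m hr0,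
            ENNReal.ofReal_mul (show (0 : ℝ) ≤ ε from ε.2), ENNReal.ofReal_coe_nnreal]
      _ ≤ ε * μ (closedBall x r) := by gcongr; exact ball_subset_closedBall
  have h1 : ν univ = 0 := by
    rw [← union_compl_self S]; exact measure_union_null h0 h.null
  exact (h.measure_ball_pos h.zero_mem one_pos).ne' (measure_mono_null (subset_univ _) h1)

/-- Somewhere and at some scale, `S` is `ε`-close to a `d`-plane. -/
def HasFlat (d : ℕ) (S : Set E) : Prop := ∀ ε > 0, ∃ z ∈ S, ∃ ρ > 0, Fl d ε (dil z ρ S)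

lemma HasFlat.of_ulim {d : ℕ} {S : Set E} {ι : Type*} {𝒰 : Filter ι} [𝒰.NeBot] {x : ι → E}
    {r : ι → ℝ} (hS : IsClosed S) (hx : ∀ i, x i ∈ S) (hr : ∀ i, 0 < r i)
    (h : HasFlat d (ulim 𝒰 fun i => dil (x i) (r i) S)) : HasFlat d S := by
  intro ε hε
  obtain ⟨z, hz, ρ, hρ, hF⟩ := h (ε / 2) (by positivity)
  obtain ⟨a, ha, haz⟩ := exists_seq_of_mem_ulim (fun i => hS.dil _ _)
    (fun i => ⟨0, by simpa [mem_dil] using hx i⟩) hz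
  have h2 := (hF.mono le_rfl (dil_ulim_subset haz hρ)).of_ulim (half_lt_self hε)
  obtain ⟨i, hi⟩ := h2.exists
  rw [dil_dil] at hi
  exact ⟨_, ha i, _, mul_pos (hr i) hρ, hi⟩

lemma ulim_subset_of_isClosed {X : Type*} [PseudoMetricSpace X] {ι : Type*} {𝒰 : Filter ι} [𝒰.NeBot]
    {A : ι → Set X} {C : Set X} (hC : IsClosed C) (h : ∀ i, A i ⊆ C) : ulim 𝒰 A ⊆ C := by
  intro z hz
  rw [← hC.closure_eq]
  refine Metric.mem_closure_iff.2 fun ε hε => ?_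
  obtain ⟨i, a, ha, haz⟩ := (hz ε hε).exists
  exact ⟨a, h i ha, by rwa [dist_comm]⟩

lemma dil_subset_submodule {S : Set E} {W : Submodule ℝ E} (h : S ⊆ W) {x : E} (hx : x ∈ S) {r : ℝ}
    (hr : 0 < r) : dil x r S ⊆ W := by
  intro a ha
  have h1 := W.sub_mem (h ha) (h hx)
  rw [add_sub_cancel_left] at h1
  simpa [smul_smul, hr.ne'] using W.smul_mem r⁻¹ h1

end dimension

section tangent
variable {E : Type*} [NormedAddCommGroup E] [InnerProductSpace ℝ E] [FiniteDimensional ℝ E]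
  [MeasurableSpace E] [BorelSpace E]

lemma abs_sq_max_sub_le (a b : ℝ) :
    |(max (1 - b) 0) ^ 2 - (max (1 - a) 0) ^ 2 + 2 * max (1 - a) 0 * (b - a)| ≤ (b - a) ^ 2 := by
  rw [abs_le]
  rcases le_total (1 - a) 0 with ha | ha <;> rcases le_total (1 - b) 0 with hb | hb <;>
    simp only [max_eq_left, max_eq_right, ha, hb] <;> constructor <;> nlinarith

lemma cutoff_eq_zero {s : ℝ} (hs : 0 < s) {z : E} (hz : 1 + 1 / s ≤ ‖z‖) :
    max (1 - s * ‖z‖ ^ 2) 0 = 0 := by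
  apply max_eq_right
  have h1 : s * (1 + 1 / s) ^ 2 ≤ s * ‖z‖ ^ 2 := by gcongr
  have h2 : s * (1 + 1 / s) ^ 2 = s + 2 + 1 / s := by field_simp; ring
  have : 0 < 1 / s := by positivity
  linarith

lemma hasCompactSupport_of_ball {F : E → ℝ} (ρ : ℝ) (h : ∀ z, ρ ≤ ‖z‖ → F z = 0) :
    HasCompactSupport F :=
  HasCompactSupport.of_support_subset_isCompact (isCompact_closedBall (0 : E) ρ) fun z hz => by
    rw [mem_closedBall_zero_iff]
    by_contra! hlt
    exact hz (h z hlt.le)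

lemma hasCompactSupport_cutoff_mul {s : ℝ} (hs : 0 < s) (f : E → ℝ) :
    HasCompactSupport fun z => max (1 - s * ‖z‖ ^ 2) 0 * f z :=
  hasCompactSupport_of_ball (1 + 1 / s) fun z hz => by rw [cutoff_eq_zero hs hz, zero_mul]

lemma Unif.moment_bound {d : ℕ} {ν : Measure E} {S : Set E} (h : Unif d ν S) {s : ℝ}
    (hs : 0 < s) : ∃ C : ℝ, ∀ w ∈ S, ‖w‖ ≤ 1 →
      |∫ z, max (1 - s * ‖z‖ ^ 2) 0 * ⟪z, w⟫ ∂ν| ≤ C * ‖w‖ ^ 2 := by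
  have := h.isLocallyFinite
  set ρ : ℝ := 2 + 1 / s with hρ
  have hs' : 0 < 1 / s := by positivity
  set I := ∫ z, max (1 - s * ‖z‖ ^ 2) 0 ∂ν with hI
  set K := s ^ 2 * (2 * ρ + 1) ^ 2 with hK
  set N := (ν (ball 0 ρ)).toReal
  refine ⟨(2 * s * |I| + K * N) / (4 * s), fun w hw hw1 => ?_⟩
  set m := ∫ z, max (1 - s * ‖z‖ ^ 2) 0 * ⟪z, w⟫ ∂ν with hm
  have hz1 : ∀ z : E, ρ ≤ ‖z‖ → max (1 - s * ‖z‖ ^ 2) 0 = 0 := fun z hz =>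
    cutoff_eq_zero hs (by linarith)
  have hz2 : ∀ z : E, ρ ≤ ‖z‖ → max (1 - s * ‖z - w‖ ^ 2) 0 = 0 := fun z hz =>
    cutoff_eq_zero hs (by linarith [norm_sub_norm_le z w])
  have i1 : Integrable (fun z => (max (1 - s * ‖z - w‖ ^ 2) 0) ^ 2) ν :=
    Continuous.integrable_of_hasCompactSupport (by fun_prop)
      (hasCompactSupport_of_ball ρ fun z hz => by simp [hz2 z hz])
  have i2 : Integrable (fun z => (max (1 - s * ‖z‖ ^ 2) 0) ^ 2) ν :=
    Continuous.integrable_of_hasCompactSupport (by fun_prop)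
      (hasCompactSupport_of_ball ρ fun z hz => by simp [hz1 z hz])
  have i3 : Integrable (fun z => max (1 - s * ‖z‖ ^ 2) 0 * ⟪z, w⟫) ν :=
    Continuous.integrable_of_hasCompactSupport (by fun_prop) (hasCompactSupport_cutoff_mul hs _)
  have i4 : Integrable (fun z => max (1 - s * ‖z‖ ^ 2) 0) ν :=
    Continuous.integrable_of_hasCompactSupport (by fun_prop)
      (hasCompactSupport_of_ball ρ fun z hz => by simp [hz1 z hz])
  have e1 : ∫ z, (max (1 - s * ‖z - w‖ ^ 2) 0) ^ 2 ∂ν = ∫ z, (max (1 - s * ‖z‖ ^ 2) 0) ^ 2 ∂ν := by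
    have hg : Measurable fun t : ℝ => (max (1 - s * t ^ 2) 0) ^ 2 := by fun_prop
    rw [h.integral_radial hw hg]
    have := h.integral_radial h.zero_mem hg
    simp only [sub_zero] at this
    rw [this]
  set F : E → ℝ := fun z => (max (1 - s * ‖z - w‖ ^ 2) 0) ^ 2 - (max (1 - s * ‖z‖ ^ 2) 0) ^ 2
    + (2 * s * ‖w‖ ^ 2 * max (1 - s * ‖z‖ ^ 2) 0 - 4 * s * (max (1 - s * ‖z‖ ^ 2) 0 * ⟪z, w⟫)) with hF
  have eF : ∫ z, F z ∂ν = 2 * s * ‖w‖ ^ 2 * I - 4 * s * m := by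
    have j1 : Integrable (fun z => (max (1 - s * ‖z - w‖ ^ 2) 0) ^ 2 -
      (max (1 - s * ‖z‖ ^ 2) 0) ^ 2) ν := i1.sub i2
    have j2 : Integrable (fun z => 2 * s * ‖w‖ ^ 2 * max (1 - s * ‖z‖ ^ 2) 0 -
      4 * s * (max (1 - s * ‖z‖ ^ 2) 0 * ⟪z, w⟫)) ν := (i4.const_mul _).sub (i3.const_mul _)
    simp only [hF]
    rw [integral_add j1 j2, integral_sub i1 i2, e1, sub_self, zero_add,
      integral_sub (i4.const_mul _) (i3.const_mul _), integral_const_mul, integral_const_mul]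
  have hFb : ∀ z ∈ ball (0 : E) ρ, ‖F z‖ ≤ K * ‖w‖ ^ 2 := by
    intro z hz
    rw [mem_ball_zero_iff] at hz
    have hzw := norm_sub_sq_real z w
    have e : F z = (max (1 - s * ‖z - w‖ ^ 2) 0) ^ 2 - (max (1 - s * ‖z‖ ^ 2) 0) ^ 2
        + 2 * max (1 - s * ‖z‖ ^ 2) 0 * (s * ‖z - w‖ ^ 2 - s * ‖z‖ ^ 2) := by
      have : s * ‖z - w‖ ^ 2 - s * ‖z‖ ^ 2 = s * (-(2 * ⟪z, w⟫) + ‖w‖ ^ 2) := by rw [hzw]; ring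
      rw [this]; simp only [hF]; ring
    rw [e, Real.norm_eq_abs]
    refine (abs_sq_max_sub_le (s * ‖z‖ ^ 2) (s * ‖z - w‖ ^ 2)).trans ?_
    rw [hzw]
    have hin := abs_le.1 (abs_real_inner_le_norm z w)
    have : |-(2 * ⟪z, w⟫) + ‖w‖ ^ 2| ≤ (2 * ρ + 1) * ‖w‖ := by
      rw [abs_le]
      constructor <;> nlinarith [norm_nonneg w, norm_nonneg z]
    have h2 := pow_le_pow_left₀ (abs_nonneg _) this 2
    rw [sq_abs] at h2
    calc _ = s ^ 2 * (-(2 * ⟪z, w⟫) + ‖w‖ ^ 2) ^ 2 := by ring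
      _ ≤ s ^ 2 * ((2 * ρ + 1) * ‖w‖) ^ 2 := by gcongr
      _ = K * ‖w‖ ^ 2 := by rw [hK]; ring
  have hFI : ‖∫ z, F z ∂ν‖ ≤ K * ‖w‖ ^ 2 * N := by
    have : ∫ z, F z ∂ν = ∫ z in ball 0 ρ, F z ∂ν := by
      rw [setIntegral_eq_integral_of_forall_compl_eq_zero]
      intro z hz
      rw [mem_ball_zero_iff, not_lt] at hz
      simp [hF, hz1 z hz, hz2 z hz]
    rw [this]
    exact norm_setIntegral_le_of_norm_le_const measure_ball_lt_top hFb
  rw [eF, Real.norm_eq_abs] at hFI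
  have h3 : |4 * s * m| ≤ 2 * s * ‖w‖ ^ 2 * |I| + K * ‖w‖ ^ 2 * N := by
    have : 4 * s * m = 2 * s * ‖w‖ ^ 2 * I - (2 * s * ‖w‖ ^ 2 * I - 4 * s * m) := by ring
    rw [this]
    refine (abs_sub _ _).trans (add_le_add ?_ hFI)
    rw [abs_mul, abs_of_nonneg (by positivity : 0 ≤ 2 * s * ‖w‖ ^ 2)]
  rw [abs_mul, abs_of_pos (by positivity : 0 < 4 * s)] at h3
  rw [div_mul_eq_mul_div, le_div_iff₀ (by positivity)]
  linarith

/-- The tangent set at a touching point lies in a half space. -/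
lemma ulim_subset_halfspace {S : Set E} {p z : E} (hmin : ∀ x ∈ S, ‖z - p‖ ≤ ‖x - p‖) {r : ℕ → ℝ}
    {𝒰 : Filter ℕ} [𝒰.NeBot] (hr : ∀ i, 0 < r i) (hr0 : Tendsto r 𝒰 (𝓝 0)) (hS : IsClosed S) (hz : z ∈ S) :
    ∀ a ∈ ulim 𝒰 (fun i => dil z (r i) S), 0 ≤ ⟪a, z - p⟫ := by
  intro a ha
  obtain ⟨b, hb, hba⟩ := exists_seq_of_mem_ulim (fun i => hS.dil _ _)
    (fun i => ⟨0, by simpa [mem_dil] using hz⟩) ha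
  have h1 : ∀ i, 0 ≤ 2 * ⟪b i, z - p⟫ + r i * ‖b i‖ ^ 2 := fun i => by
    have h := hmin _ (hb i)
    have e : z + r i • b i - p = (z - p) + r i • b i := by abel
    rw [e] at h
    have h2 := pow_le_pow_left₀ (norm_nonneg _) h 2
    rw [norm_add_sq_real, inner_smul_right, norm_smul, Real.norm_of_nonneg (hr i).le, real_inner_comm] at h2
    have : 0 ≤ r i * (2 * ⟪b i, z - p⟫ + r i * ‖b i‖ ^ 2) := by
      nlinarith
    exact nonneg_of_mul_nonneg_right this (hr i)
  have h2 : Tendsto (fun i => 2 * ⟪b i, z - p⟫ + r i * ‖b i‖ ^ 2) 𝒰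
      (𝓝 (2 * ⟪a, z - p⟫ + 0 * ‖a‖ ^ 2)) :=
    ((hba.inner tendsto_const_nhds).const_mul 2).add (hr0.mul (hba.norm.pow 2))
  have := ge_of_tendsto' h2 h1
  linarith

/-- A tangent measure at a boundary point of a uniform measure in a half space lies in the bounding hyperplane. -/
lemma Unif.tangent_subset_hyperplane {d : ℕ} {ν : Measure E} {S : Set E} (h : Unif d ν S) {e : E}
    (he : ∀ a ∈ S, 0 ≤ ⟪a, e⟫) {𝒰 : Ultrafilter ℕ} {r : ℕ → ℝ} (hr : ∀ i, 0 < r i)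
    (hr0 : Tendsto r 𝒰 (𝓝 0)) :
    ∀ a ∈ _root_.ulim 𝒰 (fun i => _root_.dil 0 (r i) S), ⟪a, e⟫ = 0 := by
  have := h.isLocallyFinite
  obtain ⟨μ, hμ, hlim⟩ := Unif.exists_limit 𝒰 (fun i => h.dil h.zero_mem (hr i))
  have := hμ.isLocallyFinite
  set T := _root_.ulim 𝒰 (fun i => _root_.dil 0 (r i) S) with hT
  have hTe : ∀ a ∈ T, 0 ≤ ⟪a, e⟫ := by
    refine ulim_subset_of_isClosed (C := {a | 0 ≤ ⟪a, e⟫})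
      (isClosed_le continuous_const (by fun_prop)) fun i a ha => ?_
    have := he _ ha
    simp only [zero_add, inner_smul_left] at this
    exact nonneg_of_mul_nonneg_right this (hr i)
  have key1 : ∀ s > 0, ∀ a ∈ T, ∫ z, max (1 - s * ‖z‖ ^ 2) 0 * ⟪z, a⟫ ∂ν = 0 := by
    intro s hs a ha
    obtain ⟨b, hb, hba⟩ := exists_seq_of_mem_ulim (fun i => h.closed.dil _ _)
      (fun i => ⟨0, by simpa [mem_dil] using h.zero_mem⟩) ha
    obtain ⟨C, hC⟩ := h.moment_bound hs
    have hlin : ∀ x : E, ∀ c : ℝ, ∫ z, max (1 - s * ‖z‖ ^ 2) 0 * ⟪z, c • x⟫ ∂ν =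
        c * ∫ z, max (1 - s * ‖z‖ ^ 2) 0 * ⟪z, x⟫ ∂ν := fun x c => by
      rw [← integral_const_mul]; congr 1; ext z; rw [inner_smul_right]; ring
    have hi : ∀ x : E, Integrable (fun z => max (1 - s * ‖z‖ ^ 2) 0 * ⟪z, x⟫) ν := fun x =>
      Continuous.integrable_of_hasCompactSupport (by fun_prop) (hasCompactSupport_cutoff_mul hs _)
    let φ : E →ₗ[ℝ] ℝ :=
      { toFun := fun x => ∫ z, max (1 - s * ‖z‖ ^ 2) 0 * ⟪z, x⟫ ∂ν
        map_add' := fun x y => by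
          rw [← integral_add (hi x) (hi y)]; congr 1; ext z; rw [inner_add_right]; ring
        map_smul' := fun c x => hlin x c }
    have hφ : Continuous φ := φ.continuous_of_finiteDimensional
    have hrb : Tendsto (fun i => ‖r i • b i‖) 𝒰 (𝓝 0) := by
      simpa using (hr0.smul hba).norm
    have h1 : ∀ᶠ i in (𝒰 : Filter ℕ), |φ (b i)| ≤ C * r i * ‖b i‖ ^ 2 := by
      filter_upwards [hrb.eventually_le_const one_pos] with i hi1
      have hbi : r i • b i ∈ S := by simpa [mem_dil] using hb i
      have h2 : |φ (r i • b i)| ≤ _ := hC _ hbi hi1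
      rw [map_smul, smul_eq_mul, abs_mul, norm_smul, Real.norm_of_nonneg (hr i).le, abs_of_pos (hr i)] at h2
      have : r i * |φ (b i)| ≤ r i * (C * r i * ‖b i‖ ^ 2) := by linarith
      exact le_of_mul_le_mul_left this (hr i)
    have h3 : Tendsto (fun i => C * r i * ‖b i‖ ^ 2) 𝒰 (𝓝 (C * 0 * ‖a‖ ^ 2)) :=
      (hr0.const_mul C).mul (hba.norm.pow 2)
    have h4 : Tendsto (fun i => |φ (b i)|) 𝒰 (𝓝 |φ a|) := ((hφ.tendsto a).comp hba).abs
    have h5 := le_of_tendsto_of_tendsto h4 h3 h1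
    have : |φ a| ≤ 0 := by simpa using h5
    exact abs_eq_zero.1 (le_antisymm this (abs_nonneg _))
  have key2 : ∀ s > 0, ∀ a ∈ T, ∫ z, max (1 - s * ‖z‖ ^ 2) 0 * ⟪z, a⟫ ∂μ = 0 := by
    intro s hs a ha
    refine tendsto_nhds_unique (hlim _ (by fun_prop) (hasCompactSupport_cutoff_mul hs _)) ?_
    refine tendsto_const_nhds.congr fun i => ?_
    rw [integral_smul_measure, integral_map (by fun_prop) (by fun_prop)]
    have e1 : ∀ z : E, max (1 - s * ‖(r i)⁻¹ • (z - 0)‖ ^ 2) 0 * ⟪(r i)⁻¹ • (z - 0), a⟫ =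
        (r i)⁻¹ * (max (1 - s * (r i)⁻¹ ^ 2 * ‖z‖ ^ 2) 0 * ⟪z, a⟫) := fun z => by
      rw [sub_zero, norm_smul, inner_smul_left, norm_inv, Real.norm_of_nonneg (hr i).le, mul_pow,
        mul_assoc s]
      simp; ring
    simp only [e1]
    rw [integral_const_mul, key1 _ (by have := hr i; positivity) a ha]; simp
  have key3 : ∀ s > 0, ∀ x : E, ∫ z, max (1 - s * ‖z‖ ^ 2) 0 * ⟪z, x⟫ ∂μ = 0 := by
    intro s hs
    have hi : Integrable (fun z => max (1 - s * ‖z‖ ^ 2) 0 • z) μ := by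
      refine Continuous.integrable_of_hasCompactSupport (by fun_prop) ?_
      refine HasCompactSupport.of_support_subset_isCompact (isCompact_closedBall (0 : E) (1 + 1 / s))
        fun z hz => ?_
      rw [mem_closedBall_zero_iff]
      by_contra! hlt
      exact hz (by simp only [cutoff_eq_zero hs hlt.le, zero_smul])
    set v := ∫ z, max (1 - s * ‖z‖ ^ 2) 0 • z ∂μ with hv
    have hvx : ∀ x : E, ∫ z, max (1 - s * ‖z‖ ^ 2) 0 * ⟪z, x⟫ ∂μ = ⟪x, v⟫ := fun x => by
      rw [hv, ← integral_inner hi x]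
      congr 1; ext z; rw [inner_smul_right, real_inner_comm]
    have hv0 : v = 0 := by
      rw [← inner_self_eq_zero (𝕜 := ℝ), ← hvx]
      refine integral_eq_zero_of_ae ?_
      filter_upwards [hμ.ae_mem] with z hz
      have := key2 s hs z hz
      rw [hvx] at this
      simp [this]
    intro x
    rw [hvx, hv0, inner_zero_right]
  intro a ha
  by_contra hne
  have hpos : 0 < ⟪a, e⟫ := lt_of_le_of_ne (hTe a ha) (Ne.symm hne)
  set s : ℝ := 1 / (‖a‖ ^ 2 + 1) with hs_def
  have hs : 0 < s := by positivity
  have hca : 0 < 1 - s * ‖a‖ ^ 2 := by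
    rw [hs_def, div_mul_eq_mul_div, one_mul, sub_pos, div_lt_one (by positivity)]; linarith
  have hi : Integrable (fun z => max (1 - s * ‖z‖ ^ 2) 0 * ⟪z, e⟫) μ :=
    Continuous.integrable_of_hasCompactSupport (by fun_prop) (hasCompactSupport_cutoff_mul hs _)
  have h0 : (fun z => max (1 - s * ‖z‖ ^ 2) 0 * ⟪z, e⟫) =ᵐ[μ] 0 := by
    refine (integral_eq_zero_iff_of_nonneg_ae ?_ hi).1 (key3 s hs e)
    filter_upwards [hμ.ae_mem] with z hz
    exact mul_nonneg (le_max_right _ _) (hTe z hz)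
  have hcont : Continuous (fun z : E => (1 - s * ‖z‖ ^ 2) ) := by fun_prop
  have hcont2 : Continuous (fun z : E => ⟪z, e⟫) := by fun_prop
  obtain ⟨δ, hδ, hball⟩ := Metric.eventually_nhds_iff.1
    ((hcont.continuousAt.eventually_const_lt hca).and (hcont2.continuousAt.eventually_const_lt hpos))
  obtain ⟨z, -, hz, hz0⟩ := hμ.exists_mem_ball ha hδ h0
  have := hball hz
  have h2 : 0 < max (1 - s * ‖z‖ ^ 2) 0 * ⟪z, e⟫ := mul_pos (lt_max_of_lt_left this.1) this.2
  exact h2.ne' hz0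

lemma finrank_inf_orthogonal_lt {W : Submodule ℝ E} {e : E} (he : e ∈ W) (he0 : e ≠ 0) :
    Module.finrank ℝ (W ⊓ (ℝ ∙ e)ᗮ : Submodule ℝ E) < Module.finrank ℝ W := by
  apply Submodule.finrank_lt_finrank_of_lt
  refine lt_of_le_of_ne inf_le_left fun h => ?_
  have : e ∈ W ⊓ (ℝ ∙ e)ᗮ := h.ge he
  have h2 := Submodule.mem_orthogonal_singleton_iff_inner_right.1 this.2
  exact he0 (inner_self_eq_zero.1 h2)

/-- A uniform measure whose carrier is a proper subset of a subspace has iterated tangents in a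
smaller subspace. -/
lemma Unif.exists_tangent_smaller {d : ℕ} {ν : Measure E} {S : Set E} (h : Unif d ν S)
    {W : Submodule ℝ E} (hSW : S ⊆ W) (hne : S ≠ W) : ∃ (μ : Measure E) (T : Set E)
      (W' : Submodule ℝ E), Unif d μ T ∧ T ⊆ W' ∧ Module.finrank ℝ W' < Module.finrank ℝ W ∧
        (HasFlat d T → HasFlat d S) := by
  obtain ⟨p, hpW, hpS⟩ := Set.exists_of_ssubset (hSW.ssubset_of_ne hne)
  obtain ⟨z, hz, hzp⟩ := h.closed.exists_infDist_eq_dist ⟨0, h.zero_mem⟩ p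
  have hmin : ∀ x ∈ S, ‖z - p‖ ≤ ‖x - p‖ := fun x hx => by
    rw [← dist_eq_norm, ← dist_eq_norm, dist_comm z, dist_comm x, ← hzp]
    exact infDist_le_dist_of_mem hx
  set r : ℕ → ℝ := fun i => 1 / (i + 1) with hr_def
  have hr : ∀ i, 0 < r i := fun i => by rw [hr_def]; positivity
  set 𝒰 : Ultrafilter ℕ := hyperfilter ℕ
  have hr0 : Tendsto r 𝒰 (𝓝 0) :=
    tendsto_one_div_add_atTop_nhds_zero_nat.mono_left Nat.hyperfilter_le_atTop
  have hWc : IsClosed (W : Set E) := W.closed_of_finiteDimensional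
  obtain ⟨μ₁, h₁, -⟩ := Unif.exists_limit 𝒰 (fun i => h.dil hz (hr i))
  obtain ⟨μ₂, h₂, -⟩ := Unif.exists_limit 𝒰 (fun i => h₁.dil h₁.zero_mem (hr i))
  have hs1 : _root_.ulim 𝒰 (fun i => _root_.dil z (r i) S) ⊆ (W : Set E) :=
    ulim_subset_of_isClosed hWc fun i => dil_subset_submodule hSW hz (hr i)
  refine ⟨μ₂, _, W ⊓ (ℝ ∙ (z - p))ᗮ, h₂, ?_, finrank_inf_orthogonal_lt (W.sub_mem (hSW hz) hpW) ?_,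
    fun hF => ?_⟩
  · intro a ha
    refine ⟨?_, ?_⟩
    · exact (ulim_subset_of_isClosed hWc fun i => dil_subset_submodule hs1 h₁.zero_mem (hr i)) ha
    · refine Submodule.mem_orthogonal_singleton_iff_inner_left.2 ?_
      exact h₁.tangent_subset_hyperplane (ulim_subset_halfspace hmin hr hr0 h.closed hz) hr hr0 a ha
  · exact sub_ne_zero.2 fun h => hpS (h ▸ hz)
  · exact HasFlat.of_ulim h.closed (fun _ => hz) hr
      (HasFlat.of_ulim h₁.closed (fun _ => h₁.zero_mem) hr hF)

lemma Unif.eq_submodule {d : ℕ} {ν : Measure E} {S : Set E} (h : Unif d ν S)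
    {W : Submodule ℝ E} (hSW : S ⊆ W) (hW : Module.finrank ℝ W = d) : S = W := by
  by_contra hne
  obtain ⟨μ, T, W', hT, hTW, hlt, -⟩ := h.exists_tangent_smaller hSW hne
  obtain ⟨m, hm⟩ := exists_unif_submodule W'
  have := hT.dim_le hm hTW
  omega

lemma Unif.hasFlat {d : ℕ} {ν : Measure E} {S : Set E} (h : Unif d ν S) : HasFlat d S := by
  have key : ∀ k : ℕ, ∀ (ν : Measure E) (S : Set E) (W : Submodule ℝ E), Unif d ν S → S ⊆ W →
      Module.finrank ℝ W = k → HasFlat d S := by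
    intro k
    induction k using Nat.strong_induction_on with
    | _ k ih =>
      intro ν S W h hSW hW
      by_cases hne : S = W
      · obtain ⟨m, hm⟩ := exists_unif_submodule W
        have hd : Module.finrank ℝ W = d :=
          le_antisymm (hm.dim_le h hne.ge) (h.dim_le hm hSW)
        obtain ⟨L, hL⟩ := exists_isometry_range W hd
        intro ε hε
        refine ⟨0, h.zero_mem, 1, one_pos, ?_⟩
        rw [dil_zero_one]
        exact Fl.of_range L (by rw [hL, hne]) hε.le
      · obtain ⟨μ, T, W', hT, hTW, hlt, hF⟩ := h.exists_tangent_smaller hSW hne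
        exact hF (ih _ (hW ▸ hlt) μ T W' hT hTW rfl)
  exact key _ ν S ⊤ h (fun x _ => trivial) rfl

end tangent

section gaussian

lemma pow_le_exp_sq (k : ℕ) {ε : ℝ} (hε : 0 < ε) :
    ∃ C > 0, ∀ t : ℝ, |t| ^ k ≤ C * Real.exp (ε * t ^ 2) := by
  refine ⟨1 + k.factorial / ε ^ k, by positivity, fun t => ?_⟩
  have h1 : |t| ^ k ≤ 1 + (t ^ 2) ^ k := by
    rw [← sq_abs, ← pow_mul, mul_comm, pow_mul]
    nlinarith [sq_nonneg (|t| ^ k - 1 / 2)]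
  have h2 := Real.pow_div_factorial_le_exp (x := ε * t ^ 2) (by positivity) k
  have h3 : (t ^ 2) ^ k ≤ k.factorial / ε ^ k * Real.exp (ε * t ^ 2) := by
    rw [div_le_iff₀ (by positivity), mul_pow] at h2
    rw [div_mul_eq_mul_div, le_div_iff₀ (by positivity)]
    linarith
  have h4 : 1 ≤ Real.exp (ε * t ^ 2) := Real.one_le_exp (by positivity)
  linarith

lemma abs_exp_sub_quadratic_le (x : ℝ) :
    |Real.exp x - (1 + x + x ^ 2 / 2)| ≤ |x| ^ 3 * Real.exp |x| := by
  have h := Complex.norm_exp_sub_sum_le_norm_mul_exp (x : ℂ) 3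
  have e : (Complex.exp (x : ℂ) - ∑ m ∈ Finset.range 3, (x : ℂ) ^ m / (m.factorial : ℂ)) =
      ((Real.exp x - (1 + x + x ^ 2 / 2) : ℝ) : ℂ) := by
    simp [Finset.sum_range_succ, Nat.factorial]
  rw [e, Complex.norm_real, Complex.norm_real] at h
  exact h

/-- Integrability of functions of sub-Gaussian growth against Gaussian weights. -/
lemma integrable_gauss_smul {Ω : Type*} [MeasurableSpace Ω] {ν : Measure Ω} {ρ : Ω → ℝ}
    (hi : ∀ s > 0, Integrable (fun z => Real.exp (-s * ρ z ^ 2)) ν) (hρ : Measurable ρ) {F : Type*}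
    [NormedAddCommGroup F] [NormedSpace ℝ F] {f : Ω → F} (hf : AEStronglyMeasurable f ν) {s s' C : ℝ}
    (hs : s' < s) (hb : ∀ᵐ z ∂ν, ‖f z‖ ≤ C * Real.exp (s' * ρ z ^ 2)) :
    Integrable (fun z => Real.exp (-s * ρ z ^ 2) • f z) ν := by
  refine ((hi (s - s') (sub_pos.2 hs)).const_mul C).mono'
    (AEStronglyMeasurable.smul (by fun_prop) hf) ?_
  filter_upwards [hb] with z hz
  rw [norm_smul, Real.norm_of_nonneg (Real.exp_pos _).le]
  calc _ ≤ Real.exp (-s * ρ z ^ 2) * (C * Real.exp (s' * ρ z ^ 2)) := by gcongr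
    _ = C * Real.exp (-(s - s') * ρ z ^ 2) := by
      rw [mul_left_comm, ← Real.exp_add]; ring_nf

lemma integrable_gauss_smul_pow {Ω : Type*} [MeasurableSpace Ω] {ν : Measure Ω} {ρ : Ω → ℝ}
    (hi : ∀ s > 0, Integrable (fun z => Real.exp (-s * ρ z ^ 2)) ν) (hρ : Measurable ρ) {F : Type*}
    [NormedAddCommGroup F] [NormedSpace ℝ F] {f : Ω → F} (hf : AEStronglyMeasurable f ν) {s K : ℝ}
    (k : ℕ) (hs : 0 < s) (hK : 0 ≤ K) (hb : ∀ᵐ z ∂ν, ‖f z‖ ≤ K * |ρ z| ^ k) :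
    Integrable (fun z => Real.exp (-s * ρ z ^ 2) • f z) ν := by
  obtain ⟨C, hC, h⟩ := pow_le_exp_sq k (half_pos hs)
  refine integrable_gauss_smul hi hρ hf (half_lt_self hs) (C := K * C) ?_
  filter_upwards [hb] with z hz
  exact hz.trans (by rw [mul_assoc]; exact mul_le_mul_of_nonneg_left (h _) hK)

variable {E : Type*} [NormedAddCommGroup E] [InnerProductSpace ℝ E] [FiniteDimensional ℝ E]
  [MeasurableSpace E] [BorelSpace E]

lemma integrable_gauss_euc (d : ℕ) {s : ℝ} (hs : 0 < s) :
    Integrable (fun u : Euc d => Real.exp (-s * ‖u‖ ^ 2)) := by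
  have h := GaussianFourier.integral_rexp_neg_mul_sq_norm (V := Euc d) hs
  by_contra hn
  rw [integral_undef hn] at h
  exact (Real.rpow_pos_of_pos (by positivity) _).ne h

/-- The total Gaussian mass `(π / s) ^ (d / 2)`. -/
def gaussMass (d : ℕ) (s : ℝ) : ℝ := (Real.pi / s) ^ ((d : ℝ) / 2)

lemma gaussMass_pos (d : ℕ) {s : ℝ} (hs : 0 < s) : 0 < gaussMass d s :=
  Real.rpow_pos_of_pos (by positivity) _

lemma gaussMass_div (d : ℕ) {s t : ℝ} (hs : 0 < s) (ht : 0 < t) :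
    gaussMass d (s / t) = t ^ ((d : ℝ) / 2) * gaussMass d s := by
  rw [gaussMass, gaussMass, ← Real.mul_rpow ht.le (by positivity)]
  congr 1; field_simp

variable {d : ℕ} {ν : Measure E} {S : Set E}

lemma Unif.integrable_gauss (h : Unif d ν S) {x : E} (hx : x ∈ S) {s : ℝ} (hs : 0 < s) :
    Integrable (fun z => Real.exp (-s * ‖z - x‖ ^ 2)) ν :=
  h.integrable_radial hx (g := fun t => Real.exp (-s * t ^ 2)) (by fun_prop) (integrable_gauss_euc d hs)

lemma Unif.integral_gauss (h : Unif d ν S) {x : E} (hx : x ∈ S) {s : ℝ} (hs : 0 < s) :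
    ∫ z, Real.exp (-s * ‖z - x‖ ^ 2) ∂ν = gaussMass d s := by
  rw [h.integral_radial hx (g := fun t => Real.exp (-s * t ^ 2)) (by fun_prop),
    GaussianFourier.integral_rexp_neg_mul_sq_norm hs, finrank_euclideanSpace_fin, gaussMass]

lemma Unif.integrable_gauss_zero (h : Unif d ν S) :
    ∀ s > 0, Integrable (fun z : E => Real.exp (-s * ‖z‖ ^ 2)) ν := fun s hs => by
  simpa using h.integrable_gauss h.zero_mem hs

lemma Unif.integral_gauss_zero (h : Unif d ν S) {s : ℝ} (hs : 0 < s) :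
    ∫ z, Real.exp (-s * ‖z‖ ^ 2) ∂ν = gaussMass d s := by
  simpa using h.integral_gauss h.zero_mem hs

lemma hasDerivAt_gaussMass (d : ℕ) {s : ℝ} (hs : 0 < s) :
    HasDerivAt (gaussMass d) (-(d / (2 * s) * gaussMass d s)) s := by
  have h1 : HasDerivAt (fun s : ℝ => Real.pi / s) (-Real.pi / s ^ 2) s := by
    simpa using (hasDerivAt_const s Real.pi).fun_div (hasDerivAt_id' s) hs.ne'
  have hp : 0 < Real.pi / s := by positivity
  refine (h1.rpow_const (p := (d : ℝ) / 2) (Or.inl hp.ne')).congr_deriv ?_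
  rw [Real.rpow_sub_one hp.ne', gaussMass]
  field_simp

lemma Unif.gauss_second_moment (h : Unif d ν S) {s : ℝ} (hs : 0 < s) :
    ∫ z, Real.exp (-s * ‖z‖ ^ 2) * ‖z‖ ^ 2 ∂ν = d / (2 * s) * gaussMass d s := by
  have hi := h.integrable_gauss_zero
  set M := ∫ z, Real.exp (-s * ‖z‖ ^ 2) * ‖z‖ ^ 2 ∂ν with hM
  have hiM : Integrable (fun z : E => Real.exp (-s * ‖z‖ ^ 2) * ‖z‖ ^ 2) ν :=
    integrable_gauss_smul_pow (ρ := fun z => ‖z‖) hi (by fun_prop) (f := fun z => ‖z‖ ^ 2) (by fun_prop) 2 hs zero_le_one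
      (by simp)
  have hd : HasDerivAt (fun t => gaussMass d t + t * M) (-(d / (2 * s) * gaussMass d s) + 1 * M) s :=
    (hasDerivAt_gaussMass d hs).add ((hasDerivAt_id s).mul_const M)
  have hmin : IsLocalMin (fun t => gaussMass d t + t * M) s := by
    filter_upwards [lt_mem_nhds hs] with t ht
    rw [← h.integral_gauss_zero ht, ← h.integral_gauss_zero hs, hM, ← integral_const_mul, ← integral_const_mul,
      ← integral_add (hi s hs) (hiM.const_mul s), ← integral_add (hi t ht) (hiM.const_mul t)]
    refine integral_mono ((hi s hs).add (hiM.const_mul s)) ((hi t ht).add (hiM.const_mul t)) fun z => ?_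
    have h1 := Real.add_one_le_exp ((s - t) * ‖z‖ ^ 2)
    have h2 : Real.exp (-t * ‖z‖ ^ 2) = Real.exp (-s * ‖z‖ ^ 2) * Real.exp ((s - t) * ‖z‖ ^ 2) := by
      rw [← Real.exp_add]; ring_nf
    have h3 := Real.exp_pos (-s * ‖z‖ ^ 2)
    simp only
    rw [h2]
    nlinarith
  have := hmin.hasDerivAt_eq_zero hd
  linarith

lemma Unif.quadric (h : Unif d ν S) {x : E} (hx : x ∈ S) :
    Tendsto (fun s => (gaussMass d s)⁻¹ * (2 * ∫ z, Real.exp (-s * ‖z‖ ^ 2) * ⟪z, x⟫ ∂ν +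
      2 * s * ∫ z, Real.exp (-s * ‖z‖ ^ 2) * ⟪z, x⟫ ^ 2 ∂ν)) (𝓝[>] 0) (𝓝 (‖x‖ ^ 2)) := by
  have hi := h.integrable_gauss_zero
  obtain ⟨C, hC, hCt⟩ := pow_le_exp_sq 3 (by norm_num : (0 : ℝ) < 1 / 4)
  set K := 8 * ‖x‖ ^ 3 * C * Real.exp (4 * ‖x‖ ^ 2) with hK
  have key : ∀ s : ℝ, 0 < s → s ≤ 1 → |(gaussMass d s)⁻¹ * (2 * ∫ z, Real.exp (-s * ‖z‖ ^ 2) * ⟪z, x⟫ ∂ν +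
      2 * s * ∫ z, Real.exp (-s * ‖z‖ ^ 2) * ⟪z, x⟫ ^ 2 ∂ν) - (Real.exp (s * ‖x‖ ^ 2) - 1) / s| ≤
      K * 2 ^ ((d : ℝ) / 2) * √s := by
    intro s hs hs1
    have i1 : Integrable (fun z : E => Real.exp (-s * ‖z‖ ^ 2) * ⟪z, x⟫) ν :=
      integrable_gauss_smul_pow (ρ := fun z => ‖z‖) hi (by fun_prop) (f := fun z => ⟪z, x⟫) (by fun_prop) 1 hs
        (norm_nonneg x) (Eventually.of_forall fun z => by
          rw [abs_norm, pow_one, mul_comm]; exact norm_inner_le_norm _ _)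
    have i2 : Integrable (fun z : E => Real.exp (-s * ‖z‖ ^ 2) * ⟪z, x⟫ ^ 2) ν :=
      integrable_gauss_smul_pow (ρ := fun z => ‖z‖) hi (by fun_prop) (f := fun z => ⟪z, x⟫ ^ 2) (by fun_prop) 2 hs
        (sq_nonneg ‖x‖) (Eventually.of_forall fun z => by
          rw [abs_norm, norm_pow, ← mul_pow, mul_comm]; gcongr; exact norm_inner_le_norm _ _)
    have i0 := hi s hs
    have i3 : Integrable (fun z : E => Real.exp (-s * ‖z - x‖ ^ 2) * Real.exp (s * ‖x‖ ^ 2)) ν :=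
      (h.integrable_gauss hx hs).mul_const _
    have e3 : ∫ z, Real.exp (-s * ‖z - x‖ ^ 2) * Real.exp (s * ‖x‖ ^ 2) ∂ν =
        gaussMass d s * Real.exp (s * ‖x‖ ^ 2) := by
      rw [integral_mul_const, h.integral_gauss hx hs]
    set G := gaussMass d s
    have hG : 0 < G := gaussMass_pos d hs
    set I1 := ∫ z, Real.exp (-s * ‖z‖ ^ 2) * ⟪z, x⟫ ∂ν
    set I2 := ∫ z, Real.exp (-s * ‖z‖ ^ 2) * ⟪z, x⟫ ^ 2 ∂ν
    have e4 : ∫ z, (Real.exp (-s * ‖z - x‖ ^ 2) * Real.exp (s * ‖x‖ ^ 2) -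
        (Real.exp (-s * ‖z‖ ^ 2) + (2 * s * (Real.exp (-s * ‖z‖ ^ 2) * ⟪z, x⟫) +
          2 * s ^ 2 * (Real.exp (-s * ‖z‖ ^ 2) * ⟪z, x⟫ ^ 2)))) ∂ν =
        G * Real.exp (s * ‖x‖ ^ 2) - (G + (2 * s * I1 + 2 * s ^ 2 * I2)) := by
      have j1 : Integrable (fun z => 2 * s * (Real.exp (-s * ‖z‖ ^ 2) * ⟪z, x⟫) +
          2 * s ^ 2 * (Real.exp (-s * ‖z‖ ^ 2) * ⟪z, x⟫ ^ 2)) ν := (i1.const_mul _).add (i2.const_mul _)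
      have j2 : Integrable (fun z => Real.exp (-s * ‖z‖ ^ 2) + (2 * s * (Real.exp (-s * ‖z‖ ^ 2) * ⟪z, x⟫) +
          2 * s ^ 2 * (Real.exp (-s * ‖z‖ ^ 2) * ⟪z, x⟫ ^ 2))) ν := i0.add j1
      rw [integral_sub i3 j2, e3, integral_add i0 j1, integral_add (i1.const_mul _) (i2.const_mul _),
        integral_const_mul, integral_const_mul, h.integral_gauss_zero hs]
    have b4 : ∀ z : E, ‖Real.exp (-s * ‖z - x‖ ^ 2) * Real.exp (s * ‖x‖ ^ 2) -
        (Real.exp (-s * ‖z‖ ^ 2) + (2 * s * (Real.exp (-s * ‖z‖ ^ 2) * ⟪z, x⟫) +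
          2 * s ^ 2 * (Real.exp (-s * ‖z‖ ^ 2) * ⟪z, x⟫ ^ 2)))‖ ≤
        K * (s * √s) * Real.exp (-(s / 2) * ‖z‖ ^ 2) := by
      intro z
      have e : Real.exp (-s * ‖z - x‖ ^ 2) * Real.exp (s * ‖x‖ ^ 2) -
        (Real.exp (-s * ‖z‖ ^ 2) + (2 * s * (Real.exp (-s * ‖z‖ ^ 2) * ⟪z, x⟫) +
          2 * s ^ 2 * (Real.exp (-s * ‖z‖ ^ 2) * ⟪z, x⟫ ^ 2))) =
          Real.exp (-s * ‖z‖ ^ 2) * (Real.exp (2 * s * ⟪z, x⟫) -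
            (1 + 2 * s * ⟪z, x⟫ + (2 * s * ⟪z, x⟫) ^ 2 / 2)) := by
        have : Real.exp (-s * ‖z - x‖ ^ 2) * Real.exp (s * ‖x‖ ^ 2) =
            Real.exp (-s * ‖z‖ ^ 2) * Real.exp (2 * s * ⟪z, x⟫) := by
          rw [← Real.exp_add, ← Real.exp_add, norm_sub_sq_real]; ring_nf
        rw [this]; ring
      rw [e, norm_mul, Real.norm_of_nonneg (Real.exp_pos _).le, Real.norm_eq_abs]
      set t := √s * ‖z‖ with ht
      have hss : √s * √s = s := Real.mul_self_sqrt hs.le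
      have hs1' : √s ≤ 1 := by rw [← Real.sqrt_one]; exact Real.sqrt_le_sqrt hs1
      have ht0 : 0 ≤ t := by positivity
      have ht2 : t ^ 2 = s * ‖z‖ ^ 2 := by rw [ht, mul_pow, Real.sq_sqrt hs.le]
      have hy : |2 * s * ⟪z, x⟫| ≤ 2 * √s * ‖x‖ * t := by
        rw [abs_mul, abs_of_pos (by positivity : 0 < 2 * s)]
        calc _ ≤ 2 * s * (‖z‖ * ‖x‖) := by gcongr; exact abs_real_inner_le_norm _ _
          _ = 2 * (√s * √s) * (‖z‖ * ‖x‖) := by rw [hss]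
          _ = _ := by rw [ht]; ring
      have hexp : Real.exp |2 * s * ⟪z, x⟫| ≤ Real.exp (4 * ‖x‖ ^ 2 + 1 / 4 * t ^ 2) := by
        apply Real.exp_le_exp.2
        have : 2 * √s * ‖x‖ * t ≤ 2 * 1 * ‖x‖ * t := by gcongr
        nlinarith [sq_nonneg (2 * ‖x‖ - 1 / 2 * t)]
      have h3 := hCt t
      rw [abs_of_nonneg ht0] at h3
      have hs3 : √s ^ 3 = s * √s := by rw [pow_succ, Real.sq_sqrt hs.le]
      calc _ ≤ Real.exp (-s * ‖z‖ ^ 2) * (|2 * s * ⟪z, x⟫| ^ 3 * Real.exp |2 * s * ⟪z, x⟫|) := by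
            gcongr; exact abs_exp_sub_quadratic_le _
        _ ≤ Real.exp (-s * ‖z‖ ^ 2) * ((2 * √s * ‖x‖ * t) ^ 3 * Real.exp (4 * ‖x‖ ^ 2 + 1 / 4 * t ^ 2)) := by
            gcongr
        _ = 8 * (s * √s) * ‖x‖ ^ 3 * Real.exp (-s * ‖z‖ ^ 2) * Real.exp (4 * ‖x‖ ^ 2 + 1 / 4 * t ^ 2) * t ^ 3 := by
            rw [← hs3]; ring
        _ ≤ 8 * (s * √s) * ‖x‖ ^ 3 * Real.exp (-s * ‖z‖ ^ 2) * Real.exp (4 * ‖x‖ ^ 2 + 1 / 4 * t ^ 2) *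
            (C * Real.exp (1 / 4 * t ^ 2)) := by gcongr
        _ = K * (s * √s) * (Real.exp (-s * ‖z‖ ^ 2) * Real.exp (1 / 4 * t ^ 2) * Real.exp (1 / 4 * t ^ 2)) := by
            rw [hK, Real.exp_add]; ring
        _ = _ := by
            rw [← Real.exp_add, ← Real.exp_add, ht2]; ring_nf
    have b5 := norm_integral_le_of_norm_le ((hi (s / 2) (by positivity)).const_mul (K * (s * √s)))
      (Eventually.of_forall b4)
    rw [e4, integral_const_mul, h.integral_gauss_zero (by positivity), gaussMass_div d hs two_pos,
      Real.norm_eq_abs] at b5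
    have e6 : G⁻¹ * (2 * I1 + 2 * s * I2) - (Real.exp (s * ‖x‖ ^ 2) - 1) / s =
      -((G * s)⁻¹ * (G * Real.exp (s * ‖x‖ ^ 2) - (G + (2 * s * I1 + 2 * s ^ 2 * I2)))) := by
      field_simp; ring
    rw [e6, abs_neg, abs_mul, abs_of_pos (by positivity : 0 < (G * s)⁻¹), inv_mul_le_iff₀ (by positivity)]
    refine b5.trans_eq ?_
    ring
  have hder : Tendsto (fun s : ℝ => (Real.exp (s * ‖x‖ ^ 2) - 1) / s) (𝓝[>] 0) (𝓝 (‖x‖ ^ 2)) := by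
    have h1 : HasDerivAt (fun s : ℝ => Real.exp (s * ‖x‖ ^ 2)) (‖x‖ ^ 2) 0 := by
      simpa using ((hasDerivAt_id (0 : ℝ)).mul_const (‖x‖ ^ 2)).exp
    have := h1.tendsto_slope_zero_right
    refine this.congr fun s => ?_
    simp [div_eq_inv_mul]
  have hsq : Tendsto (fun s : ℝ => K * 2 ^ ((d : ℝ) / 2) * √s) (𝓝[>] 0) (𝓝 0) := by
    have : Tendsto (fun s : ℝ => K * 2 ^ ((d : ℝ) / 2) * √s) (𝓝 0) (𝓝 (K * 2 ^ ((d : ℝ) / 2) * √0)) :=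
      Continuous.tendsto (by fun_prop) _
    simpa using this.mono_left nhdsWithin_le_nhds
  have h0 := squeeze_zero_norm' (f := fun s => (gaussMass d s)⁻¹ * (2 * ∫ z, Real.exp (-s * ‖z‖ ^ 2) * ⟪z, x⟫ ∂ν +
      2 * s * ∫ z, Real.exp (-s * ‖z‖ ^ 2) * ⟪z, x⟫ ^ 2 ∂ν) - (Real.exp (s * ‖x‖ ^ 2) - 1) / s) (by
    filter_upwards [Ioc_mem_nhdsGT (zero_lt_one : (0 : ℝ) < 1)] with s hs
    exact key s hs.1 hs.2) hsq
  simpa using h0.add hder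

end gaussian

section rigidity
variable {E : Type*} [NormedAddCommGroup E] [InnerProductSpace ℝ E] [FiniteDimensional ℝ E]

/-- Flatness threshold for the rigidity of quadrics. -/
def flatEps (d : ℕ) : ℝ := 1 / (1200 * (d + 1) ^ 5)

lemma flatEps_pos (d : ℕ) : 0 < flatEps d := by unfold flatEps; positivity

set_option maxHeartbeats 1000000 in
lemma diagonal_rigidity {ι : Type*} [Fintype ι] [DecidableEq ι] (b : OrthonormalBasis ι ℝ E) {α : ι → ℝ} {d : ℕ}
    (hα : ∀ i, 0 ≤ α i) (hsum : ∑ i, α i = d) {C : Set E}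
    (hC : ∀ a ∈ C, ∑ i, α i * ⟪b i, a⟫ ^ 2 = ‖a‖ ^ 2) (hF : Fl d (flatEps d) C) :
    (∀ i, α i = 0 ∨ α i = 1) ∧ (Finset.univ.filter fun i => 1 / 2 < α i).card = d := by
  obtain ⟨L, hL⟩ := hF
  set ε := flatEps d with hε
  have hε0 : 0 < ε := flatEps_pos d
  set D : ℝ := d + 1 with hD
  have hD1 : 1 ≤ D := by simp [hD]
  have hεD : ε * (1200 * D ^ 5) = 1 := by
    rw [hε, flatEps, ← hD]; field_simp
  have hαd : ∀ i, α i ≤ d := fun i => by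
    rw [← hsum]; exact Finset.single_le_sum (fun j _ => hα j) (Finset.mem_univ i)
  set k : ℝ := 1 / (20 * D ^ 2) with hk
  have hk0 : 0 < k := by positivity
  have hkD : k * (20 * D ^ 2) = 1 := by rw [hk]; field_simp
  have hk2 : 3 * D * ε ≤ k ^ 2 := by
    have h1 : ε = 1 / (1200 * D ^ 5) := by field_simp; linarith
    rw [h1, hk]
    apply le_of_eq
    field_simp; norm_num
  have hε1 : ε ≤ 1 := by
    have : (1 : ℝ) ≤ 1200 * D ^ 5 := by
      have := one_le_pow₀ hD1 (n := 5); linarith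
    nlinarith
  have hnorm : ∀ x : E, ∑ i, ⟪b i, x⟫ ^ 2 = ‖x‖ ^ 2 := fun x => by
    rw [← b.sum_sq_norm_inner_right x]; simp
  -- the form is close to the squared norm on the plane
  have hA : ∀ u : Euc d, ‖u‖ ≤ 1 → |∑ i, α i * ⟪b i, L u⟫ ^ 2 - ‖L u‖ ^ 2| ≤ k ^ 2 := by
    intro u hu
    obtain ⟨a, ha, hau⟩ := hL u hu
    have h1 : ∑ i, α i * ⟪b i, L u⟫ ^ 2 - ‖L u‖ ^ 2 =
        ∑ i, ((α i - 1) * ⟪b i, L u - a⟫) * ⟪b i, L u + a⟫ := by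
      have h2 : ∑ i, α i * ⟪b i, L u⟫ ^ 2 - ‖L u‖ ^ 2 =
        (∑ i, α i * ⟪b i, L u⟫ ^ 2 - ∑ i, ⟪b i, L u⟫ ^ 2) -
        (∑ i, α i * ⟪b i, a⟫ ^ 2 - ∑ i, ⟪b i, a⟫ ^ 2) := by rw [hC a ha, hnorm, hnorm]; ring
      rw [h2, ← Finset.sum_sub_distrib, ← Finset.sum_sub_distrib, ← Finset.sum_sub_distrib]
      refine Finset.sum_congr rfl fun i _ => ?_
      rw [inner_sub_right, inner_add_right]; ring
    have h3 := Finset.sum_mul_sq_le_sq_mul_sq Finset.univ (fun i => (α i - 1) * ⟪b i, L u - a⟫) (fun i => ⟪b i, L u + a⟫)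
    rw [← h1, hnorm] at h3
    have h4 : ∑ i, ((α i - 1) * ⟪b i, L u - a⟫) ^ 2 ≤ D ^ 2 * ‖L u - a‖ ^ 2 := by
      rw [← hnorm, Finset.mul_sum]
      refine Finset.sum_le_sum fun i _ => ?_
      rw [mul_pow]
      have := hα i
      have := hαd i
      exact mul_le_mul_of_nonneg_right (sq_le_sq' (by linarith) (by linarith)) (sq_nonneg _)
    have hn1 : ‖L u - a‖ ≤ ε := by rw [norm_sub_rev]; exact hau
    have hn2 : ‖L u + a‖ ≤ 3 := by
      have h5 : L u + a = (a - L u) + (L u + L u) := by abel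
      have h6 : ‖L u‖ ≤ 1 := by simpa using hu
      rw [h5]
      linarith [norm_add_le (a - L u) (L u + L u), norm_add_le (L u) (L u)]
    have h7 : (∑ i, α i * ⟪b i, L u⟫ ^ 2 - ‖L u‖ ^ 2) ^ 2 ≤ (3 * D * ε) ^ 2 := by
      calc _ ≤ D ^ 2 * ‖L u - a‖ ^ 2 * ‖L u + a‖ ^ 2 := h3.trans (by gcongr)
        _ ≤ D ^ 2 * ε ^ 2 * 3 ^ 2 := by gcongr
        _ = _ := by ring
    exact (abs_le_of_sq_le_sq h7 (by positivity)).trans hk2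
  have hk1 : k ≤ 1 / 20 := by
    rw [hk]; apply one_div_le_one_div_of_le (by norm_num); nlinarith
  have hB : ∀ w : E, (∀ u, ⟪L u, w⟫ = 0) → ∑ i, α i * ⟪b i, w⟫ ^ 2 ≤ D * k ^ 2 * ‖w‖ ^ 2 := by
    intro w hw
    rcases eq_or_ne w 0 with rfl | hw0
    · simp
    have hwn : 0 < ‖w‖ := norm_pos_iff.2 hw0
    set e := EuclideanSpace.basisFun (Fin d) ℝ
    have hon : Orthonormal ℝ fun j => L (e j) := e.orthonormal.comp_linearIsometry L
    let f : Option (Fin d) → E := fun o => o.elim (‖w‖⁻¹ • w) fun j => L (e j)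
    have hf : Orthonormal ℝ f := by
      rw [orthonormal_iff_ite] at hon ⊢
      rintro (_ | i) (_ | j)
      · show ⟪‖w‖⁻¹ • w, ‖w‖⁻¹ • w⟫ = _
        rw [real_inner_self_eq_norm_sq, norm_smul, norm_inv, norm_norm, inv_mul_cancel₀ hwn.ne']
        simp
      · show ⟪‖w‖⁻¹ • w, L (e j)⟫ = _
        rw [inner_smul_left, real_inner_comm, hw]
        simp
      · simp [f, inner_smul_right, hw]
      · simpa [f] using hon i j
    have hbes : ∀ i, ⟪b i, w⟫ ^ 2 ≤ ‖w‖ ^ 2 * (1 - ∑ j, ⟪b i, L (e j)⟫ ^ 2) := fun i => by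
      have h1 := hf.sum_inner_products_le (x := b i) (s := Finset.univ)
      rw [Fintype.sum_option, b.orthonormal.1 i] at h1
      simp only [f, Option.elim, inner_smul_left, norm_mul, Real.norm_eq_abs, mul_pow, sq_abs] at h1
      simp only [real_inner_comm] at h1 ⊢
      have h2 : ⟪b i, w⟫ ^ 2 = ‖w‖ ^ 2 * ((‖w‖⁻¹) ^ 2 * ⟪b i, w⟫ ^ 2) := by field_simp
      simp only [real_inner_comm] at h2 ⊢
      rw [h2]
      gcongr
      simp at h1 ⊢
      linarith
    have h3 : (d : ℝ) - d * k ^ 2 ≤ ∑ j, ∑ i, α i * ⟪b i, L (e j)⟫ ^ 2 := by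
      have : ∑ j : Fin d, (1 - k ^ 2) ≤ ∑ j, ∑ i, α i * ⟪b i, L (e j)⟫ ^ 2 := by
        refine Finset.sum_le_sum fun j _ => ?_
        have h4 := (abs_le.1 (hA (e j) (by simp [e.orthonormal.1 j]))).1
        rw [L.norm_map, e.orthonormal.1 j] at h4
        linarith
      simp at this
      linarith
    calc ∑ i, α i * ⟪b i, w⟫ ^ 2 ≤ ∑ i, α i * (‖w‖ ^ 2 * (1 - ∑ j, ⟪b i, L (e j)⟫ ^ 2)) :=
          Finset.sum_le_sum fun i _ => mul_le_mul_of_nonneg_left (hbes i) (hα i)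
      _ = ‖w‖ ^ 2 * (d - ∑ j, ∑ i, α i * ⟪b i, L (e j)⟫ ^ 2) := by
          rw [Finset.sum_comm, ← hsum, ← Finset.sum_sub_distrib, Finset.mul_sum]
          refine Finset.sum_congr rfl fun i _ => ?_
          rw [← Finset.mul_sum]; ring
      _ ≤ ‖w‖ ^ 2 * (D * k ^ 2) := by
          gcongr
          have : 0 ≤ k ^ 2 := sq_nonneg k
          simp only [hD]; linarith
      _ = _ := by ring
  set ε' := ε + 2 * D * k with hε'
  have hε'0 : 0 ≤ ε' := by positivity
  have hε'D : ε' * (5 * D) ≤ 1 := by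
    have h1 : 2 * D * k * (10 * D) = 1 := by linarith
    have h2 : ε * (10 * D) ≤ 1 := by
      rw [← hεD]
      have := one_le_pow₀ hD1 (n := 4)
      have : 10 * D ≤ 1200 * D ^ 5 := by nlinarith
      gcongr
    rw [hε']; linarith
  have hε'5 : ε' ≤ 1 / 5 := by nlinarith
  -- eigenvectors with large eigenvalue are close to the plane
  have hN : ∀ i, 1 / 2 < α i → ∃ a ∈ C, ‖a - b i‖ ≤ ε' := by
    intro i hi
    set V : Submodule ℝ E := LinearMap.range L.toLinearMap with hV
    obtain ⟨u, hu⟩ : V.starProjection (b i) ∈ V := Submodule.starProjection_apply_mem _ _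
    set w := b i - V.starProjection (b i) with hw
    have hwV : ∀ u, ⟪L u, w⟫ = 0 := fun u => by
      have : w ∈ Vᗮ := Submodule.sub_starProjection_mem_orthogonal _
      exact (Submodule.mem_orthogonal _ _).1 this _ ⟨u, rfl⟩
    have h1 : ⟪b i, w⟫ = ‖w‖ ^ 2 := by
      have h2 : b i = w + L u := by rw [hw]; erw [hu]; abel
      conv_lhs => rw [h2]
      rw [inner_add_left, hwV, add_zero, real_inner_self_eq_norm_sq]
    have h2 : α i * ⟪b i, w⟫ ^ 2 ≤ D * k ^ 2 * ‖w‖ ^ 2 :=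
      (Finset.single_le_sum (f := fun i => α i * ⟪b i, w⟫ ^ 2) (fun j _ => mul_nonneg (hα j) (sq_nonneg _)) (Finset.mem_univ i)).trans (hB w hwV)
    have h3 : ‖w‖ ≤ 2 * D * k := by
      rw [h1] at h2
      by_contra! hlt
      have hw0 : 0 < ‖w‖ := lt_of_le_of_lt (by positivity) hlt
      have h5 : 1 / 2 * ‖w‖ ^ 2 ≤ D * k ^ 2 := by
        have : (1 / 2 * ‖w‖ ^ 2) * ‖w‖ ^ 2 ≤ D * k ^ 2 * ‖w‖ ^ 2 := by
          refine le_trans ?_ h2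
          have : 0 ≤ ‖w‖ ^ 2 * ‖w‖ ^ 2 := by positivity
          nlinarith
        exact le_of_mul_le_mul_right this (by positivity)
      have h6 : (2 * D * k) ^ 2 < ‖w‖ ^ 2 := by gcongr
      have h7 : 0 < k ^ 2 := by positivity
      nlinarith [mul_pos h7 (by linarith : 0 < D)]
    have hun : ‖u‖ ≤ 1 := by
      rw [← L.norm_map, ← b.orthonormal.1 i]
      have : L u = V.starProjection (b i) := hu
      rw [this]
      exact Submodule.norm_starProjection_apply_le _ _
    obtain ⟨a, ha, hau⟩ := hL u hun
    refine ⟨a, ha, ?_⟩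
    have : a - b i = (a - L u) - w := by
      have : L u = V.starProjection (b i) := hu
      rw [hw, this]; abel
    rw [this]
    exact (norm_sub_le _ _).trans (add_le_add hau h3)
  set I := Finset.univ.filter fun i => 1 / 2 < α i with hI
  have hmI : ∀ i, i ∈ I ↔ 1 / 2 < α i := fun i => by simp [hI]
  have hcard : d ≤ I.card := by
    by_contra! hlt
    let φ : Euc d →ₗ[ℝ] (I → ℝ) := LinearMap.pi fun i => (innerₛₗ ℝ (b i)).comp L.toLinearMap
    have hker : LinearMap.ker φ ≠ ⊥ := LinearMap.ker_ne_bot_of_finrank_lt (by simpa using hlt)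
    obtain ⟨u, hu, hu0⟩ := Submodule.exists_mem_ne_zero_of_ne_bot hker
    have hφ : ∀ i, 1 / 2 < α i → ⟪b i, L u⟫ = 0 := fun i hi => by
      have := congrFun (LinearMap.mem_ker.1 hu) ⟨i, (hmI i).2 hi⟩
      simpa [φ] using this
    have hun : 0 < ‖u‖ := norm_pos_iff.2 hu0
    have h1 := (abs_le.1 (hA (‖u‖⁻¹ • u) (by rw [norm_smul, norm_inv, norm_norm, inv_mul_cancel₀ hun.ne']))).1
    have h2 : ‖L (‖u‖⁻¹ • u)‖ = 1 := by
      rw [L.norm_map, norm_smul, norm_inv, norm_norm, inv_mul_cancel₀ hun.ne']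
    have h3 : ∑ i, α i * ⟪b i, L (‖u‖⁻¹ • u)⟫ ^ 2 ≤ ∑ i, 1 / 2 * ⟪b i, L (‖u‖⁻¹ • u)⟫ ^ 2 := by
      refine Finset.sum_le_sum fun i _ => ?_
      by_cases hi : 1 / 2 < α i
      · rw [map_smul, inner_smul_right, hφ i hi]; simp
      · gcongr; linarith
    rw [← Finset.mul_sum, hnorm] at h3
    rw [h2] at h1 h3
    nlinarith
  have hsplit : ∀ f : ι → ℝ, ∑ i, f i = ∑ i ∈ I, f i + ∑ i ∈ Iᶜ, f i := fun f =>
    (Finset.sum_add_sum_compl I f).symm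
  set B := ∑ i ∈ I, |α i - 1| with hBdef
  have hB0 : 0 ≤ B := Finset.sum_nonneg fun _ _ => abs_nonneg _
  have hJ : ∀ j ∈ I, 1 - α j ≤ 4 * ε' ^ 2 * B := by
    intro j hj
    obtain ⟨a, ha, haj⟩ := hN j ((hmI j).1 hj)
    by_cases hlt : 1 - α j ≤ 0
    · exact hlt.trans (by positivity)
    push Not at hlt
    have h1 : 0 ≤ ∑ i ∈ I, (α i - 1) * ⟪b i, a⟫ ^ 2 := by
      have h2 : ∑ i, (α i - 1) * ⟪b i, a⟫ ^ 2 = 0 := by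
        simp only [sub_mul, one_mul, Finset.sum_sub_distrib, hC a ha, hnorm, sub_self]
      rw [hsplit] at h2
      have : ∑ i ∈ Iᶜ, (α i - 1) * ⟪b i, a⟫ ^ 2 ≤ 0 := Finset.sum_nonpos fun i hi => by
        have : ¬ 1 / 2 < α i := fun h => (Finset.mem_compl.1 hi) ((hmI i).2 h)
        nlinarith [sq_nonneg ⟪b i, a⟫]
      linarith
    rw [← Finset.add_sum_erase _ _ hj] at h1
    have h2 : ∑ i ∈ I.erase j, (α i - 1) * ⟪b i, a⟫ ^ 2 ≤ ∑ i ∈ I.erase j, |α i - 1| * ε' ^ 2 := by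
      refine Finset.sum_le_sum fun i hi => ?_
      have hij : i ≠ j := Finset.ne_of_mem_erase hi
      have h3 : ⟪b i, a⟫ = ⟪b i, a - b j⟫ := by
        rw [inner_sub_right, b.orthonormal.2 hij, sub_zero]
      have h4 : |⟪b i, a⟫| ≤ ε' := by
        rw [h3]
        refine (abs_real_inner_le_norm _ _).trans ?_
        rw [b.orthonormal.1 i, one_mul]; exact haj
      have h5 : ⟪b i, a⟫ ^ 2 ≤ ε' ^ 2 := sq_le_sq' (abs_le.1 h4).1 (abs_le.1 h4).2
      exact mul_le_mul (le_abs_self _) h5 (sq_nonneg _) (abs_nonneg _)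
    have h3 : ∑ i ∈ I.erase j, |α i - 1| * ε' ^ 2 ≤ B * ε' ^ 2 := by
      rw [← Finset.sum_mul]
      gcongr
      exact Finset.sum_le_sum_of_subset_of_nonneg (Finset.erase_subset _ _) fun _ _ _ => abs_nonneg _
    have h4 : 1 - ε' ≤ ⟪b j, a⟫ := by
      have h5 : ⟪b j, a⟫ = 1 + ⟪b j, a - b j⟫ := by
        rw [inner_sub_right, real_inner_self_eq_norm_sq, b.orthonormal.1 j]; ring
      have h6 : |⟪b j, a - b j⟫| ≤ ε' := (abs_real_inner_le_norm (b j) (a - b j)).trans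
        (by rw [b.orthonormal.1 j, one_mul]; exact haj)
      linarith [(abs_le.1 h6).1]
    have h5 : 1 / 4 ≤ ⟪b j, a⟫ ^ 2 := by nlinarith
    nlinarith
  have hIs : ∑ i ∈ I, α i ≤ d := by
    rw [← hsum]; exact Finset.sum_le_sum_of_subset_of_nonneg (Finset.subset_univ _) fun i _ _ => hα i
  have hI2 : (I.card : ℝ) ≤ 2 * d := by
    have : ∑ i ∈ I, (1 / 2 : ℝ) ≤ ∑ i ∈ I, α i := Finset.sum_le_sum fun i hi => ((hmI i).1 hi).le
    simp at this
    linarith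
  have hdI : (d : ℝ) ≤ I.card := by exact_mod_cast hcard
  have hBz : B = 0 := by
    have h1 : B ≤ ∑ i ∈ I, ((α i - 1) + 2 * (4 * ε' ^ 2 * B)) := by
      refine Finset.sum_le_sum fun i hi => ?_
      have := hJ i hi
      have h0 : 0 ≤ 4 * ε' ^ 2 * B := by positivity
      rw [abs_le]; constructor <;> linarith
    rw [Finset.sum_add_distrib, Finset.sum_sub_distrib] at h1
    simp at h1
    have h2 : B ≤ 2 * d * (8 * ε' ^ 2 * B) := by
      have : (I.card : ℝ) * (2 * (4 * ε' ^ 2 * B)) ≤ 2 * d * (2 * (4 * ε' ^ 2 * B)) := by gcongr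
      linarith
    have h3 : 16 * d * ε' ^ 2 ≤ 16 / 25 := by
      have h4 : (d : ℝ) ≤ D ^ 2 := by simp only [hD]; nlinarith [(Nat.cast_nonneg d : (0 : ℝ) ≤ d)]
      have h5 : (ε' * (5 * D)) ^ 2 ≤ 1 := pow_le_one₀ (by positivity) hε'D
      have h6 : 0 ≤ ε' ^ 2 := sq_nonneg _
      nlinarith
    nlinarith
  have hI1 : ∀ i ∈ I, α i = 1 := fun i hi => by
    have := (Finset.sum_eq_zero_iff_of_nonneg fun _ _ => abs_nonneg _).1 hBz i hi
    linarith [abs_eq_zero.1 this]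
  have hIc : I.card = d := by
    refine le_antisymm ?_ hcard
    have : ∑ i ∈ I, α i = I.card := by rw [Finset.sum_congr rfl hI1]; simp
    rw [this] at hIs
    exact_mod_cast hIs
  refine ⟨fun i => ?_, hIc⟩
  by_cases hi : i ∈ I
  · exact Or.inr (hI1 i hi)
  · left
    have h1 := hsplit α
    rw [hsum, Finset.sum_congr rfl hI1] at h1
    simp [hIc] at h1
    exact (Finset.sum_eq_zero_iff_of_nonneg fun i _ => hα i).1 (by simpa using h1) i (Finset.mem_compl.2 hi)

/-- A nonnegative symmetric operator of trace `d` whose quadratic form agrees with the squared norm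
on a set close to the unit ball of a `d`-plane is an orthogonal projection of rank `d`. -/
lemma eq_starProjection_of_flat {d : ℕ} {Q : E →L[ℝ] E} (hsym : (Q : E →ₗ[ℝ] E).IsSymmetric)
    (hpos : ∀ x, 0 ≤ ⟪Q x, x⟫) (htr : (Q : E →ₗ[ℝ] E).trace ℝ E = d) {C : Set E}
    (hC : ∀ a ∈ C, ⟪Q a, a⟫ = ‖a‖ ^ 2) (hF : Fl d (flatEps d) C) :
    ∃ V : Submodule ℝ E, Module.finrank ℝ V = d ∧ Q = V.starProjection := by
  classical
  set b := hsym.eigenvectorBasis rfl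
  set α := hsym.eigenvalues rfl
  have hQb : ∀ i, Q (b i) = α i • b i := fun i => by
    have := hsym.apply_eigenvectorBasis rfl i
    exact this
  have hexp : ∀ x, Q x = ∑ i, (α i * ⟪b i, x⟫) • b i := fun x => by
    conv_lhs => rw [← b.sum_repr' x, map_sum]
    refine Finset.sum_congr rfl fun i _ => ?_
    rw [map_smul, hQb, smul_smul, mul_comm]
  have hq : ∀ x, ⟪Q x, x⟫ = ∑ i, α i * ⟪b i, x⟫ ^ 2 := fun x => by
    rw [hexp, sum_inner]
    refine Finset.sum_congr rfl fun i _ => ?_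
    rw [inner_smul_left]; simp; ring
  have hα : ∀ i, 0 ≤ α i := fun i => by
    have := hpos (b i)
    rw [hQb, inner_smul_left, real_inner_self_eq_norm_sq, b.orthonormal.1 i] at this
    simpa using this
  have hsum : ∑ i, α i = d := by
    rw [← htr, hsym.trace_eq_sum_eigenvalues rfl]; simp [α]
  obtain ⟨h01, hcard⟩ := diagonal_rigidity b hα hsum (fun a ha => by rw [← hq, hC a ha]) hF
  set I := Finset.univ.filter fun i => 1 / 2 < α i with hI
  set V : Submodule ℝ E := Submodule.span ℝ (range fun i : I => b i) with hV
  have hmem : ∀ i, α i ≠ 0 → b i ∈ V := fun i hi => by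
    refine Submodule.subset_span ⟨⟨i, ?_⟩, rfl⟩
    have := (h01 i).resolve_left hi
    simp [hI, this]; norm_num
  refine ⟨V, ?_, ?_⟩
  · have := finrank_span_eq_card (R := ℝ) (b := fun i : I => b i)
      (b.orthonormal.linearIndependent.comp (Subtype.val : I → _) Subtype.val_injective)
    rw [hV]
    exact this.trans (by simpa using hcard)
  · ext x
    refine (Submodule.eq_starProjection_of_mem_orthogonal ?_ ?_).symm
    · rw [hexp]
      refine Submodule.sum_mem _ fun i _ => ?_
      by_cases hi : α i = 0
      · simp [hi]
      · exact V.smul_mem _ (hmem i hi)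
    · refine (Submodule.mem_orthogonal _ _).2 fun u hu => ?_
      induction hu using Submodule.span_induction with
      | mem u hu =>
        obtain ⟨i, rfl⟩ := hu
        have h1 : α i = 1 := by
          refine (h01 i).resolve_left fun h => ?_
          have := (Finset.mem_filter.1 i.2).2
          rw [h] at this; norm_num at this
        have h2 : ⟪b i, Q x⟫ = ⟪Q (b i), x⟫ := (hsym (b i) x).symm
        show ⟪b i, x - Q x⟫ = 0
        rw [inner_sub_right, h2, hQb, h1, one_smul, sub_self]
      | zero => simp
      | add u v _ _ hu hv => rw [inner_add_left, hu, hv, add_zero]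
      | smul c u _ hu => rw [inner_smul_left, hu, mul_zero]

end rigidity

section moments
variable {E : Type*} [NormedAddCommGroup E] [InnerProductSpace ℝ E] [FiniteDimensional ℝ E]

lemma tendsto_of_inner_span {ι : Type*} {l : Filter ι} {f : ι → E} {S : Set E}
    (hf : ∀ i, f i ∈ Submodule.span ℝ S) (h : ∀ x ∈ S, ∃ c, Tendsto (fun i => ⟪f i, x⟫) l (𝓝 c)) :
    ∃ b, Tendsto f l (𝓝 b) := by
  set W := Submodule.span ℝ S with hW
  have h1 : ∀ x ∈ W, ∃ c, Tendsto (fun i => ⟪f i, x⟫) l (𝓝 c) := by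
    intro x hx
    induction hx using Submodule.span_induction with
    | mem x hx => exact h x hx
    | zero => exact ⟨0, by simp only [inner_zero_right]; exact tendsto_const_nhds⟩
    | add x y _ _ hx hy =>
      obtain ⟨c, hc⟩ := hx
      obtain ⟨c', hc'⟩ := hy
      exact ⟨c + c', by simpa [inner_add_right] using hc.add hc'⟩
    | smul a x _ hx =>
      obtain ⟨c, hc⟩ := hx
      exact ⟨a * c, by simpa [inner_smul_right] using hc.const_mul a⟩
  have h2 : ∀ x, ∃ c, Tendsto (fun i => ⟪f i, x⟫) l (𝓝 c) := fun x => by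
    obtain ⟨c, hc⟩ := h1 (W.starProjection x) (Submodule.starProjection_apply_mem _ _)
    refine ⟨c, hc.congr fun i => ?_⟩
    have h3 : x - W.starProjection x ∈ Wᗮ := Submodule.sub_starProjection_mem_orthogonal _
    have h4 := (Submodule.mem_orthogonal _ _).1 h3 _ (hf i)
    rw [inner_sub_right] at h4
    linarith
  choose c hc using h2
  set b := stdOrthonormalBasis ℝ E
  refine ⟨∑ j, c (b j) • b j, ?_⟩
  have h3 : f = fun i => ∑ j, ⟪f i, b j⟫ • b j := by
    ext i
    conv_lhs => rw [← b.sum_repr' (f i)]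
    simp only [real_inner_comm]
  rw [h3]
  exact tendsto_finset_sum _ fun j _ => (hc (b j)).smul_const _

variable [MeasurableSpace E] [BorelSpace E]

/-- Gaussian second moment operator. -/
def gaussOp (d : ℕ) (ν : Measure E) (s : ℝ) : E →L[ℝ] E :=
  (2 * s / gaussMass d s) • ∫ z, Real.exp (-s * ‖z‖ ^ 2) • (innerSL ℝ z).smulRight z ∂ν

/-- Gaussian first moment. -/
def gaussMean (d : ℕ) (ν : Measure E) (s : ℝ) : E :=
  (gaussMass d s)⁻¹ • ∫ z, Real.exp (-s * ‖z‖ ^ 2) • z ∂ν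

variable {d : ℕ} {ν : Measure E} {S : Set E}

lemma Unif.integrable_gaussOp (h : Unif d ν S) {s : ℝ} (hs : 0 < s) :
    Integrable (fun z : E => Real.exp (-s * ‖z‖ ^ 2) • (innerSL ℝ z).smulRight z) ν := by
  refine integrable_gauss_smul_pow (ρ := fun z => ‖z‖) h.integrable_gauss_zero (by fun_prop)
    (f := fun z => (innerSL ℝ z).smulRight z) ?_ 2 hs zero_le_one (Eventually.of_forall fun z => ?_)
  · apply Continuous.aestronglyMeasurable
    fun_prop
  · rw [ContinuousLinearMap.norm_smulRight_apply, innerSL_apply_norm, abs_norm]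
    apply le_of_eq; ring

lemma Unif.integrable_gaussMean (h : Unif d ν S) {s : ℝ} (hs : 0 < s) :
    Integrable (fun z : E => Real.exp (-s * ‖z‖ ^ 2) • z) ν :=
  integrable_gauss_smul_pow (ρ := fun z => ‖z‖) h.integrable_gauss_zero (by fun_prop)
    (f := fun z => z) (by fun_prop) 1 hs zero_le_one (Eventually.of_forall fun z => by simp)

lemma Unif.inner_gaussOp (h : Unif d ν S) {s : ℝ} (hs : 0 < s) (x y : E) :
    ⟪gaussOp d ν s x, y⟫ = 2 * s / gaussMass d s * ∫ z, Real.exp (-s * ‖z‖ ^ 2) * (⟪z, x⟫ * ⟪z, y⟫) ∂ν := by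
  rw [gaussOp, ContinuousLinearMap.smul_apply, inner_smul_left,
    ContinuousLinearMap.integral_apply (h.integrable_gaussOp hs), real_inner_comm, ← integral_inner]
  · simp only [conj_trivial]
    congr 1
    refine integral_congr_ae (Eventually.of_forall fun z => ?_)
    simp [inner_smul_right, real_inner_comm]
  · exact (h.integrable_gaussOp hs).apply_continuousLinearMap x

lemma Unif.inner_gaussMean (h : Unif d ν S) {s : ℝ} (hs : 0 < s) (x : E) :
    ⟪gaussMean d ν s, x⟫ = (gaussMass d s)⁻¹ * ∫ z, Real.exp (-s * ‖z‖ ^ 2) * ⟪z, x⟫ ∂ν := by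
  rw [gaussMean, inner_smul_left, real_inner_comm, ← integral_inner (h.integrable_gaussMean hs)]
  simp only [conj_trivial]
  congr 1
  refine integral_congr_ae (Eventually.of_forall fun z => ?_)
  simp [inner_smul_right, real_inner_comm]

lemma Unif.gaussMean_mem (h : Unif d ν S) {s : ℝ} (hs : 0 < s) :
    gaussMean d ν s ∈ Submodule.span ℝ S := by
  rw [← Submodule.orthogonal_orthogonal (Submodule.span ℝ S)]
  refine (Submodule.mem_orthogonal _ _).2 fun y hy => ?_
  rw [real_inner_comm, h.inner_gaussMean hs]
  have : ∫ z, Real.exp (-s * ‖z‖ ^ 2) * ⟪z, y⟫ ∂ν = 0 := by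
    refine integral_eq_zero_of_ae ?_
    filter_upwards [h.ae_mem] with z hz
    have := (Submodule.mem_orthogonal _ _).1 hy z (Submodule.subset_span hz)
    simp [this]
  rw [this, mul_zero]

lemma Unif.quadric' (h : Unif d ν S) {x : E} (hx : x ∈ S) :
    Tendsto (fun s => 2 * ⟪gaussMean d ν s, x⟫ + ⟪gaussOp d ν s x, x⟫) (𝓝[>] 0) (𝓝 (‖x‖ ^ 2)) := by
  refine (h.quadric hx).congr' ?_
  filter_upwards [self_mem_nhdsWithin] with s hs
  rw [h.inner_gaussMean hs, h.inner_gaussOp hs]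
  simp only [← sq]
  ring

lemma Unif.gaussOp_symm (h : Unif d ν S) {s : ℝ} (hs : 0 < s) (x y : E) :
    ⟪gaussOp d ν s x, y⟫ = ⟪x, gaussOp d ν s y⟫ := by
  rw [real_inner_comm (gaussOp d ν s y) x, h.inner_gaussOp hs, h.inner_gaussOp hs]
  simp only [mul_comm]

lemma Unif.gaussOp_nonneg (h : Unif d ν S) {s : ℝ} (hs : 0 < s) (x : E) :
    0 ≤ ⟪gaussOp d ν s x, x⟫ := by
  rw [h.inner_gaussOp hs]
  have := gaussMass_pos d hs
  refine mul_nonneg (by positivity) (integral_nonneg fun z => ?_)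
  exact mul_nonneg (Real.exp_pos _).le (mul_self_nonneg _)

lemma Unif.gaussOp_trace (h : Unif d ν S) {s : ℝ} (hs : 0 < s) :
    LinearMap.trace ℝ E (gaussOp d ν s : E →ₗ[ℝ] E) = d := by
  set b := stdOrthonormalBasis ℝ E
  rw [LinearMap.trace_eq_sum_inner _ b]
  have h1 : ∀ i, ⟪b i, gaussOp d ν s (b i)⟫ =
    2 * s / gaussMass d s * ∫ z, Real.exp (-s * ‖z‖ ^ 2) * (⟪z, b i⟫ * ⟪z, b i⟫) ∂ν := fun i => by
    rw [real_inner_comm, h.inner_gaussOp hs]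
  simp only [ContinuousLinearMap.coe_coe, h1]
  rw [← Finset.mul_sum, ← integral_finset_sum]
  · have h2 : ∀ z : E, ∑ i, Real.exp (-s * ‖z‖ ^ 2) * (⟪z, b i⟫ * ⟪z, b i⟫) =
        Real.exp (-s * ‖z‖ ^ 2) * ‖z‖ ^ 2 := fun z => by
      rw [← Finset.mul_sum, ← b.sum_sq_norm_inner_left z]
      simp [sq]
    simp only [h2]
    rw [h.gauss_second_moment hs]
    have := gaussMass_pos d hs
    field_simp
  · intro i _
    refine integrable_gauss_smul_pow (ρ := fun z => ‖z‖) h.integrable_gauss_zero (by fun_prop)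
      (f := fun z => ⟪z, b i⟫ * ⟪z, b i⟫) (by fun_prop) 2 hs zero_le_one (Eventually.of_forall fun z => ?_)
    have := norm_inner_le_norm (𝕜 := ℝ) z (b i)
    rw [b.orthonormal.1 i, mul_one] at this
    rw [norm_mul, abs_norm, one_mul, sq]
    gcongr

lemma Unif.norm_gaussOp_le (h : Unif d ν S) {s : ℝ} (hs : 0 < s) : ‖gaussOp d ν s‖ ≤ d := by
  have hM := gaussMass_pos d hs
  have h1 : ‖∫ z, Real.exp (-s * ‖z‖ ^ 2) • (innerSL ℝ z).smulRight z ∂ν‖ ≤ d / (2 * s) * gaussMass d s := by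
    rw [← h.gauss_second_moment hs]
    refine (norm_integral_le_integral_norm _).trans_eq ?_
    refine integral_congr_ae (Eventually.of_forall fun z => ?_)
    simp only [norm_smul, Real.norm_eq_abs, Real.abs_exp, ContinuousLinearMap.norm_smulRight_apply, innerSL_apply_norm]
    ring
  rw [gaussOp, norm_smul, Real.norm_of_nonneg (by positivity)]
  calc _ ≤ 2 * s / gaussMass d s * (d / (2 * s) * gaussMass d s) := by gcongr
    _ = d := by field_simp

lemma Unif.quadric_structure (h : Unif d ν S) (hF : ∀ r ≥ 1, _root_.Fl d (flatEps d) (_root_.dil 0 r S)) :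
    ∃ V : Submodule ℝ E, Module.finrank ℝ V = d ∧ ∃ b ∈ Vᗮ,
      (∀ x ∈ S, ‖x - V.starProjection x‖ ^ 2 = 2 * ⟪b, x⟫) ∧
      Tendsto (gaussMean d ν) (𝓝[>] 0) (𝓝 b) ∧
      Tendsto (gaussOp d ν) (𝓝[>] 0) (𝓝 V.starProjection) ∧
      ∀ v ∈ V, ∃ x : ℕ → E, (∀ i : ℕ, (i + 1 : ℝ) • x i ∈ S) ∧ Tendsto x (hyperfilter ℕ) (𝓝 v) := by
  set 𝒲 : Ultrafilter ℕ := hyperfilter ℕ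
  set C := _root_.ulim 𝒲 (fun i : ℕ => _root_.dil 0 (i + 1 : ℝ) S) with hC
  have hpos' : ∀ i : ℕ, (0 : ℝ) < i + 1 := fun i => by positivity
  obtain ⟨ν', hC', -⟩ := Unif.exists_limit 𝒲 (fun i : ℕ => h.dil h.zero_mem (hpos' i))
  have hCF : _root_.Fl d (flatEps d) C := Fl.ulim (Eventually.of_forall fun i => hF _ (by simp))
  have hseq : ∀ a ∈ C, ∃ x : ℕ → E, (∀ i : ℕ, (i + 1 : ℝ) • x i ∈ S) ∧ Tendsto x 𝒲 (𝓝 a) := fun a ha => by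
    obtain ⟨x, hx, hxa⟩ := exists_seq_of_mem_ulim (fun i => h.closed.dil _ _)
      (fun i => ⟨0, by simpa [mem_dil] using h.zero_mem⟩) ha
    exact ⟨x, fun i => by simpa [mem_dil] using hx i, hxa⟩
  have hinf : Tendsto (fun i : ℕ => ((i : ℝ) + 1)⁻¹) 𝒲 (𝓝 0) :=
    (tendsto_one_div_add_atTop_nhds_zero_nat.congr fun i => by simp).mono_left
      (Nat.hyperfilter_le_atTop)
  -- the limit along any ultrafilter
  have key : ∀ 𝒰 : Ultrafilter ℝ, (𝒰 : Filter ℝ) ≤ 𝓝[>] 0 → ∃ V : Submodule ℝ E,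
      (V : Set E) = C ∧ Module.finrank ℝ V = d ∧ Tendsto (gaussOp d ν) 𝒰 (𝓝 V.starProjection) := by
    intro 𝒰 h𝒰
    have hpos : ∀ᶠ s in (𝒰 : Filter ℝ), 0 < s := h𝒰 self_mem_nhdsWithin
    obtain ⟨Q, -, hQ⟩ := (isCompact_closedBall (0 : E →L[ℝ] E) d).ultrafilter_le_nhds (𝒰.map (gaussOp d ν)) (by
      rw [le_principal_iff]
      show ∀ᶠ s in (𝒰 : Filter ℝ), gaussOp d ν s ∈ _
      filter_upwards [hpos] with s hs
      simpa using h.norm_gaussOp_le hs)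
    have hQ : Tendsto (gaussOp d ν) 𝒰 (𝓝 Q) := hQ
    have hQx : ∀ x y, Tendsto (fun s => ⟪gaussOp d ν s x, y⟫) 𝒰 (𝓝 ⟪Q x, y⟫) := fun x y =>
      (((ContinuousLinearMap.apply ℝ E x).continuous.tendsto Q).comp hQ).inner tendsto_const_nhds
    have hsym : (Q : E →ₗ[ℝ] E).IsSymmetric := fun x y => by
      have h1 := hQx x y
      have h2 := hQx y x
      refine tendsto_nhds_unique h1 ?_
      rw [real_inner_comm]
      refine h2.congr' ?_
      filter_upwards [hpos] with s hs
      rw [h.gaussOp_symm hs, real_inner_comm]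
    have hnn : ∀ x, 0 ≤ ⟪Q x, x⟫ := fun x => ge_of_tendsto (hQx x x) (by
      filter_upwards [hpos] with s hs using h.gaussOp_nonneg hs x)
    have htr : LinearMap.trace ℝ E (Q : E →ₗ[ℝ] E) = d := by
      set b := stdOrthonormalBasis ℝ E
      have h1 : Tendsto (fun s => ∑ i, ⟪gaussOp d ν s (b i), b i⟫) 𝒰 (𝓝 (∑ i, ⟪Q (b i), b i⟫)) :=
        tendsto_finset_sum _ fun i _ => hQx _ _
      rw [LinearMap.trace_eq_sum_inner _ b]
      simp only [ContinuousLinearMap.coe_coe, real_inner_comm] at h1 ⊢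
      refine tendsto_nhds_unique h1 (tendsto_const_nhds.congr' ?_)
      filter_upwards [hpos] with s hs
      rw [← h.gaussOp_trace hs, LinearMap.trace_eq_sum_inner _ b]
      simp only [ContinuousLinearMap.coe_coe, real_inner_comm]
    have hb : ∀ x ∈ S, Tendsto (fun s => ⟪gaussMean d ν s, x⟫) 𝒰 (𝓝 ((‖x‖ ^ 2 - ⟪Q x, x⟫) / 2)) := fun x hx => by
      refine ((((h.quadric' hx).mono_left h𝒰).sub (hQx x x)).div_const 2).congr fun s => ?_
      ring
    have h𝒰s : ∃ b, Tendsto (fun s => if 0 < s then gaussMean d ν s else 0) 𝒰 (𝓝 b) := by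
      refine tendsto_of_inner_span (S := S) (fun s => ?_) fun x hx => ⟨_, (hb x hx).congr' ?_⟩
      · split_ifs with hs
        exacts [h.gaussMean_mem hs, Submodule.zero_mem _]
      · filter_upwards [hpos] with s hs
        rw [if_pos (show 0 < s from hs)]
    obtain ⟨b, hb'⟩ := h𝒰s
    have hb' : Tendsto (gaussMean d ν) 𝒰 (𝓝 b) := hb'.congr' (by
      filter_upwards [hpos] with s hs
      rw [if_pos (show 0 < s from hs)])
    have hbx : ∀ x ∈ S, ‖x‖ ^ 2 - ⟪Q x, x⟫ = 2 * ⟪b, x⟫ := fun x hx => by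
      have := tendsto_nhds_unique (hb x hx) (hb'.inner tendsto_const_nhds)
      linarith
    have hQC : ∀ a ∈ C, ⟪Q a, a⟫ = ‖a‖ ^ 2 := fun a ha => by
      obtain ⟨x, hx, hxa⟩ := hseq a ha
      have h1 : Tendsto (fun i => ‖x i‖ ^ 2 - ⟪Q (x i), x i⟫) 𝒲 (𝓝 (‖a‖ ^ 2 - ⟪Q a, a⟫)) :=
        (hxa.norm.pow 2).sub (((Q.continuous.tendsto a).comp hxa).inner hxa)
      have h2 : Tendsto (fun i : ℕ => ((i : ℝ) + 1)⁻¹ * (2 * ⟪b, x i⟫)) 𝒲 (𝓝 (0 * (2 * ⟪b, a⟫))) :=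
        hinf.mul ((tendsto_const_nhds.inner hxa).const_mul 2)
      have h3 : ∀ i : ℕ, ((i : ℝ) + 1)⁻¹ * (2 * ⟪b, x i⟫) = ‖x i‖ ^ 2 - ⟪Q (x i), x i⟫ := fun i => by
        have h4 := hbx _ (hx i)
        have h5 := hpos' i
        rw [norm_smul, map_smul, inner_smul_left, inner_smul_right, inner_smul_right, Real.norm_of_nonneg h5.le] at h4
        simp only [conj_trivial] at h4
        field_simp
        have h6 : ((i : ℝ) + 1) * (((i : ℝ) + 1) * (‖x i‖ ^ 2 - ⟪Q (x i), x i⟫)) = ((i : ℝ) + 1) * (2 * ⟪b, x i⟫) := by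
          linarith
        exact (mul_left_cancel₀ h5.ne' h6).symm
      have := tendsto_nhds_unique (h2.congr h3) h1
      linarith
    obtain ⟨V, hV, hVQ⟩ := eq_starProjection_of_flat hsym hnn htr hQC hCF
    refine ⟨V, ?_, hV, hVQ ▸ hQ⟩
    refine (hC'.eq_submodule (fun a ha => ?_) hV).symm
    have h1 := hQC a ha
    rw [hVQ] at h1
    have h2 : ‖a - V.starProjection a‖ ^ 2 = 0 := by
      have h3 := V.starProjection_inner_eq_zero a _ (Submodule.starProjection_apply_mem V a)
      rw [← real_inner_self_eq_norm_sq, inner_sub_right, h3, inner_sub_left, h1, real_inner_self_eq_norm_sq]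
      ring
    have h4 : a = V.starProjection a := by
      rw [← sub_eq_zero, ← norm_eq_zero]; simpa using h2
    rw [h4]
    exact Submodule.starProjection_apply_mem V a
  obtain ⟨V, hVC, hVd, -⟩ := key (Ultrafilter.of (𝓝[>] 0)) (Ultrafilter.of_le _)
  have hlim : Tendsto (gaussOp d ν) (𝓝[>] 0) (𝓝 V.starProjection) := by
    rw [tendsto_iff_ultrafilter]
    intro 𝒰 h𝒰
    obtain ⟨V', hV', -, h'⟩ := key 𝒰 h𝒰
    have : V' = V := SetLike.coe_injective (hV'.trans hVC.symm)
    exact this ▸ h'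
  have hb : ∀ x ∈ S, Tendsto (fun s => ⟪gaussMean d ν s, x⟫) (𝓝[>] 0)
      (𝓝 ((‖x‖ ^ 2 - ⟪V.starProjection x, x⟫) / 2)) := fun x hx => by
    refine (((h.quadric' hx).sub ((((ContinuousLinearMap.apply ℝ E x).continuous.tendsto _).comp hlim).inner
      (tendsto_const_nhds (x := x)))).div_const 2).congr fun s => ?_
    simp
  have h𝒰s : ∃ b, Tendsto (fun s => if 0 < s then gaussMean d ν s else 0) (𝓝[>] 0) (𝓝 b) := by
    refine tendsto_of_inner_span (S := S) (fun s => ?_) fun x hx => ⟨_, (hb x hx).congr' ?_⟩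
    · split_ifs with hs
      exacts [h.gaussMean_mem hs, Submodule.zero_mem _]
    · filter_upwards [self_mem_nhdsWithin] with s hs
      rw [if_pos (show 0 < s from hs)]
  obtain ⟨b, hb'⟩ := h𝒰s
  have hb' : Tendsto (gaussMean d ν) (𝓝[>] 0) (𝓝 b) := hb'.congr' (by
    filter_upwards [self_mem_nhdsWithin] with s hs
    rw [if_pos (show 0 < s from hs)])
  have hbx : ∀ x ∈ S, ‖x - V.starProjection x‖ ^ 2 = 2 * ⟪b, x⟫ := fun x hx => by
    have h1 := tendsto_nhds_unique (hb x hx) (hb'.inner tendsto_const_nhds)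
    have h3 := V.starProjection_inner_eq_zero x _ (Submodule.starProjection_apply_mem V x)
    rw [← real_inner_self_eq_norm_sq, inner_sub_right, h3, inner_sub_left, real_inner_self_eq_norm_sq]
    linarith
  refine ⟨V, hVd, b, (Submodule.mem_orthogonal _ _).2 fun v hv => ?_, hbx, hb', hlim,
    fun v hv => hseq v (hVC ▸ hv)⟩
  have hge : ∀ v ∈ V, 0 ≤ ⟪b, v⟫ := fun v hv => by
    obtain ⟨x, hx, hxv⟩ := hseq v (hVC ▸ hv)
    refine ge_of_tendsto (tendsto_const_nhds.inner hxv) (Eventually.of_forall fun i => ?_)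
    have h1 := hbx _ (hx i)
    rw [inner_smul_right] at h1
    have h2 : 0 ≤ 2 * (((i : ℝ) + 1) * ⟪b, x i⟫) := h1 ▸ sq_nonneg _
    have h3 := hpos' i
    exact nonneg_of_mul_nonneg_right (by linarith) h3
  have h1 := hge v hv
  have h2 := hge _ (V.neg_mem hv)
  rw [inner_neg_right] at h2
  rw [real_inner_comm]
  linarith

end moments

section expansion

/-- Second order asymptotic expansion at `0+`. -/
def HasExp2 (f : ℝ → ℝ) (a b c : ℝ) : Prop :=
  Tendsto (fun s => (f s - a - b * s) / s ^ 2) (𝓝[>] 0) (𝓝 c)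

lemma hasExp2_iff {f : ℝ → ℝ} {a b c : ℝ} : HasExp2 f a b c ↔
    ∃ g : ℝ → ℝ, Tendsto g (𝓝[>] 0) (𝓝 c) ∧ ∀ s > 0, f s = a + b * s + s ^ 2 * g s := by
  constructor
  · intro h
    refine ⟨_, h, fun s hs => ?_⟩
    field_simp
    ring
  · rintro ⟨g, hg, h⟩
    refine hg.congr' ?_
    filter_upwards [self_mem_nhdsWithin] with s hs
    rw [h s hs]
    have : (s : ℝ) ≠ 0 := ne_of_gt hs
    field_simp
    ring

lemma tendsto_id_nhdsGT : Tendsto (fun s : ℝ => s) (𝓝[>] 0) (𝓝 0) :=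
  tendsto_id.mono_left nhdsWithin_le_nhds

lemma hasExp2_const (a : ℝ) : HasExp2 (fun _ => a) a 0 0 :=
  hasExp2_iff.2 ⟨fun _ => 0, tendsto_const_nhds, fun s _ => by ring⟩

variable {f g : ℝ → ℝ} {a b c a' b' c' : ℝ}

lemma HasExp2.add (hf : HasExp2 f a b c) (hg : HasExp2 g a' b' c') :
    HasExp2 (fun s => f s + g s) (a + a') (b + b') (c + c') := by
  obtain ⟨u, hu, h⟩ := hasExp2_iff.1 hf
  obtain ⟨v, hv, h'⟩ := hasExp2_iff.1 hg
  exact hasExp2_iff.2 ⟨_, hu.add hv, fun s hs => by rw [h s hs, h' s hs]; ring⟩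

lemma HasExp2.mul (hf : HasExp2 f a b c) (hg : HasExp2 g a' b' c') :
    HasExp2 (fun s => f s * g s) (a * a') (a * b' + b * a') (a * c' + b * b' + c * a') := by
  obtain ⟨u, hu, h⟩ := hasExp2_iff.1 hf
  obtain ⟨v, hv, h'⟩ := hasExp2_iff.1 hg
  have h0 := tendsto_id_nhdsGT
  refine hasExp2_iff.2 ⟨fun s => a * v s + b * b' + u s * a' + s * (b * v s + u s * b' + s * (u s * v s)), ?_,
    fun s hs => by rw [h s hs, h' s hs]; ring⟩
  have := (((hv.const_mul a).add_const (b * b')).add (hu.mul_const a')).add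
    (h0.mul (((hv.const_mul b).add (hu.mul_const b')).add (h0.mul (hu.mul hv))))
  simpa using this

lemma HasExp2.inv (hf : HasExp2 f a b c) (ha : a ≠ 0) :
    ∃ b' c', HasExp2 (fun s => (f s)⁻¹) a⁻¹ b' c' := by
  obtain ⟨u, hu, h⟩ := hasExp2_iff.1 hf
  have h0 := tendsto_id_nhdsGT
  have hfa : Tendsto f (𝓝[>] 0) (𝓝 a) := by
    have : Tendsto (fun s => a + b * s + s ^ 2 * u s) (𝓝[>] 0) (𝓝 a) := by
      simpa using ((h0.const_mul b).const_add a).add ((h0.pow 2).mul hu)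
    refine this.congr' ?_
    filter_upwards [self_mem_nhdsWithin] with s hs using (h s hs).symm
  have h1 : Tendsto (fun s => (-(a⁻¹ * u s) + (b / a ^ 2) * b + (b / a ^ 2) * s * u s) * (f s)⁻¹) (𝓝[>] 0)
      (𝓝 ((-(a⁻¹ * c) + (b / a ^ 2) * b + (b / a ^ 2) * 0 * c) * a⁻¹)) :=
    (((hu.const_mul _).neg.add_const _).add ((h0.const_mul _).mul hu)).mul (hfa.inv₀ ha)
  refine ⟨-(b / a ^ 2), _, h1.congr' ?_⟩
  filter_upwards [self_mem_nhdsWithin, hfa.eventually_ne ha] with s hs hs'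
  have hs0 : s ≠ 0 := ne_of_gt hs
  rw [eq_div_iff (by positivity)]
  have h2 := h s hs
  field_simp
  have : s ^ 2 * u s = f s - a - b * s := by linarith
  linear_combination (-a + b * s) * this

lemma HasExp2.congr (hf : HasExp2 f a b c) (h : ∀ s > 0, f s = g s) : HasExp2 g a b c := by
  refine Tendsto.congr' ?_ hf
  filter_upwards [self_mem_nhdsWithin] with s hs
  rw [h s hs]

lemma exists_hasExp2_sum {ι : Type*} (t : Finset ι) {F : ι → ℝ → ℝ}
    (h : ∀ i ∈ t, ∃ a b c, HasExp2 (F i) a b c) : ∃ a b c, HasExp2 (fun s => ∑ i ∈ t, F i s) a b c := by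
  classical
  induction t using Finset.induction_on with
  | empty => exact ⟨0, 0, 0, by simpa using hasExp2_const 0⟩
  | insert i t hi ih =>
    obtain ⟨a, b, c, h1⟩ := h i (Finset.mem_insert_self _ _)
    obtain ⟨a', b', c', h2⟩ := ih fun j hj => h j (Finset.mem_insert_of_mem hj)
    exact ⟨_, _, _, by simpa [Finset.sum_insert hi] using h1.add h2⟩

lemma exists_hasExp2_polynomial (P : Polynomial ℝ) : ∃ b c, HasExp2 (fun s => P.eval s) (P.eval 0) b c := by
  have key : ∀ P : Polynomial ℝ, ∀ s, P.eval s = P.divX.eval s * s + P.eval 0 := fun P s => by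
    conv_lhs => rw [← P.divX_mul_X_add]
    simp [Polynomial.coeff_zero_eq_eval_zero]
  refine ⟨P.divX.eval 0, P.divX.divX.eval 0, hasExp2_iff.2 ⟨fun s => P.divX.divX.eval s, ?_, fun s _ => ?_⟩⟩
  · exact (P.divX.divX.continuous.tendsto 0).mono_left nhdsWithin_le_nhds
  · simp only [key P s, key P.divX s]; ring

lemma exists_hasExp2_div {P Q : Polynomial ℝ} {C : ℝ} (hQ : ∀ s > 0, Q.eval s ≠ 0)
    (hb : ∀ s > 0, |P.eval s / Q.eval s| ≤ C) : ∃ a b c, HasExp2 (fun s => P.eval s / Q.eval s) a b c := by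
  by_cases hP : P = 0
  · exact ⟨0, 0, 0, by simpa [hP] using hasExp2_const 0⟩
  have hQ0 : Q ≠ 0 := fun h => hQ 1 one_pos (by simp [h])
  obtain ⟨P', hP', hP0⟩ := Polynomial.exists_eq_pow_rootMultiplicity_mul_and_not_dvd P hP 0
  obtain ⟨Q', hQ', hQ0'⟩ := Polynomial.exists_eq_pow_rootMultiplicity_mul_and_not_dvd Q hQ0 0
  set n := P.rootMultiplicity 0
  set m := Q.rootMultiplicity 0
  rw [Polynomial.dvd_iff_isRoot, Polynomial.IsRoot] at hP0 hQ0'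
  have eP : ∀ s, P.eval s = s ^ n * P'.eval s := fun s => by rw [hP']; simp
  have eQ : ∀ s, Q.eval s = s ^ m * Q'.eval s := fun s => by rw [hQ']; simp
  have hQs : ∀ s > 0, Q'.eval s ≠ 0 := fun s hs h => hQ s hs (by rw [eQ, h, mul_zero])
  have hmn : m ≤ n := by
    by_contra! hlt
    obtain ⟨k, hk⟩ : ∃ k, m = n + (k + 1) := ⟨m - n - 1, by omega⟩
    apply hP0
    have h1 : Tendsto (fun s => |P'.eval s|) (𝓝[>] 0) (𝓝 |P'.eval 0|) :=
      ((P'.continuous.abs).tendsto 0).mono_left nhdsWithin_le_nhds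
    have h2 : Tendsto (fun s : ℝ => C * (s ^ (k + 1) * |Q'.eval s|)) (𝓝[>] 0) (𝓝 (C * (0 ^ (k + 1) * |Q'.eval 0|))) :=
      ((tendsto_id_nhdsGT.pow _).mul (((Q'.continuous.abs).tendsto 0).mono_left nhdsWithin_le_nhds)).const_mul C
    have h3 : |P'.eval 0| ≤ C * (0 ^ (k + 1) * |Q'.eval 0|) := by
      refine le_of_tendsto_of_tendsto h1 h2 ?_
      filter_upwards [self_mem_nhdsWithin] with s hs
      have h4 := hb s hs
      have hs' : 0 < s := hs
      have h5 : 0 < |Q'.eval s| := abs_pos.2 (hQs s hs)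
      rw [eP, eQ, hk, abs_div, abs_mul, abs_mul, abs_of_pos (pow_pos hs' n), abs_of_pos (pow_pos hs' _), div_le_iff₀ (by positivity),
        pow_add] at h4
      have h6 : s ^ n * |P'.eval s| ≤ s ^ n * (C * (s ^ (k + 1) * |Q'.eval s|)) := by linarith
      exact le_of_mul_le_mul_left h6 (by positivity)
    have h7 : |P'.eval 0| ≤ 0 := by simpa using h3
    exact abs_nonpos_iff.1 h7
  obtain ⟨b1, c1, h1⟩ := exists_hasExp2_polynomial (Polynomial.X ^ (n - m) * P')
  obtain ⟨b2, c2, h2⟩ := exists_hasExp2_polynomial Q'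
  obtain ⟨b3, c3, h3⟩ := h2.inv hQ0'
  refine ⟨_, _, _, (h1.mul h3).congr fun s hs => ?_⟩
  have h4 := hQs s hs
  have hs' : s ≠ 0 := ne_of_gt hs
  obtain ⟨k, hk⟩ := Nat.exists_eq_add_of_le hmn
  rw [eP, eQ, hk, pow_add]
  simp only [Nat.add_sub_cancel_left, Polynomial.eval_mul, Polynomial.eval_pow, Polynomial.eval_X]
  field_simp

/-- A uniform bound for weighted projections, independent of the weights. -/
lemma weighted_projection_bound {ι κ : Type*} [Fintype ι] [Fintype κ] (B : κ → ι → ℝ) :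
    ∃ C : ℝ, ∀ (D : ι → ℝ), (∀ i, 0 < D i) → ∀ (α : κ → ℝ) (m : ℝ), 0 ≤ m →
      (∀ k, |∑ i, D i * (∑ j, α j * B j i) * B k i| ≤ m) → ∀ i, |D i * ∑ j, α j * B j i| ≤ C * m := by
  set A : Set (ι → ℝ) := {x | ‖x‖ = 1 ∧ ∃ D : ι → ℝ, (∀ i, 0 < D i) ∧ ∃ α : κ → ℝ, ∀ i, x i = D i * ∑ j, α j * B j i}
  set F : (ι → ℝ) → (κ → ℝ) := fun x k => ∑ i, x i * B k i
  have hF : Continuous F := by fun_prop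
  have hA1 : closure A ⊆ sphere 0 1 := closure_minimal (fun x hx => by simpa using hx.1) isClosed_sphere
  have hAc : IsCompact (closure A) := (isCompact_sphere 0 1).of_isClosed_subset isClosed_closure hA1
  have hpos : ∀ x ∈ closure A, 0 < ‖F x‖ := by
    intro x hx
    rw [norm_pos_iff]
    intro h0
    have hev : ∀ᶠ y in 𝓝 x, ∀ i, x i ≠ 0 → 0 < x i * y i := by
      rw [eventually_all]
      intro i
      by_cases hi : x i = 0
      · simp [hi]
      · have : Tendsto (fun y : ι → ℝ => x i * y i) (𝓝 x) (𝓝 (x i * x i)) :=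
          Continuous.tendsto (by fun_prop) _
        filter_upwards [this.eventually_const_lt (mul_self_pos.2 hi)] with y hy _ using hy
    obtain ⟨y, ⟨-, D, hD, α, hy⟩, hxy⟩ := ((mem_closure_iff_frequently.1 hx).and_eventually hev).exists
    have h1 : ∑ i, x i * ∑ j, α j * B j i = 0 := by
      have : ∑ j, α j * F x j = 0 := by simp [h0]
      rw [← this]
      simp only [F, Finset.mul_sum]
      rw [Finset.sum_comm]
      exact Finset.sum_congr rfl fun j _ => Finset.sum_congr rfl fun i _ => by ring
    have h2 : ∀ i, x i ≠ 0 → 0 < x i * ∑ j, α j * B j i := fun i hi => by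
      have h3 := hxy i hi
      rw [hy i] at h3
      have h4 : 0 < D i * (x i * ∑ j, α j * B j i) := by linarith
      exact (mul_pos_iff_of_pos_left (hD i)).1 h4
    have h3 : ∃ i, x i ≠ 0 := by
      by_contra! h
      have : x = 0 := funext h
      have h5 := hA1 hx
      simp [this] at h5
    obtain ⟨i, hi⟩ := h3
    have : 0 < ∑ i, x i * ∑ j, α j * B j i := by
      refine Finset.sum_pos' (fun i _ => ?_) ⟨i, Finset.mem_univ _, h2 i hi⟩
      by_cases h : x i = 0
      · simp [h]
      · exact (h2 i h).le
    linarith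
  obtain ⟨c, hc, hcA⟩ : ∃ c > 0, ∀ x ∈ closure A, c ≤ ‖F x‖ := by
    rcases (closure A).eq_empty_or_nonempty with he | hne
    · exact ⟨1, one_pos, by simp [he]⟩
    · obtain ⟨x, hx, hmin⟩ := hAc.exists_isMinOn hne hF.norm.continuousOn
      exact ⟨_, hpos x hx, hmin⟩
  refine ⟨c⁻¹, fun D hD α m hm0 hm i => ?_⟩
  set y : ι → ℝ := fun i => D i * ∑ j, α j * B j i with hy
  change |y i| ≤ _
  by_cases hy0 : y = 0
  · have hm0 : 0 ≤ c⁻¹ * m := by positivity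
    simpa [hy0] using hm0
  have hn : 0 < ‖y‖ := norm_pos_iff.2 hy0
  have hmem : ‖y‖⁻¹ • y ∈ A := by
    refine ⟨by rw [norm_smul, norm_inv, norm_norm, inv_mul_cancel₀ hn.ne'], D, hD, fun j => ‖y‖⁻¹ * α j, fun i => ?_⟩
    simp only [Pi.smul_apply, smul_eq_mul, hy, Finset.mul_sum]
    exact Finset.sum_congr rfl fun j _ => by ring
  have h1 := hcA _ (subset_closure hmem)
  have h2 : F (‖y‖⁻¹ • y) = ‖y‖⁻¹ • F y := by
    ext k
    simp only [F, Pi.smul_apply, smul_eq_mul, Finset.mul_sum]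
    exact Finset.sum_congr rfl fun j _ => by ring
  rw [h2, norm_smul, norm_inv, norm_norm] at h1
  have h3 : ‖F y‖ ≤ m := (pi_norm_le_iff_of_nonneg hm0).2 hm
  rw [le_inv_mul_iff₀ hn] at h1
  rw [le_inv_mul_iff₀ hc]
  have h4 := norm_le_pi_norm y i
  rw [Real.norm_eq_abs] at h4
  nlinarith

/-- Weighted averages of a feature map, whose pairings with the features have second order expansions,
have second order expansions themselves. -/
theorem exists_hasExp2_of_pairing {ι σ : Type*} [Fintype ι] (Θ : σ → ι → ℝ) (D : ι → Polynomial ℝ)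
    (hD : ∀ i, ∀ s > 0, 0 < (D i).eval s) (a : ℝ → ι → ℝ)
    (ha : ∀ s > 0, ∀ c : ι → ℝ, (∀ w, ∑ i, c i * Θ w i = 0) → ∑ i, c i * a s i = 0)
    (hE : ∀ w, ∃ t₀ t₁ t₂, HasExp2 (fun s => ∑ i, (D i).eval s * a s i * Θ w i) t₀ t₁ t₂) (i : ι) :
    ∃ t₀ t₁ t₂, HasExp2 (fun s => (D i).eval s * a s i) t₀ t₁ t₂ := by
  classical
  obtain ⟨T, hT, hspan, hli⟩ := exists_linearIndependent ℝ (range Θ)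
  have : Fintype T := hli.setFinite.fintype
  set B : T → ι → ℝ := fun j => j.1
  have hmem : ∀ s > 0, ∃ α : T → ℝ, ∑ j, α j • B j = a s := fun s hs => by
    rw [← Submodule.mem_span_range_iff_exists_fun ℝ]
    simp only [B, Subtype.range_coe_subtype, setOf_mem_eq, hspan]
    by_contra hns
    obtain ⟨f, hf, hfb⟩ := Submodule.exists_le_ker_of_notMem hns
    have hfc : ∀ x : ι → ℝ, f x = ∑ i, f (Pi.single i 1) * x i := fun x => by
      conv_lhs => rw [LinearMap.pi_apply_eq_sum_univ f x]
      refine Finset.sum_congr rfl fun i _ => ?_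
      rw [smul_eq_mul, mul_comm]
      congr 2
      ext j
      simp [Pi.single_apply, eq_comm]
    refine hf ?_
    rw [hfc]
    refine ha s hs _ fun w => ?_
    rw [← hfc]
    exact hfb (Submodule.subset_span (mem_range_self w))
  choose! α hα using hmem
  set G : Matrix T T (Polynomial ℝ) := Matrix.of fun j k =>
    ∑ i, Polynomial.C (B j i) * D i * Polynomial.C (B k i) with hG
  set Gs : ℝ → Matrix T T ℝ := fun s => (Polynomial.evalRingHom s).mapMatrix G with hGs
  have hGv : ∀ s (β : T → ℝ) k, (Gs s).mulVec β k = ∑ i, (D i).eval s * (∑ j, β j * B j i) * B k i := fun s β k => by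
    simp only [Matrix.mulVec, dotProduct, hGs, RingHom.mapMatrix_apply, Matrix.map_apply, hG, Matrix.of_apply,
      Polynomial.coe_evalRingHom, Polynomial.eval_finset_sum, Polynomial.eval_mul, Polynomial.eval_C, Finset.sum_mul,
      Finset.mul_sum]
    rw [Finset.sum_comm]
    exact Finset.sum_congr rfl fun i _ => Finset.sum_congr rfl fun j _ => by ring
  have hdet : ∀ s, G.det.eval s = (Gs s).det := fun s => by
    rw [hGs, ← RingHom.map_det, Polynomial.coe_evalRingHom]
  have hdet0 : ∀ s > 0, G.det.eval s ≠ 0 := fun s hs h0 => by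
    rw [hdet] at h0
    obtain ⟨β, hβ, hβ0⟩ := Matrix.exists_mulVec_eq_zero_iff.2 h0
    have h1 : ∑ i, (D i).eval s * (∑ j, β j * B j i) ^ 2 = 0 := by
      have : ∑ k, β k * (Gs s).mulVec β k = 0 := by simp [hβ0]
      rw [← this]
      simp only [hGv, Finset.mul_sum]
      rw [Finset.sum_comm]
      refine Finset.sum_congr rfl fun i _ => ?_
      rw [sq, ← mul_assoc, Finset.mul_sum]
      exact Finset.sum_congr rfl fun j _ => by rw [← Finset.mul_sum]; ring
    rw [Finset.sum_eq_zero_iff_of_nonneg fun i _ => mul_nonneg (hD i s hs).le (sq_nonneg _)] at h1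
    refine hβ (funext fun j => Fintype.linearIndependent_iff.1 hli β ?_ j)
    ext i
    have h2 := h1 i (Finset.mem_univ _)
    have h3 := (mul_eq_zero.1 h2).resolve_left (hD i s hs).ne'
    simpa [B] using h3
  set adj : Matrix T T (Polynomial ℝ) := G.adjugate
  set P : T → Polynomial ℝ := fun k => D i * ∑ j, Polynomial.C (B j i) * adj j k with hP
  obtain ⟨C, hC⟩ := weighted_projection_bound B
  have hadj : ∀ s, Gs s * (Polynomial.evalRingHom s).mapMatrix adj = (G.det.eval s) • 1 := fun s => by
    rw [hGs, ← map_mul, Matrix.mul_adjugate, hdet]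
    ext j k
    simp [Matrix.one_apply, apply_ite (Polynomial.eval s), hdet, hGs]
  have hadj' : ∀ s, (Polynomial.evalRingHom s).mapMatrix adj * Gs s = (G.det.eval s) • 1 := fun s => by
    rw [hGs, ← map_mul, Matrix.adjugate_mul, hdet]
    ext j k
    simp [Matrix.one_apply, apply_ite (Polynomial.eval s), hdet, hGs]
  have hbound : ∀ k, ∀ s > 0, |(P k).eval s / G.det.eval s| ≤ C * 1 := fun k s hs => by
    have h1 := hC (fun i => (D i).eval s) (fun i => hD i s hs) (fun j => (adj j k).eval s / G.det.eval s) 1 zero_le_one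
      (fun l => by
        rw [← hGv]
        have h2 := congrFun (congrFun (hadj s) l) k
        have h3 : (Gs s).mulVec (fun j => (adj j k).eval s / G.det.eval s) l = (1 : Matrix T T ℝ) l k := by
          simp only [Matrix.mulVec, dotProduct, Matrix.mul_apply, RingHom.mapMatrix_apply, Matrix.map_apply,
            Polynomial.coe_evalRingHom, Matrix.smul_apply, smul_eq_mul] at h2 ⊢
          simp only [← mul_div_assoc, ← Finset.sum_div]
          rw [h2, mul_div_cancel_left₀ _ (hdet0 s hs)]
        rw [h3, Matrix.one_apply]
        split_ifs <;> simp) i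
    refine le_trans (le_of_eq ?_) h1
    congr 1
    simp only [hP, Polynomial.eval_mul, Polynomial.eval_finset_sum, Polynomial.eval_C]
    rw [mul_div_assoc, Finset.sum_div]
    exact congrArg _ (Finset.sum_congr rfl fun j _ => by ring)
  have hB : ∀ j : T, ∃ w, Θ w = B j := fun j => hT j.2
  have hrep : ∀ s > 0, ∑ k, (P k).eval s / G.det.eval s * (∑ l, (D l).eval s * a s l * B k l) = (D i).eval s * a s i := by
    intro s hs
    have h1 : ∀ k, ∑ l, (D l).eval s * a s l * B k l = (Gs s).mulVec (α s) k := fun k => by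
      rw [hGv, ← hα s hs]
      simp
    have h2 : ((Polynomial.evalRingHom s).mapMatrix adj).mulVec ((Gs s).mulVec (α s)) = G.det.eval s • α s := by
      rw [Matrix.mulVec_mulVec, hadj', Matrix.smul_mulVec, Matrix.one_mulVec]
    have h3 : a s i = ∑ j, α s j * B j i := by rw [← hα s hs]; simp
    have h4 : ∀ j, α s j = (∑ k, (adj j k).eval s * (Gs s).mulVec (α s) k) / G.det.eval s := fun j => by
      have := congrFun h2 j
      rw [eq_div_iff (hdet0 s hs), mul_comm, ← smul_eq_mul, ← Pi.smul_apply, ← this]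
      simp [Matrix.mulVec, dotProduct]
    simp only [h1]
    rw [h3]
    generalize (Gs s).mulVec (α s) = g at h4 ⊢
    generalize α s = β at h4 ⊢
    obtain rfl : β = _ := funext h4
    simp only [hP, Polynomial.eval_mul, Polynomial.eval_finset_sum, Polynomial.eval_C, Finset.mul_sum, Finset.sum_mul,
      Finset.sum_div]
    rw [Finset.sum_comm]
    exact Finset.sum_congr rfl fun j _ => Finset.sum_congr rfl fun k _ => by ring
  have hsum : ∃ t₀ t₁ t₂, HasExp2 (fun s => ∑ k, (P k).eval s / G.det.eval s * (∑ l, (D l).eval s * a s l * B k l)) t₀ t₁ t₂ := by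
    refine exists_hasExp2_sum _ fun k _ => ?_
    obtain ⟨w, hw⟩ := hB k
    obtain ⟨_, _, _, h1⟩ := exists_hasExp2_div hdet0 (hbound k)
    obtain ⟨_, _, _, h2⟩ := hE w
    rw [hw] at h2
    exact ⟨_, _, _, h1.mul h2⟩
  obtain ⟨t₀, t₁, t₂, h⟩ := hsum
  exact ⟨t₀, t₁, t₂, h.congr hrep⟩

end expansion

section gaussExpectation

variable {E : Type*} [NormedAddCommGroup E] [InnerProductSpace ℝ E]

/-- Continuous functions of polynomial growth. -/
def PolyGrowth (f : E → ℝ) : Prop :=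
  Continuous f ∧ ∃ K : ℝ, 0 ≤ K ∧ ∃ k : ℕ, ∀ z, |f z| ≤ K * (1 + ‖z‖) ^ k

namespace PolyGrowth

lemma const (c : ℝ) : PolyGrowth (fun _ : E => c) :=
  ⟨continuous_const, |c|, abs_nonneg _, 0, fun z => by simp⟩

lemma norm : PolyGrowth (fun z : E => ‖z‖) :=
  ⟨continuous_norm, 1, zero_le_one, 1, fun z => by simp⟩

lemma inner (u : E) : PolyGrowth (fun z : E => ⟪z, u⟫) :=
  ⟨by fun_prop, ‖u‖, norm_nonneg u, 1, fun z => by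
    have := abs_real_inner_le_norm z u
    have h2 := norm_nonneg u
    rw [pow_one]; nlinarith⟩

lemma add {f g : E → ℝ} (hf : PolyGrowth f) (hg : PolyGrowth g) : PolyGrowth (fun z => f z + g z) := by
  obtain ⟨hc, K, hK, k, h⟩ := hf
  obtain ⟨hc', K', hK', k', h'⟩ := hg
  refine ⟨hc.add hc', K + K', add_nonneg hK hK', k + k', fun z => ?_⟩
  have h1 : (1 + ‖z‖) ^ k ≤ (1 + ‖z‖) ^ (k + k') := pow_le_pow_right₀ (by simp) (by omega)
  have h2 : (1 + ‖z‖) ^ k' ≤ (1 + ‖z‖) ^ (k + k') := pow_le_pow_right₀ (by simp) (by omega)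
  have := abs_add_le (f z) (g z)
  nlinarith [h z, h' z]

lemma mul {f g : E → ℝ} (hf : PolyGrowth f) (hg : PolyGrowth g) : PolyGrowth (fun z => f z * g z) := by
  obtain ⟨hc, K, hK, k, h⟩ := hf
  obtain ⟨hc', K', hK', k', h'⟩ := hg
  refine ⟨hc.mul hc', K * K', mul_nonneg hK hK', k + k', fun z => ?_⟩
  rw [abs_mul, pow_add, mul_mul_mul_comm]
  exact mul_le_mul (h z) (h' z) (abs_nonneg _) (by positivity)

lemma const_mul {f : E → ℝ} (c : ℝ) (hf : PolyGrowth f) : PolyGrowth (fun z => c * f z) := (const c).mul hf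

lemma neg {f : E → ℝ} (hf : PolyGrowth f) : PolyGrowth (fun z => -f z) := by
  simpa using hf.const_mul (-1)

lemma sub {f g : E → ℝ} (hf : PolyGrowth f) (hg : PolyGrowth g) : PolyGrowth (fun z => f z - g z) := by
  simpa [sub_eq_add_neg] using hf.add hg.neg

lemma pow {f : E → ℝ} (hf : PolyGrowth f) (k : ℕ) : PolyGrowth (fun z => f z ^ k) := by
  induction k with
  | zero => simpa using const 1
  | succ k ih => simpa [pow_succ] using ih.mul hf

lemma sum {ι : Type*} {f : ι → E → ℝ} (t : Finset ι) (hf : ∀ i, PolyGrowth (f i)) :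
    PolyGrowth (fun z => ∑ i ∈ t, f i z) := by
  classical
  induction t using Finset.induction_on with
  | empty => simpa using const 0
  | insert i t hi ih => simpa [Finset.sum_insert hi] using (hf i).add ih

lemma prod {ι : Type*} {f : ι → E → ℝ} (t : Finset ι) (hf : ∀ i, PolyGrowth (f i)) :
    PolyGrowth (fun z => ∏ i ∈ t, f i z) := by
  classical
  induction t using Finset.induction_on with
  | empty => simpa using const 1
  | insert i t hi ih => simpa [Finset.prod_insert hi] using (hf i).mul ih

end PolyGrowth

variable [FiniteDimensional ℝ E] [MeasurableSpace E] [BorelSpace E]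

/-- Gaussian expectation at scale `s`, normalised by the Gaussian mass of a `d`-plane. -/
def gaussExp (d : ℕ) (ν : Measure E) (s : ℝ) (f : E → ℝ) : ℝ :=
  (gaussMass d s)⁻¹ * ∫ z, Real.exp (-s * ‖z‖ ^ 2) * f z ∂ν

variable {d : ℕ} {ν : Measure E} {S : Set E} {s : ℝ} {f g : E → ℝ}

lemma Unif.integrable_polyGrowth (h : Unif d ν S) (hs : 0 < s) (hf : PolyGrowth f) :
    Integrable (fun z => Real.exp (-s * ‖z‖ ^ 2) * f z) ν := by
  obtain ⟨hc, K, hK, k, hb⟩ := hf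
  obtain ⟨C, hC, hCt⟩ := pow_le_exp_sq k (by positivity : 0 < s / 4)
  refine integrable_gauss_smul (ρ := fun z => ‖z‖) h.integrable_gauss_zero (by fun_prop) hc.aestronglyMeasurable
    (half_lt_self hs) (C := K * C * Real.exp (s / 2)) (Eventually.of_forall fun z => ?_)
  have h1 := hCt (1 + ‖z‖)
  rw [abs_of_nonneg (by positivity)] at h1
  calc _ ≤ K * (C * Real.exp (s / 4 * (1 + ‖z‖) ^ 2)) := (hb z).trans (by gcongr)
    _ ≤ K * (C * (Real.exp (s / 2) * Real.exp (s / 2 * ‖z‖ ^ 2))) := by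
      rw [← Real.exp_add]; gcongr; nlinarith [sq_nonneg (1 - ‖z‖)]
    _ = _ := by ring

lemma Unif.gaussExp_one (h : Unif d ν S) (hs : 0 < s) (c : ℝ) : gaussExp d ν s (fun _ => c) = c := by
  have := gaussMass_pos d hs
  rw [gaussExp, integral_mul_const, h.integral_gauss_zero hs]
  field_simp

lemma Unif.gaussExp_add (h : Unif d ν S) (hs : 0 < s) (hf : PolyGrowth f) (hg : PolyGrowth g) :
    gaussExp d ν s (fun z => f z + g z) = gaussExp d ν s f + gaussExp d ν s g := by
  simp only [gaussExp, mul_add]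
  rw [integral_add (h.integrable_polyGrowth hs hf) (h.integrable_polyGrowth hs hg), mul_add]

lemma gaussExp_const_mul (c : ℝ) : gaussExp d ν s (fun z => c * f z) = c * gaussExp d ν s f := by
  simp only [gaussExp, mul_left_comm _ c]
  rw [integral_const_mul]
  ring

lemma Unif.gaussExp_sub (h : Unif d ν S) (hs : 0 < s) (hf : PolyGrowth f) (hg : PolyGrowth g) :
    gaussExp d ν s (fun z => f z - g z) = gaussExp d ν s f - gaussExp d ν s g := by
  simp only [gaussExp, mul_sub]
  rw [integral_sub (h.integrable_polyGrowth hs hf) (h.integrable_polyGrowth hs hg), mul_sub]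

lemma Unif.gaussExp_sum (h : Unif d ν S) (hs : 0 < s) {ι : Type*} (t : Finset ι) {f : ι → E → ℝ}
    (hf : ∀ i, PolyGrowth (f i)) :
    gaussExp d ν s (fun z => ∑ i ∈ t, f i z) = ∑ i ∈ t, gaussExp d ν s (f i) := by
  simp only [gaussExp, Finset.mul_sum]
  rw [integral_finset_sum _ fun i _ => h.integrable_polyGrowth hs (hf i), Finset.mul_sum]

lemma Unif.gaussExp_congr (h : Unif d ν S) (hfg : ∀ z ∈ S, f z = g z) :
    gaussExp d ν s f = gaussExp d ν s g := by
  rw [gaussExp, gaussExp]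
  congr 1
  refine integral_congr_ae ?_
  filter_upwards [h.ae_mem] with z hz
  rw [hfg z hz]

lemma Unif.gaussExp_mono (h : Unif d ν S) (hs : 0 < s) (hf : PolyGrowth f) (hg : PolyGrowth g)
    (hfg : ∀ z ∈ S, f z ≤ g z) : gaussExp d ν s f ≤ gaussExp d ν s g := by
  have := gaussMass_pos d hs
  refine mul_le_mul_of_nonneg_left (integral_mono_ae (h.integrable_polyGrowth hs hf) (h.integrable_polyGrowth hs hg) ?_)
    (by positivity)
  filter_upwards [h.ae_mem] with z hz
  exact mul_le_mul_of_nonneg_left (hfg z hz) (Real.exp_pos _).le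

lemma Unif.abs_gaussExp_le (h : Unif d ν S) (hs : 0 < s) (hf : PolyGrowth f) (hg : PolyGrowth g)
    (hfg : ∀ z ∈ S, |f z| ≤ g z) : |gaussExp d ν s f| ≤ gaussExp d ν s g := by
  refine abs_le.2 ⟨?_, h.gaussExp_mono hs hf hg fun z hz => (abs_le.1 (hfg z hz)).2⟩
  have h1 := h.gaussExp_mono hs (hg.const_mul (-1)) hf fun z hz => by
    have := (abs_le.1 (hfg z hz)).1
    linarith
  rw [gaussExp_const_mul] at h1
  linarith

lemma Unif.gaussExp_norm_sq (h : Unif d ν S) (hs : 0 < s) : gaussExp d ν s (fun z => ‖z‖ ^ 2) = d / (2 * s) := by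
  have := gaussMass_pos d hs
  rw [gaussExp, h.gauss_second_moment hs]
  field_simp

lemma exists_gaussExp_bound (d k : ℕ) : ∃ C > 0, ∀ (ν : Measure E) (S : Set E), Unif d ν S → ∀ s > 0, ∀ f : E → ℝ,
    PolyGrowth f → ∀ K : ℝ, 0 ≤ K → (∀ z ∈ S, |f z| ≤ K * ‖z‖ ^ k) → |gaussExp d ν s f| * √s ^ k ≤ K * C := by
  obtain ⟨C, hC, hCt⟩ := pow_le_exp_sq k (by norm_num : (0 : ℝ) < 1 / 2)
  refine ⟨C * 2 ^ ((d : ℝ) / 2), by positivity, fun ν S h s hs f hf K hK hb => ?_⟩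
  have hG := gaussMass_pos d hs
  have hq : 0 < √s := Real.sqrt_pos.2 hs
  have h1 := h.abs_gaussExp_le hs hf ((PolyGrowth.norm.pow k).const_mul K) hb
  rw [gaussExp_const_mul] at h1
  have h2 : gaussExp d ν s (fun z => ‖z‖ ^ k) * √s ^ k ≤ C * 2 ^ ((d : ℝ) / 2) := by
    rw [gaussExp, mul_assoc, ← integral_mul_const, inv_mul_le_iff₀ hG]
    have h3 : ∫ z, C * Real.exp (-(s / 2) * ‖z‖ ^ 2) ∂ν = gaussMass d s * (C * 2 ^ ((d : ℝ) / 2)) := by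
      rw [integral_const_mul, h.integral_gauss_zero (by positivity), gaussMass_div d hs two_pos]
      ring
    rw [← h3]
    refine integral_mono ((h.integrable_polyGrowth hs (PolyGrowth.norm.pow k)).mul_const _)
      ((h.integrable_gauss_zero _ (by positivity)).const_mul _) fun z => ?_
    have h4 := hCt (√s * ‖z‖)
    rw [abs_of_nonneg (by positivity), mul_pow, mul_pow, Real.sq_sqrt hs.le] at h4
    calc _ = Real.exp (-s * ‖z‖ ^ 2) * (√s ^ k * ‖z‖ ^ k) := by ring
      _ ≤ Real.exp (-s * ‖z‖ ^ 2) * (C * Real.exp (1 / 2 * (s * ‖z‖ ^ 2))) := by gcongr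
      _ = C * Real.exp (-(s / 2) * ‖z‖ ^ 2) := by rw [mul_left_comm, ← Real.exp_add]; ring_nf
  calc _ ≤ K * gaussExp d ν s (fun z => ‖z‖ ^ k) * √s ^ k := by gcongr
    _ = K * (gaussExp d ν s (fun z => ‖z‖ ^ k) * √s ^ k) := by ring
    _ ≤ _ := by gcongr

lemma abs_exp_sub_sum_le (x : ℝ) (n : ℕ) :
    |Real.exp x - ∑ m ∈ Finset.range n, x ^ m / m.factorial| ≤ |x| ^ n * Real.exp |x| := by
  have h := Complex.norm_exp_sub_sum_le_norm_mul_exp (x : ℂ) n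
  have e : (Complex.exp (x : ℂ) - ∑ m ∈ Finset.range n, (x : ℂ) ^ m / (m.factorial : ℂ)) =
      ((Real.exp x - ∑ m ∈ Finset.range n, x ^ m / m.factorial : ℝ) : ℂ) := by
    push_cast; rfl
  rw [e, Complex.norm_real, Complex.norm_real] at h
  exact h

/-- The moment expansion at points of the support. -/
lemma Unif.moment_expansion (h : Unif d ν S) {x : E} (hx : x ∈ S) (n : ℕ) : ∃ K, ∀ s, 0 < s → s ≤ 1 →
    |Real.exp (s * ‖x‖ ^ 2) - ∑ m ∈ Finset.range n, (2 * s) ^ m / m.factorial * gaussExp d ν s (fun z => ⟪z, x⟫ ^ m)| ≤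
      K * √s ^ n := by
  obtain ⟨C, hC, hCt⟩ := pow_le_exp_sq n (by norm_num : (0 : ℝ) < 1 / 4)
  refine ⟨(2 * ‖x‖) ^ n * C * Real.exp (4 * ‖x‖ ^ 2) * 2 ^ ((d : ℝ) / 2), fun s hs hs1 => ?_⟩
  have hG := gaussMass_pos d hs
  have hp : ∀ m, PolyGrowth (fun z : E => (2 * s) ^ m / m.factorial * ⟪z, x⟫ ^ m) :=
    fun m => ((PolyGrowth.inner x).pow m).const_mul _
  simp only [← gaussExp_const_mul]
  rw [← h.gaussExp_sum hs _ hp]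
  have e1 : Real.exp (s * ‖x‖ ^ 2) = (gaussMass d s)⁻¹ * ∫ z, Real.exp (-s * ‖z‖ ^ 2) * Real.exp (2 * s * ⟪z, x⟫) ∂ν := by
    have h1 := h.integral_gauss hx hs
    have h2 : ∀ z : E, Real.exp (-s * ‖z‖ ^ 2) * Real.exp (2 * s * ⟪z, x⟫) =
        Real.exp (s * ‖x‖ ^ 2) * Real.exp (-s * ‖z - x‖ ^ 2) := fun z => by
      rw [← Real.exp_add, ← Real.exp_add, norm_sub_sq_real]; ring_nf
    simp only [h2]
    rw [integral_const_mul, h1]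
    field_simp
  have i1 : Integrable (fun z => Real.exp (-s * ‖z‖ ^ 2) * Real.exp (2 * s * ⟪z, x⟫)) ν := by
    have h2 : ∀ z : E, Real.exp (-s * ‖z‖ ^ 2) * Real.exp (2 * s * ⟪z, x⟫) =
        Real.exp (s * ‖x‖ ^ 2) * Real.exp (-s * ‖z - x‖ ^ 2) := fun z => by
      rw [← Real.exp_add, ← Real.exp_add, norm_sub_sq_real]; ring_nf
    simp only [h2]
    exact (h.integrable_gauss hx hs).const_mul _
  rw [e1, gaussExp, ← mul_sub, ← integral_sub i1 (h.integrable_polyGrowth hs (PolyGrowth.sum _ hp)), abs_mul,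
    abs_of_pos (inv_pos.2 hG), inv_mul_le_iff₀ hG, ← Real.norm_eq_abs]
  have hq : √s * √s = s := Real.mul_self_sqrt hs.le
  have hq1 : √s ≤ 1 := by rw [← Real.sqrt_one]; exact Real.sqrt_le_sqrt hs1
  refine (norm_integral_le_of_norm_le ((h.integrable_gauss_zero (s / 2) (by positivity)).const_mul
    ((2 * ‖x‖) ^ n * C * Real.exp (4 * ‖x‖ ^ 2) * √s ^ n)) (Eventually.of_forall fun z => ?_)).trans_eq ?_
  · rw [← mul_sub, norm_mul, Real.norm_of_nonneg (Real.exp_pos _).le, Real.norm_eq_abs]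
    have h0 := abs_exp_sub_sum_le (2 * s * ⟪z, x⟫) n
    simp only [mul_pow _ (⟪z, x⟫ : ℝ), mul_div_right_comm] at h0
    set t := √s * ‖z‖ with ht
    have ht0 : 0 ≤ t := by positivity
    have ht2 : t ^ 2 = s * ‖z‖ ^ 2 := by rw [ht, mul_pow, Real.sq_sqrt hs.le]
    have hy : |2 * s * ⟪z, x⟫| ≤ 2 * √s * ‖x‖ * t := by
      rw [abs_mul, abs_of_pos (by positivity : 0 < 2 * s)]
      calc _ ≤ 2 * s * (‖z‖ * ‖x‖) := by gcongr; exact abs_real_inner_le_norm _ _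
        _ = 2 * (√s * √s) * (‖z‖ * ‖x‖) := by rw [hq]
        _ = _ := by rw [ht]; ring
    have hexp : Real.exp |2 * s * ⟪z, x⟫| ≤ Real.exp (4 * ‖x‖ ^ 2 + 1 / 4 * t ^ 2) := by
      apply Real.exp_le_exp.2
      have : 2 * √s * ‖x‖ * t ≤ 2 * 1 * ‖x‖ * t := by gcongr
      nlinarith [sq_nonneg (2 * ‖x‖ - 1 / 2 * t)]
    have h3 := hCt t
    rw [abs_of_nonneg ht0] at h3
    calc _ ≤ Real.exp (-s * ‖z‖ ^ 2) * (|2 * s * ⟪z, x⟫| ^ n * Real.exp |2 * s * ⟪z, x⟫|) := by gcongr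
      _ ≤ Real.exp (-s * ‖z‖ ^ 2) * ((2 * √s * ‖x‖ * t) ^ n * Real.exp (4 * ‖x‖ ^ 2 + 1 / 4 * t ^ 2)) := by
          gcongr
      _ = (2 * ‖x‖) ^ n * √s ^ n * Real.exp (-s * ‖z‖ ^ 2) * Real.exp (4 * ‖x‖ ^ 2 + 1 / 4 * t ^ 2) * t ^ n := by
          ring
      _ ≤ (2 * ‖x‖) ^ n * √s ^ n * Real.exp (-s * ‖z‖ ^ 2) * Real.exp (4 * ‖x‖ ^ 2 + 1 / 4 * t ^ 2) *
          (C * Real.exp (1 / 4 * t ^ 2)) := by gcongr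
      _ = (2 * ‖x‖) ^ n * C * Real.exp (4 * ‖x‖ ^ 2) * √s ^ n *
          (Real.exp (-s * ‖z‖ ^ 2) * Real.exp (1 / 4 * t ^ 2) * Real.exp (1 / 4 * t ^ 2)) := by
          rw [Real.exp_add]; ring
      _ = _ := by
          rw [← Real.exp_add, ← Real.exp_add, ht2]; ring_nf
  · rw [integral_const_mul, h.integral_gauss_zero (by positivity), gaussMass_div d hs two_pos]
    ring

end gaussExpectation

section moments

variable {E : Type*} [NormedAddCommGroup E] [InnerProductSpace ℝ E] [FiniteDimensional ℝ E]
  [MeasurableSpace E] [BorelSpace E] {d : ℕ} {ν : Measure E} {S : Set E}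

lemma tendsto_sqrt_nhdsGT : Tendsto (fun s : ℝ => √s) (𝓝[>] 0) (𝓝 0) := by
  have : Tendsto (fun s : ℝ => √s) (𝓝 0) (𝓝 √0) := Real.continuous_sqrt.tendsto _
  simpa using this.mono_left nhdsWithin_le_nhds

lemma hasExp2_of_le {f g : ℝ → ℝ} {a b c K : ℝ} (hf : HasExp2 f a b c)
    (h : ∀ s, 0 < s → s ≤ 1 → |f s - g s| ≤ K * √s ^ 5) : HasExp2 g a b c := by
  have h1 : Tendsto (fun s => (f s - g s) / s ^ 2) (𝓝[>] 0) (𝓝 0) := by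
    refine squeeze_zero_norm' (a := fun s => K * √s) ?_ (by simpa using tendsto_sqrt_nhdsGT.const_mul K)
    filter_upwards [Ioc_mem_nhdsGT (zero_lt_one : (0 : ℝ) < 1)] with s hs
    have hs0 : 0 < s := hs.1
    rw [norm_div, Real.norm_eq_abs, Real.norm_of_nonneg (sq_nonneg s), div_le_iff₀ (by positivity)]
    refine (h s hs.1 hs.2).trans_eq ?_
    have : √s ^ 5 = √s * (√s ^ 2) ^ 2 := by ring
    rw [this, Real.sq_sqrt hs0.le]
    ring
  have h2 : Tendsto (fun s => (f s - a - b * s) / s ^ 2 - (f s - g s) / s ^ 2) (𝓝[>] 0) (𝓝 (c - 0)) := hf.sub h1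
  rw [sub_zero] at h2
  refine h2.congr fun s => ?_
  rw [← sub_div]
  congr 1
  ring

lemma hasExp2_exp_sub_one (a : ℝ) : HasExp2 (fun s => Real.exp (s * a) - 1) 0 a (a ^ 2 / 2) := by
  have h0 : HasExp2 (fun s => s * a + s ^ 2 * (a ^ 2 / 2)) 0 a (a ^ 2 / 2) :=
    hasExp2_iff.2 ⟨fun _ => a ^ 2 / 2, tendsto_const_nhds, fun s _ => by ring⟩
  refine hasExp2_of_le (K := |a| ^ 3 * Real.exp |a|) h0 fun s hs hs1 => ?_
  have h1 := abs_exp_sub_quadratic_le (s * a)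
  rw [abs_sub_comm]
  have e : Real.exp (s * a) - 1 - (s * a + s ^ 2 * (a ^ 2 / 2)) = Real.exp (s * a) - (1 + s * a + (s * a) ^ 2 / 2) := by
    ring
  rw [e]
  refine h1.trans ?_
  rw [abs_mul, abs_of_pos hs, mul_pow]
  have hq1 : √s ≤ 1 := by rw [← Real.sqrt_one]; exact Real.sqrt_le_sqrt hs1
  have h3 : s ^ 3 ≤ √s ^ 5 := by
    have : s ^ 3 = √s ^ 6 := by rw [show √s ^ 6 = (√s ^ 2) ^ 3 by ring, Real.sq_sqrt hs.le]
    rw [this]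
    exact pow_le_pow_of_le_one (Real.sqrt_nonneg s) hq1 (by norm_num)
  have h4 : Real.exp (s * |a|) ≤ Real.exp |a| := by
    apply Real.exp_le_exp.2
    nlinarith [abs_nonneg a]
  calc _ ≤ √s ^ 5 * |a| ^ 3 * Real.exp |a| := by gcongr
    _ = _ := by ring

lemma Unif.hasExp2_moments (h : Unif d ν S) {x : E} (hx : x ∈ S) :
    HasExp2 (fun s => ∑ k : Fin 4, (2 * s) ^ (k + 1 : ℕ) / (k + 1 : ℕ).factorial *
      gaussExp d ν s (fun z => ⟪z, x⟫ ^ (k + 1 : ℕ))) 0 (‖x‖ ^ 2) (‖x‖ ^ 4 / 2) := by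
  obtain ⟨K, hK⟩ := h.moment_expansion hx 5
  have h0 := hasExp2_exp_sub_one (‖x‖ ^ 2)
  rw [← pow_mul] at h0
  refine hasExp2_of_le h0 (K := K) fun s hs hs1 => ?_
  refine le_trans (le_of_eq ?_) (hK s hs hs1)
  rw [Finset.sum_range_succ', ← Fin.sum_univ_eq_sum_range]
  simp only [pow_zero, Nat.factorial_zero, Nat.cast_one, div_one, h.gaussExp_one hs]
  congr 1
  ring

lemma prod_inner_eq_sum {N k : ℕ} (e : OrthonormalBasis (Fin N) ℝ E) (z : E) (u : Fin k → E) :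
    ∏ i, ⟪z, u i⟫ = ∑ f : Fin k → Fin N, (∏ i, ⟪u i, e (f i)⟫) * ∏ i, ⟪z, e (f i)⟫ := by
  have h1 : ∀ i, ⟪z, u i⟫ = ∑ j, ⟪u i, e j⟫ * ⟪z, e j⟫ := fun i => by
    rw [← e.sum_inner_mul_inner]
    exact Finset.sum_congr rfl fun j _ => by rw [mul_comm, real_inner_comm (u i)]
  simp only [h1]
  rw [Finset.prod_univ_sum]
  simp only [Fintype.piFinset_univ, Finset.prod_mul_distrib]

lemma polyGrowth_prod_inner {k : ℕ} (u : Fin k → E) : PolyGrowth (fun z => ∏ i, ⟪z, u i⟫) :=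
  PolyGrowth.prod _ fun i => PolyGrowth.inner (u i)

/-- The Gaussian moments of degree at most four of a uniform measure have second order expansions. -/
theorem Unif.exists_hasExp2_moment (h : Unif d ν S) {k : ℕ} (hk : k < 4) (u : Fin (k + 1) → E) :
    ∃ t₀ t₁ t₂, HasExp2 (fun s => s ^ (k + 1) * gaussExp d ν s (fun z => ∏ i, ⟪z, u i⟫)) t₀ t₁ t₂ := by
  set N := Module.finrank ℝ E
  set e := stdOrthonormalBasis ℝ E
  set Θ : E → (Σ k : Fin 4, (Fin (k + 1) → Fin N)) → ℝ := fun z i => ∏ j, ⟪z, e (i.2 j)⟫ with hΘ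
  set D : (Σ k : Fin 4, (Fin (k + 1) → Fin N)) → Polynomial ℝ := fun i =>
    Polynomial.C (2 ^ (i.1 + 1 : ℕ) / (i.1 + 1 : ℕ).factorial : ℝ) * Polynomial.X ^ (i.1 + 1 : ℕ) with hDdef
  have hDe : ∀ i s, (D i).eval s = (2 * s) ^ (i.1 + 1 : ℕ) / (i.1 + 1 : ℕ).factorial := fun i s => by
    simp only [hDdef, Polynomial.eval_mul, Polynomial.eval_C, Polynomial.eval_pow, Polynomial.eval_X]
    ring
  have hPΘ : ∀ i, PolyGrowth (fun z => Θ z i) := fun i => polyGrowth_prod_inner _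
  have main : ∀ i, ∃ t₀ t₁ t₂, HasExp2 (fun s => (D i).eval s * gaussExp d ν s (fun z => Θ z i)) t₀ t₁ t₂ := by
    refine exists_hasExp2_of_pairing (σ := S) (fun w i => Θ w i) D (fun i s hs => ?_)
      (fun s i => gaussExp d ν s (fun z => Θ z i)) (fun s hs c hc => ?_) (fun w => ?_)
    · rw [hDe]; positivity
    · simp only [← gaussExp_const_mul]
      rw [← h.gaussExp_sum hs _ fun i => (hPΘ i).const_mul (c i), ← h.gaussExp_one hs 0]
      exact h.gaussExp_congr fun z hz => hc ⟨z, hz⟩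
    · refine ⟨_, _, _, (h.hasExp2_moments w.2).congr fun s hs => ?_⟩
      rw [Fintype.sum_sigma]
      refine Finset.sum_congr rfl fun k _ => ?_
      have h1 : ∀ z : E, ⟪z, (w : E)⟫ ^ (k + 1 : ℕ) = ∑ f : Fin (k + 1) → Fin N, Θ w ⟨k, f⟩ * Θ z ⟨k, f⟩ := fun z => by
        have := prod_inner_eq_sum e z (fun _ : Fin (k + 1 : ℕ) => (w : E))
        rw [Finset.prod_const, Finset.card_univ, Fintype.card_fin] at this
        rw [this]
      simp only [h1]
      rw [h.gaussExp_sum hs _ fun f => (hPΘ ⟨k, f⟩).const_mul _, Finset.mul_sum]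
      refine Finset.sum_congr rfl fun f _ => ?_
      rw [gaussExp_const_mul, hDe]
      ring
  have main' : ∀ f : Fin (k + 1) → Fin N, ∃ t₀ t₁ t₂, HasExp2 (fun s => (∏ i, ⟪u i, e (f i)⟫) *
      (s ^ (k + 1) * gaussExp d ν s (fun z => ∏ i, ⟪z, e (f i)⟫))) t₀ t₁ t₂ := fun f => by
    obtain ⟨_, _, _, h1⟩ := main ⟨⟨k, hk⟩, f⟩
    have h2 := (hasExp2_const ((∏ i, ⟪u i, e (f i)⟫) * ((k + 1 : ℕ).factorial / 2 ^ (k + 1)))).mul h1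
    refine ⟨_, _, _, h2.congr fun s hs => ?_⟩
    rw [hDe]
    simp only [hΘ, mul_pow]
    field_simp
  obtain ⟨_, _, _, h3⟩ := exists_hasExp2_sum Finset.univ fun f _ => main' f
  refine ⟨_, _, _, h3.congr fun s hs => ?_⟩
  simp only [prod_inner_eq_sum e _ u]
  rw [h.gaussExp_sum hs _ fun f => (polyGrowth_prod_inner _).const_mul _, Finset.mul_sum]
  refine Finset.sum_congr rfl fun f _ => ?_
  rw [gaussExp_const_mul]
  ring

end moments

section signs

lemma sum_signs_mul {d : ℕ} (k : Fin d) (F : (Fin d → ℤˣ) → ℝ)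
    (hF : ∀ ε, F (ε * Pi.mulSingle k (-1)) = -F ε) : ∑ ε, F ε = 0 := by
  have h1 := Equiv.sum_comp (Equiv.mulRight (Pi.mulSingle k (-1) : Fin d → ℤˣ)) F
  simp only [Equiv.coe_mulRight, hF, Finset.sum_neg_distrib] at h1
  linarith

variable {E : Type*} [NormedAddCommGroup E] [InnerProductSpace ℝ E]

/-- Sign averaging: a quadratic form dominated by a traceless vector valued form. -/
theorem eq_zero_of_sign_averaging {d : ℕ} {R : ℝ} (hR : 0 ≤ R) (H : Fin d → Fin d → E) (Q : Fin d → Fin d → ℝ)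
    (hsymm : ∀ i j, H i j = H j i)
    (hQH : ∀ c : Fin d → ℝ, |∑ i, ∑ j, c i * c j * Q i j| ≤ R * ‖∑ i, ∑ j, (c i * c j) • H i j‖)
    (hH : ∑ i, H i i = 0) (hQ : ∑ i, Q i i = -4 * R ^ 2) (hHn : ∑ i, ∑ j, ‖H i j‖ ^ 2 = 8 * R ^ 2) : R = 0 := by
  classical
  by_contra hR0
  have hRp : 0 < R := lt_of_le_of_ne hR (Ne.symm hR0)
  obtain ⟨n, hn⟩ : ∃ n : ℝ, n = (Fintype.card (Fin d → ℤˣ) : ℝ) := ⟨_, rfl⟩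
  have hnp : 0 < n := by rw [hn]; exact_mod_cast (Fintype.card_pos (α := Fin d → ℤˣ))
  let σ : (Fin d → ℤˣ) → Fin d → ℝ := fun ε i => ((ε i : ℤ) : ℝ)
  have hσ : ∀ ε i, σ ε i * σ ε i = 1 := fun ε i => by
    simp only [σ]
    rcases Int.units_eq_one_or (ε i) with h | h <;> simp [h]
  have hflip : ∀ ε k i, σ (ε * Pi.mulSingle k (-1)) i = if i = k then -σ ε i else σ ε i := fun ε k i => by
    by_cases hik : i = k
    · subst hik; simp [σ]
    · simp [σ, hik]
  let H' : Fin d → Fin d → E := fun i j => if i = j then 0 else H i j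
  have hH' : ∀ ε, ∑ i, ∑ j, (σ ε i * σ ε j) • H i j = ∑ i, ∑ j, (σ ε i * σ ε j) • H' i j := fun ε => by
    have : ∀ i, ∑ j, (σ ε i * σ ε j) • H i j = H i i + ∑ j, (σ ε i * σ ε j) • H' i j := fun i => by
      rw [← Finset.add_sum_erase _ _ (Finset.mem_univ i), hσ, one_smul]
      rw [← Finset.add_sum_erase Finset.univ (fun j => (σ ε i * σ ε j) • H' i j) (Finset.mem_univ i)]
      simp only [H', if_true, smul_zero, zero_add]
      congr 1
      refine Finset.sum_congr rfl fun j hj => ?_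
      rw [if_neg (Finset.ne_of_mem_erase hj).symm]
    simp only [this]
    rw [Finset.sum_add_distrib, hH, zero_add]
  have hQ2 : ∑ ε, ∑ i, ∑ j, σ ε i * σ ε j * Q i j = n * (-4 * R ^ 2) := by
    rw [Finset.sum_comm, ← hQ, Finset.mul_sum]
    refine Finset.sum_congr rfl fun i _ => ?_
    rw [Finset.sum_comm, Finset.sum_eq_single i]
    · simp [hσ, hn]
    · intro j _ hj
      refine sum_signs_mul j _ fun ε => ?_
      rw [hflip, hflip, if_neg hj.symm, if_pos rfl]
      ring
    · simp
  have hH2 : ∑ ε, ‖∑ i, ∑ j, (σ ε i * σ ε j) • H i j‖ ^ 2 = n * (2 * (8 * R ^ 2 - ∑ i, ‖H i i‖ ^ 2)) := by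
    have hexp : ∀ ε, ‖∑ i, ∑ j, (σ ε i * σ ε j) • H i j‖ ^ 2 =
        ∑ i, ∑ j, ∑ k, ∑ l, σ ε i * σ ε j * (σ ε k * σ ε l) * ⟪H' i j, H' k l⟫ := fun ε => by
      rw [hH', ← real_inner_self_eq_norm_sq]
      simp only [sum_inner, inner_sum, inner_smul_left, inner_smul_right, conj_trivial, Finset.mul_sum]
      refine Finset.sum_congr rfl fun i _ => Finset.sum_congr rfl fun j _ => Finset.sum_congr rfl fun k _ =>
        Finset.sum_congr rfl fun l _ => ?_
      rw [real_inner_comm]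
      ring
    have hij : ∀ i j, ∑ k, ∑ l, ∑ ε, σ ε i * σ ε j * (σ ε k * σ ε l) * ⟪H' i j, H' k l⟫ = n * (2 * ‖H' i j‖ ^ 2) := by
      intro i j
      by_cases hij : i = j
      · simp [H', hij]
      have hz : ∀ k l, (k ≠ i ∨ l ≠ j) → (k ≠ j ∨ l ≠ i) →
          ∑ ε, σ ε i * σ ε j * (σ ε k * σ ε l) * ⟪H' i j, H' k l⟫ = 0 := fun k l h1 h2 => by
        by_cases hkl : k = l
        · simp [H', hkl]
        by_cases hk : k = i ∨ k = j
        · have hli : l ≠ i := by rintro rfl; rcases hk with h | h; exacts [hkl h, h2.elim (fun g => g h) (fun g => g rfl)]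
          have hlj : l ≠ j := by rintro rfl; rcases hk with h | h; exacts [h1.elim (fun g => g h) (fun g => g rfl), hkl h]
          refine sum_signs_mul l _ fun ε => ?_
          simp only [hflip, if_neg hli.symm, if_neg hlj.symm, if_neg hkl, if_true]
          ring
        · rw [not_or] at hk
          refine sum_signs_mul k _ fun ε => ?_
          simp only [hflip, if_neg (Ne.symm hk.1), if_neg (Ne.symm hk.2), if_neg (Ne.symm hkl), if_true]
          ring
      have hterm : ∀ k l, ∑ ε, σ ε i * σ ε j * (σ ε k * σ ε l) * ⟪H' i j, H' k l⟫ =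
          (if k = i then (if l = j then n * ‖H' i j‖ ^ 2 else 0) else 0) +
          (if k = j then (if l = i then n * ‖H' i j‖ ^ 2 else 0) else 0) := fun k l => by
        by_cases h1 : k = i ∧ l = j
        · obtain ⟨rfl, rfl⟩ := h1
          have : ∀ ε, σ ε k * σ ε l * (σ ε k * σ ε l) = 1 := fun ε => by
            rw [mul_mul_mul_comm, hσ, hσ, one_mul]
          simp [this, hij, hn]
        by_cases h2 : k = j ∧ l = i
        · obtain ⟨rfl, rfl⟩ := h2
          have h3 : ∀ ε, σ ε l * σ ε k * (σ ε k * σ ε l) = 1 := fun ε => by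
            rw [mul_comm (σ ε l), mul_mul_mul_comm, hσ, hσ, one_mul]
          have h4 : H' k l = H' l k := by simp only [H', hsymm k l, eq_comm]
          simp [h3, h4, Ne.symm hij, hn]
        rw [hz k l (by tauto) (by tauto)]
        rw [not_and] at h1 h2
        split_ifs <;> simp_all
      simp only [hterm, Finset.sum_add_distrib, Finset.sum_ite_eq', Finset.mem_univ, if_true, Finset.sum_ite_irrel, Finset.sum_const_zero]
      ring
    have hsum : ∑ i, ∑ j, ‖H' i j‖ ^ 2 = 8 * R ^ 2 - ∑ i, ‖H i i‖ ^ 2 := by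
      rw [← hHn, ← Finset.sum_sub_distrib]
      refine Finset.sum_congr rfl fun i _ => ?_
      rw [← Finset.add_sum_erase _ _ (Finset.mem_univ i),
        ← Finset.add_sum_erase Finset.univ (fun j => ‖H i j‖ ^ 2) (Finset.mem_univ i)]
      simp only [H', if_true, norm_zero, ne_eq, OfNat.ofNat_ne_zero, not_false_eq_true, zero_pow, zero_add, add_sub_cancel_left]
      refine Finset.sum_congr rfl fun j hj => ?_
      rw [if_neg (Finset.ne_of_mem_erase hj).symm]
    simp only [hexp]
    rw [Finset.sum_comm]
    have h5 : ∀ i, ∑ ε, ∑ j, ∑ k, ∑ l, σ ε i * σ ε j * (σ ε k * σ ε l) * ⟪H' i j, H' k l⟫ =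
        ∑ j, n * (2 * ‖H' i j‖ ^ 2) := fun i => by
      rw [Finset.sum_comm]
      refine Finset.sum_congr rfl fun j _ => ?_
      rw [← hij, Finset.sum_comm]
      refine Finset.sum_congr rfl fun k _ => ?_
      rw [Finset.sum_comm]
    simp only [h5, ← Finset.mul_sum, hsum]
  -- Cauchy-Schwarz over the signs
  have hcs : (n * (-4 * R ^ 2)) ^ 2 ≤ n * (R ^ 2 * (n * (2 * (8 * R ^ 2 - ∑ i, ‖H i i‖ ^ 2)))) := by
    rw [← hQ2, ← hH2]
    refine (sq_sum_le_card_mul_sum_sq).trans ?_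
    rw [Finset.card_univ, ← hn, Finset.mul_sum (s := Finset.univ) (a := R ^ 2)]
    refine mul_le_mul_of_nonneg_left (Finset.sum_le_sum fun ε _ => ?_) hnp.le
    rw [← sq_abs, ← mul_pow]
    exact pow_le_pow_left₀ (abs_nonneg _) (hQH (σ ε)) 2
  have hD0 : 0 ≤ ∑ i, ‖H i i‖ ^ 2 := Finset.sum_nonneg fun i _ => sq_nonneg _
  have hD : ∑ i, ‖H i i‖ ^ 2 = 0 := by
    have h6 : n ^ 2 * (R ^ 2 * ∑ i, ‖H i i‖ ^ 2) ≤ 0 := by nlinarith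
    have h7 : 0 < n ^ 2 * R ^ 2 := by positivity
    nlinarith
  rw [Finset.sum_eq_zero_iff_of_nonneg fun i _ => sq_nonneg _] at hD
  have hQii : ∀ i, Q i i = 0 := fun i => by
    have h8 := hQH (Pi.single i 1)
    simp only [Pi.single_apply, ite_mul, mul_ite, one_mul, zero_mul, mul_one, mul_zero, Finset.sum_ite_eq', Finset.mem_univ, if_true,
      ite_smul, one_smul, zero_smul, Finset.sum_ite_irrel, Finset.sum_const_zero] at h8
    have h9 : ‖H i i‖ = 0 := by simpa using hD i (Finset.mem_univ i)
    rw [h9, mul_zero] at h8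
    exact abs_nonpos_iff.1 h8
  simp only [hQii, Finset.sum_const_zero] at hQ
  nlinarith

end signs

section momentLimits

variable {E : Type*} [NormedAddCommGroup E] [InnerProductSpace ℝ E] [FiniteDimensional ℝ E]
  [MeasurableSpace E] [BorelSpace E] {d : ℕ} {ν : Measure E} {S : Set E}

lemma HasExp2.tendsto_sub_div {f : ℝ → ℝ} {a b c β : ℝ} (hf : HasExp2 f a b c)
    (hβ : Tendsto (fun s => f s / s) (𝓝[>] 0) (𝓝 β)) : Tendsto (fun s => (f s - β * s) / s ^ 2) (𝓝[>] 0) (𝓝 c) := by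
  obtain ⟨g, hg, hfg⟩ := hasExp2_iff.1 hf
  have h0 := tendsto_id_nhdsGT
  have ha : a = 0 := by
    have h1 : Tendsto (fun s => a + b * s + s ^ 2 * g s) (𝓝[>] 0) (𝓝 a) := by
      simpa using ((h0.const_mul b).const_add a).add ((h0.pow 2).mul hg)
    have h2 : Tendsto (fun s => a + b * s + s ^ 2 * g s) (𝓝[>] 0) (𝓝 0) := by
      have := h0.mul hβ
      rw [zero_mul] at this
      refine this.congr' ?_
      filter_upwards [self_mem_nhdsWithin] with s hs
      rw [← hfg s hs, mul_div_cancel₀ _ (ne_of_gt hs)]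
    exact tendsto_nhds_unique h1 h2
  subst ha
  have hb : b = β := by
    have h1 : Tendsto (fun s => b + s * g s) (𝓝[>] 0) (𝓝 b) := by simpa using (h0.mul hg).const_add b
    refine tendsto_nhds_unique (h1.congr' ?_) hβ
    filter_upwards [self_mem_nhdsWithin] with s hs
    have : (s : ℝ) ≠ 0 := ne_of_gt hs
    rw [hfg s hs]
    field_simp
    ring
  subst hb
  refine hg.congr' ?_
  filter_upwards [self_mem_nhdsWithin] with s hs
  have : (s : ℝ) ≠ 0 := ne_of_gt hs
  rw [hfg s hs]
  field_simp
  ring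

/-- Moments of degree `k` are of order `s ^ (-k / 2)`. -/
lemma Unif.tendsto_gaussExp_zero (h : Unif d ν S) {f : E → ℝ} (hf : PolyGrowth f) {K : ℝ} {k m : ℕ}
    (hkm : k < 2 * m) (hb : ∀ z ∈ S, |f z| ≤ K * ‖z‖ ^ k) :
    Tendsto (fun s => s ^ m * gaussExp d ν s f) (𝓝[>] 0) (𝓝 0) := by
  obtain ⟨C, hC, hCb⟩ := exists_gaussExp_bound (E := E) d k
  have hb' : ∀ z ∈ S, |f z| ≤ |K| * ‖z‖ ^ k := fun z hz =>
    (hb z hz).trans (mul_le_mul_of_nonneg_right (le_abs_self K) (by positivity))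
  have h1 : Tendsto (fun s : ℝ => |K| * C * √s) (𝓝[>] 0) (𝓝 0) := by simpa using tendsto_sqrt_nhdsGT.const_mul (|K| * C)
  refine squeeze_zero_norm' ?_ h1
  filter_upwards [Ioc_mem_nhdsGT (zero_lt_one : (0 : ℝ) < 1)] with s hs
  have hs0 : 0 < s := hs.1
  have hq : 0 ≤ √s := Real.sqrt_nonneg s
  have hq1 : √s ≤ 1 := by rw [← Real.sqrt_one]; exact Real.sqrt_le_sqrt hs.2
  have h2 := hCb ν S h s hs.1 f hf |K| (abs_nonneg K) hb'
  obtain ⟨j, hj⟩ : ∃ j, 2 * m = k + (j + 1) := ⟨2 * m - k - 1, by omega⟩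
  have h3 : s ^ m = √s ^ k * (√s ^ j * √s) := by
    rw [← pow_succ, ← pow_add, ← hj, pow_mul, Real.sq_sqrt hs0.le]
  have h4 : √s ^ j ≤ 1 := pow_le_one₀ hq hq1
  rw [norm_mul, Real.norm_eq_abs, Real.norm_eq_abs, abs_of_pos (by positivity), h3]
  calc √s ^ k * (√s ^ j * √s) * |gaussExp d ν s f| = |gaussExp d ν s f| * √s ^ k * (√s ^ j * √s) := by ring
    _ ≤ (|K| * C) * (1 * √s) := by gcongr
    _ = _ := by ring

lemma gaussExp_inner (h : Unif d ν S) {s : ℝ} (hs : 0 < s) (u : E) :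
    gaussExp d ν s (fun z => ⟪z, u⟫) = ⟪gaussMean d ν s, u⟫ := by
  rw [h.inner_gaussMean hs, gaussExp]

lemma gaussExp_inner_inner (h : Unif d ν S) {s : ℝ} (hs : 0 < s) (u v : E) :
    2 * s * gaussExp d ν s (fun z => ⟪z, u⟫ * ⟪z, v⟫) = ⟪gaussOp d ν s u, v⟫ := by
  rw [h.inner_gaussOp hs, gaussExp]
  ring

lemma Unif.gaussExp_prod (h : Unif d ν S) {s : ℝ} (hs : 0 < s) {N k : ℕ} (e : OrthonormalBasis (Fin N) ℝ E)
    (u : Fin k → E) : gaussExp d ν s (fun z => ∏ i, ⟪z, u i⟫) =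
      ∑ f : Fin k → Fin N, (∏ i, ⟪u i, e (f i)⟫) * gaussExp d ν s (fun z => ∏ i, ⟪z, e (f i)⟫) := by
  simp only [prod_inner_eq_sum e _ u]
  rw [h.gaussExp_sum hs _ fun f => (polyGrowth_prod_inner _).const_mul _]
  simp only [gaussExp_const_mul]

/-- The first order term of the first moment. -/
lemma Unif.exists_limit_one (h : Unif d ν S) {b : E} (hb : Tendsto (gaussMean d ν) (𝓝[>] 0) (𝓝 b)) :
    ∃ τ : E → ℝ, ∃ C, 0 ≤ C ∧ (∀ u, |τ u| ≤ C * ‖u‖) ∧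
      ∀ u, Tendsto (fun s => (gaussExp d ν s (fun z => ⟪z, u⟫) - ⟪b, u⟫) / s) (𝓝[>] 0) (𝓝 (τ u)) := by
  have h1 : ∀ u : E, ∃ t, Tendsto (fun s => (gaussExp d ν s (fun z => ⟪z, u⟫) - ⟪b, u⟫) / s) (𝓝[>] 0) (𝓝 t) := fun u => by
    obtain ⟨_, _, t, ht⟩ := h.exists_hasExp2_moment (by norm_num : 0 < 4) (fun _ => u)
    have h2 : Tendsto (fun s => s ^ (0 + 1) * gaussExp d ν s (fun z => ∏ i : Fin (0 + 1), ⟪z, u⟫) / s) (𝓝[>] 0) (𝓝 ⟪b, u⟫) := by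
      refine (hb.inner tendsto_const_nhds).congr' ?_
      filter_upwards [self_mem_nhdsWithin] with s hs
      have : (s : ℝ) ≠ 0 := ne_of_gt hs
      rw [← gaussExp_inner h hs]
      simp
      field_simp
    refine ⟨t, (ht.tendsto_sub_div h2).congr' ?_⟩
    filter_upwards [self_mem_nhdsWithin] with s hs
    have : (s : ℝ) ≠ 0 := ne_of_gt hs
    simp
    field_simp
  set e := stdOrthonormalBasis ℝ E
  choose t ht using fun k => h1 (e k)
  refine ⟨fun u => ∑ k, ⟪u, e k⟫ * t k, ∑ k, |t k|, by positivity, fun u => ?_, fun u => ?_⟩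
  · refine (Finset.abs_sum_le_sum_abs _ _).trans ?_
    rw [Finset.sum_mul]
    refine Finset.sum_le_sum fun k _ => ?_
    rw [abs_mul, mul_comm]
    gcongr
    simpa using abs_real_inner_le_norm u (e k)
  · refine (tendsto_finset_sum Finset.univ fun k _ => (ht k).const_mul ⟪u, e k⟫).congr' ?_
    filter_upwards [self_mem_nhdsWithin] with s hs
    simp only [gaussExp_inner h hs, ← inner_sub_left]
    conv_rhs => rw [← e.sum_inner_mul_inner]
    rw [Finset.sum_div]
    refine Finset.sum_congr rfl fun k _ => ?_
    rw [real_inner_comm u]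
    ring

/-- The constant term of the second moment. -/
lemma Unif.exists_limit_two (h : Unif d ν S) {P : E →L[ℝ] E} (hP : Tendsto (gaussOp d ν) (𝓝[>] 0) (𝓝 P)) :
    ∃ τ : E → E → ℝ, ∃ C, 0 ≤ C ∧ (∀ u v, |τ u v| ≤ C * (‖u‖ * ‖v‖)) ∧
      ∀ u v, Tendsto (fun s => gaussExp d ν s (fun z => ⟪z, u⟫ * ⟪z, v⟫) - ⟪P u, v⟫ / (2 * s)) (𝓝[>] 0) (𝓝 (τ u v)) := by
  have h1 : ∀ u v : E, ∃ t, Tendsto (fun s => gaussExp d ν s (fun z => ⟪z, u⟫ * ⟪z, v⟫) - ⟪P u, v⟫ / (2 * s)) (𝓝[>] 0)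
      (𝓝 t) := fun u v => by
    obtain ⟨_, _, t, ht⟩ := h.exists_hasExp2_moment (by norm_num : 1 < 4) ![u, v]
    have h2 : Tendsto (fun s => s ^ (1 + 1) * gaussExp d ν s (fun z => ∏ i : Fin (1 + 1), ⟪z, ![u, v] i⟫) / s) (𝓝[>] 0)
        (𝓝 (⟪P u, v⟫ / 2)) := by
      have h3 : Tendsto (fun s => ⟪gaussOp d ν s u, v⟫ / 2) (𝓝[>] 0) (𝓝 (⟪P u, v⟫ / 2)) :=
        (((((ContinuousLinearMap.apply ℝ E u).continuous.tendsto P).comp hP).inner tendsto_const_nhds).div_const 2)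
      refine h3.congr' ?_
      filter_upwards [self_mem_nhdsWithin] with s hs
      have : (s : ℝ) ≠ 0 := ne_of_gt hs
      rw [← gaussExp_inner_inner h hs]
      simp [Fin.prod_univ_two]
      field_simp
    refine ⟨t, (ht.tendsto_sub_div h2).congr' ?_⟩
    filter_upwards [self_mem_nhdsWithin] with s hs
    have : (s : ℝ) ≠ 0 := ne_of_gt hs
    simp [Fin.prod_univ_two]
    field_simp
  set e := stdOrthonormalBasis ℝ E
  choose t ht using fun k l => h1 (e k) (e l)
  refine ⟨fun u v => ∑ k, ∑ l, ⟪u, e k⟫ * ⟪v, e l⟫ * t k l, ∑ k, ∑ l, |t k l|, by positivity, fun u v => ?_, fun u v => ?_⟩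
  · refine (Finset.abs_sum_le_sum_abs _ _).trans ?_
    rw [Finset.sum_mul]
    refine Finset.sum_le_sum fun k _ => (Finset.abs_sum_le_sum_abs _ _).trans ?_
    rw [Finset.sum_mul]
    refine Finset.sum_le_sum fun l _ => ?_
    rw [abs_mul, abs_mul, mul_comm]
    gcongr
    · simpa using abs_real_inner_le_norm u (e k)
    · simpa using abs_real_inner_le_norm v (e l)
  · refine (tendsto_finset_sum Finset.univ fun k _ => tendsto_finset_sum Finset.univ fun l _ =>
      (ht k l).const_mul (⟪u, e k⟫ * ⟪v, e l⟫)).congr' ?_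
    filter_upwards [self_mem_nhdsWithin] with s hs
    have hs0 : (s : ℝ) ≠ 0 := ne_of_gt hs
    set A : E →L[ℝ] E := (2 * s)⁻¹ • (gaussOp d ν s - P) with hA
    have h4 : ∀ u v : E, gaussExp d ν s (fun z => ⟪z, u⟫ * ⟪z, v⟫) - ⟪P u, v⟫ / (2 * s) = ⟪A u, v⟫ := fun u v => by
      rw [hA, ContinuousLinearMap.smul_apply, ContinuousLinearMap.sub_apply, inner_smul_left, inner_sub_left,
        ← gaussExp_inner_inner h hs]
      simp only [conj_trivial]
      field_simp
    simp only [h4]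
    have h5 : ⟪A u, v⟫ = ∑ k, ⟪u, e k⟫ * ⟪A (e k), v⟫ := by
      conv_lhs => rw [← e.sum_repr' u, map_sum, sum_inner]
      refine Finset.sum_congr rfl fun k _ => ?_
      rw [map_smul, inner_smul_left, real_inner_comm u]
      simp
    rw [h5]
    refine Finset.sum_congr rfl fun k _ => ?_
    rw [← e.sum_inner_mul_inner (A (e k)) v, Finset.mul_sum]
    refine Finset.sum_congr rfl fun l _ => ?_
    rw [real_inner_comm v]
    ring

lemma Unif.exists_limit_prod (h : Unif d ν S) {k : ℕ} (hk : 2 ≤ k) (hk4 : k < 4) :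
    ∃ τ : (Fin (k + 1) → E) → ℝ, Continuous (fun x : E => τ (fun _ => x)) ∧
      (∃ C, 0 ≤ C ∧ ∀ u, |τ u| ≤ C * ∏ i, ‖u i‖) ∧
      ∀ u, Tendsto (fun s => s ^ (k - 1) * gaussExp d ν s (fun z => ∏ i, ⟪z, u i⟫)) (𝓝[>] 0) (𝓝 (τ u)) := by
  have h1 : ∀ u : Fin (k + 1) → E, ∃ t,
      Tendsto (fun s => s ^ (k - 1) * gaussExp d ν s (fun z => ∏ i, ⟪z, u i⟫)) (𝓝[>] 0) (𝓝 t) := fun u => by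
    obtain ⟨_, _, t, ht⟩ := h.exists_hasExp2_moment hk4 u
    have h2 : Tendsto (fun s => s ^ (k + 1) * gaussExp d ν s (fun z => ∏ i, ⟪z, u i⟫) / s) (𝓝[>] 0) (𝓝 0) := by
      refine (h.tendsto_gaussExp_zero (polyGrowth_prod_inner u) (K := ∏ i, ‖u i‖) (k := k + 1) (m := k) (by omega)
        fun z _ => ?_).congr' ?_
      · rw [Finset.abs_prod]
        calc _ ≤ ∏ i, (‖u i‖ * ‖z‖) := Finset.prod_le_prod (fun _ _ => abs_nonneg _) fun i _ => by
              rw [mul_comm]; exact abs_real_inner_le_norm _ _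
          _ = _ := by rw [Finset.prod_mul_distrib]; simp
      · filter_upwards [self_mem_nhdsWithin] with s hs
        have : (s : ℝ) ≠ 0 := ne_of_gt hs
        rw [pow_succ]
        field_simp
    refine ⟨t, (ht.tendsto_sub_div h2).congr' ?_⟩
    filter_upwards [self_mem_nhdsWithin] with s hs
    have : (s : ℝ) ≠ 0 := ne_of_gt hs
    obtain ⟨m, rfl⟩ : ∃ m, k = m + 1 := ⟨k - 1, by omega⟩
    rw [add_tsub_cancel_right, zero_mul, sub_zero, pow_add _ _ 1, pow_add]
    field_simp
  set e := stdOrthonormalBasis ℝ E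
  choose t ht using fun f : Fin (k + 1) → Fin (Module.finrank ℝ E) => h1 (fun i => e (f i))
  refine ⟨fun u => ∑ f, (∏ i, ⟪u i, e (f i)⟫) * t f, by fun_prop,
    ⟨∑ f, |t f|, by positivity, fun u => ?_⟩, fun u => ?_⟩
  · refine (Finset.abs_sum_le_sum_abs _ _).trans ?_
    rw [Finset.sum_mul]
    refine Finset.sum_le_sum fun f _ => ?_
    rw [abs_mul, mul_comm, Finset.abs_prod]
    gcongr with i
    simpa using abs_real_inner_le_norm (u i) (e (f i))
  refine (tendsto_finset_sum Finset.univ fun f _ => (ht f).const_mul (∏ i, ⟪u i, e (f i)⟫)).congr' ?_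
  filter_upwards [self_mem_nhdsWithin] with s hs
  rw [h.gaussExp_prod hs e u, Finset.mul_sum]
  exact Finset.sum_congr rfl fun f _ => by ring

lemma Unif.hasDerivAt_integral_gauss (h : Unif d ν S) {f : E → ℝ} (hf : PolyGrowth f) {s : ℝ} (hs : 0 < s) :
    HasDerivAt (fun s => ∫ z, Real.exp (-s * ‖z‖ ^ 2) * f z ∂ν)
      (-∫ z, Real.exp (-s * ‖z‖ ^ 2) * (‖z‖ ^ 2 * f z) ∂ν) s := by
  have hf2 : PolyGrowth (fun z => ‖z‖ ^ 2 * f z) := (PolyGrowth.norm.pow 2).mul hf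
  rw [← integral_neg]
  refine (hasDerivAt_integral_of_dominated_loc_of_deriv_le (F' := fun t z => -(Real.exp (-t * ‖z‖ ^ 2) * (‖z‖ ^ 2 * f z)))
    (bound := fun z => ‖Real.exp (-(s / 2) * ‖z‖ ^ 2) * (‖z‖ ^ 2 * f z)‖) (Ioi_mem_nhds (half_lt_self hs)) ?_ ?_ ?_ ?_ ?_ ?_).2
  · filter_upwards [lt_mem_nhds hs] with t ht using (h.integrable_polyGrowth ht hf).aestronglyMeasurable
  · exact h.integrable_polyGrowth hs hf
  · exact (h.integrable_polyGrowth hs hf2).aestronglyMeasurable.neg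
  · refine Eventually.of_forall fun z t ht => ?_
    simp only [norm_neg, norm_mul]
    refine mul_le_mul_of_nonneg_right ?_ (by positivity)
    rw [Real.norm_of_nonneg (Real.exp_pos _).le, Real.norm_of_nonneg (Real.exp_pos _).le]
    apply Real.exp_le_exp.2
    have : s / 2 < t := ht
    nlinarith [sq_nonneg ‖z‖]
  · exact (h.integrable_polyGrowth (half_pos hs) hf2).norm
  · refine Eventually.of_forall fun z t _ => ?_
    have h1 : HasDerivAt (fun t : ℝ => -t * ‖z‖ ^ 2) (-1 * ‖z‖ ^ 2) t := (hasDerivAt_neg t).mul_const _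
    exact (h1.exp.mul_const (f z)).congr_deriv (by ring)

lemma eq_zero_of_tendsto_mul_deriv {g g' : ℝ → ℝ} {a c : ℝ} (hg : Tendsto g (𝓝[>] 0) (𝓝 a))
    (hd : ∀ s > 0, HasDerivAt g (g' s) s) (hc : Tendsto (fun s => s * g' s) (𝓝[>] 0) (𝓝 c)) : c = 0 := by
  have h2 : Tendsto (fun s : ℝ => 2 * s) (𝓝[>] 0) (𝓝[>] 0) := by
    refine tendsto_nhdsWithin_iff.2 ⟨by simpa using tendsto_id_nhdsGT.const_mul 2, ?_⟩
    filter_upwards [self_mem_nhdsWithin] with s hs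
    exact mul_pos two_pos (mem_Ioi.1 hs)
  have h1 : ∀ s > 0, ∃ t ∈ Ioo s (2 * s), s * g' t = g (2 * s) - g s := fun s hs => by
    obtain ⟨t, ht, h⟩ := exists_hasDerivAt_eq_slope g g' (by linarith : s < 2 * s)
      (fun t ht => (hd t (hs.trans_le ht.1)).continuousAt.continuousWithinAt) fun t ht => hd t (hs.trans ht.1)
    refine ⟨t, ht, ?_⟩
    rw [h]
    field_simp
    ring
  choose! t ht hgt using h1
  have ht0 : Tendsto t (𝓝[>] 0) (𝓝[>] 0) := by
    refine tendsto_nhdsWithin_iff.2 ⟨?_, ?_⟩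
    · refine tendsto_of_tendsto_of_tendsto_of_le_of_le' tendsto_id_nhdsGT (h2.mono_right nhdsWithin_le_nhds) ?_ ?_
      · filter_upwards [self_mem_nhdsWithin] with s hs using (ht s hs).1.le
      · filter_upwards [self_mem_nhdsWithin] with s hs using (ht s hs).2.le
    · filter_upwards [self_mem_nhdsWithin] with s hs
      exact lt_trans hs (ht s hs).1
  have h3 : Tendsto (fun s => g (2 * s) - g s) (𝓝[>] 0) (𝓝 0) := by
    simpa using (hg.comp h2).sub hg
  have h4 : Tendsto (fun s => |t s * g' (t s)|) (𝓝[>] 0) (𝓝 |c|) := (hc.comp ht0).abs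
  have h5 : Tendsto (fun s => 2 * |g (2 * s) - g s|) (𝓝[>] 0) (𝓝 0) := by simpa using h3.abs.const_mul 2
  have h6 : |c| ≤ 0 := by
    refine le_of_tendsto_of_tendsto h4 h5 ?_
    filter_upwards [self_mem_nhdsWithin] with s hs
    have hs0 : 0 < s := hs
    have := ht s hs
    rw [← hgt s hs, abs_mul, abs_mul, abs_of_pos hs0, abs_of_pos (hs0.trans this.1)]
    nlinarith [abs_nonneg (g' (t s)), this.2]
  exact abs_nonpos_iff.1 h6

lemma Unif.limit_norm_sq_inner (h : Unif d ν S) {b u : E} (hb : Tendsto (gaussMean d ν) (𝓝[>] 0) (𝓝 b)) {c : ℝ}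
    (hc : Tendsto (fun s => s * gaussExp d ν s (fun z => ‖z‖ ^ 2 * ⟪z, u⟫)) (𝓝[>] 0) (𝓝 c)) : c = d / 2 * ⟪b, u⟫ := by
  have hg : Tendsto (fun s => gaussExp d ν s (fun z => ⟪z, u⟫)) (𝓝[>] 0) (𝓝 ⟪b, u⟫) := by
    refine (hb.inner tendsto_const_nhds).congr' ?_
    filter_upwards [self_mem_nhdsWithin] with s hs
    rw [← gaussExp_inner h hs]
  have hd : ∀ s > 0, HasDerivAt (fun s => gaussExp d ν s (fun z => ⟪z, u⟫))
      (d / (2 * s) * gaussExp d ν s (fun z => ⟪z, u⟫) - gaussExp d ν s (fun z => ‖z‖ ^ 2 * ⟪z, u⟫)) s := fun s hs => by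
    have hM := gaussMass_pos d hs
    refine (((hasDerivAt_gaussMass d hs).inv hM.ne').mul
      (h.hasDerivAt_integral_gauss (PolyGrowth.inner u) hs)).congr_deriv ?_
    simp only [gaussExp, Pi.inv_apply]
    field_simp
    ring
  have h1 := eq_zero_of_tendsto_mul_deriv (c := d / 2 * ⟪b, u⟫ - c) hg hd ?_
  · linarith
  · refine ((hg.const_mul (d / 2 : ℝ)).sub hc).congr' ?_
    filter_upwards [self_mem_nhdsWithin] with s hs
    have : (s : ℝ) ≠ 0 := ne_of_gt hs
    field_simp

end momentLimits

section boundedHeight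

variable {E : Type*} [NormedAddCommGroup E] [InnerProductSpace ℝ E] [FiniteDimensional ℝ E]
  [MeasurableSpace E] [BorelSpace E] {d : ℕ} {ν : Measure E} {S : Set E}

/-- The quadric structure of a flat uniform measure. -/
structure QuadricData (d : ℕ) (ν : Measure E) (S : Set E) (V : Submodule ℝ E) (b : E) : Prop where
  unif : Unif d ν S
  finrank : Module.finrank ℝ V = d
  mem_orth : b ∈ Vᗮ
  quadric : ∀ x ∈ S, ‖x - V.starProjection x‖ ^ 2 = 2 * ⟪b, x⟫
  mean : Tendsto (gaussMean d ν) (𝓝[>] 0) (𝓝 b)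
  op : Tendsto (gaussOp d ν) (𝓝[>] 0) (𝓝 V.starProjection)
  exists_seq : ∀ v ∈ V, ∃ x : ℕ → E, (∀ i : ℕ, (i + 1 : ℝ) • x i ∈ S) ∧ Tendsto x (hyperfilter ℕ) (𝓝 v)

variable {V : Submodule ℝ E} {b : E}

lemma starProjection_sub_self (V : Submodule ℝ E) (z : E) : V.starProjection (z - V.starProjection z) = 0 := by
  rw [map_sub, V.starProjection_eq_self_iff.2 (V.starProjection_apply_mem z), sub_self]

lemma inner_starProjection_right (V : Submodule ℝ E) (z u : E) : ⟪V.starProjection z, u⟫ = ⟪z, V.starProjection u⟫ :=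
  V.inner_starProjection_left_eq_right z u

namespace QuadricData

lemma inner_proj (h : QuadricData d ν S V b) (z : E) : ⟪b, V.starProjection z⟫ = 0 :=
  Submodule.inner_left_of_mem_orthogonal (V.starProjection_apply_mem z) h.mem_orth

lemma norm_height_sub (h : QuadricData d ν S V b) {z : E} (hz : z ∈ S) : ‖z - V.starProjection z - b‖ = ‖b‖ := by
  have h1 := h.quadric z hz
  have h2 := norm_sub_sq_real (z - V.starProjection z) b
  rw [inner_sub_left, real_inner_comm b z, real_inner_comm b (V.starProjection z), h.inner_proj, h1] at h2
  have h3 : ‖z - V.starProjection z - b‖ ^ 2 = ‖b‖ ^ 2 := by linarith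
  exact (sq_eq_sq₀ (norm_nonneg _) (norm_nonneg _)).1 h3

lemma norm_height_le (h : QuadricData d ν S V b) {z : E} (hz : z ∈ S) : ‖z - V.starProjection z‖ ≤ 2 * ‖b‖ := by
  have := norm_add_le (z - V.starProjection z - b) b
  rw [h.norm_height_sub hz, sub_add_cancel] at this
  linarith

lemma abs_inner_height_le (h : QuadricData d ν S V b) {z : E} (hz : z ∈ S) (x : E) :
    |⟪z, x - V.starProjection x⟫| ≤ 2 * ‖b‖ * ‖x - V.starProjection x‖ := by
  have h1 : ⟪z, x - V.starProjection x⟫ = ⟪z - V.starProjection z, x - V.starProjection x⟫ := by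
    rw [inner_sub_left z, inner_starProjection_right, starProjection_sub_self, inner_zero_right, sub_zero]
  rw [h1]
  exact (abs_real_inner_le_norm _ _).trans (mul_le_mul_of_nonneg_right (h.norm_height_le hz) (norm_nonneg _))

lemma norm_sq_eq (h : QuadricData d ν S V b) {x : E} (hx : x ∈ S) :
    ‖x‖ ^ 2 = ⟪V.starProjection x, x⟫ + 2 * ⟪b, x⟫ := by
  rw [← h.quadric x hx, ← real_inner_self_eq_norm_sq, ← real_inner_self_eq_norm_sq, inner_sub_left, inner_sub_right,
    inner_sub_right, ← inner_starProjection_right V (V.starProjection x) x,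
    V.starProjection_eq_self_iff.2 (V.starProjection_apply_mem x)]
  have := real_inner_comm x (V.starProjection x)
  linarith

lemma norm_sq_proj (V : Submodule ℝ E) (x : E) : ‖x‖ ^ 2 = ‖V.starProjection x‖ ^ 2 + ‖x - V.starProjection x‖ ^ 2 := by
  have h1 : ⟪V.starProjection x, x - V.starProjection x⟫ = 0 := by
    rw [inner_starProjection_right, starProjection_sub_self, inner_zero_right]
  have h2 := norm_add_sq_eq_norm_sq_add_norm_sq_of_inner_eq_zero _ _ h1
  rw [add_sub_cancel] at h2
  nlinarith

/-- A homogeneous function which on `S` is of lower order vanishes on `V`. -/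
lemma eq_zero_of_homogeneous (h : QuadricData d ν S V b) {F : E → ℝ} (hF : Continuous F) {k : ℕ}
    (hom : ∀ t > 0, ∀ x, F (t • x) = t ^ (k + 1) * F x) {C : ℝ} (hC : ∀ x ∈ S, |F x| ≤ C * (1 + ‖x‖) ^ k) {e : E}
    (he : e ∈ V) : F e = 0 := by
  obtain ⟨x, hx, hxe⟩ := h.exists_seq e he
  have hC0 : 0 ≤ C := by
    have := (abs_nonneg _).trans (hC 0 h.unif.zero_mem)
    simpa using this
  have h1 : Tendsto (fun i => |F (x i)|) (hyperfilter ℕ) (𝓝 |F e|) := ((hF.tendsto e).comp hxe).abs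
  have h2 : Tendsto (fun i : ℕ => C * (1 + ‖x i‖) ^ k * (1 / ((i : ℝ) + 1))) (hyperfilter ℕ) (𝓝 (C * (1 + ‖e‖) ^ k * 0)) :=
    (((hxe.norm.const_add 1).pow k).const_mul C).mul
      (tendsto_one_div_add_atTop_nhds_zero_nat.mono_left Nat.hyperfilter_le_atTop)
  rw [mul_zero] at h2
  refine abs_nonpos_iff.1 (le_of_tendsto_of_tendsto h1 h2 (Eventually.of_forall fun i => ?_))
  have hi : (0 : ℝ) < i + 1 := by positivity
  have h3 := hC _ (hx i)
  rw [hom _ hi, abs_mul, abs_of_pos (by positivity), norm_smul, Real.norm_of_nonneg hi.le] at h3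
  have h4 : (1 + ((i : ℝ) + 1) * ‖x i‖) ^ k ≤ (((i : ℝ) + 1) * (1 + ‖x i‖)) ^ k := by
    gcongr
    nlinarith [norm_nonneg (x i), (Nat.cast_nonneg i : (0 : ℝ) ≤ i)]
  dsimp only
  rw [mul_one_div, le_div_iff₀ hi]
  have h5 : ((i : ℝ) + 1) ^ (k + 1) * |F (x i)| ≤ C * (((i : ℝ) + 1) * (1 + ‖x i‖)) ^ k := h3.trans (by gcongr)
  rw [mul_pow, pow_succ] at h5
  have h6 : (0 : ℝ) < ((i : ℝ) + 1) ^ k := by positivity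
  refine le_of_mul_le_mul_left ?_ h6
  linarith

end QuadricData

lemma Unif.tendsto_gaussExp_zero_of_le (h : Unif d ν S) {f : E → ℝ} (hf : PolyGrowth f) {K : ℝ}
    (hb : ∀ z ∈ S, |f z| ≤ K * (1 + ‖z‖)) : Tendsto (fun s => s * gaussExp d ν s f) (𝓝[>] 0) (𝓝 0) := by
  have h1 := h.tendsto_gaussExp_zero (PolyGrowth.const K) (K := |K|) (k := 0) (m := 1) (by norm_num) (by simp)
  have h2 := h.tendsto_gaussExp_zero (PolyGrowth.norm.const_mul K) (K := |K|) (k := 1) (m := 1) (by norm_num)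
    (by simp [abs_mul])
  have h3 := h1.add h2
  rw [add_zero] at h3
  refine squeeze_zero_norm' ?_ h3
  filter_upwards [self_mem_nhdsWithin] with s hs
  have hs0 : (0 : ℝ) < s := hs
  have h4 := h.abs_gaussExp_le hs hf ((PolyGrowth.const K).add (PolyGrowth.norm.const_mul K))
    (fun z hz => (hb z hz).trans_eq (by ring))
  rw [h.gaussExp_add hs (PolyGrowth.const K) (PolyGrowth.norm.const_mul K)] at h4
  rw [norm_mul, Real.norm_of_nonneg hs0.le, Real.norm_eq_abs, pow_one, ← mul_add]
  exact mul_le_mul_of_nonneg_left h4 hs0.le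

/-- The constant term of the moment relation. -/
lemma QuadricData.moment_relation (h : QuadricData d ν S V b) {τ₁ : E → ℝ} {τ₂ : E → E → ℝ}
    {τ₃ : (Fin 3 → E) → ℝ} {τ₄ : (Fin 4 → E) → ℝ}
    (h₁ : ∀ u, Tendsto (fun s => (gaussExp d ν s (fun z => ⟪z, u⟫) - ⟪b, u⟫) / s) (𝓝[>] 0) (𝓝 (τ₁ u)))
    (h₂ : ∀ u v, Tendsto (fun s => gaussExp d ν s (fun z => ⟪z, u⟫ * ⟪z, v⟫) - ⟪V.starProjection u, v⟫ / (2 * s))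
      (𝓝[>] 0) (𝓝 (τ₂ u v)))
    (h₃ : ∀ u, Tendsto (fun s => s ^ 1 * gaussExp d ν s (fun z => ∏ i, ⟪z, u i⟫)) (𝓝[>] 0) (𝓝 (τ₃ u)))
    (h₄ : ∀ u, Tendsto (fun s => s ^ 2 * gaussExp d ν s (fun z => ∏ i, ⟪z, u i⟫)) (𝓝[>] 0) (𝓝 (τ₄ u)))
    {x : E} (hx : x ∈ S) :
    2 * τ₁ x + 2 * τ₂ x x + 4 / 3 * τ₃ (fun _ => x) + 2 / 3 * τ₄ (fun _ => x) = ‖x‖ ^ 4 / 2 := by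
  refine tendsto_nhds_unique (((((h₁ x).const_mul 2).add ((h₂ x x).const_mul 2)).add ((h₃ fun _ => x).const_mul (4 / 3))).add
    ((h₄ fun _ => x).const_mul (2 / 3))) ((h.unif.hasExp2_moments hx).congr' ?_)
  filter_upwards [self_mem_nhdsWithin] with s hs
  have hs0 : s ≠ 0 := ne_of_gt hs
  rw [Fin.sum_univ_four, h.norm_sq_eq hx]
  have e : ∀ z : E, ⟪z, x⟫ * ⟪z, x⟫ = ⟪z, x⟫ ^ 2 := fun z => by ring
  simp only [Finset.prod_const, Finset.card_univ, Fintype.card_fin, e]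
  simp [Nat.factorial]
  field_simp
  ring

end boundedHeight

section boundedHeight

variable {E : Type*} [NormedAddCommGroup E] [InnerProductSpace ℝ E] [FiniteDimensional ℝ E]
  [MeasurableSpace E] [BorelSpace E] {d : ℕ} {ν : Measure E} {S : Set E} {V : Submodule ℝ E} {b : E}

namespace QuadricData

/-- The moment relation after separating the orders of magnitude at infinity. -/
lemma exists_reduced_relation (h : QuadricData d ν S V b) :
    ∃ (τ₂ : E → E → ℝ) (τ₃ : (Fin 3 → E) → ℝ) (C : ℝ), 0 ≤ C ∧ (∀ u v, |τ₂ u v| ≤ C * (‖u‖ * ‖v‖)) ∧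
      (∀ u v, Tendsto (fun s => gaussExp d ν s (fun z => ⟪z, u⟫ * ⟪z, v⟫) - ⟪V.starProjection u, v⟫ / (2 * s))
        (𝓝[>] 0) (𝓝 (τ₂ u v))) ∧
      (∀ u, Tendsto (fun s => s ^ 1 * gaussExp d ν s (fun z => ∏ i, ⟪z, u i⟫)) (𝓝[>] 0) (𝓝 (τ₃ u))) ∧
      ∀ x ∈ S, |2 * τ₂ x x + 4 * τ₃ ![V.starProjection x, V.starProjection x, x - V.starProjection x] -
        ‖V.starProjection x‖ ^ 2 * ‖x - V.starProjection x‖ ^ 2| ≤ C * (1 + ‖x‖) := by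
  obtain ⟨τ₁, C₁, hC₁, hb₁, h₁⟩ := h.unif.exists_limit_one h.mean
  obtain ⟨τ₂, C₂, hC₂, hb₂, h₂⟩ := h.unif.exists_limit_two h.op
  obtain ⟨τ₃, hc₃, ⟨C₃, hC₃, hb₃⟩, h₃⟩ := h.unif.exists_limit_prod le_rfl (by norm_num : 2 < 4)
  obtain ⟨τ₄, hc₄, -, h₄⟩ := h.unif.exists_limit_prod (by norm_num : 2 ≤ 3) (by norm_num : 3 < 4)
  have hM : ∀ {x : E}, x ∈ S → _ := fun hx => h.moment_relation h₁ h₂ h₃ h₄ hx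
  have hom₃ : ∀ t > 0, ∀ x, τ₃ (fun _ => t • x) = t ^ 3 * τ₃ (fun _ => x) := fun t _ x => by
    refine tendsto_nhds_unique (h₃ _) (((h₃ fun _ => x).const_mul (t ^ 3)).congr fun s => ?_)
    rw [mul_left_comm, ← gaussExp_const_mul]
    simp only [Finset.prod_const, Finset.card_univ, Fintype.card_fin, inner_smul_right, mul_pow]
  have hom₄ : ∀ t > 0, ∀ x, τ₄ (fun _ => t • x) = t ^ 4 * τ₄ (fun _ => x) := fun t _ x => by
    refine tendsto_nhds_unique (h₄ _) (((h₄ fun _ => x).const_mul (t ^ 4)).congr fun s => ?_)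
    rw [mul_left_comm, ← gaussExp_const_mul]
    simp only [Finset.prod_const, Finset.card_univ, Fintype.card_fin, inner_smul_right, mul_pow]
  have h1 : ∀ x : E, ‖x‖ ≤ 1 + ‖x‖ := fun x => by linarith
  have hp : ∀ x : E, 1 ≤ 1 + ‖x‖ := fun x => by linarith [norm_nonneg x]
  have hmono : ∀ x : E, ∀ j k : ℕ, j ≤ k → (1 + ‖x‖) ^ j ≤ (1 + ‖x‖) ^ k := fun x j k hjk =>
    pow_le_pow_right₀ (hp x) hjk
  have e₄ : ∀ e ∈ V, 2 / 3 * τ₄ (fun _ => e) - ‖e‖ ^ 4 / 2 = 0 := fun e he => by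
    refine h.eq_zero_of_homogeneous (F := fun x => 2 / 3 * τ₄ (fun _ => x) - ‖x‖ ^ 4 / 2) (k := 3)
      (C := 2 * C₁ + 2 * C₂ + 4 / 3 * C₃) ((continuous_const.mul hc₄).sub ((continuous_norm.pow 4).div_const 2)) (fun t ht x => ?_) (fun x hx => ?_) he
    · rw [hom₄ t ht, norm_smul, Real.norm_of_nonneg ht.le]
      ring
    · have a1 : |τ₁ x| ≤ C₁ * (1 + ‖x‖) ^ 3 := (hb₁ x).trans <| mul_le_mul_of_nonneg_left
        ((h1 x).trans (by simpa using hmono x 1 3 (by norm_num))) hC₁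
      have a2 : |τ₂ x x| ≤ C₂ * (1 + ‖x‖) ^ 3 := (hb₂ x x).trans <| mul_le_mul_of_nonneg_left
        ((mul_le_mul (h1 x) (h1 x) (norm_nonneg x) (by positivity)).trans
          (by simpa [sq] using hmono x 2 3 (by norm_num))) hC₂
      have a3 : |τ₃ (fun _ => x)| ≤ C₃ * (1 + ‖x‖) ^ 3 := (hb₃ _).trans <| mul_le_mul_of_nonneg_left
        (by simpa using pow_le_pow_left₀ (norm_nonneg x) (h1 x) 3) hC₃
      have := hM hx
      rw [abs_le] at a1 a2 a3 ⊢
      constructor <;> linarith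
  have τ₄_proj : ∀ x ∈ S, τ₄ (fun _ => x) = τ₄ (fun _ => V.starProjection x) := fun x hx => by
    have := (h₄ fun _ => x).sub (h₄ fun _ => V.starProjection x)
    refine sub_eq_zero.1 (tendsto_nhds_unique this ((h.unif.tendsto_gaussExp_zero
      (((PolyGrowth.inner x).pow 4).sub ((PolyGrowth.inner (V.starProjection x)).pow 4)) (k := 3) (m := 2)
      (K := 2 * ‖b‖ * ‖x - V.starProjection x‖ * ((‖x‖ + ‖V.starProjection x‖) * (‖x‖ ^ 2 + ‖V.starProjection x‖ ^ 2)))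
      (by norm_num) fun z hz => ?_).congr' ?_))
    · have a1 := h.abs_inner_height_le hz x
      rw [inner_sub_right] at a1
      have a2 := abs_real_inner_le_norm z x
      have a3 := abs_real_inner_le_norm z (V.starProjection x)
      have e : ⟪z, x⟫ ^ 4 - ⟪z, V.starProjection x⟫ ^ 4 = (⟪z, x⟫ - ⟪z, V.starProjection x⟫) *
        ((⟪z, x⟫ + ⟪z, V.starProjection x⟫) * (⟪z, x⟫ ^ 2 + ⟪z, V.starProjection x⟫ ^ 2)) := by ring
      rw [e, abs_mul, abs_mul]
      have a4 : |⟪z, x⟫ + ⟪z, V.starProjection x⟫| ≤ ‖z‖ * (‖x‖ + ‖V.starProjection x‖) :=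
        (abs_add_le _ _).trans (by rw [mul_add]; exact add_le_add a2 a3)
      have a5 : |⟪z, x⟫ ^ 2 + ⟪z, V.starProjection x⟫ ^ 2| ≤ ‖z‖ ^ 2 * (‖x‖ ^ 2 + ‖V.starProjection x‖ ^ 2) := by
        rw [abs_of_nonneg (by positivity), mul_add, ← mul_pow, ← mul_pow, ← sq_abs ⟪z, x⟫,
          ← sq_abs ⟪z, V.starProjection x⟫]
        gcongr
      calc _ ≤ (2 * ‖b‖ * ‖x - V.starProjection x‖) * ((‖z‖ * (‖x‖ + ‖V.starProjection x‖)) *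
            (‖z‖ ^ 2 * (‖x‖ ^ 2 + ‖V.starProjection x‖ ^ 2))) := by gcongr
        _ = _ := by ring
    · filter_upwards [self_mem_nhdsWithin] with s hs
      rw [h.unif.gaussExp_sub hs ((PolyGrowth.inner x).pow 4) ((PolyGrowth.inner (V.starProjection x)).pow 4)]
      simp only [Finset.prod_const, Finset.card_univ, Fintype.card_fin]
      ring
  have hred : ∀ x ∈ S, 2 * τ₁ x + 2 * τ₂ x x + 4 / 3 * τ₃ (fun _ => x) =
      ‖V.starProjection x‖ ^ 2 * ‖x - V.starProjection x‖ ^ 2 + ‖x - V.starProjection x‖ ^ 4 / 2 := fun x hx => by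
    have a1 := hM hx
    have a2 := e₄ _ (V.starProjection_apply_mem x)
    rw [τ₄_proj x hx] at a1
    have a3 := norm_sq_proj V x
    have a4 : ‖x‖ ^ 4 = (‖x‖ ^ 2) ^ 2 := by ring
    rw [a4, a3] at a1
    linarith
  set D := 2 * ‖b‖ with hD
  have hD0 : 0 ≤ D := by positivity
  have hproj : ∀ x : E, ‖V.starProjection x‖ ≤ ‖x‖ := fun x => V.norm_starProjection_apply_le x
  have e₃ : ∀ e ∈ V, 4 / 3 * τ₃ (fun _ => e) = 0 := fun e he => by
    refine h.eq_zero_of_homogeneous (F := fun x => 4 / 3 * τ₃ (fun _ => x)) (k := 2)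
      (C := 2 * C₁ + 2 * C₂ + D ^ 2 + D ^ 4 / 2) (continuous_const.mul hc₃) (fun t ht x => ?_) (fun x hx => ?_) he
    · rw [hom₃ t ht]
      ring
    · have a1 : |τ₁ x| ≤ C₁ * (1 + ‖x‖) ^ 2 := (hb₁ x).trans <| mul_le_mul_of_nonneg_left
        ((h1 x).trans (by simpa using hmono x 1 2 (by norm_num))) hC₁
      have a2 : |τ₂ x x| ≤ C₂ * (1 + ‖x‖) ^ 2 := (hb₂ x x).trans <| mul_le_mul_of_nonneg_left
        ((mul_le_mul (h1 x) (h1 x) (norm_nonneg x) (by positivity)).trans (by simp [sq])) hC₂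
      have a3 := hred x hx
      have a4 : ‖x - V.starProjection x‖ ≤ D := h.norm_height_le hx
      have a5 : ‖V.starProjection x‖ ^ 2 * ‖x - V.starProjection x‖ ^ 2 ≤ D ^ 2 * (1 + ‖x‖) ^ 2 := by
        rw [mul_comm]
        gcongr
        exact (hproj x).trans (h1 x)
      have a6 : ‖x - V.starProjection x‖ ^ 4 / 2 ≤ D ^ 4 / 2 * (1 + ‖x‖) ^ 2 := by
        have : ‖x - V.starProjection x‖ ^ 4 ≤ D ^ 4 := by gcongr
        have b1 : 1 ≤ (1 + ‖x‖) ^ 2 := one_le_pow₀ (hp x)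
        have b2 : 0 ≤ D ^ 4 := by positivity
        nlinarith
      have a7 : 0 ≤ ‖V.starProjection x‖ ^ 2 * ‖x - V.starProjection x‖ ^ 2 := by positivity
      have a8 : 0 ≤ ‖x - V.starProjection x‖ ^ 4 / 2 := by positivity
      rw [abs_le] at a1 a2 ⊢
      constructor <;> linarith
  have τ₃_proj : ∀ x ∈ S, τ₃ (fun _ => x) = 3 * τ₃ ![V.starProjection x, V.starProjection x, x - V.starProjection x] :=
    fun x hx => by
    have a0 : τ₃ (fun _ => V.starProjection x) = 0 := by
      have := e₃ _ (V.starProjection_apply_mem x)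
      linarith
    have := ((h₃ fun _ => x).sub (h₃ fun _ => V.starProjection x)).sub
      ((h₃ ![V.starProjection x, V.starProjection x, x - V.starProjection x]).const_mul 3)
    rw [a0, sub_zero] at this
    set p := V.starProjection x
    have hP : PolyGrowth (fun z : E => ⟪z, x⟫ ^ 3 - ⟪z, p⟫ ^ 3) := ((PolyGrowth.inner x).pow 3).sub ((PolyGrowth.inner p).pow 3)
    have hP' : PolyGrowth (fun z : E => 3 * (⟪z, p⟫ * ⟪z, p⟫ * ⟪z, x - p⟫)) :=
      (((PolyGrowth.inner p).mul (PolyGrowth.inner p)).mul (PolyGrowth.inner (x - p))).const_mul 3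
    refine sub_eq_zero.1 (tendsto_nhds_unique this ((h.unif.tendsto_gaussExp_zero
      (hP.sub hP') (k := 1) (m := 1) (K := (D * ‖x - p‖) ^ 2 * (2 * ‖p‖ + ‖x‖)) (by norm_num) fun z hz => ?_).congr' ?_))
    · have a1 := h.abs_inner_height_le hz x
      have a2 := abs_real_inner_le_norm z x
      have a3 := abs_real_inner_le_norm z p
      have e : ⟪z, x⟫ ^ 3 - ⟪z, p⟫ ^ 3 - 3 * (⟪z, p⟫ * ⟪z, p⟫ * ⟪z, x - p⟫) = ⟪z, x - p⟫ ^ 2 * (2 * ⟪z, p⟫ + ⟪z, x⟫) := by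
        rw [inner_sub_right]
        ring
      rw [e, abs_mul, abs_pow]
      have a4 : |2 * ⟪z, p⟫ + ⟪z, x⟫| ≤ ‖z‖ * (2 * ‖p‖ + ‖x‖) := by
        refine (abs_add_le _ _).trans ?_
        rw [abs_mul, abs_two]
        linarith
      calc _ ≤ (D * ‖x - p‖) ^ 2 * (‖z‖ * (2 * ‖p‖ + ‖x‖)) := by gcongr
        _ = _ := by ring
    · filter_upwards [self_mem_nhdsWithin] with s hs
      rw [h.unif.gaussExp_sub hs hP hP', gaussExp_const_mul, h.unif.gaussExp_sub hs ((PolyGrowth.inner x).pow 3)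
        ((PolyGrowth.inner p).pow 3)]
      simp only [Finset.prod_const, Finset.card_univ, Fintype.card_fin]
      simp [Fin.prod_univ_three]
      ring
  refine ⟨τ₂, τ₃, C₂ + 2 * C₁ + D ^ 4 / 2, by positivity, fun u v => (hb₂ u v).trans ?_, h₂, h₃, fun x hx => ?_⟩
  · have : 0 ≤ 2 * C₁ + D ^ 4 / 2 := by positivity
    have h3 : 0 ≤ ‖u‖ * ‖v‖ := by positivity
    nlinarith
  · have a1 := hred x hx
    rw [τ₃_proj x hx] at a1
    have a2 : |2 * τ₁ x| ≤ 2 * C₁ * (1 + ‖x‖) := by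
      rw [abs_mul, abs_two, mul_assoc]
      gcongr
      exact (hb₁ x).trans (mul_le_mul_of_nonneg_left (h1 x) hC₁)
    have a4 : ‖x - V.starProjection x‖ ≤ D := h.norm_height_le hx
    have a6 : ‖x - V.starProjection x‖ ^ 4 / 2 ≤ D ^ 4 / 2 * (1 + ‖x‖) := by
      have : ‖x - V.starProjection x‖ ^ 4 ≤ D ^ 4 := by gcongr
      have b2 : 0 ≤ D ^ 4 := by positivity
      nlinarith [hp x]
    have a8 : 0 ≤ ‖x - V.starProjection x‖ ^ 4 / 2 := by positivity
    have a9 : 0 ≤ C₂ * (1 + ‖x‖) := by positivity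
    have e : 2 * τ₂ x x + 4 * τ₃ ![V.starProjection x, V.starProjection x, x - V.starProjection x] -
        ‖V.starProjection x‖ ^ 2 * ‖x - V.starProjection x‖ ^ 2 = ‖x - V.starProjection x‖ ^ 4 / 2 - 2 * τ₁ x := by linarith
    rw [e]
    rw [abs_le] at a2 ⊢
    constructor <;> linarith

end QuadricData

end boundedHeight

section boundedHeight

variable {E : Type*} [NormedAddCommGroup E] [InnerProductSpace ℝ E] [FiniteDimensional ℝ E]
  [MeasurableSpace E] [BorelSpace E] {d : ℕ} {ν : Measure E} {S : Set E} {V : Submodule ℝ E} {b : E}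

namespace QuadricData

lemma bilin_expand {d : ℕ} {τ : E → E → ℝ} {A : ℝ → E →L[ℝ] E} (hτ : ∀ u v, Tendsto (fun s => ⟪A s u, v⟫) (𝓝[>] 0) (𝓝 (τ u v)))
    (v : Fin d → E) (c : Fin d → ℝ) :
    τ (∑ i, c i • v i) (∑ i, c i • v i) = ∑ i, ∑ j, c i * c j * τ (v i) (v j) := by
  refine tendsto_nhds_unique (hτ _ _) ((tendsto_finset_sum Finset.univ fun i _ => tendsto_finset_sum Finset.univ fun j _ =>
    (hτ (v i) (v j)).const_mul (c i * c j)).congr fun s => ?_)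
  rw [map_sum, sum_inner]
  refine Finset.sum_congr rfl fun i _ => ?_
  rw [inner_sum]
  refine Finset.sum_congr rfl fun j _ => ?_
  rw [map_smul, inner_smul_left, inner_smul_right, conj_trivial]
  ring

lemma polyGrowth_height (u : E) (V : Submodule ℝ E) (b : E) :
    PolyGrowth (fun z : E => ⟪z, u - V.starProjection u⟫ - ⟪b, u⟫) := (PolyGrowth.inner _).sub (PolyGrowth.const _)

lemma inner_height (V : Submodule ℝ E) (b z u : E) :
    ⟪z, u - V.starProjection u⟫ - ⟪b, u⟫ = ⟪z - V.starProjection z - b, u⟫ := by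
  rw [inner_sub_right, inner_sub_left, inner_sub_left, inner_starProjection_right]

/-- The limit of the second moments of the height over a uniform measure. -/
lemma exists_second_moment_height (h : QuadricData d ν S V b) {τ₃ : (Fin 3 → E) → ℝ}
    (h₃ : ∀ u, Tendsto (fun s => s ^ 1 * gaussExp d ν s (fun z => ∏ i, ⟪z, u i⟫)) (𝓝[>] 0) (𝓝 (τ₃ u))) :
    (∀ p q u, Tendsto (fun s => 4 * s * gaussExp d ν s (fun z => ⟪z, p⟫ * ⟪z, q⟫ * (⟪z, u - V.starProjection u⟫ - ⟪b, u⟫)))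
      (𝓝[>] 0) (𝓝 (4 * τ₃ ![p, q, u - V.starProjection u] - 2 * ⟪V.starProjection p, q⟫ * ⟪b, u⟫))) ∧
    ∀ p q, ∃ H : E, ∀ u,
      Tendsto (fun s => 4 * s * gaussExp d ν s (fun z => ⟪z, p⟫ * ⟪z, q⟫ * (⟪z, u - V.starProjection u⟫ - ⟪b, u⟫)))
      (𝓝[>] 0) (𝓝 ⟪H, u⟫) := by
  have h1 : ∀ p q u, Tendsto (fun s => 4 * s * gaussExp d ν s
      (fun z => ⟪z, p⟫ * ⟪z, q⟫ * (⟪z, u - V.starProjection u⟫ - ⟪b, u⟫)))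
      (𝓝[>] 0) (𝓝 (4 * τ₃ ![p, q, u - V.starProjection u] - 2 * ⟪V.starProjection p, q⟫ * ⟪b, u⟫)) := fun p q u => by
    have h2 : Tendsto (fun s => ⟪gaussOp d ν s p, q⟫) (𝓝[>] 0) (𝓝 ⟪V.starProjection p, q⟫) :=
      (((ContinuousLinearMap.apply ℝ E p).continuous.tendsto _).comp h.op).inner tendsto_const_nhds
    refine (((h₃ ![p, q, u - V.starProjection u]).const_mul 4).sub ((h2.const_mul 2).mul_const ⟪b, u⟫)).congr' ?_
    filter_upwards [self_mem_nhdsWithin] with s hs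
    have e : ∀ z : E, ⟪z, p⟫ * ⟪z, q⟫ * (⟪z, u - V.starProjection u⟫ - ⟪b, u⟫) =
      ⟪z, p⟫ * ⟪z, q⟫ * ⟪z, u - V.starProjection u⟫ - ⟪b, u⟫ * (⟪z, p⟫ * ⟪z, q⟫) := fun z => by ring
    simp only [e]
    rw [h.unif.gaussExp_sub hs (((PolyGrowth.inner p).mul (PolyGrowth.inner q)).mul (PolyGrowth.inner _))
      (((PolyGrowth.inner p).mul (PolyGrowth.inner q)).const_mul _), gaussExp_const_mul,
      ← gaussExp_inner_inner h.unif hs]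
    simp [Fin.prod_univ_three]
    ring
  refine ⟨h1, fun p q => ?_⟩
  set e := stdOrthonormalBasis ℝ E
  refine ⟨∑ k, (4 * τ₃ ![p, q, e k - V.starProjection (e k)] - 2 * ⟪V.starProjection p, q⟫ * ⟪b, e k⟫) • e k, fun u => ?_⟩
  rw [sum_inner]
  simp only [inner_smul_left, conj_trivial]
  refine (tendsto_finset_sum Finset.univ fun k _ => (h1 p q (e k)).mul_const ⟪e k, u⟫).congr' ?_
  filter_upwards [self_mem_nhdsWithin] with s hs
  have e1 : ∀ z : E, ⟪z, p⟫ * ⟪z, q⟫ * (⟪z, u - V.starProjection u⟫ - ⟪b, u⟫) =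
      ∑ k, ⟪e k, u⟫ * (⟪z, p⟫ * ⟪z, q⟫ * (⟪z, e k - V.starProjection (e k)⟫ - ⟪b, e k⟫)) := fun z => by
    simp only [inner_height]
    rw [← e.sum_inner_mul_inner _ u, Finset.mul_sum]
    refine Finset.sum_congr rfl fun k _ => by ring
  simp only [e1]
  rw [h.unif.gaussExp_sum hs Finset.univ fun k => (((PolyGrowth.inner p).mul (PolyGrowth.inner q)).mul
    (polyGrowth_height _ V b)).const_mul _, Finset.mul_sum]
  refine Finset.sum_congr rfl fun k _ => ?_
  rw [gaussExp_const_mul]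
  ring

/-- A flat uniform measure has vanishing mean curvature vector. -/
lemma eq_zero (h : QuadricData d ν S V b) : b = 0 := by
  obtain ⟨τ₂, τ₃, C, hC, hb₂, h₂, h₃, hrel⟩ := h.exists_reduced_relation
  obtain ⟨hlim, hH⟩ := h.exists_second_moment_height h₃
  choose H' hH' using hH
  let v := (stdOrthonormalBasis ℝ V).reindex (finCongr h.finrank)
  let w : Fin d → E := fun i => (v i : E)
  have hwV : ∀ i, V.starProjection (w i) = w i := fun i => V.starProjection_eq_self_iff.2 (v i).2
  have hww : ∀ i j, ⟪w i, w j⟫ = if i = j then 1 else 0 := fun i j => by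
    have := orthonormal_iff_ite.1 v.orthonormal i j
    simpa [w] using this
  have hexp : ∀ z : E, V.starProjection z = ∑ i, ⟪z, w i⟫ • w i := fun z => by
    have h1 := v.sum_repr' (V.orthogonalProjection z)
    have h2 := congrArg (Subtype.val) h1
    rw [Submodule.starProjection_apply, ← h2, AddSubmonoidClass.coe_finset_sum]
    refine Finset.sum_congr rfl fun i _ => ?_
    rw [Submodule.coe_smul, real_inner_comm, Submodule.coe_inner, ← Submodule.starProjection_apply,
      inner_starProjection_right, hwV]
  have hnorm : ∀ z : E, ‖V.starProjection z‖ ^ 2 = ∑ i, ⟪z, w i⟫ ^ 2 := fun z => by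
    rw [← real_inner_self_eq_norm_sq, inner_starProjection_right,
      V.starProjection_eq_self_iff.2 (V.starProjection_apply_mem z), hexp, inner_sum]
    refine Finset.sum_congr rfl fun i _ => ?_
    rw [inner_smul_right]
    ring
  set R := ‖b‖ with hR
  let H : Fin d → Fin d → E := fun i j => H' (w i) (w j)
  let Q : Fin d → Fin d → ℝ := fun i j => 2 * τ₂ (w i) (w j) + ⟪H i j, b⟫
  let HH : (Fin d → ℝ) → E := fun c => ∑ i, ∑ j, (c i * c j) • H i j
  let QQ : (Fin d → ℝ) → ℝ := fun c => ∑ i, ∑ j, c i * c j * Q i j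
  have hP2 : ∀ p q : E, PolyGrowth (fun z => ⟪z, p⟫ * ⟪z, q⟫) := fun p q => (PolyGrowth.inner p).mul (PolyGrowth.inner q)
  have hP3 : ∀ p q u : E, PolyGrowth (fun z => ⟪z, p⟫ * ⟪z, q⟫ * (⟪z, u - V.starProjection u⟫ - ⟪b, u⟫)) := fun p q u =>
    (hP2 p q).mul (polyGrowth_height u V b)
  have hsumE : ∀ s > 0, ∀ G : Fin d → Fin d → E → ℝ, (∀ i j, PolyGrowth (G i j)) →
      gaussExp d ν s (fun z => ∑ i, ∑ j, G i j z) = ∑ i, ∑ j, gaussExp d ν s (G i j) := fun s hs G hG => by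
    rw [h.unif.gaussExp_sum hs Finset.univ fun i => PolyGrowth.sum Finset.univ (hG i)]
    exact Finset.sum_congr rfl fun i _ => h.unif.gaussExp_sum hs Finset.univ (hG i)
  -- the quadratic maps in terms of moments
  have hHH : ∀ (c : Fin d → ℝ) (u : E), ⟪HH c, u⟫ =
      4 * τ₃ ![∑ i, c i • w i, ∑ i, c i • w i, u - V.starProjection u] - 2 * ‖∑ i, c i • w i‖ ^ 2 * ⟪b, u⟫ := fun c u => by
    have h1 := hlim (∑ i, c i • w i) (∑ i, c i • w i) u
    have h0 : V.starProjection (∑ i, c i • w i) = ∑ i, c i • w i := by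
      rw [map_sum]
      exact Finset.sum_congr rfl fun i _ => by rw [map_smul, hwV]
    rw [h0, real_inner_self_eq_norm_sq] at h1
    have e : ⟪HH c, u⟫ = ∑ i, ∑ j, c i * c j * ⟪H' (w i) (w j), u⟫ := by
      simp only [HH, H, sum_inner, inner_smul_left, conj_trivial]
    rw [e]
    refine tendsto_nhds_unique ((tendsto_finset_sum Finset.univ fun i _ =>
      tendsto_finset_sum Finset.univ fun j _ => (hH' (w i) (w j) u).const_mul (c i * c j)).congr' ?_) h1
    filter_upwards [self_mem_nhdsWithin] with s hs
    have e1 : ∀ z : E, ⟪z, ∑ i, c i • w i⟫ * ⟪z, ∑ i, c i • w i⟫ * (⟪z, u - V.starProjection u⟫ - ⟪b, u⟫) =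
        ∑ i, ∑ j, c i * c j * (⟪z, w i⟫ * ⟪z, w j⟫ * (⟪z, u - V.starProjection u⟫ - ⟪b, u⟫)) := fun z => by
      simp only [inner_sum, inner_smul_right]
      rw [Finset.sum_mul_sum, Finset.sum_mul]
      refine Finset.sum_congr rfl fun i _ => ?_
      rw [Finset.sum_mul]
      exact Finset.sum_congr rfl fun j _ => by ring
    simp only [e1]
    rw [hsumE s hs _ fun i j => (hP3 _ _ _).const_mul _, Finset.mul_sum]
    refine Finset.sum_congr rfl fun i _ => ?_
    rw [Finset.mul_sum]
    refine Finset.sum_congr rfl fun j _ => ?_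
    rw [gaussExp_const_mul]
    ring
  have hA : ∀ u v, Tendsto (fun s => ⟪((2 * s)⁻¹ • (gaussOp d ν s - V.starProjection)) u, v⟫) (𝓝[>] 0) (𝓝 (τ₂ u v)) :=
      fun u v => by
    refine (h₂ u v).congr' ?_
    filter_upwards [self_mem_nhdsWithin] with s hs
    have : s ≠ 0 := ne_of_gt hs
    rw [ContinuousLinearMap.smul_apply, ContinuousLinearMap.sub_apply, inner_smul_left, inner_sub_left,
        ← gaussExp_inner_inner h.unif hs, conj_trivial]
    field_simp
  have hτ₂ : ∀ c : Fin d → ℝ, τ₂ (∑ i, c i • w i) (∑ i, c i • w i) = ∑ i, ∑ j, c i * c j * τ₂ (w i) (w j) := fun c =>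
    bilin_expand hA w c
  have hadd : ∀ p y, τ₂ (p + y) (p + y) = τ₂ p p + τ₂ p y + τ₂ y p + τ₂ y y := fun p y => by
    refine tendsto_nhds_unique (hA _ _) (((((hA p p).add (hA p y)).add (hA y p)).add (hA y y)).congr fun s => ?_)
    rw [map_add, inner_add_left, inner_add_right, inner_add_right]
    ring
  have hQQ : ∀ c, QQ c = 2 * τ₂ (∑ i, c i • w i) (∑ i, c i • w i) + ⟪HH c, b⟫ := fun c => by
    simp only [QQ, HH, Q, hτ₂, sum_inner, inner_smul_left, conj_trivial, Finset.mul_sum, ← Finset.sum_add_distrib]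
    exact Finset.sum_congr rfl fun i _ => Finset.sum_congr rfl fun j _ => by ring
  -- the relation on the support
  let cc : E → Fin d → ℝ := fun z i => ⟪z, w i⟫
  have hcc : ∀ z, ∑ i, cc z i • w i = V.starProjection z := fun z => (hexp z).symm
  set D := 2 * R with hD
  have hD0 : 0 ≤ D := by positivity
  have hstar : ∃ C', 0 ≤ C' ∧ ∀ x ∈ S, |⟪HH (cc x), x - V.starProjection x - b⟫ + QQ (cc x)| ≤ C' * (1 + ‖x‖) := by
    refine ⟨C + 4 * C * D + 2 * C * D ^ 2, by positivity, fun x hx => ?_⟩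
    have a1 := hrel x hx
    have a2 := hHH (cc x) (x - V.starProjection x)
    have a3 := hQQ (cc x)
    rw [hcc] at a2 a3
    have a4 := h.quadric x hx
    set p := V.starProjection x with hp
    set y := x - p with hy
    have a5 := hadd p y
    rw [hy, add_sub_cancel, ← hy] at a5
    have a6 : V.starProjection y = 0 := starProjection_sub_self V x
    have a7 : ⟪b, y⟫ = ⟪b, x⟫ := by rw [hy, inner_sub_right, h.inner_proj, sub_zero]
    rw [a6, sub_zero, a7] at a2
    have a8 : ⟪HH (cc x), y - b⟫ + QQ (cc x) = (2 * τ₂ x x + 4 * τ₃ ![p, p, y] - ‖p‖ ^ 2 * ‖y‖ ^ 2) -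
        2 * τ₂ p y - 2 * τ₂ y p - 2 * τ₂ y y := by
      rw [inner_sub_right, a2, a3, a4, a5]
      ring
    have hyD : ‖y‖ ≤ D := h.norm_height_le hx
    have hpx : ‖p‖ ≤ 1 + ‖x‖ := (V.norm_starProjection_apply_le x).trans (by linarith)
    have hx1 : 1 ≤ 1 + ‖x‖ := by linarith [norm_nonneg x]
    have b1 : |τ₂ p y| ≤ C * ((1 + ‖x‖) * D) := (hb₂ p y).trans (by gcongr)
    have b2 : |τ₂ y p| ≤ C * (D * (1 + ‖x‖)) := (hb₂ y p).trans (by gcongr)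
    have b3 : |τ₂ y y| ≤ C * (D * D * (1 + ‖x‖)) := (hb₂ y y).trans (by
      refine mul_le_mul_of_nonneg_left ?_ hC
      calc ‖y‖ * ‖y‖ ≤ D * D := by gcongr
        _ ≤ D * D * (1 + ‖x‖) := le_mul_of_one_le_right (by positivity) hx1)
    rw [a8]
    rw [abs_le] at a1 b1 b2 b3 ⊢
    constructor <;> nlinarith
  obtain ⟨C', hC', hstar⟩ := hstar
  have hQH : ∀ c : Fin d → ℝ, |QQ c| ≤ R * ‖HH c‖ := fun c => by
    have hccc : cc (∑ i, c i • w i) = c := by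
      funext i
      simp [cc, sum_inner, inner_smul_left, hww]
    have := h.eq_zero_of_homogeneous (F := fun x => max (|QQ (cc x)| - R * ‖HH (cc x)‖) 0) (k := 1) (C := C')
      (by simp only [QQ, HH, cc]; fun_prop) (fun t ht x => ?_) (fun x hx => ?_)
      (V.sum_mem fun i _ => V.smul_mem (c i) (v i).2 : ∑ i, c i • w i ∈ V)
    · rw [hccc] at this
      have := (max_eq_right_iff.1 this)
      linarith
    · have e1 : ∀ i, cc (t • x) i = t * cc x i := fun i => by simp [cc, inner_smul_left]
      have e2 : HH (cc (t • x)) = (t ^ 2) • HH (cc x) := by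
        simp only [HH, e1, Finset.smul_sum, smul_smul]
        exact Finset.sum_congr rfl fun i _ => Finset.sum_congr rfl fun j _ => by congr 1; ring
      have e3 : QQ (cc (t • x)) = t ^ 2 * QQ (cc x) := by
        simp only [QQ, e1, Finset.mul_sum]
        exact Finset.sum_congr rfl fun i _ => Finset.sum_congr rfl fun j _ => by ring
      rw [e2, e3, abs_mul, norm_smul, Real.norm_of_nonneg (sq_nonneg t), abs_of_nonneg (sq_nonneg t),
        mul_max_of_nonneg _ _ (by positivity), mul_zero]
      congr 1
      ring
    · rw [abs_of_nonneg (le_max_right _ _), pow_one]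
      have a1 := hstar x hx
      have a2 := abs_real_inner_le_norm (HH (cc x)) (x - V.starProjection x - b)
      rw [h.norm_height_sub hx] at a2
      refine max_le ?_ (by positivity)
      have a3 := abs_sub (⟪HH (cc x), x - V.starProjection x - b⟫ + QQ (cc x)) ⟪HH (cc x), x - V.starProjection x - b⟫
      rw [add_sub_cancel_left] at a3
      linarith
  have hsymm : ∀ i j, H i j = H j i := fun i j => by
    refine ext_inner_right ℝ fun u => tendsto_nhds_unique (hH' (w i) (w j) u) ((hH' (w j) (w i) u).congr fun s => ?_)
    simp only [mul_comm ⟪_, w i⟫]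
  have hsplit : ∀ z ∈ S, ‖z‖ ^ 2 = ∑ i, ⟪z, w i⟫ * ⟪z, w i⟫ + 2 * ⟪z, b⟫ := fun z hz => by
    rw [norm_sq_proj V z, h.quadric z hz, hnorm, real_inner_comm b]
    simp only [sq]
  have hHtr : ∑ i, H i i = 0 := by
    refine ext_inner_right ℝ fun u => ?_
    rw [inner_zero_left, sum_inner]
    set u' := u - V.starProjection u with hu'
    have hbu : ⟪b, u'⟫ = ⟪b, u⟫ := by rw [hu', inner_sub_right, h.inner_proj, sub_zero]
    have hL := tendsto_finset_sum Finset.univ fun i _ => hH' (w i) (w i) u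
    have hG : PolyGrowth (fun z : E => ⟪z, b⟫ * (⟪z, u'⟫ - ⟪b, u⟫)) := (PolyGrowth.inner b).mul (polyGrowth_height u V b)
    have hY := h.unif.tendsto_gaussExp_zero_of_le (f := fun z => ⟪z, b⟫ * (⟪z, u'⟫ - ⟪b, u⟫)) hG
      (K := D ^ 2 * (R * ‖u‖)) (fun z hz => by
        have a1 := h.quadric z hz
        have a2 := h.norm_height_le hz
        have a3 : ⟪z, b⟫ = ‖z - V.starProjection z‖ ^ 2 / 2 := by rw [a1, real_inner_comm]; ring
        have a4 := abs_real_inner_le_norm (z - V.starProjection z - b) u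
        rw [h.norm_height_sub hz] at a4
        rw [hu', inner_height, a3, abs_mul, abs_of_nonneg (by positivity)]
        calc ‖z - V.starProjection z‖ ^ 2 / 2 * |⟪z - V.starProjection z - b, u⟫| ≤ D ^ 2 * (R * ‖u‖) := by
              gcongr
              have : ‖z - V.starProjection z‖ ^ 2 ≤ D ^ 2 := by gcongr
              have := sq_nonneg D
              linarith
          _ ≤ D ^ 2 * (R * ‖u‖) * (1 + ‖z‖) := le_mul_of_one_le_right (by positivity) (by linarith [norm_nonneg z]))
    have hlim2 := h.unif.limit_norm_sq_inner h.mean (u := u') (((hL.const_mul (1 / 4)).add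
      (hY.const_mul 2)).add_const (⟪b, u⟫ * (d / 2)) |>.congr' ?_)
    · rw [hbu, mul_zero] at hlim2
      have : (∑ i, ⟪H i i, u⟫) = 0 := by
        simp only [H]
        linarith
      exact this
    · filter_upwards [self_mem_nhdsWithin] with s hs
      have hs0 : s ≠ 0 := ne_of_gt hs
      have e1 : gaussExp d ν s (fun z => ‖z‖ ^ 2 * ⟪z, u'⟫) = gaussExp d ν s (fun z => (∑ i, ⟪z, w i⟫ * ⟪z, w i⟫ *
          (⟪z, u'⟫ - ⟪b, u⟫) + 2 * (⟪z, b⟫ * (⟪z, u'⟫ - ⟪b, u⟫))) + ⟪b, u⟫ * ‖z‖ ^ 2) := h.unif.gaussExp_congr fun z hz => by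
        rw [← Finset.sum_mul]
        have := hsplit z hz
        linear_combination (⟪z, u'⟫ - ⟪b, u⟫) * this
      rw [e1, h.unif.gaussExp_add hs ((PolyGrowth.sum Finset.univ fun i => hP3 (w i) (w i) u).add (hG.const_mul 2))
        ((PolyGrowth.norm.pow 2).const_mul _), h.unif.gaussExp_add hs (PolyGrowth.sum Finset.univ fun i => hP3 (w i) (w i) u)
        (hG.const_mul 2), h.unif.gaussExp_sum hs Finset.univ fun i => hP3 (w i) (w i) u, gaussExp_const_mul,
        gaussExp_const_mul, h.unif.gaussExp_norm_sq hs, ← Finset.mul_sum]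
      field_simp
  have hPw : ∀ i j, Tendsto (fun s => 4 * s * gaussExp d ν s (fun z => ⟪z, w i⟫ * ⟪z, w j⟫)) (𝓝[>] 0)
      (𝓝 (2 * if i = j then 1 else 0)) := fun i j => by
    have h2 : Tendsto (fun s => ⟪gaussOp d ν s (w i), w j⟫) (𝓝[>] 0) (𝓝 ⟪V.starProjection (w i), w j⟫) :=
      (((ContinuousLinearMap.apply ℝ E (w i)).continuous.tendsto _).comp h.op).inner tendsto_const_nhds
    rw [hwV, hww] at h2
    refine (h2.const_mul 2).congr' ?_
    filter_upwards [self_mem_nhdsWithin] with s hs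
    rw [← gaussExp_inner_inner h.unif hs]
    ring
  have hQtr : ∑ i, Q i i = -4 * R ^ 2 := by
    have h4 : ∑ i, τ₂ (w i) (w i) = -2 * ⟪b, b⟫ := by
      refine tendsto_nhds_unique (tendsto_finset_sum Finset.univ fun i _ => h₂ (w i) (w i))
        (((h.mean.inner tendsto_const_nhds).const_mul (-2)).congr' ?_)
      filter_upwards [self_mem_nhdsWithin] with s hs
      have e1 := h.unif.gaussExp_norm_sq hs
      rw [h.unif.gaussExp_congr hsplit, h.unif.gaussExp_add hs (PolyGrowth.sum Finset.univ fun i => hP2 (w i) (w i))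
        ((PolyGrowth.inner b).const_mul 2), h.unif.gaussExp_sum hs Finset.univ fun i => hP2 (w i) (w i),
        gaussExp_const_mul, gaussExp_inner h.unif hs] at e1
      rw [Finset.sum_sub_distrib]
      simp only [hwV, hww, if_true, Finset.sum_const, Finset.card_univ, Fintype.card_fin, nsmul_eq_mul]
      rw [mul_one_div]
      linarith
    have h5 : ∑ i, ⟪H i i, b⟫ = 0 := by rw [← sum_inner, hHtr, inner_zero_left]
    simp only [Q]
    rw [Finset.sum_add_distrib, ← Finset.mul_sum, h4, h5, real_inner_self_eq_norm_sq]
    ring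
  have hHn : ∑ i, ∑ j, ‖H i j‖ ^ 2 = 8 * R ^ 2 := by
    have l1 := tendsto_finset_sum Finset.univ fun i (_ : i ∈ Finset.univ) =>
      tendsto_finset_sum Finset.univ fun j (_ : j ∈ Finset.univ) => hH' (w i) (w j) (H i j)
    have l2 := tendsto_finset_sum Finset.univ fun i (_ : i ∈ Finset.univ) =>
      tendsto_finset_sum Finset.univ fun j (_ : j ∈ Finset.univ) => (hPw i j).const_mul (Q i j)
    have hF1 : ∀ i j, PolyGrowth (fun z => ⟪z, w i⟫ * ⟪z, w j⟫ * (⟪z, H i j - V.starProjection (H i j)⟫ - ⟪b, H i j⟫)) :=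
      fun i j => hP3 _ _ _
    have hF2 : ∀ i j, PolyGrowth (fun z => Q i j * (⟪z, w i⟫ * ⟪z, w j⟫)) := fun i j => (hP2 _ _).const_mul _
    have hF1s := PolyGrowth.sum Finset.univ fun i => PolyGrowth.sum Finset.univ (hF1 i)
    have hF2s := PolyGrowth.sum Finset.univ fun i => PolyGrowth.sum Finset.univ (hF2 i)
    have l3 := h.unif.tendsto_gaussExp_zero_of_le (hF1s.add hF2s) (K := C') (fun z hz => by
      refine (le_of_eq ?_).trans (hstar z hz)
      simp only [HH, QQ, cc, sum_inner, inner_smul_left, conj_trivial, inner_height]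
      congr 2
      · exact Finset.sum_congr rfl fun i _ => Finset.sum_congr rfl fun j _ => by rw [real_inner_comm (H i j)]
      · exact Finset.sum_congr rfl fun i _ => Finset.sum_congr rfl fun j _ => by ring)
    have l4 := tendsto_nhds_unique ((l1.add l2).congr' (f₂ := _) ?_) (l3.const_mul 4)
    · simp only [mul_ite, mul_one, mul_zero, Finset.sum_ite_eq, Finset.mem_univ, if_true, ← Finset.sum_mul] at l4
      simp only [← real_inner_self_eq_norm_sq, H] at l4 hQtr ⊢
      rw [hQtr] at l4
      linarith
    · filter_upwards [self_mem_nhdsWithin] with s hs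
      rw [h.unif.gaussExp_add hs hF1s hF2s, hsumE s hs _ hF1, hsumE s hs _ hF2, mul_add, mul_add]
      simp only [gaussExp_const_mul, Finset.mul_sum]
      congr 1
      · exact Finset.sum_congr rfl fun i _ => Finset.sum_congr rfl fun j _ => by ring
      · exact Finset.sum_congr rfl fun i _ => Finset.sum_congr rfl fun j _ => by ring
  exact norm_eq_zero.1 (eq_zero_of_sign_averaging (norm_nonneg b) H Q hsymm hQH hHtr hQtr hHn)

end QuadricData

/-- A uniform measure which is flat at all large scales is flat. -/
theorem Unif.eq_submodule_of_flat (h : Unif d ν S) (hF : ∀ r ≥ 1, _root_.Fl d (flatEps d) (_root_.dil 0 r S)) :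
    ∃ V : Submodule ℝ E, Module.finrank ℝ V = d ∧ S = V := by
  obtain ⟨V, hV, b, hb, hq, hmean, hop, hseq⟩ := h.quadric_structure hF
  have hb0 : b = 0 := QuadricData.eq_zero ⟨h, hV, hb, hq, hmean, hop, hseq⟩
  refine ⟨V, hV, h.eq_submodule (fun x hx => ?_) hV⟩
  have := hq x hx
  rw [hb0, inner_zero_left, mul_zero, sq_eq_zero_iff, norm_eq_zero, sub_eq_zero] at this
  rw [SetLike.mem_coe, this]
  exact V.starProjection_apply_mem x

end boundedHeight

section
variable {E : Type*} [NormedAddCommGroup E] [InnerProductSpace ℝ E] [FiniteDimensional ℝ E]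
  [MeasurableSpace E] [BorelSpace E]

def om (d : ℕ) : ℝ := (ballVol d).toReal

lemma om_pos (d : ℕ) : 0 < om d := ENNReal.toReal_pos (ballVol_pos d).ne' (ballVol_ne_top d)

/-- The `d`-dimensional density of `μ` is `1`, uniformly on `K`. -/
def Dens (d : ℕ) (μ : Measure E) (K : Set E) : Prop :=
  ∀ ε > 0, ∃ δ > 0, ∀ x ∈ K, ∀ r, 0 < r → r < δ →
    (1 - ε) * om d * r ^ d ≤ μ.real (ball x r) ∧ μ.real (ball x r) ≤ (1 + ε) * om d * r ^ d

/-- The complement of `K` has `d`-dimensional `μ`-density zero, uniformly on `A`. -/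
def Thin (d : ℕ) (μ : Measure E) (K A : Set E) : Prop :=
  ∀ ε > 0, ∃ δ > 0, ∀ x ∈ A, ∀ r, 0 < r → r < δ → μ.real (ball x r \ K) ≤ ε * r ^ d

lemma isClosed_measure_ball_le (d : ℕ) (μ : Measure E) [IsFiniteMeasure μ] (c δ : ℝ) :
    IsClosed {x | ∀ r, 0 < r → r < δ → μ.real (ball x r) ≤ c * r ^ d} := by
  refine isClosed_of_closure_subset fun x hx r hr hrδ => ?_
  obtain ⟨u, hu, hux⟩ := mem_closure_iff_seq_limit.1 hx
  have h1 : Tendsto (fun n => r + dist x (u n)) atTop (𝓝 r) := by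
    have := (tendsto_iff_dist_tendsto_zero.1 hux).const_add r
    simpa [dist_comm] using this
  refine ge_of_tendsto ((h1.pow d).const_mul c) ?_
  filter_upwards [h1.eventually_lt_const hrδ] with n hn
  refine le_trans (measureReal_mono (ball_subset_ball' le_rfl)) (hu n _ ?_ hn)
  positivity

lemma isClosed_le_measure_ball (d : ℕ) (μ : Measure E) [IsFiniteMeasure μ] (c δ : ℝ) :
    IsClosed {x | ∀ r, 0 < r → r < δ → c * r ^ d ≤ μ.real (ball x r)} := by
  refine isClosed_of_closure_subset fun x hx r hr hrδ => ?_
  obtain ⟨u, hu, hux⟩ := mem_closure_iff_seq_limit.1 hx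
  have h1 : Tendsto (fun n => r - dist x (u n)) atTop (𝓝 r) := by
    have := (tendsto_iff_dist_tendsto_zero.1 hux).const_sub r
    simpa [dist_comm] using this
  refine le_of_tendsto ((h1.pow d).const_mul c) ?_
  filter_upwards [h1.eventually_const_lt hr] with n hn
  refine le_trans (hu n _ hn ?_) (measureReal_mono (ball_subset_ball' (by rw [dist_comm]; simp)))
  have : 0 ≤ dist x (u n) := dist_nonneg
  linarith

lemma exists_measure_compl_iInter_le {X : Type*} [MeasurableSpace X] (μ : Measure X)
    [IsFiniteMeasure μ] {C : ℕ → ℕ → Set X} (hC : ∀ m j, MeasurableSet (C m j))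
    (hmono : ∀ m, Monotone (C m)) (hae : ∀ᵐ x ∂μ, ∀ m, ∃ j, x ∈ C m j) {ε : ℝ≥0∞} (hε : ε ≠ 0) :
    ∃ J : ℕ → ℕ, μ (⋂ m, C m (J m))ᶜ ≤ ε := by
  obtain ⟨e, he0, he⟩ := ENNReal.exists_pos_sum_of_countable' hε ℕ
  have : ∀ m, ∃ j, μ (C m j)ᶜ ≤ e m := by
    intro m
    have h0 : μ (⋂ j, (C m j)ᶜ) = 0 := by
      rw [← compl_iUnion]
      filter_upwards [hae] with x hx
      simpa using hx m
    have ht := tendsto_measure_iInter_atTop (μ := μ) (s := fun j => (C m j)ᶜ)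
      (fun j => (hC m j).compl.nullMeasurableSet)
      (fun i j hij => compl_subset_compl.2 (hmono m hij)) ⟨0, measure_ne_top _ _⟩
    rw [h0] at ht
    exact (ht.eventually (ge_mem_nhds (he0 m))).exists
  choose J hJ using this
  refine ⟨J, ?_⟩
  rw [compl_iInter]
  calc μ (⋃ m, (C m (J m))ᶜ) ≤ ∑' m, μ (C m (J m))ᶜ := measure_iUnion_le _
    _ ≤ ∑' m, e m := ENNReal.tsum_le_tsum hJ
    _ ≤ ε := he.le

lemma exists_dens (d : ℕ) (μ : Measure E) [IsFiniteMeasure μ]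
    (h : ∀ᵐ x ∂μ, Tendsto (fun r => μ.real (ball x r) / r ^ d) (𝓝[>] 0) (𝓝 (om d)))
    {ε : ℝ≥0∞} (hε : ε ≠ 0) : ∃ K, IsClosed K ∧ Dens d μ K ∧ μ Kᶜ ≤ ε := by
  have hom := om_pos d
  let C : ℕ → ℕ → Set E := fun m j =>
    {x | ∀ r, 0 < r → r < 1 / ((j : ℝ) + 1) → (1 - 1 / ((m : ℝ) + 1)) * om d * r ^ d ≤ μ.real (ball x r)} ∩
    {x | ∀ r, 0 < r → r < 1 / ((j : ℝ) + 1) → μ.real (ball x r) ≤ (1 + 1 / ((m : ℝ) + 1)) * om d * r ^ d}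
  have hcl : ∀ m j, IsClosed (C m j) := fun m j =>
    (isClosed_le_measure_ball d μ _ _).inter (isClosed_measure_ball_le d μ _ _)
  have hmono : ∀ m, Monotone (C m) := fun m i j hij x hx => by
    have hle : 1 / ((j : ℝ) + 1) ≤ 1 / ((i : ℝ) + 1) := by gcongr
    exact ⟨fun r hr hrj => hx.1 r hr (hrj.trans_le hle), fun r hr hrj => hx.2 r hr (hrj.trans_le hle)⟩
  have hae : ∀ᵐ x ∂μ, ∀ m, ∃ j, x ∈ C m j := by
    filter_upwards [h] with x hx m
    have hb : (0:ℝ) < 1 / ((m : ℝ) + 1) := by positivity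
    have h1 := hx.eventually (Icc_mem_nhds (a := (1 - 1 / ((m : ℝ) + 1)) * om d)
      (b := (1 + 1 / ((m : ℝ) + 1)) * om d) (by nlinarith) (by nlinarith))
    obtain ⟨δ, hδ, hδ'⟩ := (mem_nhdsGT_iff_exists_Ioo_subset).1 h1
    obtain ⟨j, hj⟩ := exists_nat_one_div_lt (mem_Ioi.1 hδ)
    refine ⟨j, fun r hr hrj => ?_, fun r hr hrj => ?_⟩
    · exact (le_div_iff₀ (by positivity)).1 (hδ' ⟨hr, hrj.trans hj⟩).1
    · exact (div_le_iff₀ (by positivity)).1 (hδ' ⟨hr, hrj.trans hj⟩).2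
  obtain ⟨J, hJ⟩ := exists_measure_compl_iInter_le μ (C := C) (fun m j => (hcl m j).measurableSet)
    hmono hae hε
  · refine ⟨_, isClosed_iInter fun m => hcl m (J m), fun ε hε => ?_, hJ⟩
    obtain ⟨m, hm⟩ := exists_nat_one_div_lt hε
    refine ⟨1 / ((J m : ℝ) + 1), by positivity, fun x hx r hr hrδ => ?_⟩
    have := mem_iInter.1 hx m
    have hp : 0 < om d * r ^ d := by positivity
    refine ⟨le_trans ?_ (this.1 r hr hrδ), (this.2 r hr hrδ).trans ?_⟩ <;>
    · rw [mul_assoc, mul_assoc]; gcongr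

lemma Dens.mono {d : ℕ} {μ : Measure E} {K K' : Set E} (h : Dens d μ K) (hK : K' ⊆ K) :
    Dens d μ K' := fun ε hε => by
  obtain ⟨δ, hδ, H⟩ := h ε hε
  exact ⟨δ, hδ, fun x hx => H x (hK hx)⟩

lemma Thin.mono {d : ℕ} {μ : Measure E} {K A A' : Set E} (h : Thin d μ K A) (hA : A' ⊆ A) :
    Thin d μ K A' := fun ε hε => by
  obtain ⟨δ, hδ, H⟩ := h ε hε
  exact ⟨δ, hδ, fun x hx => H x (hA hx)⟩

lemma ae_tendsto_diff_div {d : ℕ} {μ : Measure E} [IsFiniteMeasure μ] {K : Set E}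
    (hK : MeasurableSet K) {D : Set E} (hD : Dens d μ D) :
    ∀ᵐ x ∂μ, x ∈ K → x ∈ D → Tendsto (fun r => μ.real (ball x r \ K) / r ^ d) (𝓝[>] 0) (𝓝 0) := by
  filter_upwards [Besicovitch.ae_tendsto_measure_inter_div_of_measurableSet μ hK.compl]
    with x hx hxK hxD
  have h0 : Kᶜ.indicator (1 : E → ℝ≥0∞) x = 0 := by simp [hxK]
  rw [h0] at hx
  have h1 : Tendsto (fun r => μ.real (Kᶜ ∩ closedBall x r) / μ.real (closedBall x r)) (𝓝[>] 0) (𝓝 0) := by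
    have := (ENNReal.tendsto_toReal ENNReal.zero_ne_top).comp hx
    simpa [Function.comp_def, ENNReal.toReal_div, measureReal_def] using this
  obtain ⟨δ, hδ, H⟩ := hD 1 one_pos
  have hom := om_pos d
  have h2 := h1.mul_const (2 * om d * 2 ^ d)
  rw [zero_mul] at h2
  refine squeeze_zero' ?_ ?_ h2
  · filter_upwards [self_mem_nhdsWithin] with r hr
    have hr0 : 0 < r := hr
    positivity
  · filter_upwards [self_mem_nhdsWithin, Ioo_mem_nhdsGT (show (0:ℝ) < δ / 2 by positivity)] with r hr hr'
    have hr0 : 0 < r := hr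
    have h3 : μ.real (closedBall x r) ≤ 2 * om d * 2 ^ d * r ^ d := by
      refine (measureReal_mono (closedBall_subset_ball (show r < 2 * r by linarith))).trans ?_
      refine ((H x hxD (2 * r) (by linarith) (by linarith [hr'.2])).2).trans (le_of_eq ?_)
      rw [mul_pow]; ring
    have h4 : μ.real (ball x r \ K) ≤ μ.real (Kᶜ ∩ closedBall x r) :=
      measureReal_mono fun z hz => ⟨hz.2, ball_subset_closedBall hz.1⟩
    rcases eq_or_lt_of_le (measureReal_nonneg (μ := μ) (s := closedBall x r)) with h5 | h5
    · have : μ.real (Kᶜ ∩ closedBall x r) ≤ 0 := by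
        rw [h5]; exact measureReal_mono inter_subset_right
      have h6 : μ.real (ball x r \ K) = 0 := le_antisymm (h4.trans this) measureReal_nonneg
      rw [h6]; simp; positivity
    · rw [div_mul_eq_mul_div, div_le_div_iff₀ (by positivity) h5]
      calc _ ≤ μ.real (Kᶜ ∩ closedBall x r) * (2 * om d * 2 ^ d * r ^ d) := by gcongr
        _ = _ := by ring

lemma exists_thin {d : ℕ} {μ : Measure E} [IsFiniteMeasure μ] {K : Set E}
    (hK : IsClosed K) (hD : Dens d μ K) {ε : ℝ≥0∞} (hε : ε ≠ 0) :
    ∃ A ⊆ K, IsClosed A ∧ Thin d μ K A ∧ μ (K \ A) ≤ ε := by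
  let C : ℕ → ℕ → Set E := fun m j =>
    {x | ∀ r, 0 < r → r < 1 / ((j : ℝ) + 1) → (μ.restrict Kᶜ).real (ball x r) ≤ 1 / ((m : ℝ) + 1) * r ^ d}
  have hcl : ∀ m j, IsClosed (C m j) := fun m j => isClosed_measure_ball_le d _ _ _
  have hre : ∀ x r, (μ.restrict Kᶜ).real (ball x r) = μ.real (ball x r \ K) := fun x r => by
    rw [measureReal_restrict_apply measurableSet_ball]; rfl
  have hmono : ∀ m, Monotone (C m) := fun m i j hij x hx => by
    have hle : 1 / ((j : ℝ) + 1) ≤ 1 / ((i : ℝ) + 1) := by gcongr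
    exact fun r hr hrj => hx r hr (hrj.trans_le hle)
  have hae : ∀ᵐ x ∂(μ.restrict K), ∀ m, ∃ j, x ∈ C m j := by
    rw [ae_restrict_iff' hK.measurableSet]
    filter_upwards [ae_tendsto_diff_div hK.measurableSet hD] with x hx hxK m
    have h1 := (hx hxK hxK).eventually (ge_mem_nhds (show (0:ℝ) < 1 / ((m : ℝ) + 1) by positivity))
    obtain ⟨δ, hδ, hδ'⟩ := (mem_nhdsGT_iff_exists_Ioo_subset).1 h1
    obtain ⟨j, hj⟩ := exists_nat_one_div_lt (mem_Ioi.1 hδ)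
    refine ⟨j, fun r hr hrj => ?_⟩
    rw [hre]
    exact (div_le_iff₀ (by positivity)).1 (hδ' ⟨hr, hrj.trans hj⟩)
  obtain ⟨J, hJ⟩ := exists_measure_compl_iInter_le (μ.restrict K) (C := C)
    (fun m j => (hcl m j).measurableSet) hmono hae hε
  · refine ⟨K ∩ ⋂ m, C m (J m), inter_subset_left, hK.inter (isClosed_iInter fun m => hcl m (J m)),
      fun ε hε => ?_, ?_⟩
    · obtain ⟨m, hm⟩ := exists_nat_one_div_lt hε
      refine ⟨1 / ((J m : ℝ) + 1), by positivity, fun x hx r hr hrδ => ?_⟩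
      have := mem_iInter.1 hx.2 m r hr hrδ
      rw [hre] at this
      exact this.trans (by gcongr)
    · rw [Measure.restrict_apply' hK.measurableSet] at hJ
      refine le_trans (measure_mono ?_) hJ
      intro z hz; exact ⟨fun h => hz.2 ⟨hz.1, h⟩, hz.1⟩
end

section
variable {E : Type*} [NormedAddCommGroup E] [InnerProductSpace ℝ E] [FiniteDimensional ℝ E]
  [MeasurableSpace E] [BorelSpace E]

/-- The rescaling of `μ` by `r` around `x`. -/
def blow (d : ℕ) (μ : Measure E) (x : E) (r : ℝ) : Measure E :=
  (ENNReal.ofReal r ^ d)⁻¹ • μ.map (fun z => r⁻¹ • (z - x))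

lemma blow_apply (d : ℕ) (μ : Measure E) (x : E) (r : ℝ) {B : Set E} (hB : MeasurableSet B) :
    blow d μ x r B = (ENNReal.ofReal r ^ d)⁻¹ * μ ((fun z => r⁻¹ • (z - x)) ⁻¹' B) := by
  rw [blow, Measure.smul_apply, Measure.map_apply (by fun_prop) hB, smul_eq_mul]

lemma preimage_ball_blow (x z : E) {r : ℝ} (hr : 0 < r) (ρ : ℝ) :
    (fun w => r⁻¹ • (w - x)) ⁻¹' ball z ρ = ball (x + r • z) (r * ρ) := by
  ext w
  simp only [mem_preimage, mem_ball, dist_eq_norm]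
  have : w - (x + r • z) = r • (r⁻¹ • (w - x) - z) := by
    rw [smul_sub, smul_inv_smul₀ hr.ne']; abel
  rw [this, norm_smul, Real.norm_of_nonneg hr.le, mul_lt_mul_iff_right₀ hr]

lemma preimage_dil_blow (x : E) {r : ℝ} (hr : 0 < r) (K : Set E) :
    (fun w => r⁻¹ • (w - x)) ⁻¹' dil x r K = K := by
  ext w
  simp [mem_dil, smul_inv_smul₀ hr.ne']

lemma blow_real (d : ℕ) (μ : Measure E) (x : E) {r : ℝ} (hr : 0 < r) {B : Set E}
    (hB : MeasurableSet B) :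
    (blow d μ x r).real B = μ.real ((fun z => r⁻¹ • (z - x)) ⁻¹' B) / r ^ d := by
  rw [measureReal_def, blow_apply d μ x r hB, ENNReal.toReal_mul, ENNReal.toReal_inv,
    ENNReal.toReal_pow, ENNReal.toReal_ofReal hr.le, measureReal_def, div_eq_inv_mul]

lemma isFiniteMeasure_blow (d : ℕ) (μ : Measure E) [IsFiniteMeasure μ] (x : E) {r : ℝ} (hr : 0 < r) :
    IsFiniteMeasure (blow d μ x r) := by
  refine ⟨?_⟩
  rw [blow_apply d μ x r MeasurableSet.univ]
  refine ENNReal.mul_lt_top ?_ (measure_lt_top _ _)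
  rw [ENNReal.inv_lt_top]
  have : 0 < ENNReal.ofReal r := ENNReal.ofReal_pos.2 hr
  positivity

/-- Blow-ups of a set of uniform density one are `d`-uniform. -/
lemma Dens.exists_limit {d : ℕ} {μ : Measure E} [IsFiniteMeasure μ] {K A : Set E}
    (hK : IsClosed K) (h : Dens d μ K) (hAK : A ⊆ K) (hA : Thin d μ K A) {ι : Type*}
    (𝒰 : Ultrafilter ι) {x : ι → E} (hx : ∀ i, x i ∈ A) {r : ι → ℝ} (hr : ∀ i, 0 < r i)
    (hr0 : Tendsto r 𝒰 (𝓝 0)) :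
    ∃ ν, Unif d ν (ulim 𝒰 fun i => dil (x i) (r i) K) ∧
      ∀ f : E → ℝ, Continuous f → HasCompactSupport f →
      Tendsto (fun i => ∫ z, f z ∂(blow d μ (x i) (r i))) 𝒰 (𝓝 (∫ z, f z ∂ν)) := by
  have hom := om_pos d
  have hfin := fun i => isFiniteMeasure_blow d μ (x i) (hr i)
  have hpre : ∀ i R, (fun z => (r i)⁻¹ • (z - x i)) ⁻¹' (ball 0 R \ dil (x i) (r i) K) =
      ball (x i) (r i * R) \ K := fun i R => by
    rw [preimage_diff, preimage_dil_blow _ (hr i), preimage_ball_blow _ _ (hr i)]; simp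
  have hmK : ∀ i, MeasurableSet (dil (x i) (r i) K) := fun i => (hK.dil _ _).measurableSet
  have hball : ∀ i z ρ, (blow d μ (x i) (r i)).real (ball z ρ) =
      μ.real (ball (x i + r i • z) (r i * ρ)) / r i ^ d := fun i z ρ => by
    rw [blow_real d μ _ (hr i) measurableSet_ball, preimage_ball_blow _ _ (hr i)]
  refine exists_unif_limit 𝒰 (fun i => blow d μ (x i) (r i)) _ (fun i => ?_) (fun R => ?_) ?_ ?_
  · simp [mem_dil, hAK (hx i)]
  · rw [← ENNReal.ofReal_zero]
    have key : Tendsto (fun i => (blow d μ (x i) (r i)).real (ball 0 R \ dil (x i) (r i) K)) 𝒰 (𝓝 0) := by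
      rcases le_or_gt R 0 with hR | hR
      · simp [ball_eq_empty.2 hR]
      refine Metric.tendsto_nhds.2 fun ε hε => ?_
      obtain ⟨δ, hδ, H⟩ := hA (ε / (2 * R ^ d)) (by positivity)
      have h2 := hr0.mul_const R
      rw [zero_mul] at h2
      filter_upwards [h2.eventually_lt_const hδ] with i hi
      have hi0 := hr i
      rw [Real.dist_0_eq_abs, abs_of_nonneg measureReal_nonneg,
        blow_real d μ _ (hr i) (measurableSet_ball.diff (hmK i)), hpre, div_lt_iff₀ (by positivity)]
      refine (H _ (hx i) (r i * R) (by positivity) hi).trans_lt ?_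
      rw [mul_pow]
      calc ε / (2 * R ^ d) * (r i ^ d * R ^ d) = ε / 2 * r i ^ d := by field_simp
        _ < _ := by gcongr; linarith
    have := ENNReal.tendsto_ofReal key
    simpa [ofReal_measureReal] using this
  · intro R ρ hρ b hb
    rw [volume_ball_ofReal d hρ] at hb
    obtain ⟨ε, hε, hεb⟩ : ∃ ε > 0, ENNReal.ofReal ((1 + ε) * om d * ρ ^ d) ≤ b := by
      have : Tendsto (fun ε : ℝ => ENNReal.ofReal ((1 + ε) * om d * ρ ^ d)) (𝓝[>] 0)
          (𝓝 (ENNReal.ofReal (ρ ^ d * (ballVol d).toReal))) := by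
        refine ENNReal.tendsto_ofReal ?_
        have : Tendsto (fun ε : ℝ => (1 + ε) * om d * ρ ^ d) (𝓝 0) (𝓝 ((1 + 0) * om d * ρ ^ d)) :=
          Continuous.tendsto (by fun_prop) 0
        rw [add_zero, one_mul, mul_comm] at this
        exact this.mono_left nhdsWithin_le_nhds
      obtain ⟨ε, h1, h2⟩ := ((this.eventually_lt_const hb).and self_mem_nhdsWithin).exists
      exact ⟨ε, h2, h1.le⟩
    obtain ⟨δ, hδ, H⟩ := h ε hε
    have h2 := hr0.mul_const ρ
    rw [zero_mul] at h2
    filter_upwards [h2.eventually_lt_const hδ] with i hi z hz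
    refine le_trans ?_ hεb
    have hi0 := hr i
    refine ENNReal.le_ofReal_iff_toReal_le (measure_ne_top _ _) (by positivity) |>.2 ?_
    rw [← measureReal_def, hball, div_le_iff₀ (by positivity)]
    refine ((H _ hz.1 _ (by positivity) hi).2).trans (le_of_eq ?_)
    rw [mul_pow]; ring
  · intro R ρ hρ b hb
    rw [volume_ball_ofReal d hρ] at hb
    obtain ⟨ε, hε, hεb⟩ : ∃ ε > 0, b ≤ ENNReal.ofReal ((1 - ε) * om d * ρ ^ d) := by
      have : Tendsto (fun ε : ℝ => ENNReal.ofReal ((1 - ε) * om d * ρ ^ d)) (𝓝[>] 0)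
          (𝓝 (ENNReal.ofReal (ρ ^ d * (ballVol d).toReal))) := by
        refine ENNReal.tendsto_ofReal ?_
        have : Tendsto (fun ε : ℝ => (1 - ε) * om d * ρ ^ d) (𝓝 0) (𝓝 ((1 - 0) * om d * ρ ^ d)) :=
          Continuous.tendsto (by fun_prop) 0
        rw [sub_zero, one_mul, mul_comm] at this
        exact this.mono_left nhdsWithin_le_nhds
      obtain ⟨ε, h1, h2⟩ := ((this.eventually_const_lt hb).and self_mem_nhdsWithin).exists
      exact ⟨ε, h2, h1.le⟩
    obtain ⟨δ, hδ, H⟩ := h ε hε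
    have h2 := hr0.mul_const ρ
    rw [zero_mul] at h2
    filter_upwards [h2.eventually_lt_const hδ] with i hi z hz
    refine hεb.trans ?_
    have hi0 := hr i
    refine ENNReal.ofReal_le_iff_le_toReal (measure_ne_top _ _) |>.2 ?_
    rw [← measureReal_def, hball, le_div_iff₀ (by positivity)]
    refine le_trans (le_of_eq ?_) ((H _ hz.1 _ (by positivity) hi).1)
    rw [mul_pow]; ring

/-- A subset of small complement is dense at small scales. -/
lemma Dens.exists_near {d : ℕ} {μ : Measure E} [IsFiniteMeasure μ] {K : Set E} (h : Dens d μ K) :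
    ∃ δ > 0, ∀ r, 0 < r → r < δ → ∀ z ∈ K, ∀ G B : Set E, ball z r ⊆ B →
      μ.real (B \ G) < om d / 2 * r ^ d → ∃ y ∈ G, dist y z < r := by
  obtain ⟨δ, hδ, H⟩ := h (1 / 2) (by norm_num)
  refine ⟨δ, hδ, fun r hr hrδ z hz G B hB hlt => ?_⟩
  by_contra! hcon
  have h1 := (H z hz r hr hrδ).1
  have h2 : μ.real (ball z r) ≤ μ.real (B \ G) :=
    measureReal_mono fun w hw => ⟨hB hw, fun hG => (hcon w hG).not_gt hw⟩
  nlinarith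
end

section
variable {E : Type*} [NormedAddCommGroup E] [InnerProductSpace ℝ E] [FiniteDimensional ℝ E]
  [MeasurableSpace E] [BorelSpace E]

lemma dil_submodule (V : Submodule ℝ E) {r : ℝ} (hr : 0 < r) : dil 0 r (V : Set E) = V := by
  ext a
  simp only [mem_dil, zero_add, SetLike.mem_coe]
  exact V.smul_mem_iff hr.ne'

lemma Unif.eq_submodule_of_flat_ge {d : ℕ} {ν : Measure E} {S : Set E} (h : Unif d ν S) {R : ℝ}
    (hR : 0 < R) (hF : ∀ r ≥ R, Fl d (flatEps d) (_root_.dil 0 r S)) :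
    ∃ V : Submodule ℝ E, Module.finrank ℝ V = d ∧ S = V := by
  obtain ⟨V, hV, hS⟩ := (h.dil h.zero_mem hR).eq_submodule_of_flat (fun r hr => by
    rw [dil_dil]
    simpa using hF (R * r) (by nlinarith))
  refine ⟨V, hV, ?_⟩
  have h1 := congrArg (_root_.dil 0 R⁻¹) hS
  rw [dil_dil, dil_submodule V (by positivity), mul_inv_cancel₀ hR.ne'] at h1
  simpa [dil_zero_one] using h1

lemma ulim_dil_subset {ι : Type*} {𝒰 : Filter ι} {A : ι → Set E} {R : ℝ} (hR : 0 < R) :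
    ulim 𝒰 (fun i => dil 0 R (A i)) ⊆ dil 0 R (ulim 𝒰 A) := by
  intro w hw ε hε
  filter_upwards [hw (ε / R) (by positivity)] with i ⟨a, ha, haw⟩
  refine ⟨_, ha, ?_⟩
  simp only [zero_add]
  rw [dist_smul₀, Real.norm_of_nonneg hR.le]
  rwa [lt_div_iff₀' hR] at haw

lemma Fl.submodule {d : ℕ} {ε : ℝ} (hε : 0 ≤ ε) {V : Submodule ℝ E} (hV : Module.finrank ℝ V = d) :
    Fl d ε (V : Set E) := by
  obtain ⟨L, hL⟩ := exists_isometry_range V hV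
  exact Fl.of_range L hL.le hε

/-- Limits of blow-ups that are flat at all larger scales are planes. -/
lemma Dens.limit_eq_submodule {d : ℕ} {μ : Measure E} [IsFiniteMeasure μ] {K A : Set E}
    (hK : IsClosed K) (h : Dens d μ K) (hAK : A ⊆ K) (hA : Thin d μ K A) {ι : Type*}
    (𝒰 : Ultrafilter ι) {x : ι → E} (hx : ∀ i, x i ∈ A) {r : ι → ℝ} (hr : ∀ i, 0 < r i)
    (hr0 : Tendsto r 𝒰 (𝓝 0))
    (hF : ∀ R ≥ (3 : ℝ), ∀ᶠ i in (𝒰 : Filter ι), Fl d (flatEps d) (dil (x i) (r i * R) K)) :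
    ∃ V : Submodule ℝ E, Module.finrank ℝ V = d ∧
      (ulim 𝒰 fun i => dil (x i) (r i) K) = V ∧
      ∃ ν, Unif d ν (V : Set E) ∧
      ∀ f : E → ℝ, Continuous f → HasCompactSupport f →
      Tendsto (fun i => ∫ z, f z ∂(blow d μ (x i) (r i))) 𝒰 (𝓝 (∫ z, f z ∂ν)) := by
  obtain ⟨ν, hν, hlim⟩ := h.exists_limit hK hAK hA 𝒰 hx hr hr0
  obtain ⟨V, hV, hS⟩ := hν.eq_submodule_of_flat_ge three_pos (fun R hR => by
    have h1 := Fl.ulim (hF R hR)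
    refine h1.mono le_rfl ?_
    have h2 : ∀ i, dil (x i) (r i * R) K = dil 0 R (dil (x i) (r i) K) := fun i => by
      rw [dil_dil]; simp
    simp only [h2]
    exact ulim_dil_subset (by linarith))
  exact ⟨V, hV, hS, ν, hS ▸ hν, hlim⟩

/-- Flatness at one scale propagates to all smaller scales. -/
lemma Dens.flat_of_flat {d : ℕ} {μ : Measure E} [IsFiniteMeasure μ] {K A : Set E}
    (hK : IsClosed K) (h : Dens d μ K) (hAK : A ⊆ K) (hA : Thin d μ K A) :
    ∃ ε₁ > 0, ∃ δ > 0, ∀ x ∈ A, ∀ r, 0 < r → r < δ → Fl d ε₁ (dil x r K) →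
      ∀ r', 0 < r' → r' ≤ r → Fl d (flatEps d) (dil x r' K) := by
  by_contra! hcon
  have hpos : ∀ i : ℕ, (0:ℝ) < 1 / ((i : ℝ) + 1) := fun i => by positivity
  choose x hx r hr hrδ hF t ht htr hbad using fun i : ℕ =>
    hcon (1 / ((i : ℝ) + 1)) (hpos i) (1 / ((i : ℝ) + 1)) (hpos i)
  have : ∀ i, ∃ s, 0 < s ∧ s ≤ r i ∧ ¬ Fl d (flatEps d) (dil (x i) s K) ∧
      ∀ s', 2 * s < s' → s' ≤ r i → Fl d (flatEps d) (dil (x i) s' K) := by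
    intro i
    let B := {s | 0 < s ∧ s ≤ r i ∧ ¬ Fl d (flatEps d) (dil (x i) s K)}
    have hne : (B).Nonempty := ⟨t i, ht i, htr i, hbad i⟩
    have hbd : BddAbove B := ⟨r i, fun s hs => hs.2.1⟩
    have hsup : 0 < sSup B := (ht i).trans_le (le_csSup hbd ⟨ht i, htr i, hbad i⟩)
    obtain ⟨s, hs, hlt⟩ := exists_lt_of_lt_csSup hne (half_lt_self hsup)
    refine ⟨s, hs.1, hs.2.1, hs.2.2, fun s' h1 h2 => ?_⟩
    by_contra hb
    have : s' ≤ sSup B := le_csSup hbd ⟨by linarith [hs.1], h2, hb⟩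
    linarith
  choose s hs hsr hsb hgood using this
  let 𝒰 : Ultrafilter ℕ := hyperfilter ℕ
  have h𝒰 : (𝒰 : Filter ℕ) ≤ atTop := Nat.hyperfilter_le_atTop
  have hone : Tendsto (fun i : ℕ => 1 / ((i : ℝ) + 1)) 𝒰 (𝓝 0) :=
    tendsto_one_div_add_atTop_nhds_zero_nat.mono_left h𝒰
  have hs0 : Tendsto s 𝒰 (𝓝 0) := squeeze_zero (fun i => (hs i).le)
    (fun i => (hsr i).trans (hrδ i).le) hone
  have hfe := flatEps_pos d
  have hbig : ∀ R : ℝ, 0 < R → ∀ᶠ i in (𝒰 : Filter ℕ), s i * R ≤ r i := by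
    intro R hR
    by_contra hcon
    have hcon' := Ultrafilter.eventually_not.2 hcon
    have h3 := hone.mul_const R
    rw [zero_mul] at h3
    obtain ⟨i, h1, h2⟩ := (hcon'.and (h3.eventually_lt_const hfe)).exists
    push Not at h1
    have hri := hr i
    have hsi := hs i
    have := (hF i).scale (t := s i / r i) (by positivity) ((div_le_one hri).2 (hsr i))
    rw [mul_div_cancel₀ _ hri.ne'] at this
    refine hsb i (this.mono ?_ Subset.rfl)
    have h4 : r i / s i ≤ R := by rw [div_le_iff₀ hsi]; linarith
    calc 1 / ((i : ℝ) + 1) / (s i / r i) = 1 / ((i : ℝ) + 1) * (r i / s i) := by field_simp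
      _ ≤ 1 / ((i : ℝ) + 1) * R := by gcongr
      _ ≤ _ := h2.le
  obtain ⟨V, hV, hS, -⟩ := h.limit_eq_submodule hK hAK hA 𝒰 hx hs hs0 (fun R hR => by
    filter_upwards [hbig R (by linarith)] with i hi
    exact hgood i _ (by nlinarith [hs i]) hi)
  have h5 : Fl d (flatEps d / 2) (ulim 𝒰 fun i => dil (x i) (s i) K) := by
    rw [hS]; exact Fl.submodule (by positivity) hV
  obtain ⟨i, hi⟩ := (h5.of_ulim (half_lt_self hfe)).exists
  exact hsb i hi

lemma Fl.translate {d : ℕ} {ε η : ℝ} {x y : E} {r : ℝ} (hr : 0 < r) {K : Set E}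
    (h : Fl d ε (dil x r K)) (hxy : ‖x - y‖ ≤ η * r) : Fl d (ε + η) (dil y r K) := by
  obtain ⟨L, hL⟩ := h
  refine ⟨L, fun c hc => ?_⟩
  obtain ⟨a, ha, h⟩ := hL c hc
  refine ⟨a + r⁻¹ • (x - y), ?_, ?_⟩
  · rw [mem_dil] at ha ⊢
    rw [smul_add, smul_inv_smul₀ hr.ne']
    convert ha using 1
    abel
  · calc ‖a + r⁻¹ • (x - y) - L c‖ = ‖(a - L c) + r⁻¹ • (x - y)‖ := by congr 1; abel
      _ ≤ ‖a - L c‖ + ‖r⁻¹ • (x - y)‖ := norm_add_le _ _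
      _ ≤ ε + η := by
        gcongr
        rw [norm_smul, norm_inv, Real.norm_of_nonneg hr.le, inv_mul_le_iff₀ hr]
        linarith

/-- `E` is a subset of `K` with uniform density one, at whose points `K` has flat limits. -/
structure FlatPiece (d : ℕ) (μ : Measure E) (K A : Set E) : Prop where
  closed : IsClosed K
  closed' : IsClosed A
  sub : A ⊆ K
  dens : Dens d μ K
  thin : Thin d μ K A
  flat : ∃ δ > 0, ∀ x ∈ A, ∀ r, 0 < r → r < δ → Fl d (flatEps d) (dil x r K)

lemma Dens.exists_flatPiece {d : ℕ} {μ : Measure E} [IsFiniteMeasure μ] {K : Set E}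
    (hK : IsClosed K) (h : Dens d μ K) (hμ : μ K ≠ 0) : ∃ A, FlatPiece d μ K A ∧ μ A ≠ 0 := by
  have hom := om_pos d
  obtain ⟨A, hAK, hAc, hA, hAm⟩ := exists_thin hK h (ENNReal.half_pos hμ).ne'
  have hA0 : μ A ≠ 0 := by
    intro h0
    have h1 : μ K ≤ μ K / 2 := calc
      μ K ≤ μ (K \ A ∪ A) := measure_mono (by simp)
      _ ≤ μ (K \ A) + μ A := measure_union_le _ _
      _ ≤ μ K / 2 := by rw [h0, add_zero]; exact hAm
    exact (ENNReal.half_lt_self hμ (measure_ne_top _ _)).not_ge h1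
  obtain ⟨B, hBA, hBc, hB, hBm⟩ := exists_thin hAc (h.mono hAK) (ENNReal.half_pos hA0).ne'
  have hB0 : B.Nonempty := by
    rw [nonempty_iff_ne_empty]
    rintro rfl
    rw [diff_empty] at hBm
    exact (ENNReal.half_lt_self hA0 (measure_ne_top _ _)).not_ge hBm
  obtain ⟨x, hx⟩ := hB0
  obtain ⟨ε₁, hε₁, δ, hδ, hC⟩ := h.flat_of_flat hK hAK hA
  let 𝒰 : Ultrafilter ℕ := hyperfilter ℕ
  have h𝒰 : (𝒰 : Filter ℕ) ≤ atTop := Nat.hyperfilter_le_atTop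
  have hone : Tendsto (fun i : ℕ => 1 / ((i : ℝ) + 1)) 𝒰 (𝓝 0) :=
    tendsto_one_div_add_atTop_nhds_zero_nat.mono_left h𝒰
  have hpos : ∀ i : ℕ, (0:ℝ) < 1 / ((i : ℝ) + 1) := fun i => by positivity
  obtain ⟨ν, hν, -⟩ := (h.mono hAK).exists_limit hAc hBA hB 𝒰 (fun _ => hx) hpos hone
  obtain ⟨z, hz, ρ, hρ, hF⟩ := hν.hasFlat (ε₁ / 4) (by positivity)
  obtain ⟨a, ha, haz⟩ := exists_seq_of_mem_ulim (fun i => hAc.dil x _)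
    (fun i => ⟨0, by simpa [mem_dil] using hBA hx⟩) hz
  have hF' := (hF.mono le_rfl (dil_ulim_subset haz hρ)).of_ulim
    (show ε₁ / 4 < ε₁ / 2 by linarith)
  set C := ‖z‖ + 1 + ρ * (ε₁ / 2) with hCdef
  have hC0 : 0 < C := by positivity
  obtain ⟨δ₂, hδ₂, hB'⟩ := hB (om d / 4 * (ρ * (ε₁ / 2)) ^ d / C ^ d) (by positivity)
  obtain ⟨δ₃, hδ₃, hD⟩ := h (1 / 2) (by norm_num)
  have e1 := hone.mul_const C
  have e2 := hone.mul_const (ρ * (ε₁ / 2))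
  have e3 := hone.mul_const ρ
  rw [zero_mul] at e1 e2 e3
  obtain ⟨i, hi, h1, h2, h3, h4⟩ := (hF'.and ((haz.norm.eventually_lt_const (lt_add_one _)).and
    ((e1.eventually_lt_const hδ₂).and ((e2.eventually_lt_const hδ₃).and
      (e3.eventually_lt_const hδ))))).exists
  have hri := hpos i
  set r := 1 / ((i : ℝ) + 1) with hr
  rw [dil_dil] at hi
  set y := x + r • a i with hy
  have hyA : y ∈ A := ha i
  have hη : 0 < r * (ρ * (ε₁ / 2)) := by positivity
  refine ⟨A ∩ closedBall y (r * (ρ * (ε₁ / 2))), ⟨hK, hAc.inter isClosed_closedBall,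
    inter_subset_left.trans hAK, h, hA.mono inter_subset_left, r * ρ, by positivity, ?_⟩, ?_⟩
  · intro w hw s hs hsr
    refine hC w hw.1 (r * ρ) (by positivity) h4 ?_ s hs hsr.le
    have := (hi.mono le_rfl (dil_mono hAK)).translate (η := ε₁ / 2) (y := w) (by positivity) (by
      rw [← dist_eq_norm, dist_comm]
      refine (mem_closedBall.1 hw.2).trans (le_of_eq ?_)
      ring)
    rwa [add_halves] at this
  · have g1 := (hD y (hAK hyA) _ hη h3).1
    have g2 := hB' x hx (r * C) (by positivity) h2
    have g3 : ball y (r * (ρ * (ε₁ / 2))) ⊆ ball x (r * C) := by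
      apply ball_subset_ball'
      rw [hy, dist_eq_norm, add_sub_cancel_left, norm_smul, Real.norm_of_nonneg hri.le, hCdef]
      nlinarith
    have g4 : μ.real (ball y (r * (ρ * (ε₁ / 2)))) ≤
        μ.real (ball x (r * C) \ A) + μ.real (A ∩ closedBall y (r * (ρ * (ε₁ / 2)))) := by
      refine le_trans (measureReal_mono ?_) (measureReal_union_le _ _)
      intro w hw
      by_cases hwA : w ∈ A
      · exact Or.inr ⟨hwA, ball_subset_closedBall hw⟩
      · exact Or.inl ⟨g3 hw, hwA⟩
    intro h0
    rw [measureReal_def (s := A ∩ _), h0, ENNReal.toReal_zero, add_zero] at g4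
    have g5 : om d / 4 * (ρ * (ε₁ / 2)) ^ d / C ^ d * (r * C) ^ d = om d / 4 * (r * (ρ * (ε₁ / 2))) ^ d := by
      rw [mul_pow r C, mul_pow r (ρ * _)]; field_simp
    rw [g5] at g2
    have g6 : 0 < om d * (r * (ρ * (ε₁ / 2))) ^ d := by positivity
    nlinarith
end

section
variable {E : Type*} [NormedAddCommGroup E] [InnerProductSpace ℝ E] [FiniteDimensional ℝ E]
  [MeasurableSpace E] [BorelSpace E]

lemma exists_ultrafilter_lim {ι X : Type*} [PseudoMetricSpace X] [ProperSpace X] (𝒰 : Ultrafilter ι)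
    {a : ι → X} (c : X) (R : ℝ) (h : ∀ᶠ i in (𝒰 : Filter ι), dist (a i) c ≤ R) :
    ∃ z, Tendsto a 𝒰 (𝓝 z) := by
  obtain ⟨z, -, hz⟩ := (isCompact_closedBall c R).ultrafilter_le_nhds (𝒰.map a)
    (Filter.le_principal_iff.2 h)
  exact ⟨z, hz⟩

variable {d : ℕ} {μ : Measure E} [IsFiniteMeasure μ] {K A : Set E}

lemma FlatPiece.limit (hP : FlatPiece d μ K A) {ι : Type*}
    (𝒰 : Ultrafilter ι) {x : ι → E} (hx : ∀ i, x i ∈ A) {r : ι → ℝ} (hr : ∀ i, 0 < r i)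
    (hr0 : Tendsto r 𝒰 (𝓝 0)) :
    ∃ V : Submodule ℝ E, Module.finrank ℝ V = d ∧ (ulim 𝒰 fun i => dil (x i) (r i) K) = V := by
  obtain ⟨δ, hδ, hF⟩ := hP.flat
  obtain ⟨V, h1, h2, -⟩ := hP.dens.limit_eq_submodule hP.closed hP.sub hP.thin 𝒰 hx hr hr0
    (fun R hR => by
      have h3 := hr0.mul_const R
      rw [zero_mul] at h3
      filter_upwards [h3.eventually_lt_const hδ] with i hi
      exact hF _ (hx i) _ (by have := hr i; positivity) hi)
  exact ⟨V, h1, h2⟩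

/-- A subset of asymptotically full measure has the same blow-up limits. -/
lemma Dens.mem_ulim (h : Dens d μ K) {ι : Type*} {𝒰 : Filter ι} {x : ι → E} {r : ι → ℝ}
    (hr : ∀ i, 0 < r i) (hr0 : Tendsto r 𝒰 (𝓝 0)) {Λ : ℝ} {e : ι → ℝ} (he : Tendsto e 𝒰 (𝓝 0))
    (hA : ∀ i, μ.real (ball (x i) (Λ * r i) \ A) ≤ e i * r i ^ d) {v : E}
    (hv : v ∈ ulim 𝒰 fun i => dil (x i) (r i) K) (hvΛ : ‖v‖ + 1 ≤ Λ) :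
    v ∈ ulim 𝒰 fun i => dil (x i) (r i) A := by
  have hom := om_pos d
  intro ε hε
  obtain ⟨δ, hδ, H⟩ := h.exists_near
  set η := min (ε / 2) (1 / 2) with hη
  have hη0 : 0 < η := by positivity
  have hη1 : η ≤ ε / 2 := min_le_left _ _
  have hη2 : η ≤ 1 / 2 := min_le_right _ _
  have h3 := hr0.mul_const η
  rw [zero_mul] at h3
  filter_upwards [hv η hη0, h3.eventually_lt_const hδ,
    he.eventually_lt_const (show 0 < om d / 2 * η ^ d by positivity)] with i ⟨a, ha, hav⟩ hi hei
  have hri := hr i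
  obtain ⟨y, hy, hyd⟩ := H (r i * η) (by positivity) hi _ ha A (ball (x i) (Λ * r i)) (by
    apply ball_subset_ball'
    have h4 : ‖a‖ ≤ ‖v‖ + η := by
      have := norm_le_norm_add_norm_sub' a v
      rw [← dist_eq_norm] at this
      linarith
    rw [dist_eq_norm, add_sub_cancel_left, norm_smul, Real.norm_of_nonneg hri.le]
    nlinarith) (by
    refine (hA i).trans_lt ?_
    rw [mul_pow]
    have : 0 < r i ^ d := by positivity
    nlinarith)
  refine ⟨(r i)⁻¹ • (y - x i), by simpa [mem_dil, smul_inv_smul₀ hri.ne'] using hy, ?_⟩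
  have h5 : dist ((r i)⁻¹ • (y - x i)) a < η := by
    rw [dist_eq_norm]
    have : (r i)⁻¹ • (y - x i) - a = (r i)⁻¹ • (y - (x i + r i • a)) := by
      rw [← sub_sub, smul_sub (r i)⁻¹ (y - x i), inv_smul_smul₀ hri.ne']
    rw [this, norm_smul, norm_inv, Real.norm_of_nonneg hri.le, ← dist_eq_norm, inv_mul_lt_iff₀ hri]
    exact hyd
  calc _ ≤ dist ((r i)⁻¹ • (y - x i)) a + dist a v := dist_triangle _ _ _
    _ < η + η := add_lt_add h5 hav
    _ ≤ ε := by linarith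

/-- At an untilted scale where `A` has almost full measure, the projection of `A` has no large
holes. -/
lemma FlatPiece.exists_over (hP : FlatPiece d μ K A) (π : E →L[ℝ] Euc d) {κ Λ : ℝ} (hκ : 0 < κ)
    (hΛ : 4 + 1 / κ ≤ Λ) :
    ∃ ε > 0, ∃ δ > 0, ∀ x ∈ A, ∀ r, 0 < r → r < δ →
      (∀ y ∈ A, r ≤ dist y x → dist y x ≤ Λ * r → κ * dist y x ≤ ‖π (y - x)‖) →
      μ.real (ball x (Λ * r) \ A) < ε * (Λ * r) ^ d →
      ∀ p, dist p (π x) ≤ r → ∃ x' ∈ A, dist x' x ≤ Λ * r ∧ dist (π x') p ≤ r / 4 := by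
  by_contra! hcon
  have hpos : ∀ i : ℕ, (0:ℝ) < 1 / ((i : ℝ) + 1) := fun i => by positivity
  choose x hx r hr hrδ htilt hm p hp hbad using fun i : ℕ =>
    hcon (1 / ((i : ℝ) + 1)) (hpos i) (1 / ((i : ℝ) + 1)) (hpos i)
  let 𝒰 : Ultrafilter ℕ := hyperfilter ℕ
  have hone : Tendsto (fun i : ℕ => 1 / ((i : ℝ) + 1)) 𝒰 (𝓝 0) :=
    tendsto_one_div_add_atTop_nhds_zero_nat.mono_left Nat.hyperfilter_le_atTop
  have hr0 : Tendsto r 𝒰 (𝓝 0) := squeeze_zero (fun i => (hr i).le) (fun i => (hrδ i).le) hone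
  obtain ⟨V, hV, hS⟩ := hP.limit 𝒰 hx hr hr0
  have hκ1 : 0 < 1 / κ := by positivity
  have hfill : ∀ v ∈ V, ‖v‖ ≤ 3 + 1 / κ → ∃ a : ℕ → E, (∀ i, x i + r i • a i ∈ A) ∧ Tendsto a 𝒰 (𝓝 v) := by
    intro v hv hvn
    have h1 := hone.mul_const (Λ ^ d)
    rw [zero_mul] at h1
    have h2 := hP.dens.mem_ulim (A := A) hr hr0 (Λ := Λ) h1 (fun i => by
      rw [mul_assoc, ← mul_pow]; exact (hm i).le) (v := v) (by rw [hS]; exact hv) (by linarith)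
    exact exists_seq_of_mem_ulim (fun i => hP.closed'.dil _ _)
      (fun i => ⟨0, by simpa [mem_dil] using hx i⟩) h2
  have hπ : ∀ v ∈ V, κ * ‖v‖ ≤ ‖π v‖ := by
    intro v hv
    rcases eq_or_ne v 0 with rfl | hv0
    · simp
    by_contra! hlt
    have hvn : 0 < ‖v‖ := norm_pos_iff.2 hv0
    have hn : ‖(2 / ‖v‖) • v‖ = 2 := by
      rw [norm_smul, Real.norm_of_nonneg (by positivity)]; field_simp
    have hn' : ‖π ((2 / ‖v‖) • v)‖ < κ * ‖(2 / ‖v‖) • v‖ := by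
      rw [map_smul, norm_smul, norm_smul, Real.norm_of_nonneg (by positivity), mul_left_comm]
      gcongr
    obtain ⟨a, ha, hav⟩ := hfill _ (V.smul_mem (2 / ‖v‖) hv) (by rw [hn]; linarith)
    have h1 := hav.norm
    have h2 := ((π.continuous.tendsto _).comp hav).norm
    obtain ⟨i, h3, h4, h5⟩ := ((h2.eventually_lt (h1.const_mul κ) hn').and
      ((h1.eventually_const_lt (show (1:ℝ) < _ by rw [hn]; norm_num)).and
      (h1.eventually_lt_const (show _ < (3:ℝ) by rw [hn]; norm_num)))).exists
    have hri := hr i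
    have h6 : dist (x i + r i • a i) (x i) = r i * ‖a i‖ := by
      rw [dist_eq_norm, add_sub_cancel_left, norm_smul, Real.norm_of_nonneg hri.le]
    have h7 := htilt i _ (ha i) (by rw [h6]; nlinarith) (by rw [h6]; nlinarith)
    rw [h6, add_sub_cancel_left, map_smul, norm_smul, Real.norm_of_nonneg hri.le] at h7
    simp only [Function.comp_apply] at h3
    nlinarith
  have hsurj : ∀ q, ∃ w ∈ V, π w = q := by
    have hinj : Function.Injective ((π : E →ₗ[ℝ] Euc d).domRestrict V) := by
      rw [← LinearMap.ker_eq_bot, LinearMap.ker_eq_bot']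
      intro m hm
      have h1 := hπ m m.2
      have h2 : π m = 0 := hm
      rw [h2, norm_zero] at h1
      have : ‖(m : E)‖ = 0 := le_antisymm (by nlinarith [norm_nonneg (m : E)]) (norm_nonneg _)
      exact Subtype.ext (norm_eq_zero.1 this)
    have := (LinearMap.injective_iff_surjective_of_finrank_eq_finrank (by rw [hV]; simp)).1 hinj
    intro q
    obtain ⟨w, hw⟩ := this q
    exact ⟨w, w.2, hw⟩
  have hqb : ∀ i, dist ((r i)⁻¹ • (p i - π (x i))) 0 ≤ 1 := fun i => by
    have hri := hr i
    rw [dist_zero_right, norm_smul, norm_inv, Real.norm_of_nonneg hri.le, ← dist_eq_norm,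
      inv_mul_le_iff₀ hri, mul_one]
    exact hp i
  obtain ⟨q, hq⟩ := exists_ultrafilter_lim 𝒰 0 1 (Eventually.of_forall hqb)
  have hqn : ‖q‖ ≤ 1 := le_of_tendsto hq.norm (Eventually.of_forall fun i => by simpa using hqb i)
  obtain ⟨w, hwV, hw⟩ := hsurj q
  have hwn : ‖w‖ ≤ 1 / κ := by
    rw [le_div_iff₀ hκ]
    have := hπ w hwV
    rw [hw] at this; linarith
  obtain ⟨a, ha, haw⟩ := hfill w hwV (by linarith)
  have h1 := ((π.continuous.tendsto _).comp haw).sub hq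
  rw [hw, sub_self] at h1
  have h2 := h1.norm
  rw [norm_zero] at h2
  obtain ⟨i, h3, h4⟩ := ((h2.eventually_lt_const (show (0:ℝ) < 1 / 4 by norm_num)).and
    (haw.norm.eventually_lt_const (show ‖w‖ < Λ by linarith))).exists
  have hri := hr i
  have h5 := hbad i _ (ha i) (by
    rw [dist_eq_norm, add_sub_cancel_left, norm_smul, Real.norm_of_nonneg hri.le]
    nlinarith)
  have h6 : π (x i + r i • a i) - p i = r i • ((⇑π ∘ a) i - (r i)⁻¹ • (p i - π (x i))) := by
    rw [smul_sub, smul_inv_smul₀ hri.ne', map_add, map_smul, Function.comp_apply]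
    abel
  rw [dist_eq_norm, h6, norm_smul, Real.norm_of_nonneg hri.le] at h5
  nlinarith

/-- At a tilted scale the measure piles up over the projection. -/
lemma FlatPiece.tube (hP : FlatPiece d μ K A) {π : E →L[ℝ] Euc d} (hπ : ‖π‖ ≤ 1) (N : ℕ) :
    ∃ δ > 0, ∀ x ∈ A, ∀ y ∈ A, 0 < dist y x → dist y x < δ →
      ‖π (y - x)‖ < 1 / (8 * ((N : ℝ) + 1)) * dist y x →
      N * (om d / 2 * (dist y x / 16) ^ d) ≤
        μ.real (ball x ((N + 1) * dist y x) ∩ π ⁻¹' closedBall (π x) (dist y x)) := by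
  by_contra! hcon
  have hpos : ∀ i : ℕ, (0:ℝ) < 1 / ((i : ℝ) + 1) := fun i => by positivity
  choose x hx y hy hr hrδ htilt hbad using fun i : ℕ => hcon (1 / ((i : ℝ) + 1)) (hpos i)
  set r := fun i => dist (y i) (x i) with hrdef
  let 𝒰 : Ultrafilter ℕ := hyperfilter ℕ
  have hone : Tendsto (fun i : ℕ => 1 / ((i : ℝ) + 1)) 𝒰 (𝓝 0) :=
    tendsto_one_div_add_atTop_nhds_zero_nat.mono_left Nat.hyperfilter_le_atTop
  have hr0 : Tendsto r 𝒰 (𝓝 0) := squeeze_zero (fun i => (hr i).le) (fun i => (hrδ i).le) hone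
  obtain ⟨V, hV, hS⟩ := hP.limit 𝒰 hx hr hr0
  have hvb : ∀ i, ‖(r i)⁻¹ • (y i - x i)‖ = 1 := fun i => by
    rw [norm_smul, norm_inv, Real.norm_of_nonneg (hr i).le, ← dist_eq_norm]
    exact inv_mul_cancel₀ (hr i).ne'
  obtain ⟨v, hv⟩ := exists_ultrafilter_lim 𝒰 (a := fun i => (r i)⁻¹ • (y i - x i)) (0:E) 1 (Eventually.of_forall fun i => by
    rw [dist_zero_right]; exact (hvb i).le)
  have hvn : ‖v‖ = 1 := tendsto_nhds_unique hv.norm (by simp [hvb])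
  have hvV : v ∈ V := by
    have : v ∈ ulim 𝒰 fun i => dil (x i) (r i) K := mem_ulim_of_tendsto (fun i => by
      rw [mem_dil, smul_inv_smul₀ (hr i).ne']
      simpa using hP.sub (hy i)) hv
    rwa [hS] at this
  have hπv : ‖π v‖ ≤ 1 / (8 * ((N : ℝ) + 1)) := by
    refine le_of_tendsto ((π.continuous.tendsto _).comp hv).norm (Eventually.of_forall fun i => ?_)
    rw [Function.comp_apply, map_smul, norm_smul, norm_inv, Real.norm_of_nonneg (hr i).le,
      inv_mul_le_iff₀ (hr i)]
    linarith [htilt i]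
  obtain ⟨δ, hδ, hD⟩ := hP.dens (1 / 2) (by norm_num)
  have hk : ∀ᶠ i in (𝒰 : Filter ℕ), ∀ k : Fin N, ∃ a ∈ dil (x i) (r i) K, dist a ((k : ℝ) • v) < 1 / 16 := by
    rw [Filter.eventually_all]
    intro k
    have : ((k : ℝ) • v) ∈ ulim 𝒰 fun i => dil (x i) (r i) K := by
      rw [hS]; exact V.smul_mem _ hvV
    exact this _ (by norm_num)
  have h3 := hr0.mul_const (1 / 16)
  rw [zero_mul] at h3
  obtain ⟨i, hi, hi2⟩ := (hk.and (h3.eventually_lt_const hδ)).exists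
  choose a ha hav using hi
  refine (hbad i).not_ge ?_
  change (N : ℝ) * (om d / 2 * (r i / 16) ^ d) ≤ _
  have hri := hr i
  change 0 < r i at hri
  have hna : ∀ k : Fin N, dist (a k) ((k : ℝ) • v) < 1 / 16 := hav
  have hdisj : Pairwise (Function.onFun Disjoint fun k : Fin N => ball (x i + r i • a k) (r i / 16)) := by
    intro k l hkl
    apply ball_disjoint_ball
    rw [dist_add_left, dist_smul₀, Real.norm_of_nonneg hri.le]
    have h5 : 1 ≤ dist ((k : ℝ) • v) ((l : ℝ) • v) := by
      rw [dist_eq_norm, ← sub_smul, norm_smul, hvn, mul_one, Real.norm_eq_abs]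
      have : (1:ℤ) ≤ |((k : ℕ) : ℤ) - ((l : ℕ) : ℤ)| := by
        apply Int.one_le_abs
        intro h
        apply hkl
        ext
        omega
      exact_mod_cast this
    have h6 := dist_triangle4 ((k : ℝ) • v) (a k) (a l) ((l : ℝ) • v)
    rw [dist_comm ((k : ℝ) • v) (a k)] at h6
    nlinarith [hna k, hna l]
  calc (N : ℝ) * (om d / 2 * (r i / 16) ^ d) = ∑ k : Fin N, (om d / 2 * (r i / 16) ^ d) := by simp
    _ ≤ ∑ k : Fin N, μ.real (ball (x i + r i • a k) (r i / 16)) := by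
      refine Finset.sum_le_sum fun k _ => ?_
      have := (hD _ (ha k) (r i / 16) (by positivity) (by linarith)).1
      linarith
    _ = μ.real (⋃ k : Fin N, ball (x i + r i • a k) (r i / 16)) :=
      (measureReal_iUnion_fintype hdisj fun k => measurableSet_ball).symm
    _ ≤ _ := by
      refine measureReal_mono (iUnion_subset fun k => ?_)
      have hkN : ((k : ℕ) : ℝ) + 1 ≤ N := by exact_mod_cast k.2
      have hkv : ‖a k - (k : ℝ) • v‖ < 1 / 16 := by rw [← dist_eq_norm]; exact hna k
      refine subset_inter (ball_subset_ball' ?_) fun z hz => ?_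
      · rw [dist_eq_norm, add_sub_cancel_left, norm_smul, Real.norm_of_nonneg hri.le]
        have h7 : ‖a k‖ ≤ ‖a k - (k : ℝ) • v‖ + k := by
          have := norm_le_norm_sub_add (a k) ((k : ℝ) • v)
          rwa [norm_smul, hvn, mul_one, Real.norm_of_nonneg (by positivity)] at this
        change r i / 16 + r i * ‖a k‖ ≤ (N + 1) * r i
        nlinarith
      · rw [mem_preimage, mem_closedBall, dist_eq_norm, ← map_sub]
        have h8 : z - x i = (z - (x i + r i • a k)) + r i • (a k - (k : ℝ) • v) + (r i * k) • v := by
          rw [smul_sub, smul_smul]; abel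
        have hle : ∀ w, ‖π w‖ ≤ ‖w‖ := fun w => π.le_of_opNorm_le_of_le hπ le_rfl |>.trans (by simp)
        rw [h8, map_add, map_add, map_smul π (r i * k)]
        have h9 : ‖π (z - (x i + r i • a k))‖ ≤ r i / 16 := by
          refine (hle _).trans ?_
          rw [← dist_eq_norm]; exact (mem_ball.1 hz).le
        have h10 : ‖π (r i • (a k - (k : ℝ) • v))‖ ≤ r i * (1 / 16) := by
          refine (hle _).trans ?_
          rw [norm_smul, Real.norm_of_nonneg hri.le]
          gcongr
        have h11 : ‖(r i * k) • π v‖ ≤ r i * (1 / 8) := by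
          rw [norm_smul, Real.norm_of_nonneg (by positivity), mul_assoc]
          gcongr
          calc (k : ℝ) * ‖π v‖ ≤ (N + 1) * (1 / (8 * ((N : ℝ) + 1))) := by gcongr; linarith
            _ = 1 / 8 := by field_simp
        calc _ ≤ r i / 16 + r i * (1 / 16) + r i * (1 / 8) := norm_add₃_le.trans (by gcongr)
          _ ≤ r i := by linarith

/-- Near a point with limit plane `V`, on which `π` is isometric, pairs of points at distance
comparable to the scale are not tilted. -/
lemma FlatPiece.untilted {π : E →L[ℝ] Euc d} {ι : Type*}
    {𝒰 : Ultrafilter ι} {x₀ : E} {r : ι → ℝ} (hr : ∀ i, 0 < r i) {V : Submodule ℝ E}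
    (hS : (ulim 𝒰 fun i => dil x₀ (r i) K) = V) (hπ : ∀ v ∈ V, ‖π v‖ = ‖v‖) (M : ℝ) {τ : ℝ}
    (hτ : 0 < τ) :
    ∀ᶠ i in (𝒰 : Filter ι), ∀ x ∈ K, ∀ y ∈ K, dist x x₀ ≤ M * r i → dist y x₀ ≤ M * r i →
      τ * r i ≤ dist y x → 1 / 2 * dist y x ≤ ‖π (y - x)‖ := by
  by_contra hcon
  have hcon' := Ultrafilter.eventually_not.2 hcon
  have : ∀ i, ∃ x y, (¬ (∀ x ∈ K, ∀ y ∈ K, dist x x₀ ≤ M * r i → dist y x₀ ≤ M * r i →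
      τ * r i ≤ dist y x → 1 / 2 * dist y x ≤ ‖π (y - x)‖)) → x ∈ K ∧ y ∈ K ∧ dist x x₀ ≤ M * r i ∧
      dist y x₀ ≤ M * r i ∧
      τ * r i ≤ dist y x ∧ ‖π (y - x)‖ < 1 / 2 * dist y x := by
    intro i
    by_cases h : (∀ x ∈ K, ∀ y ∈ K, dist x x₀ ≤ M * r i → dist y x₀ ≤ M * r i →
      τ * r i ≤ dist y x → 1 / 2 * dist y x ≤ ‖π (y - x)‖)
    · exact ⟨0, 0, fun h' => absurd h h'⟩
    · have h' := h
      push Not at h'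
      obtain ⟨x, hx, y, hy, h1, h2, h3, h4⟩ := h'
      exact ⟨x, y, fun _ => ⟨hx, hy, h1, h2, h3, h4⟩⟩
  choose x y hxy using this
  have hev := hcon'.mono fun i hi => hxy i hi
  have hlim : ∀ z : ι → E, (∀ᶠ i in (𝒰 : Filter ι), z i ∈ K ∧ dist (z i) x₀ ≤ M * r i) →
      ∃ a ∈ V, Tendsto (fun i => (r i)⁻¹ • (z i - x₀)) 𝒰 (𝓝 a) := by
    intro z hz
    obtain ⟨a, ha⟩ := exists_ultrafilter_lim 𝒰 0 M (a := fun i => (r i)⁻¹ • (z i - x₀)) (by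
      filter_upwards [hz] with i hi
      rw [dist_zero_right, norm_smul, norm_inv, Real.norm_of_nonneg (hr i).le, ← dist_eq_norm,
        inv_mul_le_iff₀ (hr i), mul_comm]
      exact hi.2)
    refine ⟨a, ?_, ha⟩
    have : a ∈ ulim 𝒰 fun i => dil x₀ (r i) K := fun ε hε => by
      filter_upwards [hz, Metric.tendsto_nhds.1 ha ε hε] with i hi hi'
      refine ⟨_, ?_, hi'⟩
      rw [mem_dil, smul_inv_smul₀ (hr i).ne']
      simpa using hi.1
    rwa [hS] at this
  obtain ⟨a, haV, ha⟩ := hlim x (hev.mono fun i hi => ⟨hi.1, hi.2.2.1⟩)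
  obtain ⟨b, hbV, hb⟩ := hlim y (hev.mono fun i hi => ⟨hi.2.1, hi.2.2.2.1⟩)
  have hba := hb.sub ha
  have heq : ∀ i, (r i)⁻¹ • (y i - x₀) - (r i)⁻¹ • (x i - x₀) = (r i)⁻¹ • (y i - x i) := fun i => by
    rw [← smul_sub]; congr 1; abel
  simp only [heq] at hba
  have hn : ∀ i, ‖(r i)⁻¹ • (y i - x i)‖ = (r i)⁻¹ * dist (y i) (x i) := fun i => by
    rw [norm_smul, norm_inv, Real.norm_of_nonneg (hr i).le, dist_eq_norm]
  have h1 : τ ≤ ‖b - a‖ := ge_of_tendsto hba.norm (hev.mono fun i hi => by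
    rw [hn, le_inv_mul_iff₀ (hr i), mul_comm]; exact hi.2.2.2.2.1)
  have h2 : ‖π (b - a)‖ ≤ 1 / 2 * ‖b - a‖ := by
    refine le_of_tendsto_of_tendsto ((π.continuous.tendsto _).comp hba).norm (hba.norm.const_mul _)
      (hev.mono fun i hi => ?_)
    show ‖π ((r i)⁻¹ • (y i - x i))‖ ≤ 1 / 2 * ‖(r i)⁻¹ • (y i - x i)‖
    rw [hn, map_smul, norm_smul, norm_inv, Real.norm_of_nonneg (hr i).le]
    have := hi.2.2.2.2.2
    have h5 : 0 < (r i)⁻¹ := inv_pos.2 (hr i)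
    nlinarith
  rw [hπ _ (V.sub_mem hbV haV)] at h2
  linarith
end

section
variable {E : Type*} [NormedAddCommGroup E] [InnerProductSpace ℝ E] [FiniteDimensional ℝ E]
  [MeasurableSpace E] [BorelSpace E]
variable {d : ℕ} {μ : Measure E} [IsFiniteMeasure μ] {K A : Set E}

lemma FlatPiece.exists_scale (hP : FlatPiece d μ K A) (hA : μ A ≠ 0) :
    ∃ π : E →L[ℝ] Euc d, ‖π‖ ≤ 1 ∧ ∃ x₀ ∈ A, ∀ M > 0, ∀ η > 0, ∀ δ > 0, ∃ ρ, 0 < ρ ∧ ρ < δ ∧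
      (∀ x ∈ K, ∀ y ∈ K, dist x x₀ ≤ M * ρ → dist y x₀ ≤ M * ρ → ρ / 8 ≤ dist y x →
        1 / 2 * dist y x ≤ ‖π (y - x)‖) ∧ μ.real (ball x₀ (M * ρ) \ A) ≤ η * ρ ^ d := by
  have hε : μ A / 2 ≠ 0 := by simpa using hA
  obtain ⟨A', hA'A, -, hthin, hA'μ⟩ := exists_thin hP.closed' (hP.dens.mono hP.sub) hε
  have hne : A'.Nonempty := by
    by_contra h
    rw [not_nonempty_iff_eq_empty] at h
    rw [h, diff_empty] at hA'μ
    exact absurd hA'μ (not_le.2 (ENNReal.half_lt_self hA (measure_ne_top _ _)))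
  obtain ⟨x₀, hx₀⟩ := hne
  let 𝒰 : Ultrafilter ℕ := hyperfilter ℕ
  have hone : Tendsto (fun i : ℕ => 1 / ((i : ℝ) + 1)) 𝒰 (𝓝 0) :=
    tendsto_one_div_add_atTop_nhds_zero_nat.mono_left Nat.hyperfilter_le_atTop
  have hpos : ∀ i : ℕ, (0:ℝ) < 1 / ((i : ℝ) + 1) := fun i => by positivity
  obtain ⟨V, hV, hS⟩ := hP.limit 𝒰 (x := fun _ => x₀) (fun _ => hA'A hx₀) hpos hone
  obtain ⟨L, hL⟩ := exists_isometry_range V hV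
  have hπL : ∀ w, ContinuousLinearMap.adjoint L.toContinuousLinearMap (L w) = w := fun w => by
    refine ext_inner_right ℝ fun z => ?_
    rw [ContinuousLinearMap.adjoint_inner_left]
    exact L.inner_map_map w z
  refine ⟨ContinuousLinearMap.adjoint L.toContinuousLinearMap, ?_, x₀, hA'A hx₀, ?_⟩
  · rw [LinearIsometryEquiv.norm_map]
    exact L.norm_toContinuousLinearMap_le
  intro M hM η hη δ hδ
  have hiso : ∀ v ∈ V, ‖ContinuousLinearMap.adjoint L.toContinuousLinearMap v‖ = ‖v‖ := by
    intro v hv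
    have hv' : v ∈ range L := by rw [hL]; exact hv
    obtain ⟨w, rfl⟩ := hv'
    rw [hπL, L.norm_map]
  have h1 := FlatPiece.untilted hpos hS hiso M (τ := 1 / 8) (by norm_num)
  obtain ⟨δ', hδ', hth⟩ := hthin (η / M ^ d) (by positivity)
  obtain ⟨i, hi1, hi2, hi3⟩ := (h1.and ((hone.eventually_lt_const hδ).and
    (hone.eventually_lt_const (show 0 < δ' / M by positivity)))).exists
  refine ⟨_, hpos i, hi2, fun x hx y hy hxM hyM hd => hi1 x hx y hy hxM hyM (by linarith), ?_⟩
  refine (hth _ hx₀ _ (by have := hpos i; positivity) ?_).trans_eq ?_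
  · rw [lt_div_iff₀ hM] at hi3; linarith
  · rw [mul_pow]; field_simp

/-- A scale at which a set is tilted against the projection, or has a hole. -/
def BadScale (d : ℕ) (μ : Measure E) (A : Set E) (π : E →L[ℝ] Euc d) (κ ε : ℝ) (x : E) (s : ℝ) : Prop :=
  (∃ y ∈ A, dist y x = s ∧ ‖π (y - x)‖ < κ * s) ∨ ε * s ^ d ≤ μ.real (ball x s \ A)

/-- The part of `A` near `x₀` that is a graph over the image of `π`, with slope controlled by `κ`. -/
def graphPart (d : ℕ) (A : Set E) (π : E →L[ℝ] Euc d) (κ : ℝ) (x₀ : E) (R : ℝ) : Set E :=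
  {x ∈ A | dist x x₀ ≤ R ∧ ∀ y ∈ A, dist y x₀ ≤ R → κ * dist y x ≤ ‖π (y - x)‖}

lemma isClosed_graphPart (hA : IsClosed A) (π : E →L[ℝ] Euc d) (κ : ℝ) (x₀ : E) (R : ℝ) :
    IsClosed (graphPart d A π κ x₀ R) := by
  have : graphPart d A π κ x₀ R =
      A ∩ (closedBall x₀ R ∩ ⋂ y ∈ {y ∈ A | dist y x₀ ≤ R}, {x | κ * dist y x ≤ ‖π (y - x)‖}) := by
    ext x
    simp only [graphPart, mem_setOf_eq, mem_inter_iff, mem_closedBall, mem_iInter, and_imp]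
  rw [this]
  refine hA.inter (isClosed_closedBall.inter (isClosed_biInter fun y _ => isClosed_le ?_ ?_)) <;> fun_prop

lemma exists_graph_or_badScale {π : E →L[ℝ] Euc d} (hA : IsClosed A) {κ Λ ε η ρ : ℝ} {x₀ : E}
    (hx₀ : x₀ ∈ A) (hκ : 0 < κ) (hκ1 : κ ≤ 1 / 8) (hΛ : Λ = 4 + 1 / κ) (hρ : 0 < ρ)
    (hη : η < ε * (1 / 8) ^ d)
    (hflat : ∀ x ∈ A, ∀ y ∈ A, dist x x₀ ≤ (4 + 2 * Λ) * ρ → dist y x₀ ≤ (4 + 2 * Λ) * ρ →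
      ρ / 8 ≤ dist y x → 1 / 2 * dist y x ≤ ‖π (y - x)‖)
    (hmass : μ.real (ball x₀ ((4 + 2 * Λ) * ρ) \ A) ≤ η * ρ ^ d)
    (hover : ∀ x ∈ A, ∀ r, 0 < r → r ≤ ρ →
      (∀ y ∈ A, r ≤ dist y x → dist y x ≤ Λ * r → κ * dist y x ≤ ‖π (y - x)‖) →
      μ.real (ball x (Λ * r) \ A) < ε * (Λ * r) ^ d → ∀ p, dist p (π x) ≤ r →
      ∃ x' ∈ A, dist x' x ≤ Λ * r ∧ dist (π x') p ≤ r / 4) {p : Euc d} (hp : dist p (π x₀) ≤ ρ) :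
    p ∈ π '' graphPart d A π κ x₀ (4 * ρ) ∨ ∃ x ∈ A, ∃ s, 0 < s ∧ s < ρ / 8 ∧
      dist x x₀ ≤ (4 + Λ) * ρ ∧ BadScale d μ A π κ ε x s ∧ dist p (π x) ≤ s := by
  have hΛ12 : 12 ≤ Λ := by
    have : 8 ≤ 1 / κ := by rw [le_div_iff₀ hκ]; linarith
    linarith
  have hgood : ∀ x ∈ A, dist x x₀ ≤ (4 + Λ) * ρ → ∀ s, ρ / 8 ≤ s → s ≤ Λ * ρ →
      ¬ BadScale d μ A π κ ε x s := by
    rintro x hx hxd s hs1 hs2 (⟨y, hy, rfl, hyt⟩ | hbad)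
    · have h1 := hflat x hx y hy (by nlinarith) (by
        have := dist_triangle y x x₀; nlinarith) hs1
      nlinarith
    · have h1 : μ.real (ball x s \ A) ≤ μ.real (ball x₀ ((4 + 2 * Λ) * ρ) \ A) :=
        measureReal_mono (diff_subset_diff_left (ball_subset_ball' (by nlinarith)))
      have h2 : (1 / 8) ^ d * ρ ^ d ≤ s ^ d := by
        rw [← mul_pow]; exact pow_le_pow_left₀ (by positivity) (by linarith) _
      have h3 : 0 < ρ ^ d := by positivity
      have hε : 0 < ε := by
        by_contra h
        have : η * ρ ^ d ≥ 0 := measureReal_nonneg.trans hmass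
        have h4 : 0 ≤ η := by by_contra h5; nlinarith
        have h5 : (0:ℝ) < (1 / 8) ^ d := by positivity
        nlinarith
      nlinarith [mul_le_mul_of_nonneg_left h2 hε.le]
  by_contra! hcon
  obtain ⟨hcon1, hcon2⟩ := hcon
  have hadm : ∀ k : ℕ, ∃ x ∈ A, dist x x₀ ≤ 4 * ρ ∧ dist (π x) p ≤ ρ * (1 / 4) ^ k ∧
      ∀ s, ρ * (1 / 4) ^ k ≤ s → s ≤ Λ * ρ → ¬ BadScale d μ A π κ ε x s := by
    intro k
    induction k with
    | zero =>
      refine ⟨x₀, hx₀, by rw [dist_self]; positivity, by rw [dist_comm]; simpa using hp, fun s h1 h2 =>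
        hgood x₀ hx₀ (by rw [dist_self]; positivity) s (by simp at h1; linarith) h2⟩
    | succ k ih =>
      obtain ⟨x, hx, hxd, hxp, hxs⟩ := ih
      set r := ρ * (1 / 4) ^ k with hr
      have hr0 : 0 < r := by positivity
      have hrρ : r ≤ ρ := by
        have : (1 / 4 : ℝ) ^ k ≤ 1 := pow_le_one₀ (by norm_num) (by norm_num)
        nlinarith
      have hrs : ρ * (1 / 4) ^ (k + 1) = r / 4 := by rw [hr, pow_succ]; ring
      have hΛr : Λ * r ≤ Λ * ρ := by nlinarith
      obtain ⟨x', hx', hxx', hxp'⟩ := hover x hx r hr0 hrρ (fun y hy h1 h2 => by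
        by_contra h
        exact hxs _ h1 (h2.trans hΛr) (Or.inl ⟨y, hy, rfl, not_le.1 h⟩)) (by
        by_contra h
        exact hxs _ (by nlinarith) hΛr (Or.inr (not_lt.1 h))) p (by rwa [dist_comm])
      have hd : dist x' x₀ ≤ (4 + Λ) * ρ := by
        have := dist_triangle x' x x₀
        linarith
      refine ⟨x', hx', ?_, by rw [hrs]; exact hxp', fun s h1 h2 hb => ?_⟩
      · rcases le_total (dist x' x₀) (ρ / 8) with h | h
        · linarith
        · have h1 := hflat x₀ hx₀ x' hx' (by rw [dist_self]; positivity) (by nlinarith) h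
          rw [map_sub, ← dist_eq_norm] at h1
          have := dist_triangle (π x') p (π x₀)
          linarith
      · rw [hrs] at h1
        rcases le_or_gt (ρ / 8) s with h | h
        · exact hgood x' hx' hd s h h2 hb
        · have := hcon2 x' hx' s (by linarith) h hd hb
          rw [dist_comm] at this
          linarith
  choose x hx hxd hxp hxs using hadm
  have h0 : Tendsto (fun k : ℕ => ρ * (1 / 4 : ℝ) ^ k) atTop (𝓝 0) := by
    have := (tendsto_pow_atTop_nhds_zero_of_lt_one (r := (1 / 4 : ℝ)) (by norm_num) (by norm_num)).const_mul ρ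
    simpa using this
  let 𝒰 : Ultrafilter ℕ := hyperfilter ℕ
  obtain ⟨z, hz⟩ := exists_ultrafilter_lim 𝒰 x₀ (4 * ρ) (Eventually.of_forall hxd)
  have hzA : z ∈ A := hA.mem_of_tendsto hz (Eventually.of_forall hx)
  have h0' := h0.mono_left (Nat.hyperfilter_le_atTop : (𝒰 : Filter ℕ) ≤ atTop)
  have hzd : dist z x₀ ≤ 4 * ρ := le_of_tendsto (hz.dist tendsto_const_nhds) (Eventually.of_forall hxd)
  have hπz : π z = p := by
    have h1 : Tendsto (fun k => π (x k)) 𝒰 (𝓝 (π z)) := (π.continuous.tendsto _).comp hz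
    exact tendsto_nhds_unique h1 (tendsto_iff_dist_tendsto_zero.2
      (squeeze_zero (fun _ => dist_nonneg) hxp h0'))
  refine hcon1 ⟨z, ⟨hzA, hzd, fun y hy hyd => ?_⟩, hπz⟩
  rcases eq_or_ne y z with rfl | hne
  · simp
  have hdyz : 0 < dist y z := dist_pos.2 hne
  have h1 : Tendsto (fun k => dist y (x k)) 𝒰 (𝓝 (dist y z)) := tendsto_const_nhds.dist hz
  have h2 : Tendsto (fun k => ‖π (y - x k)‖) 𝒰 (𝓝 ‖π (y - z)‖) :=
    ((π.continuous.tendsto _).comp (tendsto_const_nhds.sub hz)).norm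
  refine le_of_tendsto_of_tendsto (h1.const_mul κ) h2 ?_
  filter_upwards [h0'.eventually_lt_const (half_pos hdyz), h1.eventually_const_lt (half_lt_self hdyz)]
    with k hk1 hk2
  by_contra h
  refine hxs k (dist y (x k)) (by linarith) ?_ (Or.inl ⟨y, hy, rfl, not_le.1 h⟩)
  have := dist_triangle_right y (x k) x₀
  have := hxd k
  nlinarith
end

section
variable {E : Type*} [NormedAddCommGroup E] [InnerProductSpace ℝ E] [FiniteDimensional ℝ E]
  [MeasurableSpace E] [BorelSpace E]
variable {d : ℕ} {μ : Measure E} [IsFiniteMeasure μ] {K A : Set E}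

lemma volume_closedBall_euc' (x : Euc d) {r : ℝ} (hr : 0 ≤ r) :
    volume (closedBall x r) = ENNReal.ofReal (om d * r ^ d) := by
  rw [Measure.addHaar_closedBall _ _ hr, finrank_euclideanSpace_fin, mul_comm (om d),
    ENNReal.ofReal_mul (by positivity)]
  congr 1
  rw [om, ENNReal.ofReal_toReal (ballVol_ne_top d)]
  rfl

/-- Vitali covering bound for a family of balls whose preimages carry definite mass. -/
lemma volume_le_of_badScale {π : E →L[ℝ] Euc d} {D G : Set (Euc d)} {R : ℝ} (lam : Measure E)
    (t : Set (E × ℝ)) (ht : ∀ b ∈ t, 0 < b.2 ∧ b.2 ≤ R ∧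
      ENNReal.ofReal (om d * b.2 ^ d) ≤ lam (π ⁻¹' closedBall (π b.1) b.2))
    (hD : ∀ p ∈ D, p ∈ G ∨ ∃ b ∈ t, p ∈ closedBall (π b.1) b.2) :
    volume D ≤ volume G + ENNReal.ofReal (4 ^ d) * lam univ := by
  obtain ⟨u, hut, hdisj, hcov⟩ := Vitali.exists_disjoint_subfamily_covering_enlargement_closedBall t
    (fun b : E × ℝ => π b.1) (fun b => b.2) R (fun b hb => (ht b hb).2.1) 4 (by norm_num)
  have hcount : u.Countable := hdisj.countable_of_nonempty_interior fun b hb =>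
    ⟨π b.1, ball_subset_interior_closedBall (mem_ball_self (ht b (hut hb)).1)⟩
  have h1 : D ⊆ G ∪ ⋃ b ∈ u, closedBall (π b.1) (4 * b.2) := by
    intro p hp
    rcases hD p hp with h | ⟨b, hb, hpb⟩
    · exact Or.inl h
    · obtain ⟨b', hb', hs⟩ := hcov b hb
      exact Or.inr (mem_biUnion hb' (hs hpb))
  have := hcount.to_subtype
  calc volume D ≤ volume G + volume (⋃ b ∈ u, closedBall (π b.1) (4 * b.2)) :=
        (measure_mono h1).trans (measure_union_le _ _)
    _ ≤ volume G + ∑' b : u, volume (closedBall (π b.1.1) (4 * b.1.2)) := by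
        gcongr
        exact measure_biUnion_le _ hcount _
    _ ≤ volume G + ∑' b : u, ENNReal.ofReal (4 ^ d) * lam (π ⁻¹' closedBall (π b.1.1) b.1.2) := by
        gcongr with b
        obtain ⟨h2, -, h3⟩ := ht b.1 (hut b.2)
        rw [volume_closedBall_euc' _ (by positivity), mul_pow, mul_left_comm,
          ENNReal.ofReal_mul (by positivity)]
        gcongr
    _ = volume G + ENNReal.ofReal (4 ^ d) * ∑' b : u, lam (π ⁻¹' closedBall (π b.1.1) b.1.2) := by
        rw [ENNReal.tsum_mul_left]
    _ ≤ _ := by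
        gcongr
        rw [← measure_biUnion hcount (fun b hb b' hb' hne => (hdisj hb hb' hne).preimage π)
          (fun b _ => (isClosed_closedBall.preimage π.continuous).measurableSet)]
        exact measure_mono (subset_univ _)

lemma FlatPiece.exists_graph (hP : FlatPiece d μ K A) (hA : μ A ≠ 0) :
    ∃ π : E →L[ℝ] Euc d, ‖π‖ ≤ 1 ∧ ∃ G ⊆ A, ∃ κ > 0, IsCompact G ∧
      (∀ x ∈ G, ∀ y ∈ G, κ * dist y x ≤ ‖π (y - x)‖) ∧ volume (π '' G) ≠ 0 := by
  have hom := om_pos d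
  obtain ⟨π, hπ, x₀, hx₀, hscale⟩ := hP.exists_scale hA
  set N : ℕ := 16 * 320 ^ d with hN
  have hN0 : (0:ℝ) < N := by rw [hN]; positivity
  set κ : ℝ := 1 / (8 * ((N : ℝ) + 1)) with hκdef
  have hκ : 0 < κ := by positivity
  have hκ1 : κ ≤ 1 / 8 := by
    rw [hκdef]; exact one_div_le_one_div_of_le (by norm_num) (by linarith)
  have hκi : 1 / κ = 8 * ((N : ℝ) + 1) := by rw [hκdef, one_div_one_div]
  set Λ : ℝ := 4 + 1 / κ with hΛ
  have hΛ12 : 12 ≤ Λ := by rw [hΛ, hκi]; linarith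
  obtain ⟨δ₁, hδ₁, htube⟩ := hP.tube hπ N
  obtain ⟨ε, hε, δ₂, hδ₂, hover⟩ := hP.exists_over π hκ hΛ.ge
  obtain ⟨δ₃, hδ₃, hdens⟩ := hP.dens 1 one_pos
  set a : ℝ := 2 * 16 ^ d / N with ha
  set b : ℝ := om d / ε with hb
  have ha0 : 0 < a := by positivity
  have hb0 : 0 < b := by positivity
  set η : ℝ := min (ε * (1 / 8) ^ d / 2) (om d / (4 * 4 ^ d * (a + b))) with hη
  have hη0 : 0 < η := by positivity
  have hη1 : η < ε * (1 / 8) ^ d :=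
    (min_le_left _ _).trans_lt (half_lt_self (by positivity))
  have hη2 : 4 ^ d * ((a + b) * η) ≤ om d / 4 := by
    have h1 : η ≤ om d / (4 * 4 ^ d * (a + b)) := min_le_right _ _
    rw [le_div_iff₀ (by positivity)] at h1
    linarith
  set M : ℝ := 4 + 2 * Λ with hM
  obtain ⟨ρ, hρ, hρδ, hflat, hmass⟩ := hscale M (by positivity) η hη0 (min (min δ₁ δ₂) (δ₃ / 5)) (by positivity)
  have hρ1 : ρ < δ₁ := hρδ.trans_le ((min_le_left _ _).trans (min_le_left _ _))
  have hρ2 : ρ < δ₂ := hρδ.trans_le ((min_le_left _ _).trans (min_le_right _ _))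
  have hρ3 : ρ < δ₃ / 5 := hρδ.trans_le (min_le_right _ _)
  set T := ball x₀ (M * ρ) ∩ π ⁻¹' closedBall (π x₀) (2 * ρ) with hT
  set W := ball x₀ (M * ρ) \ A with hW
  have hMe : M = 12 + 16 * ((N : ℝ) + 1) := by rw [hM, hΛ, hκi]; ring
  have hTm : μ.real T ≤ 2 * om d * (5 * ρ) ^ d + η * ρ ^ d := by
    have h1 : T ⊆ ball x₀ (5 * ρ) ∪ W := by
      rintro z ⟨hz1, hz2⟩
      by_cases hzA : z ∈ A
      · left
        rw [mem_ball] at hz1 ⊢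
        by_contra h
        have h2 := hflat x₀ (hP.sub hx₀) z (hP.sub hzA) (by rw [dist_self]; positivity) hz1.le
          (by linarith)
        rw [map_sub, ← dist_eq_norm] at h2
        rw [mem_preimage, mem_closedBall] at hz2
        linarith
      · exact Or.inr ⟨hz1, hzA⟩
    have h2 := (hdens x₀ (hP.sub hx₀) (5 * ρ) (by positivity) (by linarith)).2
    calc μ.real T ≤ μ.real (ball x₀ (5 * ρ)) + μ.real W :=
          (measureReal_mono h1).trans (measureReal_union_le _ _)
      _ ≤ _ := add_le_add (h2.trans_eq (by ring)) hmass
  set lam : Measure E := ENNReal.ofReal a • μ.restrict T + ENNReal.ofReal b • μ.restrict W with hlam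
  set G := graphPart d A π κ x₀ (4 * ρ) with hG
  have hGc : IsCompact G := by
    exact Metric.isCompact_of_isClosed_isBounded (isClosed_graphPart hP.closed' _ _ _ _)
      ((isBounded_closedBall (x := x₀) (r := 4 * ρ)).subset fun x hx => hx.2.1)
  have hballpre : ∀ x s, ball x s ⊆ π ⁻¹' closedBall (π x) s := fun x s z hz => by
    rw [mem_preimage, mem_closedBall, dist_eq_norm, ← map_sub]
    rw [mem_ball, dist_eq_norm] at hz
    exact (π.le_opNorm _).trans (by nlinarith [norm_nonneg (z - x)])
  have key := volume_le_of_badScale (π := π) (D := closedBall (π x₀) ρ) (G := π '' G) (R := ρ / 8) lam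
    {b | b.1 ∈ A ∧ 0 < b.2 ∧ b.2 < ρ / 8 ∧ dist b.1 x₀ ≤ (4 + Λ) * ρ ∧
      BadScale d μ A π κ ε b.1 b.2 ∧ dist (π b.1) (π x₀) ≤ ρ + b.2} (by
    rintro ⟨x, s⟩ ⟨hx, hs0, hsρ, hxd, hbad, hπx⟩
    dsimp only at hx hs0 hsρ hxd hbad hπx ⊢
    refine ⟨hs0, hsρ.le, ?_⟩
    have hmeas : MeasurableSet (π ⁻¹' closedBall (π x) s) :=
      (isClosed_closedBall.preimage π.continuous).measurableSet
    rw [hlam, Measure.add_apply, Measure.smul_apply, Measure.smul_apply, smul_eq_mul, smul_eq_mul,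
      Measure.restrict_apply hmeas, Measure.restrict_apply hmeas]
    rcases hbad with ⟨y, hy, rfl, htilt⟩ | hbad
    · refine le_trans ?_ le_self_add
      have h1 := htube x hx y hy hs0 (by linarith) htilt
      have h2 : om d * dist y x ^ d ≤ a * μ.real (π ⁻¹' closedBall (π x) (dist y x) ∩ T) := by
        calc om d * dist y x ^ d = a * (N * (om d / 2 * (dist y x / 16) ^ d)) := by
              rw [ha, div_pow]; field_simp
          _ ≤ _ := by
              refine mul_le_mul_of_nonneg_left (h1.trans (measureReal_mono ?_)) ha0.le
              rintro z ⟨hz1, hz2⟩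
              refine ⟨hz2, ball_subset_ball' ?_ hz1, ?_⟩
              · have : Λ = 4 + 8 * ((N : ℝ) + 1) := by rw [hΛ, hκi]
                rw [this] at hxd
                rw [hMe]
                nlinarith
              · rw [mem_preimage, mem_closedBall] at hz2 ⊢
                have := dist_triangle (π z) (π x) (π x₀)
                linarith
      rw [← ofReal_measureReal, ← ENNReal.ofReal_mul ha0.le]
      exact ENNReal.ofReal_le_ofReal h2
    · refine le_trans ?_ le_add_self
      have h2 : om d * s ^ d ≤ b * μ.real (π ⁻¹' closedBall (π x) s ∩ W) := by
        calc om d * s ^ d = b * (ε * s ^ d) := by rw [hb]; field_simp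
          _ ≤ _ := by
              refine mul_le_mul_of_nonneg_left (hbad.trans (measureReal_mono ?_)) hb0.le
              rintro z ⟨hz1, hz2⟩
              refine ⟨hballpre _ _ hz1, ball_subset_ball' ?_ hz1, hz2⟩
              nlinarith
      rw [← ofReal_measureReal, ← ENNReal.ofReal_mul hb0.le]
      exact ENNReal.ofReal_le_ofReal h2) (by
    intro p hp
    rw [mem_closedBall] at hp
    rcases exists_graph_or_badScale (μ := μ) hP.closed' hx₀ hκ hκ1 hΛ hρ hη1
      (fun x hx y hy => hflat x (hP.sub hx) y (hP.sub hy)) hmass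
      (fun x hx r hr hrρ h1 h2 p hp => hover x hx r hr (hrρ.trans_lt hρ2) h1 h2 p hp) hp with
      h | ⟨x, hx, s, hs0, hsρ, hxd, hbad, hps⟩
    · exact Or.inl h
    · refine Or.inr ⟨(x, s), ⟨hx, hs0, hsρ, hxd, hbad, ?_⟩, hps⟩
      have := dist_triangle_left (π x) (π x₀) p
      linarith)
  refine ⟨π, hπ, G, fun x hx => hx.1, κ, hκ, hGc, fun x hx y hy => hx.2.2 y hy.1 hy.2.1, fun h0 => ?_⟩
  rw [h0, zero_add, volume_closedBall_euc' _ hρ.le, hlam, Measure.add_apply, Measure.smul_apply,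
    Measure.smul_apply, smul_eq_mul, smul_eq_mul, Measure.restrict_apply_univ,
    Measure.restrict_apply_univ, ← ofReal_measureReal (μ := μ) (s := T),
    ← ofReal_measureReal (μ := μ) (s := W), ← ENNReal.ofReal_mul ha0.le, ← ENNReal.ofReal_mul hb0.le,
    ← ENNReal.ofReal_add (by positivity) (by positivity), ← ENNReal.ofReal_mul (by positivity),
    ENNReal.ofReal_le_ofReal_iff (by positivity)] at key
  have hρd : 0 < ρ ^ d := by positivity
  have h1 : 4 ^ d * (a * (2 * om d * (5 * ρ) ^ d)) = om d / 4 * ρ ^ d := by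
    have : (320:ℝ) ^ d = 4 ^ d * 16 ^ d * 5 ^ d := by rw [← mul_pow, ← mul_pow]; norm_num
    rw [ha, hN]
    push_cast
    rw [this, mul_pow]
    field_simp
    norm_num
  have h2 : a * μ.real T + b * μ.real W ≤ a * (2 * om d * (5 * ρ) ^ d + η * ρ ^ d) + b * (η * ρ ^ d) :=
    add_le_add (mul_le_mul_of_nonneg_left hTm ha0.le) (mul_le_mul_of_nonneg_left hmass hb0.le)
  have h3 : (0:ℝ) < 4 ^ d := by positivity
  have h4 := mul_le_mul_of_nonneg_left h2 h3.le
  have h5 := mul_le_mul_of_nonneg_right hη2 hρd.le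
  have h6 : 0 < om d * ρ ^ d := by positivity
  have h7 : (4:ℝ) ^ d * (a * (2 * om d * (5 * ρ) ^ d + η * ρ ^ d) + b * (η * ρ ^ d)) =
    4 ^ d * (a * (2 * om d * (5 * ρ) ^ d)) + 4 ^ d * ((a + b) * η) * ρ ^ d := by ring
  rw [h7, h1] at h4
  linarith
end

section
variable {d : ℕ} {F : Type*} [NormedAddCommGroup F] [NormedSpace ℝ F] [CompleteSpace F]

/-- A fixed symmetric mollifier. -/
def mollifier (d : ℕ) : Euc d → ℝ :=
  (⟨1 / 2, 1, by norm_num, by norm_num⟩ : ContDiffBump (0 : Euc d)).normed volume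

lemma mollifier_contDiff : ContDiff ℝ 1 (mollifier d) := ContDiffBump.contDiff_normed _

lemma mollifier_hasCompactSupport : HasCompactSupport (mollifier d) :=
  ContDiffBump.hasCompactSupport_normed _

lemma mollifier_nonneg (x : Euc d) : 0 ≤ mollifier d x := ContDiffBump.nonneg_normed _ _

lemma integral_mollifier : ∫ x, mollifier d x = 1 := ContDiffBump.integral_normed _

lemma mollifier_neg (x : Euc d) : mollifier d (-x) = mollifier d x := ContDiffBump.normed_neg _ _

lemma tsupport_mollifier : tsupport (mollifier d) = closedBall 0 1 :=
  ContDiffBump.tsupport_normed_eq _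

lemma integrable_mollifier : Integrable (mollifier d) :=
  mollifier_contDiff.continuous.integrable_of_hasCompactSupport mollifier_hasCompactSupport

lemma integrable_fderiv_mollifier : Integrable (fderiv ℝ (mollifier d)) :=
  (mollifier_contDiff.continuous_fderiv one_ne_zero).integrable_of_hasCompactSupport
    (mollifier_hasCompactSupport.fderiv ℝ)

/-- Mollification at unit scale. -/
def mollify (h : Euc d → F) (x : Euc d) : F := ∫ y, mollifier d y • h (x - y)

lemma integrable_mollifier_smul {h : Euc d → F} (hh : Continuous h) (x : Euc d) :
    Integrable fun y => mollifier d y • h (x - y) := by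
  refine Continuous.integrable_of_hasCompactSupport ?_ (mollifier_hasCompactSupport.smul_right)
  have := (mollifier_contDiff (d := d)).continuous
  fun_prop

lemma mollify_sub {h k : Euc d → F} (hh : Continuous h) (hk : Continuous k) (x : Euc d) :
    mollify (fun z => h z - k z) x = mollify h x - mollify k x := by
  simp only [mollify, smul_sub]
  exact integral_sub (integrable_mollifier_smul hh x) (integrable_mollifier_smul hk x)

lemma norm_mollify_le {h : Euc d → F} {x : Euc d} {e : ℝ} (he : ∀ z, dist z x ≤ 1 → ‖h z‖ ≤ e) :
    ‖mollify h x‖ ≤ e := by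
  have h1 : ‖∫ y, mollifier d y • h (x - y)‖ ≤ ∫ y, mollifier d y * e := by
    refine norm_integral_le_of_norm_le (integrable_mollifier.mul_const e) (Eventually.of_forall fun y => ?_)
    by_cases hy : y ∈ tsupport (mollifier d)
    · rw [norm_smul, Real.norm_of_nonneg (mollifier_nonneg y)]
      rw [tsupport_mollifier, mem_closedBall, dist_zero_right] at hy
      exact mul_le_mul_of_nonneg_left (he _ (by simpa [dist_eq_norm] using hy)) (mollifier_nonneg y)
    · simp [image_eq_zero_of_notMem_tsupport hy]
  rwa [integral_mul_const, integral_mollifier, one_mul] at h1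

lemma hasFDerivAt_mollify {h : Euc d → F} (hh : Continuous h) (x : Euc d) :
    HasFDerivAt (mollify h) (∫ y, (fderiv ℝ (mollifier d) y).smulRight (h (x - y))) x := by
  have := mollifier_hasCompactSupport.hasFDerivAt_convolution_left (ContinuousLinearMap.lsmul ℝ ℝ)
    mollifier_contDiff (hh.locallyIntegrable (μ := volume)) x
  have h2 : ∫ y, (fderiv ℝ (mollifier d) y).smulRight (h (x - y)) = convolution (fderiv ℝ (mollifier d)) h
      (ContinuousLinearMap.precompL (Euc d) (ContinuousLinearMap.lsmul ℝ ℝ)) volume x := by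
    rw [convolution_def]
    refine integral_congr_ae (Eventually.of_forall fun y => ?_)
    ext v
    simp [ContinuousLinearMap.precompL_apply]
  rw [h2]
  exact this

lemma contDiff_mollify {h : Euc d → F} (hh : Continuous h) : ContDiff ℝ 1 (mollify h) :=
  mollifier_hasCompactSupport.contDiff_convolution_left (n := 1) (ContinuousLinearMap.lsmul ℝ ℝ)
    mollifier_contDiff (hh.locallyIntegrable (μ := volume))

lemma norm_fderiv_mollify_le {h : Euc d → F} (hh : Continuous h) {x : Euc d} {e : ℝ}
    (he : ∀ z, dist z x ≤ 1 → ‖h z‖ ≤ e) :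
    ‖fderiv ℝ (mollify h) x‖ ≤ (∫ y, ‖fderiv ℝ (mollifier d) y‖) * e := by
  rw [(hasFDerivAt_mollify hh x).fderiv, ← integral_mul_const]
  refine norm_integral_le_of_norm_le (integrable_fderiv_mollifier.norm.mul_const e)
    (Eventually.of_forall fun y => ?_)
  rw [ContinuousLinearMap.norm_smulRight_apply]
  by_cases hy : y ∈ tsupport (mollifier d)
  · rw [tsupport_mollifier, mem_closedBall, dist_zero_right] at hy
    exact mul_le_mul_of_nonneg_left (he _ (by simpa [dist_eq_norm] using hy)) (norm_nonneg _)
  · have : fderiv ℝ (mollifier d) y = 0 :=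
      image_eq_zero_of_notMem_tsupport fun h => hy (tsupport_fderiv_subset ℝ h)
    simp [this]

lemma mollify_affine (a : F) (L : Euc d →L[ℝ] F) (x : Euc d) :
    mollify (fun z => a + L z) x = a + L x := by
  have h0 : ∫ y, mollifier d y • L y = 0 := by
    have := integral_neg_eq_self (fun y : Euc d => mollifier d y • L y) volume
    simp only [mollifier_neg, map_neg, smul_neg, integral_neg] at this
    have h2 : (2:ℝ) • ∫ y, mollifier d y • L y = 0 := by
      rw [two_smul]
      nth_rewrite 1 [← this]
      exact neg_add_cancel _
    exact (smul_eq_zero.1 h2).resolve_left two_ne_zero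
  have hi : Integrable fun y => mollifier d y • L y := by
    refine Continuous.integrable_of_hasCompactSupport ?_ (mollifier_hasCompactSupport.smul_right)
    have := (mollifier_contDiff (d := d)).continuous
    fun_prop
  have h1 : ∀ y, mollifier d y • (a + L (x - y)) = mollifier d y • (a + L x) - mollifier d y • L y :=
    fun y => by rw [map_sub, ← smul_sub]; congr 1; abel
  simp only [mollify, h1]
  rw [integral_sub (integrable_mollifier.smul_const _) hi, h0, sub_zero, integral_smul_const,
    integral_mollifier, one_smul]

/-- The constant in the derivative bound for smoothing. -/
def smoothConst (d : ℕ) : ℝ := (∫ y, ‖fderiv ℝ (mollifier d) y‖) + 1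

lemma smoothConst_pos (d : ℕ) : 0 < smoothConst d := by
  have : 0 ≤ ∫ y, ‖fderiv ℝ (mollifier d) y‖ := integral_nonneg fun _ => norm_nonneg _
  unfold smoothConst
  linarith

/-- Smoothing at scale `t` preserves approximation by affine functions. -/
lemma exists_smoothing {h : Euc d → F} (hh : Continuous h) {t : ℝ} (ht : 0 < t) :
    ∃ g : Euc d → F, ContDiff ℝ 1 g ∧ ∀ (x : Euc d) (a : F) (L : Euc d →L[ℝ] F) (e : ℝ),
      (∀ z, dist z x ≤ t → ‖h z - a - L (z - x)‖ ≤ e * t) →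
      ‖g x - a‖ ≤ e * t ∧ ‖fderiv ℝ g x - L‖ ≤ smoothConst d * e := by
  set k : Euc d → F := fun z => t⁻¹ • h (t • z) with hk
  have hkc : Continuous k := by fun_prop
  have hgd : ∀ x, HasFDerivAt (fun x => t • mollify k (t⁻¹ • x)) (fderiv ℝ (mollify k) (t⁻¹ • x)) x := by
    intro x
    have h1 := ((contDiff_mollify hkc).differentiable one_ne_zero (t⁻¹ • x)).hasFDerivAt
    have h2 : HasFDerivAt (fun x : Euc d => t⁻¹ • x) (t⁻¹ • ContinuousLinearMap.id ℝ (Euc d)) x :=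
      (hasFDerivAt_id x).const_smul t⁻¹
    have h3 := (HasFDerivAt.comp x h1 h2).const_smul t
    have h4 : t • (fderiv ℝ (mollify k) (t⁻¹ • x)).comp (t⁻¹ • ContinuousLinearMap.id ℝ (Euc d)) =
        fderiv ℝ (mollify k) (t⁻¹ • x) := by
      ext v
      simp [smul_smul, ht.ne']
    rw [h4] at h3
    exact h3
  refine ⟨fun x => t • mollify k (t⁻¹ • x), ?_, fun x a L e he => ?_⟩
  · have := contDiff_mollify hkc
    fun_prop
  have he0 : 0 ≤ e := by
    have := (norm_nonneg _).trans (he x (by simpa using ht.le))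
    by_contra h; nlinarith
  set b : F := t⁻¹ • a - t⁻¹ • L x with hb
  have hT : Continuous fun z => b + L z := by fun_prop
  have hMT : mollify (fun z => b + L z) = fun z => b + L z := funext fun z => mollify_affine b L z
  have hdiff : ∀ z, dist z (t⁻¹ • x) ≤ 1 → ‖k z - (b + L z)‖ ≤ e := by
    intro z hz
    have h1 := he (t • z) (by
      rw [dist_eq_norm] at hz ⊢
      have : t • z - x = t • (z - t⁻¹ • x) := by rw [smul_sub, smul_inv_smul₀ ht.ne']
      rw [this, norm_smul, Real.norm_of_nonneg ht.le]
      nlinarith)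
    have h2 : h (t • z) - a - L (t • z - x) = t • (k z - (b + L z)) := by
      rw [hk, hb, map_sub, map_smul, smul_sub, smul_add, smul_sub, smul_inv_smul₀ ht.ne',
        smul_inv_smul₀ ht.ne', smul_inv_smul₀ ht.ne']
      abel
    rw [h2, norm_smul, Real.norm_of_nonneg ht.le, mul_comm] at h1
    exact le_of_mul_le_mul_right h1 ht
  have hsub : mollify (fun z => k z - (b + L z)) = fun z => mollify k z - (b + L z) := by
    funext z
    rw [mollify_sub hkc hT, mollify_affine]
  constructor
  · have h1 := norm_mollify_le hdiff
    rw [hsub] at h1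
    have h2 : t • mollify k (t⁻¹ • x) - a = t • (mollify k (t⁻¹ • x) - (b + L (t⁻¹ • x))) := by
      rw [hb, map_smul, smul_sub, smul_add, smul_sub, smul_inv_smul₀ ht.ne', smul_inv_smul₀ ht.ne']
      abel
    dsimp only
    rw [h2, norm_smul, Real.norm_of_nonneg ht.le, mul_comm]
    exact mul_le_mul_of_nonneg_right h1 ht.le
  · have h1 := norm_fderiv_mollify_le (h := fun z => k z - (b + L z)) (hkc.sub hT) hdiff
    rw [hsub] at h1
    have h3 : HasFDerivAt (fun z => mollify k z - (b + L z)) (fderiv ℝ (mollify k) (t⁻¹ • x) - L) (t⁻¹ • x) :=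
      ((contDiff_mollify hkc).differentiable one_ne_zero (t⁻¹ • x)).hasFDerivAt.sub
        (L.hasFDerivAt.const_add b)
    rw [h3.fderiv] at h1
    rw [(hgd x).fderiv, smoothConst]
    nlinarith
end

section
variable {d : ℕ} {F : Type*} [NormedAddCommGroup F] [NormedSpace ℝ F] [CompleteSpace F]

/-- Smooth cutoffs near a set, at every scale. -/
lemma exists_cutoff (K : Set (Euc d)) {t : ℝ} (ht : 0 < t) :
    ∃ χ : Euc d → ℝ, ContDiff ℝ 1 χ ∧ (∀ x, infDist x K ≤ 2 * t → χ x = 1 ∧ fderiv ℝ χ x = 0) ∧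
      (∀ x, 5 * t ≤ infDist x K → χ x = 0 ∧ fderiv ℝ χ x = 0) ∧
      ∀ x, ‖χ x‖ ≤ 1 ∧ ‖fderiv ℝ χ x‖ ≤ smoothConst d / t := by
  have hcont : Continuous fun z => max 0 (min 1 (4 - infDist z K / t)) :=
    continuous_const.max (continuous_const.min (continuous_const.sub ((continuous_infDist_pt K).div_const t)))
  obtain ⟨χ, hχ, H⟩ := exists_smoothing hcont ht
  refine ⟨χ, hχ, fun x hx => ?_, fun x hx => ?_, fun x => ?_⟩
  · obtain ⟨h1, h2⟩ := H x 1 0 0 (fun z hz => by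
      have h3 : infDist z K ≤ infDist x K + dist z x := infDist_le_infDist_add_dist
      have h4 : infDist z K / t ≤ 3 := by rw [div_le_iff₀ ht]; linarith
      have : max 0 (min 1 (4 - infDist z K / t)) = 1 := by
        rw [min_eq_left (by linarith), max_eq_right zero_le_one]
      simp [this])
    rw [zero_mul, norm_le_zero_iff, sub_eq_zero] at h1
    rw [mul_zero, norm_le_zero_iff, sub_zero] at h2
    exact ⟨h1, h2⟩
  · obtain ⟨h1, h2⟩ := H x 0 0 0 (fun z hz => by
      have h3 : infDist x K ≤ infDist z K + dist x z := infDist_le_infDist_add_dist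
      rw [dist_comm] at h3
      have h4 : 4 ≤ infDist z K / t := by rw [le_div_iff₀ ht]; linarith
      have : max 0 (min 1 (4 - infDist z K / t)) = 0 :=
        max_eq_left ((min_le_right _ _).trans (by linarith))
      simp [this])
    rw [zero_mul, norm_le_zero_iff, sub_zero] at h1
    rw [mul_zero, norm_le_zero_iff, sub_zero] at h2
    exact ⟨h1, h2⟩
  · obtain ⟨h1, h2⟩ := H x 0 0 (1 / t) (fun z hz => by
      rw [one_div, inv_mul_cancel₀ ht.ne', ContinuousLinearMap.zero_apply, sub_zero, sub_zero,
        Real.norm_of_nonneg (le_max_left _ _)]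
      exact max_le zero_le_one (min_le_left _ _))
    rw [one_div, inv_mul_cancel₀ ht.ne', sub_zero] at h1
    rw [sub_zero, mul_one_div] at h2
    exact ⟨h1, h2⟩

/-- A `C^1` Whitney extension theorem for uniformly differentiable restrictions. -/
lemma exists_contDiff_extension {K : Set (Euc d)} (hK : IsCompact K) (hne : K.Nonempty) {f : Euc d → F}
    (hf : Continuous f) (L : Euc d → Euc d →L[ℝ] F)
    (hL : ∀ ε > 0, ∃ δ > 0, ∀ x ∈ K, ∀ z, dist z x ≤ δ → ‖f z - f x - L x (z - x)‖ ≤ ε * dist z x) :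
    ∃ g : Euc d → F, ContDiff ℝ 1 g ∧ ∀ x ∈ K, g x = f x := by
  have hC := smoothConst_pos d
  set C := smoothConst d with hCdef
  set t : ℕ → ℝ := fun k => (1 / 8) ^ k with ht
  have ht0 : ∀ k, 0 < t k := fun k => by positivity
  have htt : ∀ k, t (k + 1) = t k / 8 := fun k => by rw [ht]; dsimp only; rw [pow_succ]; ring
  have htl : Tendsto t atTop (𝓝 0) :=
    tendsto_pow_atTop_nhds_zero_of_lt_one (by norm_num) (by norm_num)
  choose u hu hus using fun k => exists_smoothing hf (ht0 k)
  choose χ hχ hχ1 hχ0 hχb using fun k => exists_cutoff K (ht0 k)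
  have hclose : ∀ ε > 0, ∃ m₀, ∀ k ≥ m₀, ∀ x, ∀ x' ∈ K, dist x x' ≤ 128 * t k →
      ‖u k x - (f x' + L x' (x - x'))‖ ≤ ε * t k ∧ ‖fderiv ℝ (u k) x - L x'‖ ≤ C * ε := by
    intro ε hε
    obtain ⟨δ, hδ, hLδ⟩ := hL (ε / 129) (by positivity)
    obtain ⟨m₀, hm₀⟩ := eventually_atTop.1 (htl.eventually_lt_const (show 0 < δ / 129 by positivity))
    refine ⟨m₀, fun k hk x x' hx' hxx' => hus k x _ (L x') ε fun z hz => ?_⟩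
    have h1 : dist z x' ≤ 129 * t k := by have := dist_triangle z x x'; linarith
    have h2 := hLδ x' hx' z (by have := hm₀ k hk; linarith)
    have h3 : f z - (f x' + L x' (x - x')) - L x' (z - x) = f z - f x' - L x' (z - x') := by
      simp only [map_sub]; abel
    rw [h3]
    refine h2.trans ?_
    calc ε / 129 * dist z x' ≤ ε / 129 * (129 * t k) := by gcongr
      _ = _ := by ring
  set S : ℕ → Euc d → F := fun m x => u 0 x + ∑ k ∈ Finset.range m, χ k x • (u (k + 1) x - u k x) with hS
  have hSs : ∀ m x, S (m + 1) x = S m x + χ m x • (u (m + 1) x - u m x) := fun m x => by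
    simp only [hS, Finset.sum_range_succ, add_assoc]
  have hSc : ∀ m, ContDiff ℝ 1 (S m) := fun m =>
    (hu 0).add (ContDiff.sum fun k _ => (hχ k).smul ((hu (k + 1)).sub (hu k)))
  have hdu : ∀ k x, HasFDerivAt (u k) (fderiv ℝ (u k) x) x := fun k x =>
    ((hu k).differentiable one_ne_zero x).hasFDerivAt
  have hdχ : ∀ k x, HasFDerivAt (χ k) (fderiv ℝ (χ k) x) x := fun k x =>
    ((hχ k).differentiable one_ne_zero x).hasFDerivAt
  have hdS : ∀ m x, HasFDerivAt (S m) (fderiv ℝ (S m) x) x := fun k x =>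
    ((hSc k).differentiable one_ne_zero x).hasFDerivAt
  have hDs : ∀ m x, fderiv ℝ (S (m + 1)) x = fderiv ℝ (S m) x +
      (χ m x • (fderiv ℝ (u (m + 1)) x - fderiv ℝ (u m) x) +
        (fderiv ℝ (χ m) x).smulRight (u (m + 1) x - u m x)) := fun m x => by
    have h1 := (hdS m x).add ((hdχ m x).smul ((hdu (m + 1) x).sub (hdu m x)))
    have h2 : S (m + 1) = fun y => S m y + χ m y • (u (m + 1) y - u m y) := funext fun y => hSs m y
    rw [h2]
    exact h1.fderiv
  have hcauchy : ∀ ε > 0, ∃ m₀, ∀ m ≥ m₀, ∀ x, ‖fderiv ℝ (S m) x - fderiv ℝ (S m₀) x‖ ≤ 6 * C * ε := by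
    intro ε hε
    obtain ⟨m₀, hm₀⟩ := hclose ε hε
    refine ⟨m₀, fun m hm x => ?_⟩
    obtain ⟨x', hx', hxx'⟩ := hK.exists_infDist_eq_dist hne x
    have hu2 : ∀ i ≥ m₀, ∀ j ≥ m₀, dist x x' ≤ 128 * t i → dist x x' ≤ 128 * t j →
        ‖fderiv ℝ (u i) x - fderiv ℝ (u j) x‖ ≤ 2 * C * ε := by
      intro i hi j hj h1 h2
      calc _ ≤ ‖fderiv ℝ (u i) x - L x'‖ + ‖fderiv ℝ (u j) x - L x'‖ := by
            have : fderiv ℝ (u i) x - fderiv ℝ (u j) x =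
              (fderiv ℝ (u i) x - L x') - (fderiv ℝ (u j) x - L x') := by abel
            rw [this]; exact norm_sub_le _ _
        _ ≤ _ := by linarith [(hm₀ i hi x x' hx' h1).2, (hm₀ j hj x x' hx' h2).2]
    have hmono : ∀ i ≥ m₀, t i ≤ t m₀ := fun i hi =>
      pow_le_pow_of_le_one (by norm_num) (by norm_num) hi
    have key : ∀ m ≥ m₀, (infDist x K ≤ 16 * t m ∧
        fderiv ℝ (S m) x - fderiv ℝ (S m₀) x = fderiv ℝ (u m) x - fderiv ℝ (u m₀) x) ∨
        (5 * t m ≤ infDist x K ∧ ‖fderiv ℝ (S m) x - fderiv ℝ (S m₀) x‖ ≤ 6 * C * ε) := by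
      intro m hm
      induction m, hm using Nat.le_induction with
      | base =>
        rcases le_total (infDist x K) (16 * t m₀) with h | h
        · exact Or.inl ⟨h, by rw [sub_self, sub_self]⟩
        · refine Or.inr ⟨by linarith [ht0 m₀], ?_⟩
          rw [sub_self, norm_zero]; positivity
      | succ m hm ih =>
        have htm := ht0 m
        have hts := htt m
        rcases ih with ⟨h1, h2⟩ | ⟨h1, h2⟩
        · rcases le_or_gt (infDist x K) (2 * t m) with h3 | h3
          · left
            refine ⟨by linarith, ?_⟩
            obtain ⟨h4, h5⟩ := hχ1 m x h3
            rw [hDs, h4, h5, one_smul]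
            have h6 : fderiv ℝ (S m) x = fderiv ℝ (u m) x - fderiv ℝ (u m₀) x + fderiv ℝ (S m₀) x := by
              rw [← h2]; abel
            have h7 : (0 : Euc d →L[ℝ] ℝ).smulRight (u (m + 1) x - u m x) = 0 := by ext v; simp
            rw [h7, h6]; abel
          · right
            refine ⟨by linarith, ?_⟩
            obtain ⟨h4, h5⟩ := hχb m x
            rw [hxx'] at h1
            have hm' := hmono m hm
            have h6 := hu2 m hm m₀ le_rfl (by linarith) (by linarith)
            have h7 := hu2 (m + 1) (by omega) m hm (by linarith) (by linarith)
            have h8 : ‖u (m + 1) x - u m x‖ ≤ 2 * ε * t m := by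
              have h9 := (hm₀ m hm x x' hx' (by linarith)).1
              have h10 := (hm₀ (m + 1) (by omega) x x' hx' (by linarith)).1
              calc _ ≤ ‖u (m + 1) x - (f x' + L x' (x - x'))‖ + ‖u m x - (f x' + L x' (x - x'))‖ := by
                    have : u (m + 1) x - u m x = (u (m + 1) x - (f x' + L x' (x - x'))) -
                      (u m x - (f x' + L x' (x - x'))) := by abel
                    rw [this]; exact norm_sub_le _ _
                _ ≤ ε * t (m + 1) + ε * t m := add_le_add h10 h9
                _ ≤ _ := by rw [hts]; nlinarith
            have h11 : ‖χ m x • (fderiv ℝ (u (m + 1)) x - fderiv ℝ (u m) x)‖ ≤ 2 * C * ε := by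
              rw [norm_smul]
              calc _ ≤ 1 * (2 * C * ε) := by gcongr
                _ = _ := one_mul _
            have h12 : ‖(fderiv ℝ (χ m) x).smulRight (u (m + 1) x - u m x)‖ ≤ 2 * C * ε := by
              rw [ContinuousLinearMap.norm_smulRight_apply]
              calc _ ≤ C / t m * (2 * ε * t m) := by gcongr
                _ = _ := by field_simp
            have h13 : fderiv ℝ (S (m + 1)) x - fderiv ℝ (S m₀) x =
                (fderiv ℝ (u m) x - fderiv ℝ (u m₀) x) +
                (χ m x • (fderiv ℝ (u (m + 1)) x - fderiv ℝ (u m) x) +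
                  (fderiv ℝ (χ m) x).smulRight (u (m + 1) x - u m x)) := by
              rw [hDs, ← h2]; abel
            rw [h13]
            calc _ ≤ 2 * C * ε + (2 * C * ε + 2 * C * ε) :=
                  (norm_add_le _ _).trans (add_le_add h6 ((norm_add_le _ _).trans (add_le_add h11 h12)))
              _ = _ := by ring
        · right
          refine ⟨by linarith, ?_⟩
          obtain ⟨h4, h5⟩ := hχ0 m x h1
          have h7 : (0 : Euc d →L[ℝ] ℝ).smulRight (u (m + 1) x - u m x) = 0 := by ext v; simp
          rw [hDs, h4, h5, zero_smul, h7, add_zero, add_zero]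
          exact h2
    rcases key m hm with ⟨h1, h2⟩ | ⟨-, h2⟩
    · rw [h2]
      have := hmono m hm
      rw [hxx'] at h1
      have h3 := hu2 m hm m₀ le_rfl (by linarith [ht0 m]) (by linarith [ht0 m])
      have : 0 < C * ε := by positivity
      linarith
    · exact h2
  have hlimf : ∀ x ∈ K, Tendsto (fun m => S m x) atTop (𝓝 (f x)) := by
    intro x hx
    have h0 : infDist x K = 0 := infDist_zero_of_mem hx
    have h1 : ∀ m, S m x = u m x := by
      intro m
      induction m with
      | zero => simp [hS]
      | succ m ih =>
        rw [hSs, (hχ1 m x (by rw [h0]; linarith [ht0 m])).1, ih, one_smul, add_sub_cancel]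
    simp only [h1]
    obtain ⟨m₀, hm₀⟩ := hclose 1 one_pos
    rw [tendsto_iff_norm_sub_tendsto_zero]
    refine squeeze_zero' (Eventually.of_forall fun _ => norm_nonneg _) ?_ htl
    filter_upwards [eventually_ge_atTop m₀] with m hm
    have := (hm₀ m hm x x hx (by rw [dist_self]; linarith [ht0 m])).1
    simpa using this
  have hlim : ∀ x, ∃ y, Tendsto (fun m => S m x) atTop (𝓝 y) := by
    intro x
    by_cases hx : x ∈ K
    · exact ⟨_, hlimf x hx⟩
    · have h0 : 0 < infDist x K := (hK.isClosed.notMem_iff_infDist_pos hne).1 hx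
      obtain ⟨m₀, hm₀⟩ := eventually_atTop.1 (htl.eventually_lt_const (show 0 < infDist x K / 5 by positivity))
      have h1 : ∀ m ≥ m₀, S m x = S m₀ x := by
        intro m hm
        induction m, hm using Nat.le_induction with
        | base => rfl
        | succ m hm ih =>
          rw [hSs, (hχ0 m x (by linarith [hm₀ m hm])).1, ih, zero_smul, add_zero]
      exact ⟨_, tendsto_atTop_of_eventually_const h1⟩
  choose g hg using hlim
  have huc : UniformCauchySeqOn (fun m => fderiv ℝ (S m)) atTop univ := by
    rw [Metric.uniformCauchySeqOn_iff]
    intro ε hε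
    obtain ⟨m₀, hm₀⟩ := hcauchy (ε / (24 * C)) (by positivity)
    refine ⟨m₀, fun m hm n hn x _ => ?_⟩
    have h1 := hm₀ m hm x
    have h2 := hm₀ n hn x
    have h3 : 6 * C * (ε / (24 * C)) = ε / 4 := by field_simp; norm_num
    rw [h3, ← dist_eq_norm] at h1 h2
    have := dist_triangle_right (fderiv ℝ (S m) x) (fderiv ℝ (S n) x) (fderiv ℝ (S m₀) x)
    linarith
  have hD : ∀ x, ∃ D, Tendsto (fun m => fderiv ℝ (S m) x) atTop (𝓝 D) := fun x =>
    cauchySeq_tendsto_of_complete (huc.cauchySeq (mem_univ x))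
  choose D hD using hD
  have hunif : TendstoUniformly (fun m => fderiv ℝ (S m)) D atTop := by
    rw [← tendstoUniformlyOn_univ]
    exact huc.tendstoUniformlyOn_of_tendsto fun x _ => hD x
  refine ⟨g, contDiff_one_iff_hasFDerivAt.2 ⟨D, ?_, ?_⟩, fun x hx => tendsto_nhds_unique (hg x) (hlimf x hx)⟩
  · exact hunif.continuous (Frequently.of_forall fun m => (hSc m).continuous_fderiv one_ne_zero)
  · exact hasFDerivAt_of_tendstoUniformly hunif hdS hg
end

section
variable {d : ℕ}

lemma exists_uniform_fderiv {F : Type*} [NormedAddCommGroup F] [NormedSpace ℝ F] [FiniteDimensional ℝ F]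
    {f : Euc d → F} {c : ℝ≥0} (hf : LipschitzWith c f) {P : Set (Euc d)} (hP : IsCompact P)
    (hP0 : volume P ≠ 0) : ∃ K ⊆ P, IsCompact K ∧ volume K ≠ 0 ∧
      ∀ ε > 0, ∃ δ > 0, ∀ x ∈ K, ∀ z, dist z x ≤ δ → ‖f z - f x - fderiv ℝ f x (z - x)‖ ≤ ε * dist z x := by
  have := FiniteDimensional.complete ℝ F
  have hfin : IsFiniteMeasure (volume.restrict P) := ⟨by
    rw [Measure.restrict_apply_univ]; exact hP.measure_lt_top⟩
  let C : ℕ → ℕ → Set (Euc d) := fun m j => ⋂ n : ℕ, {x | dist (TopologicalSpace.denseSeq (Euc d) n) x < 1 / ((j : ℝ) + 1) →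
    ‖f (TopologicalSpace.denseSeq (Euc d) n) - f x - fderiv ℝ f x (TopologicalSpace.denseSeq (Euc d) n - x)‖ ≤
      1 / ((m : ℝ) + 1) * dist (TopologicalSpace.denseSeq (Euc d) n) x}
  have hCm : ∀ m j, MeasurableSet (C m j) := by
    intro m j
    refine MeasurableSet.iInter fun n => ?_
    have h1 : Measurable fun x => ‖f (TopologicalSpace.denseSeq (Euc d) n) - f x - fderiv ℝ f x (TopologicalSpace.denseSeq (Euc d) n - x)‖ := by
      have h2 : Continuous fun p : (Euc d →L[ℝ] F) × Euc d =>
          ‖f (TopologicalSpace.denseSeq (Euc d) n) - f p.2 - p.1 (TopologicalSpace.denseSeq (Euc d) n - p.2)‖ := by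
        have := hf.continuous
        fun_prop
      exact h2.measurable.comp ((measurable_fderiv ℝ f).prodMk measurable_id)
    have h3 : Measurable fun x => dist (TopologicalSpace.denseSeq (Euc d) n) x := (continuous_const.dist continuous_id).measurable
    simp only [imp_iff_not_or, setOf_or]
    exact (measurableSet_lt h3 measurable_const).compl.union (measurableSet_le h1 (h3.const_mul _))
  have hC : ∀ m j x, x ∈ C m j → ∀ z, dist z x < 1 / ((j : ℝ) + 1) →
      ‖f z - f x - fderiv ℝ f x (z - x)‖ ≤ 1 / ((m : ℝ) + 1) * dist z x := by
    intro m j x hx z hz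
    by_contra hcon
    rw [not_le] at hcon
    have ho : IsOpen ({z | dist z x < 1 / ((j : ℝ) + 1)} ∩
        {z | 1 / ((m : ℝ) + 1) * dist z x < ‖f z - f x - fderiv ℝ f x (z - x)‖}) := by
      have := hf.continuous
      exact (isOpen_lt (by fun_prop) (by fun_prop)).inter (isOpen_lt (by fun_prop) (by fun_prop))
    obtain ⟨_, ⟨hn1, hn2⟩, n, rfl⟩ := (TopologicalSpace.denseRange_denseSeq (Euc d)).inter_open_nonempty _ ho ⟨z, hz, hcon⟩
    exact absurd (mem_iInter.1 hx n hn1) (not_le.2 hn2)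
  have hmono : ∀ m, Monotone (C m) := by
    intro m i j hij x hx
    rw [mem_iInter] at hx ⊢
    intro n hn
    refine hx n (lt_of_lt_of_le hn ?_)
    gcongr
  have hae : ∀ᵐ x ∂(volume.restrict P), ∀ m, ∃ j, x ∈ C m j := by
    filter_upwards [ae_restrict_of_ae (hf.ae_differentiableAt (μ := volume))] with x hx m
    have h1 := hx.hasFDerivAt.isLittleO.def (show (0:ℝ) < 1 / ((m : ℝ) + 1) by positivity)
    obtain ⟨ε, hε, h2⟩ := Metric.eventually_nhds_iff.1 h1
    obtain ⟨j, hj⟩ := exists_nat_one_div_lt hε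
    refine ⟨j, mem_iInter.2 fun n hn => ?_⟩
    have h3 := h2 (hn.trans hj)
    rwa [dist_eq_norm]
  obtain ⟨J, hJ⟩ := exists_measure_compl_iInter_le (volume.restrict P) hCm hmono hae
    (show volume P / 2 ≠ 0 by simpa using hP0)
  set K := P ∩ ⋂ m, C m (J m) with hK
  have hKm : MeasurableSet K := hP.measurableSet.inter (MeasurableSet.iInter fun m => hCm m _)
  have hK0 : 0 < volume K := by
    rw [pos_iff_ne_zero]
    intro h0
    have h1 : volume P ≤ volume K + (volume.restrict P) (⋂ m, C m (J m))ᶜ := by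
      rw [Measure.restrict_apply (MeasurableSet.iInter fun m => hCm m _).compl]
      refine (measure_mono fun x hx => ?_).trans (measure_union_le _ _)
      by_cases h : x ∈ ⋂ m, C m (J m)
      · exact Or.inl ⟨hx, h⟩
      · exact Or.inr ⟨h, hx⟩
    rw [h0, zero_add] at h1
    exact absurd (h1.trans hJ) (not_le.2 (ENNReal.half_lt_self hP0 hP.measure_lt_top.ne))
  obtain ⟨K', hK'K, hK'c, hK'0⟩ := hKm.exists_lt_isCompact hK0
  refine ⟨K', hK'K.trans inter_subset_left, hK'c, hK'0.ne', fun ε hε => ?_⟩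
  obtain ⟨m, hm⟩ := exists_nat_one_div_lt hε
  refine ⟨1 / ((J m : ℝ) + 1) / 2, by positivity, fun x hx z hz => ?_⟩
  refine (hC m (J m) x (mem_iInter.1 (hK'K hx).2 m) z (hz.trans_lt (half_lt_self (by positivity)))).trans ?_
  gcongr

variable {E : Type*} [NormedAddCommGroup E] [InnerProductSpace ℝ E] [FiniteDimensional ℝ E]
  [MeasurableSpace E] [BorelSpace E]
variable {μ : Measure E} [IsFiniteMeasure μ] {K : Set E}

lemma Dens.volume_image_eq_zero (h : Dens d μ K) {π : E →L[ℝ] Euc d} (hπ : ‖π‖ ≤ 1) {B : Set E}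
    (hBK : B ⊆ K) (hB : μ B = 0) : volume (π '' B) = 0 := by
  obtain ⟨δ, hδ, hD⟩ := h (1 / 2) (by norm_num)
  have key : ∀ ε : ℝ≥0∞, 0 < ε → volume (π '' B) ≤ ENNReal.ofReal (4 ^ d) * (2 * ε) := by
    intro ε hε
    obtain ⟨U, hBU, hUo, hU⟩ := B.exists_isOpen_lt_of_lt ε (by rwa [hB])
    have := volume_le_of_badScale (π := π) (D := π '' B) (G := ∅) (R := δ) (2 • μ.restrict U)
      {b | b.1 ∈ B ∧ 0 < b.2 ∧ b.2 < δ ∧ ball b.1 b.2 ⊆ U} (by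
      rintro ⟨x, s⟩ ⟨hx, hs0, hsδ, hsU⟩
      dsimp only at hx hs0 hsδ hsU ⊢
      refine ⟨hs0, hsδ.le, ?_⟩
      have h1 := (hD x (hBK hx) s hs0 hsδ).1
      have h2 : om d * s ^ d ≤ 2 * μ.real (ball x s) := by linarith
      calc ENNReal.ofReal (om d * s ^ d) ≤ ENNReal.ofReal (2 * μ.real (ball x s)) :=
            ENNReal.ofReal_le_ofReal h2
        _ = 2 * μ (ball x s) := by
            rw [ENNReal.ofReal_mul two_pos.le, ofReal_measureReal]; norm_num
        _ ≤ 2 * μ (π ⁻¹' closedBall (π x) s ∩ U) := by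
            gcongr
            refine subset_inter (fun z hz => ?_) hsU
            rw [mem_preimage, mem_closedBall, dist_eq_norm, ← map_sub]
            rw [mem_ball, dist_eq_norm] at hz
            exact (π.le_opNorm _).trans (by nlinarith [norm_nonneg (z - x)])
        _ = _ := by
            rw [Measure.smul_apply, Measure.restrict_apply
              (isClosed_closedBall.preimage π.continuous).measurableSet, nsmul_eq_mul]
            norm_num) (by
      rintro _ ⟨x, hx, rfl⟩
      obtain ⟨s, hs, hsU⟩ := Metric.isOpen_iff.1 hUo x (hBU hx)
      refine Or.inr ⟨(x, min s (δ / 2)), ⟨hx, by positivity, ?_, ?_⟩, mem_closedBall_self (by positivity)⟩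
      · exact (min_le_right _ _).trans_lt (half_lt_self hδ)
      · exact (ball_subset_ball (min_le_left _ _)).trans hsU)
    rw [measure_empty, zero_add, Measure.smul_apply, Measure.restrict_apply_univ, nsmul_eq_mul] at this
    refine this.trans ?_
    gcongr
    norm_num
  have hlim : Tendsto (fun ε : ℝ≥0∞ => ENNReal.ofReal (4 ^ d) * (2 * ε)) (𝓝[>] 0) (𝓝 0) := by
    have h1 : Tendsto (fun ε : ℝ≥0∞ => ENNReal.ofReal (4 ^ d) * (2 * ε)) (𝓝 0)
        (𝓝 (ENNReal.ofReal (4 ^ d) * (2 * 0))) :=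
      ENNReal.Tendsto.const_mul (ENNReal.Tendsto.const_mul tendsto_id (Or.inr (by norm_num)))
        (Or.inr ENNReal.ofReal_ne_top)
    rw [mul_zero, mul_zero] at h1
    exact h1.mono_left nhdsWithin_le_nhds
  exact le_antisymm (ge_of_tendsto hlim (eventually_mem_nhdsWithin.mono key)) zero_le

lemma Dens.exists_contDiff (hK : IsClosed K) (h : Dens d μ K) (hμ : μ K ≠ 0) :
    ∃ g : Euc d → E, ContDiff ℝ 1 g ∧ μ (range g) ≠ 0 := by
  obtain ⟨A, hP, hA⟩ := h.exists_flatPiece hK hμ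
  obtain ⟨π, hπ, G, hGA, κ, hκ, hGc, hG, hG0⟩ := hP.exists_graph hA
  have hinj : InjOn π G := fun x hx y hy hxy => by
    have := hG x hx y hy
    rw [map_sub, hxy, sub_self, norm_zero] at this
    have h2 : dist y x ≤ 0 := by by_contra h3; nlinarith
    exact (dist_le_zero.1 h2).symm
  have hlip : LipschitzOnWith (Real.toNNReal κ⁻¹) (Function.invFunOn π G) (π '' G) := by
    refine LipschitzOnWith.of_dist_le_mul ?_
    rintro _ ⟨x, hx, rfl⟩ _ ⟨y, hy, rfl⟩
    rw [hinj.leftInvOn_invFunOn hx, hinj.leftInvOn_invFunOn hy, Real.coe_toNNReal _ (by positivity),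
      dist_eq_norm (π x), ← map_sub, le_inv_mul_iff₀ hκ]
    exact hG y hy x hx
  obtain ⟨f, hf, hfeq⟩ := hlip.extend_finite_dimension
  obtain ⟨Q, hQP, hQc, hQ0, hQ⟩ := exists_uniform_fderiv hf (hGc.image π.continuous) hG0
  have hQne : Q.Nonempty := by
    rw [nonempty_iff_ne_empty]; rintro rfl; exact hQ0 measure_empty
  obtain ⟨g, hg, hgf⟩ := exists_contDiff_extension hQc hQne hf.continuous (fderiv ℝ f) hQ
  refine ⟨g, hg, fun h0 => hQ0 ?_⟩
  have h1 : Q ⊆ π '' (G ∩ range g) := by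
    intro q hq
    obtain ⟨x, hx, rfl⟩ := hQP hq
    refine ⟨x, ⟨hx, π x, ?_⟩, rfl⟩
    rw [hgf _ hq, ← hfeq (mem_image_of_mem π hx), hinj.leftInvOn_invFunOn hx]
  exact measure_mono_null h1 (h.volume_image_eq_zero hπ (inter_subset_left.trans (hGA.trans hP.sub))
    (measure_mono_null inter_subset_right h0))
end

section
variable {E : Type*} [NormedAddCommGroup E] [InnerProductSpace ℝ E] [FiniteDimensional ℝ E]
  [MeasurableSpace E] [BorelSpace E]

lemma tendsto_div_pow_of_interlaced {f g : ℝ → ℝ} {d : ℕ} {θ : ℝ}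
    (hgf : ∀ t > 1, ∀ r > 0, g r ≤ f (t * r)) (hfg : ∀ t > 1, ∀ r > 0, f (r / t) ≤ g r)
    (hf : Tendsto (fun r => f r / r ^ d) (𝓝[>] 0) (𝓝 θ)) :
    Tendsto (fun r => g r / r ^ d) (𝓝[>] 0) (𝓝 θ) := by
  have hscale : ∀ c > 0, Tendsto (fun r : ℝ => c * r) (𝓝[>] 0) (𝓝[>] 0) := by
    intro c hc
    refine tendsto_nhdsWithin_iff.2 ⟨?_, eventually_mem_nhdsWithin.mono fun r hr => mul_pos hc hr⟩
    have : Tendsto (fun r : ℝ => c * r) (𝓝 0) (𝓝 (c * 0)) := tendsto_id.const_mul c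
    rw [mul_zero] at this
    exact this.mono_left nhdsWithin_le_nhds
  refine tendsto_order.2 ⟨fun a ha => ?_, fun a ha => ?_⟩
  · have h1 : Tendsto (fun t : ℝ => t⁻¹ ^ d * θ) (𝓝[>] 1) (𝓝 θ) := by
      have : ContinuousAt (fun t : ℝ => t⁻¹ ^ d * θ) 1 :=
        ((continuousAt_inv₀ one_ne_zero).pow d).mul continuousAt_const
      have h2 : Tendsto (fun t : ℝ => t⁻¹ ^ d * θ) (𝓝 1) (𝓝 ((1 : ℝ)⁻¹ ^ d * θ)) := this
      rw [inv_one, one_pow, one_mul] at h2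
      exact h2.mono_left nhdsWithin_le_nhds
    obtain ⟨t, ht, ht1⟩ := ((h1.eventually_const_lt ha).and eventually_mem_nhdsWithin).exists
    have ht1 : 1 < t := ht1
    have ht0 : 0 < t := by linarith
    have h3 := ((hf.comp (hscale t⁻¹ (by positivity))).const_mul (t⁻¹ ^ d)).eventually_const_lt ht
    filter_upwards [h3, eventually_mem_nhdsWithin] with r hr hr0
    have hr0 : 0 < r := hr0
    refine hr.trans_le ?_
    have h4 : t⁻¹ ^ d * (f (t⁻¹ * r) / (t⁻¹ * r) ^ d) = f (r / t) / r ^ d := by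
      rw [mul_pow, inv_mul_eq_div]; field_simp
    rw [Function.comp_apply, h4]
    gcongr
    exact hfg t ht1 r hr0
  · have h1 : Tendsto (fun t : ℝ => t ^ d * θ) (𝓝[>] 1) (𝓝 θ) := by
      have : Continuous (fun t : ℝ => t ^ d * θ) := by fun_prop
      have h2 := this.tendsto 1
      rw [one_pow, one_mul] at h2
      exact h2.mono_left nhdsWithin_le_nhds
    obtain ⟨t, ht, ht1⟩ := ((h1.eventually_lt_const ha).and eventually_mem_nhdsWithin).exists
    have ht1 : 1 < t := ht1
    have ht0 : 0 < t := by linarith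
    have h3 := ((hf.comp (hscale t ht0)).const_mul (t ^ d)).eventually_lt_const ht
    filter_upwards [h3, eventually_mem_nhdsWithin] with r hr hr0
    have hr0 : 0 < r := hr0
    refine lt_of_le_of_lt ?_ hr
    have h4 : t ^ d * (f (t * r) / (t * r) ^ d) = f (t * r) / r ^ d := by
      rw [mul_pow]; field_simp
    rw [Function.comp_apply, h4]
    gcongr
    exact hgf t ht1 r hr0

lemma tendsto_closedBall_of_ball {μ : Measure E} [IsLocallyFiniteMeasure μ] {x : E} {d : ℕ} {θ : ℝ}
    (h : Tendsto (fun r => μ.real (ball x r) / r ^ d) (𝓝[>] 0) (𝓝 θ)) :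
    Tendsto (fun r => μ.real (closedBall x r) / r ^ d) (𝓝[>] 0) (𝓝 θ) := by
  refine tendsto_div_pow_of_interlaced (fun t ht r hr => ?_) (fun t ht r hr => ?_) h
  · exact measureReal_mono (closedBall_subset_ball (by nlinarith)) measure_ball_lt_top.ne
  · exact measureReal_mono (ball_subset_closedBall.trans
      (closedBall_subset_closedBall (div_le_self hr.le ht.le))) measure_closedBall_lt_top.ne

lemma tendsto_ball_of_closedBall {μ : Measure E} [IsLocallyFiniteMeasure μ] {x : E} {d : ℕ} {θ : ℝ}
    (h : Tendsto (fun r => μ.real (closedBall x r) / r ^ d) (𝓝[>] 0) (𝓝 θ)) :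
    Tendsto (fun r => μ.real (ball x r) / r ^ d) (𝓝[>] 0) (𝓝 θ) := by
  refine tendsto_div_pow_of_interlaced (fun t ht r hr => ?_) (fun t ht r hr => ?_) h
  · exact measureReal_mono (ball_subset_closedBall.trans
      (closedBall_subset_closedBall (by nlinarith))) measure_closedBall_lt_top.ne
  · exact measureReal_mono (closedBall_subset_ball (div_lt_self hr ht)) measure_ball_lt_top.ne

lemma exists_measurable_density {μ : Measure E} [IsLocallyFiniteMeasure μ] {d : ℕ}
    (h : ∀ᵐ x ∂μ, ∃ τ > 0, Tendsto (fun r => μ.real (closedBall x r) / r ^ d) (𝓝[>] 0) (𝓝 τ)) :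
    ∃ τ : E → ℝ, Measurable τ ∧ ∀ᵐ x ∂μ, 0 < τ x ∧
      Tendsto (fun r => μ.real (closedBall x r) / r ^ d) (𝓝[>] 0) (𝓝 (τ x)) := by
  have hu : Tendsto (fun k : ℕ => 1 / ((k : ℝ) + 1)) atTop (𝓝[>] 0) :=
    tendsto_nhdsWithin_iff.2 ⟨tendsto_one_div_add_atTop_nhds_zero_nat,
      Eventually.of_forall fun k => by rw [mem_Ioi]; positivity⟩
  have hm : ∀ r, Measurable fun x => μ.real (closedBall x r) := by
    intro r
    have hS : MeasurableSet {p : E × E | dist p.2 p.1 ≤ r} :=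
      (isClosed_le (continuous_snd.dist continuous_fst) continuous_const).measurableSet
    exact (measurable_measure_prodMk_left (ν := μ) hS).ennreal_toReal
  obtain ⟨τ, hτ, hlim⟩ := measurable_limit_of_tendsto_metrizable_ae (μ := μ) (L := atTop)
    (f := fun (k : ℕ) x => μ.real (closedBall x (1 / ((k : ℝ) + 1))) / (1 / ((k : ℝ) + 1)) ^ d)
    (fun k => ((hm _).div_const _).aemeasurable) (by
      filter_upwards [h] with x ⟨τ, _, hx⟩
      exact ⟨τ, hx.comp hu⟩)
  refine ⟨τ, hτ, ?_⟩
  filter_upwards [h, hlim] with x ⟨t, ht, hx⟩ hxτ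
  have : t = τ x := tendsto_nhds_unique (hx.comp hu) hxτ
  rw [← this]
  exact ⟨ht, hx⟩

/-- Every set of positive measure meets the image of a `C^1` map in a set of positive measure. -/
theorem exists_contDiff_of_density {μ : Measure E} [IsLocallyFiniteMeasure μ] {d : ℕ}
    (h : ∀ᵐ x ∂μ, ∃ τ > 0, Tendsto (fun r => μ.real (closedBall x r) / r ^ d) (𝓝[>] 0) (𝓝 τ))
    {S : Set E} (hS : MeasurableSet S) (hS0 : μ S ≠ 0) :
    ∃ g : Euc d → E, ContDiff ℝ 1 g ∧ μ (S ∩ range g) ≠ 0 := by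
  obtain ⟨τ, hτm, hτ⟩ := exists_measurable_density h
  let A : ℕ → Set E := fun j => S ∩ (closedBall 0 j ∩ {x | 1 / ((j : ℝ) + 1) < τ x})
  have hA : ∀ j, MeasurableSet (A j) := fun j =>
    hS.inter (measurableSet_closedBall.inter (measurableSet_lt measurable_const hτm))
  obtain ⟨j, hj⟩ : ∃ j, μ (A j) ≠ 0 := by
    by_contra! hcon
    refine hS0 (measure_mono_null (t := (⋃ j, A j) ∪ {x | ¬ (0 < τ x)}) (fun x hx => ?_) ?_)
    · by_cases hx0 : 0 < τ x
      · left
        obtain ⟨i, hi⟩ := exists_nat_one_div_lt hx0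
        obtain ⟨k, hk⟩ := exists_nat_ge ‖x‖
        refine mem_iUnion.2 ⟨max i k, hx, ?_, ?_⟩
        · rw [mem_closedBall_zero_iff]
          exact hk.trans (by exact_mod_cast le_max_right i k)
        · refine lt_of_le_of_lt ?_ hi
          have : (i : ℝ) ≤ (max i k : ℕ) := by exact_mod_cast le_max_left i k
          gcongr
      · exact Or.inr hx0
    · rw [measure_union_null_iff]
      exact ⟨measure_iUnion_null hcon, hτ.mono fun x hx => hx.1⟩
  let f : E → ℝ≥0∞ := (A j).indicator fun x => ENNReal.ofReal (om d / τ x)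
  have hf : Measurable f := (hτm.const_div (om d)).ennreal_ofReal.indicator (hA j)
  set ν := μ.withDensity f with hν
  have hom := om_pos d
  have hνfin : IsFiniteMeasure ν := by
    refine isFiniteMeasure_withDensity (ne_of_lt ?_)
    calc ∫⁻ x, f x ∂μ ≤ ∫⁻ x, (closedBall (0 : E) j).indicator
          (fun _ => ENNReal.ofReal (om d * (j + 1))) x ∂μ := by
          refine lintegral_mono fun x => ?_
          by_cases hx : x ∈ A j
          · have hx1 : x ∈ closedBall (0 : E) j := hx.2.1
            have hx2 : 1 / ((j : ℝ) + 1) < τ x := hx.2.2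
            simp only [f]
            rw [indicator_of_mem hx, indicator_of_mem hx1]
            refine ENNReal.ofReal_le_ofReal ?_
            have h0 : 0 < 1 / ((j : ℝ) + 1) := by positivity
            rw [div_le_iff₀ (h0.trans hx2)]
            rw [div_lt_iff₀ (by positivity)] at hx2
            nlinarith
          · simp only [f]
            rw [indicator_of_notMem hx]
            exact zero_le
      _ = ENNReal.ofReal (om d * (j + 1)) * μ (closedBall 0 j) := by
          rw [lintegral_indicator measurableSet_closedBall, setLIntegral_const]
      _ < ∞ := ENNReal.mul_lt_top ENNReal.ofReal_lt_top measure_closedBall_lt_top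
  have hac : ν ≪ μ := withDensity_absolutelyContinuous _ _
  have hνA : ν (A j)ᶜ = 0 := by
    rw [hν, withDensity_apply _ (hA j).compl, setLIntegral_congr_fun (hA j).compl (g := fun _ => 0)
      (fun x hx => indicator_of_notMem hx _), lintegral_zero]
  have hν0 : ν univ ≠ 0 := by
    intro h0
    have h1 : ν (A j) = 0 := measure_mono_null (subset_univ _) h0
    rw [hν, withDensity_apply _ (hA j), setLIntegral_eq_zero_iff (hA j) hf] at h1
    refine hj (measure_mono_null (fun x hx => ?_) (ae_iff.1 h1))
    intro hcon
    have h2 : f x = 0 := hcon hx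
    simp only [f] at h2
    rw [indicator_of_mem hx, ENNReal.ofReal_eq_zero] at h2
    have hx2 : 1 / ((j : ℝ) + 1) < τ x := hx.2.2
    have h0 : 0 < 1 / ((j : ℝ) + 1) := by positivity
    exact absurd h2 (not_le.2 (div_pos hom (h0.trans hx2)))
  have hdens : ∀ᵐ x ∂ν, Tendsto (fun r => ν.real (ball x r) / r ^ d) (𝓝[>] 0) (𝓝 (om d)) := by
    filter_upwards [hac.ae_le hτ, hac.ae_le (Besicovitch.ae_tendsto_rnDeriv ν μ),
      hac.ae_le (Measure.rnDeriv_withDensity μ hf), measure_eq_zero_iff_ae_notMem.1 hνA]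
      with x hx hx1 hx2 hx3
    refine tendsto_ball_of_closedBall ?_
    rw [hx2] at hx1
    have hxA : x ∈ A j := not_not.1 hx3
    have hfx : f x = ENNReal.ofReal (om d / τ x) := indicator_of_mem hxA _
    rw [hfx] at hx1
    have h1 := (ENNReal.tendsto_toReal ENNReal.ofReal_ne_top).comp hx1
    rw [ENNReal.toReal_ofReal (div_pos hom hx.1).le] at h1
    have h2 := h1.mul hx.2
    rw [div_mul_cancel₀ _ hx.1.ne'] at h2
    refine h2.congr' ?_
    filter_upwards [hx.2.eventually_const_lt hx.1, eventually_mem_nhdsWithin] with r hr hr0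
    have hr0 : 0 < r := hr0
    have h3 : 0 < μ.real (closedBall x r) := by
      by_contra h4
      have : μ.real (closedBall x r) = 0 := le_antisymm (not_lt.1 h4) measureReal_nonneg
      rw [this, zero_div] at hr
      exact lt_irrefl _ hr
    simp only [Function.comp_apply, ENNReal.toReal_div]
    change ν.real _ / μ.real _ * _ = _
    field_simp
  obtain ⟨K, hKc, hK, hKν⟩ := exists_dens d ν hdens (ε := ν univ / 2) (by simpa using hν0)
  have hK0 : ν K ≠ 0 := by
    intro h0
    have h1 : ν univ ≤ ν univ / 2 := by
      rw [← union_compl_self K]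
      refine (measure_union_le _ _).trans ?_
      rw [h0, zero_add, union_compl_self]
      exact hKν
    exact absurd h1 (not_le.2 (ENNReal.half_lt_self hν0 (measure_ne_top _ _)))
  obtain ⟨g, hg, hg0⟩ := hK.exists_contDiff hKc hK0
  refine ⟨g, hg, fun h0 => hg0 ?_⟩
  refine measure_mono_null (t := (S ∩ range g) ∪ (A j)ᶜ) (fun x hx => ?_)
    (measure_union_null (hac h0) hνA)
  by_cases hxA : x ∈ A j
  · exact Or.inl ⟨hxA.1, hx⟩
  · exact Or.inr hxA

lemma absolutelyContinuous_hausdorffMeasure {μ : Measure E} [IsLocallyFiniteMeasure μ] {d : ℕ}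
    (h : ∀ᵐ x ∂μ, ∃ τ > 0, Tendsto (fun r => μ.real (closedBall x r) / r ^ d) (𝓝[>] 0) (𝓝 τ)) :
    μ ≪ μH[(d : ℝ)] := by
  let A : ℕ → Set E := fun j => {x | ∀ r > 0, r < 1 / ((j : ℝ) + 1) →
    μ (closedBall x r) ≤ ENNReal.ofReal ((j + 1) * r ^ d)}
  have hcov : ∀ᵐ x ∂μ, ∃ j, x ∈ A j := by
    filter_upwards [h] with x ⟨τ, _, hx⟩
    obtain ⟨δ, hδ, hδ'⟩ := mem_nhdsGT_iff_exists_Ioo_subset.1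
      (hx.eventually_lt_const (lt_add_one τ))
    obtain ⟨i, hi⟩ := exists_nat_one_div_lt (mem_Ioi.1 hδ)
    obtain ⟨k, hk⟩ := exists_nat_ge (τ + 1)
    refine ⟨max i k, fun r hr hrj => ?_⟩
    have h1 : (i : ℝ) ≤ (max i k : ℕ) := by exact_mod_cast le_max_left i k
    have h2 : (k : ℝ) ≤ (max i k : ℕ) := by exact_mod_cast le_max_right i k
    have h3 : r < δ := by
      refine hrj.trans (lt_of_le_of_lt ?_ hi)
      gcongr
    have h4 : μ.real (closedBall x r) / r ^ d < τ + 1 := hδ' ⟨hr, h3⟩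
    rw [div_lt_iff₀ (by positivity)] at h4
    rw [← ofReal_measureReal measure_closedBall_lt_top.ne]
    refine ENNReal.ofReal_le_ofReal (h4.le.trans ?_)
    gcongr
    linarith
  have hle : ∀ j : ℕ, (ENNReal.ofReal ((j : ℝ) + 1))⁻¹ • μ.restrict (A j) ≤ μH[(d : ℝ)] := by
    intro j
    have hj0 : (0 : ℝ) < j + 1 := by positivity
    refine Measure.le_hausdorffMeasure _ _ (ENNReal.ofReal (1 / ((j : ℝ) + 1) / 2))
      (by rw [ENNReal.ofReal_pos]; positivity) fun s hs => ?_
    rw [Measure.smul_apply, smul_eq_mul, ENNReal.inv_mul_le_iff (by simpa using hj0) (by simp)]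
    refine (measure_mono subset_closure).trans ?_
    rw [Measure.restrict_apply measurableSet_closure]
    obtain he | ⟨x, hx, hxA⟩ := (closure s ∩ A j).eq_empty_or_nonempty
    · rw [he, measure_empty]; exact zero_le
    have hfin : ediam s ≠ ∞ := ne_top_of_le_ne_top ENNReal.ofReal_ne_top hs
    set D := (ediam s).toReal with hD
    have hDs : ediam s = ENNReal.ofReal D := (ENNReal.ofReal_toReal hfin).symm
    have hD0 : 0 ≤ D := ENNReal.toReal_nonneg
    have hDj : D < 1 / ((j : ℝ) + 1) := by
      rw [hDs, ENNReal.ofReal_le_ofReal_iff (by positivity)] at hs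
      exact hs.trans_lt (half_lt_self (by positivity))
    have hsub : closure s ⊆ closedBall x D := by
      intro y hy
      rw [mem_closedBall, ← ENNReal.ofReal_le_ofReal_iff hD0, ← edist_dist, ← hDs,
        ← ediam_closure]
      exact edist_le_ediam_of_mem hy hx
    have h1 : ∀ r, D < r → r < 1 / ((j : ℝ) + 1) →
        μ (closure s ∩ A j) ≤ ENNReal.ofReal ((j + 1) * r ^ d) := fun r hr hrj =>
      (measure_mono (inter_subset_left.trans (hsub.trans (closedBall_subset_closedBall hr.le)))).trans
        (hxA r (hD0.trans_lt hr) hrj)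
    have hlim : Tendsto (fun r : ℝ => ENNReal.ofReal ((j + 1) * r ^ d)) (𝓝[>] D)
        (𝓝 (ENNReal.ofReal ((j + 1) * D ^ d))) := by
      have : Continuous fun r : ℝ => ENNReal.ofReal ((j + 1) * r ^ d) :=
        ENNReal.continuous_ofReal.comp (by fun_prop)
      exact (this.tendsto D).mono_left nhdsWithin_le_nhds
    have h2 : μ (closure s ∩ A j) ≤ ENNReal.ofReal ((j + 1) * D ^ d) := by
      refine ge_of_tendsto hlim ?_
      filter_upwards [Ioo_mem_nhdsGT hDj] with r hr
      exact h1 r hr.1 hr.2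
    refine h2.trans ?_
    rw [ENNReal.ofReal_mul hj0.le, ENNReal.rpow_natCast, hDs, ENNReal.ofReal_pow hD0]
  refine Measure.AbsolutelyContinuous.mk fun N hN hN0 => ?_
  refine measure_mono_null (t := (⋃ j, N ∩ A j) ∪ {x | ¬ ∃ j, x ∈ A j}) (fun x hx => ?_)
    (measure_union_null (measure_iUnion_null fun j => ?_) hcov)
  · by_cases h1 : ∃ j, x ∈ A j
    · obtain ⟨j, hj⟩ := h1
      exact Or.inl (mem_iUnion.2 ⟨j, hx, hj⟩)
    · exact Or.inr h1
  · have h1 := le_antisymm ((hle j N).trans hN0.le) zero_le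
    rw [Measure.smul_apply, smul_eq_mul, mul_eq_zero, Measure.restrict_apply hN] at h1
    exact h1.resolve_left (ENNReal.inv_ne_zero.2 ENNReal.ofReal_ne_top)

lemma sigmaFinite_hausdorffMeasure_restrict {d : ℕ} {ι : Type*} [Countable ι] {f : ι → Euc d → E}
    (hf : ∀ i, ContDiff ℝ 1 (f i)) : SigmaFinite (μH[(d : ℝ)].restrict (⋃ i, range (f i))) := by
  set K := ⋃ i, range (f i) with hK
  have hcl : ∀ i (m : ℕ), IsCompact (f i '' closedBall 0 m) := fun i m =>
    (isCompact_closedBall _ _).image (hf i).continuous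
  have hKU : K = ⋃ p : ι × ℕ, f p.1 '' closedBall 0 (p.2 : ℝ) := by
    ext y
    simp only [hK, mem_iUnion, mem_range, Prod.exists, mem_image]
    constructor
    · rintro ⟨i, x, rfl⟩
      obtain ⟨m, hm⟩ := exists_nat_ge ‖x‖
      exact ⟨i, m, x, by simpa using hm, rfl⟩
    · rintro ⟨i, m, x, _, rfl⟩
      exact ⟨i, x, rfl⟩
  have hKm : MeasurableSet K := by
    rw [hKU]
    exact MeasurableSet.iUnion fun p => (hcl p.1 p.2).measurableSet
  refine Measure.sigmaFinite_of_countable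
    (S := insert Kᶜ (range fun p : ι × ℕ => f p.1 '' closedBall 0 (p.2 : ℝ)))
    ((countable_range _).insert _) ?_ ?_
  · rintro s (rfl | ⟨⟨i, m⟩, rfl⟩)
    · rw [Measure.restrict_apply hKm.compl, compl_inter_self, measure_empty]
      exact ENNReal.zero_lt_top
    · refine (Measure.restrict_apply_le _ _).trans_lt ?_
      obtain ⟨L, hL⟩ := ((hf i).contDiffOn.exists_lipschitzOnWith (s := closedBall (0 : Euc d) (m : ℝ))
        one_ne_zero (convex_closedBall _ _) (isCompact_closedBall _ _))
      refine (hL.hausdorffMeasure_image_le (Nat.cast_nonneg d)).trans_lt ?_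
      refine ENNReal.mul_lt_top (by simp) ?_
      have := isAddHaarMeasure_hausdorffMeasure (E := Euc d)
      rw [finrank_euclideanSpace_fin] at this
      exact (isCompact_closedBall _ _).measure_lt_top
  · rw [sUnion_insert, sUnion_range, ← hKU, compl_union_self]

theorem exists_rectifiable_repr {n d : ℕ} {μ : Measure (Euc n)} [IsLocallyFiniteMeasure μ]
    (h : ∀ᵐ x ∂μ, ∃ τ > 0, Tendsto (fun r => μ.real (closedBall x r) / r ^ d) (𝓝[>] 0) (𝓝 τ)) :
    ∃ (K : Set (Euc n)) (θ : Euc n → ℝ≥0∞), Measurable θ ∧ CountablyRectifiable d K ∧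
      μ = (μH[(d : ℝ)].restrict K).withDensity θ := by
  have hrange : ∀ g : Euc d → Euc n, ContDiff ℝ 1 g → MeasurableSet (range g) := by
    intro g hg
    obtain ⟨C, hC, hCg⟩ := isSigmaCompact_range hg.continuous
    rw [← hCg]
    exact MeasurableSet.iUnion fun i => (hC i).measurableSet
  obtain ⟨D, hDC, hDc, hD⟩ := Measure.exists_ae_subset_biUnion_countable μ
    (C := {s | ∃ g : Euc d → Euc n, ContDiff ℝ 1 g ∧ s = range g})
    (by rintro _ ⟨g, hg, rfl⟩; exact hrange g hg)
  obtain ⟨u, hu⟩ := (hDc.insert (range fun _ : Euc d => (0 : Euc n))).exists_eq_range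
    (insert_nonempty _ _)
  have huC : ∀ i, ∃ g : Euc d → Euc n, ContDiff ℝ 1 g ∧ u i = range g := by
    intro i
    have : u i ∈ insert (range fun _ : Euc d => (0 : Euc n)) D := hu ▸ mem_range_self i
    rcases this with h1 | h1
    · exact ⟨_, contDiff_const, h1⟩
    · exact hDC h1
  choose f hf hfu using huC
  set K := ⋃ i, range (f i) with hK
  have hKm : MeasurableSet K := MeasurableSet.iUnion fun i => hrange _ (hf i)
  have hDK : ⋃₀ D ⊆ K := by
    rintro x ⟨s, hs, hx⟩
    obtain ⟨i, rfl⟩ : s ∈ range u := hu ▸ mem_insert_of_mem _ hs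
    exact mem_iUnion.2 ⟨i, hfu i ▸ hx⟩
  have hμK : μ Kᶜ = 0 := by
    by_contra h0
    obtain ⟨g, hg, hg0⟩ := exists_contDiff_of_density h hKm.compl h0
    refine hg0 (measure_mono_null ?_ (ae_iff.1 (hD _ ⟨g, hg, rfl⟩)))
    rintro x ⟨hxK, hxg⟩ hcon
    exact hxK (hDK (hcon hxg))
  have hσ := sigmaFinite_hausdorffMeasure_restrict hf
  have hac : μ ≪ μH[(d : ℝ)].restrict K := by
    refine Measure.AbsolutelyContinuous.mk fun N hN hN0 => ?_
    rw [Measure.restrict_apply hN] at hN0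
    refine measure_mono_null (t := (N ∩ K) ∪ Kᶜ) (fun x hx => ?_)
      (measure_union_null (absolutelyContinuous_hausdorffMeasure h hN0) hμK)
    by_cases hxK : x ∈ K
    · exact Or.inl ⟨hx, hxK⟩
    · exact Or.inr hxK
  refine ⟨K, μ.rnDeriv (μH[(d : ℝ)].restrict K), Measure.measurable_rnDeriv _ _,
    ⟨f, hf, by rw [diff_self, measure_empty]⟩, (Measure.withDensity_rnDeriv_eq _ _ hac).symm⟩

lemma HasDensityAt.exists_tendsto {n d : ℕ} {μ : Measure (Euc n)} [IsLocallyFiniteMeasure μ]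
    {x : Euc n} {θ : ℝ≥0∞} (h0 : 0 < θ) (hθ : θ < ⊤) (h : HasDensityAt d μ x θ) :
    ∃ τ > 0, Tendsto (fun r => μ.real (closedBall x r) / r ^ d) (𝓝[>] 0) (𝓝 τ) := by
  refine ⟨om d * θ.toReal, mul_pos (om_pos d) (ENNReal.toReal_pos h0.ne' hθ.ne),
    tendsto_closedBall_of_ball ?_⟩
  have h1 := ((ENNReal.tendsto_toReal hθ.ne).comp h).const_mul (om d)
  refine h1.congr' ?_
  filter_upwards [eventually_mem_nhdsWithin] with r hr
  have hr : 0 < r := hr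
  have hom := om_pos d
  simp only [Function.comp_apply, ENNReal.toReal_div, ENNReal.toReal_mul, ENNReal.toReal_pow,
    ENNReal.toReal_ofReal hr.le]
  change om d * (μ.real (ball x r) / (om d * r ^ d)) = _
  field_simp
end

/-- **Preiss' theorem.** If `μ` is a locally finite measure on `ℝ^n` whose `d`-dimensional
density exists and lies in `(0,∞)` at `μ`-a.e. point, then `μ = θ H^d ⌐ K` for some
countably `H^d`-rectifiable set `K` and some density `θ`. -/
theorem statement9 {n : ℕ} (d : ℕ) (μ : Measure (Euc n)) [IsLocallyFiniteMeasure μ]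
    (hdens : ∀ᵐ x ∂μ, ∃ θx : ℝ≥0∞, 0 < θx ∧ θx < ⊤ ∧ HasDensityAt d μ x θx) :
    ∃ (K : Set (Euc n)) (θ : Euc n → ℝ≥0∞), Measurable θ ∧ CountablyRectifiable d K ∧
      μ = (μH[(d : ℝ)].restrict K).withDensity θ := by
  refine exists_rectifiable_repr ?_
  filter_upwards [hdens] with x ⟨θ, h0, hθ, hx⟩
  exact hx.exists_tendsto h0 hθ
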